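/- Let s > 3/2, T > 0, α_n = 2^{-n}, and u_0^n = f_n + g_n where f_n(x) = 2^{-ns} φ(x) sin((17/12)·2^n x) and g_n(x) = 2^{-n} φ(x). Suppose that for each n, u^n ∈ C([0,T]; H^{s+2}(ℝ)) satisfies the Camassa–Holm integral equation u^n(t) = u_0^n − ∫_0^t [3u^n∂_xu^n + α_n²∂_x³(1 − α_n²∂_x²)^{-1}((u^n)²) + (α_n²/2)∂_x(1 − α_n²∂_x²)^{-1}((∂_xu^n)²)](τ) dτ, and v^n ∈ C([0,T]; H^{s+2}(ℝ)) satisfies the Burgers integral equation v^n(t) = u_0^n − 3∫_0^t v^n∂_xv^n (τ) dτ, and both families satisfy the a priori bounds sup_{t∈[0,T]} ‖u^n(t)‖_{H^γ(ℝ)} ≤ C₂‖u_0^n‖_{H^γ(ℝ)} and sup_{t∈[0,T]} ‖v^n(t)‖_{H^γ(ℝ)} ≤ C₂‖u_0^n‖_{H^γ(ℝ)} for γ ∈ {s−1, s, s+1, s+2}, with C₂ independent of n. Then there exist η_0 > 0 and a time 0 < T_0 ≤ T such that liminf_{n→∞} sup_{t∈[0,T_0]} ‖u^n(t) − v^n(t)‖_{H^s(ℝ)}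 ≥ η_0; in particular, the Camassa–Holm solutions do not converge to the Burgers solutions in L^∞(0,T_0; H^s(ℝ)) uniformly with respect to the initial data as the filter parameter tends to zero. -/

import Mathlib

open MeasureTheory Filter

/-- Fourier transform with convention `f̂(ξ) = ∫ f(x) e^{-i x ξ} dx`. -/
noncomputable def fourierT (f : ℝ → ℂ) (ξ : ℝ) : ℂ :=
  ∫ x : ℝ, f x * Complex.exp (-(Complex.I * x * ξ))

/-- The `H^s(ℝ)` norm, `‖f‖_{H^s}² = ∫ (1+|ξ|²)^s |f̂(ξ)|² dξ`. -/
noncomputable def sobolevNorm (s : ℝ) (f : ℝ → ℂ) : ℝ :=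
  Real.sqrt (∫ ξ : ℝ, (1 + ξ ^ 2) ^ s * ‖fourierT f ξ‖ ^ 2)

/-- Membership in `H^s(ℝ)` (for integrable representatives). -/
def MemSobolev (s : ℝ) (f : ℝ → ℂ) : Prop :=
  MeasureTheory.Integrable f ∧
    MeasureTheory.Integrable (fun ξ : ℝ => (1 + ξ ^ 2) ^ s * ‖fourierT f ξ‖ ^ 2)

/-- The high-frequency functions `f_n(x) = 2^{-ns} φ(x) sin((17/12)·2^n x)`. -/
noncomputable def fn (s : ℝ) (φ : ℝ → ℂ) (n : ℕ) : ℝ → ℂ :=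
  fun x => (((2 : ℝ) ^ (-(n : ℝ) * s) * Real.sin (17 / 12 * 2 ^ n * x) : ℝ) : ℂ) * φ x

/-- The low-frequency functions `g_n(x) = 2^{-n} φ(x)`. -/
noncomputable def gn (φ : ℝ → ℂ) (n : ℕ) : ℝ → ℂ :=
  fun x => (((2 : ℝ) ^ (-(n : ℝ)) : ℝ) : ℂ) * φ x

/-- `φ̂` is an even, real-valued, nonnegative function in `C_c^∞(ℝ)` with `φ̂ = 1` on
`{|ξ| ≤ 1/4}` and `φ̂ = 0` on `{|ξ| ≥ 1/2}`, and `φ` is the (continuous, integrable)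
function on `ℝ` whose Fourier transform is `φ̂`. -/
structure CutoffPair (φhat : ℝ → ℝ) (φ : ℝ → ℂ) : Prop where
  smooth : ContDiff ℝ (⊤ : ℕ∞) φhat
  compactSupport : HasCompactSupport φhat
  even : ∀ ξ : ℝ, φhat (-ξ) = φhat ξ
  nonneg : ∀ ξ : ℝ, 0 ≤ φhat ξ
  eq_one : ∀ ξ : ℝ, |ξ| ≤ 1 / 4 → φhat ξ = 1
  eq_zero : ∀ ξ : ℝ, 1 / 2 ≤ |ξ| → φhat ξ = 0
  continuous : Continuous φ
  integrable : MeasureTheory.Integrable φ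
  fourier_eq : ∀ ξ : ℝ, fourierT φ ξ = (φhat ξ : ℂ)

/-- The Fourier multiplier operator with symbol `m` (via the inverse Fourier transform
associated with the convention `f̂(ξ) = ∫ f(x) e^{-ixξ} dx`). -/
noncomputable def fourierMult (m : ℝ → ℂ) (f : ℝ → ℂ) : ℝ → ℂ :=
  fun x => ((1 / (2 * Real.pi) : ℝ) : ℂ) *
    ∫ ξ : ℝ, m ξ * fourierT f ξ * Complex.exp (Complex.I * ξ * x)

/-- The right-hand side `3u∂_xu + α²∂_x³(1 − α²∂_x²)^{-1}(u²)
+ (α²/2)∂_x(1 − α²∂_x²)^{-1}((∂_xu)²)` of the Camassa–Holm equation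
`u_t = −(3u∂_xu + α²∂_x³(1−α²∂_x²)^{-1}(u²) + (α²/2)∂_x(1−α²∂_x²)^{-1}((∂_xu)²))`,
where `(1 − α²∂_x²)^{-1}` is the Fourier multiplier with symbol `(1 + α²ξ²)^{-1}`
(the identity when `α = 0`). -/
noncomputable def chRHS (α : ℝ) (u : ℝ → ℂ) : ℝ → ℂ :=
  fun x => 3 * u x * deriv u x
    + fourierMult
        (fun ξ : ℝ => -(Complex.I * (α : ℂ) ^ 2 * (ξ : ℂ) ^ 3) /
          (1 + (α : ℂ) ^ 2 * (ξ : ℂ) ^ 2)) (fun y => u y ^ 2) x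
    + (1 / 2 : ℂ) * fourierMult
        (fun ξ : ℝ => Complex.I * (α : ℂ) ^ 2 * (ξ : ℂ) /
          (1 + (α : ℂ) ^ 2 * (ξ : ℂ) ^ 2)) (fun y => (deriv u y) ^ 2) x

/-! ### Part P1 -/

noncomputable section

open MeasureTheory Filter


/-- Inverse Fourier integral without normalisation. -/
def IF (q : ℝ → ℂ) (x : ℝ) : ℂ := ∫ ξ : ℝ, q ξ * Complex.exp (Complex.I * ξ * x)

/-- Convolution. -/
def cv (a b : ℝ → ℂ) (ξ : ℝ) : ℂ := ∫ ζ : ℝ, a ζ * b (ξ - ζ)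

theorem IF_eq (q : ℝ → ℂ) (x : ℝ) : IF q x = fourierT q (-x) := by
  unfold IF fourierT
  congr 1; funext ξ; congr 2; push_cast; ring

open FourierTransform in
theorem fourierT_eq (f : ℝ → ℂ) (ξ : ℝ) : fourierT f ξ = 𝓕 f (ξ / (2 * Real.pi)) := by
  unfold fourierT
  rw [Real.fourier_eq']
  congr 1; funext x
  rw [smul_eq_mul, mul_comm]
  congr 2
  have : (Real.pi : ℂ) ≠ 0 := by exact_mod_cast Real.pi_ne_zero
  simp only [RCLike.inner_apply, conj_trivial]
  push_cast; field_simp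

theorem norm_cexp_I_mul (ξ x : ℝ) : ‖Complex.exp (Complex.I * ξ * x)‖ = 1 := by
  rw [show Complex.I * ξ * x = ((ξ * x : ℝ) : ℂ) * Complex.I by push_cast; ring]
  exact Complex.norm_exp_ofReal_mul_I _

theorem norm_cexp_I_mul' (ξ x : ℝ) : ‖Complex.exp (-(Complex.I * ξ * x))‖ = 1 := by
  have := norm_cexp_I_mul (-ξ) x
  rw [← this]; congr 2; push_cast; ring

theorem IF_integrable {q : ℝ → ℂ} (hq : Integrable q) (x : ℝ) :
    Integrable (fun ξ : ℝ => q ξ * Complex.exp (Complex.I * ξ * x)) := by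
  refine hq.mul_bdd (c := 1) ?_ ?_
  · exact Continuous.aestronglyMeasurable (by fun_prop)
  · exact Eventually.of_forall fun ξ => (norm_cexp_I_mul ξ x).le

theorem fourierT_integrable {f : ℝ → ℂ} (hq : Integrable f) (ξ : ℝ) :
    Integrable (fun x : ℝ => f x * Complex.exp (-(Complex.I * x * ξ))) := by
  refine hq.mul_bdd (c := 1) ?_ ?_
  · exact Continuous.aestronglyMeasurable (by fun_prop)
  · exact Eventually.of_forall fun x => (norm_cexp_I_mul' x ξ).le

theorem norm_IF_le (q : ℝ → ℂ) (x : ℝ) : ‖IF q x‖ ≤ ∫ ξ, ‖q ξ‖ := by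
  refine (norm_integral_le_integral_norm _).trans (le_of_eq ?_)
  congr 1; funext ξ; rw [norm_mul, norm_cexp_I_mul, mul_one]

theorem norm_fourierT_le (q : ℝ → ℂ) (x : ℝ) : ‖fourierT q x‖ ≤ ∫ ξ, ‖q ξ‖ := by
  have := norm_IF_le q (-x)
  rwa [IF_eq, neg_neg] at this

theorem enorm_IF_le (q : ℝ → ℂ) (x : ℝ) : ‖IF q x‖ₑ ≤ ∫⁻ ξ, ‖q ξ‖ₑ := by
  refine (enorm_integral_le_lintegral_enorm _).trans (le_of_eq ?_)
  congr 1; funext ξ; rw [enorm_mul]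
  have : ‖Complex.exp (Complex.I * ξ * x)‖ₑ = 1 := by
    rw [← ofReal_norm, norm_cexp_I_mul, ENNReal.ofReal_one]
  rw [this, mul_one]

theorem continuous_IF {q : ℝ → ℂ} (hq : Integrable q) : Continuous (IF q) := by
  refine continuous_of_dominated (bound := fun ξ => ‖q ξ‖) ?_ ?_ hq.norm ?_
  · intro x; exact (IF_integrable hq x).aestronglyMeasurable
  · intro x; exact Eventually.of_forall fun ξ => by rw [norm_mul, norm_cexp_I_mul, mul_one]
  · exact Eventually.of_forall fun ξ => by fun_prop

theorem continuous_fourierT {f : ℝ → ℂ} (hf : Integrable f) : Continuous (fourierT f) := by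
  have := (continuous_IF hf).comp (continuous_neg)
  refine this.congr fun x => ?_
  simp [IF_eq]

theorem IF_hasDerivAt {q : ℝ → ℂ} (hq : Integrable q)
    (hq' : Integrable (fun ξ : ℝ => Complex.I * ξ * q ξ)) (x : ℝ) :
    HasDerivAt (IF q) (IF (fun ξ : ℝ => Complex.I * ξ * q ξ) x) x := by
  have := hasDerivAt_integral_of_dominated_loc_of_deriv_le (μ := volume)
    (F := fun (x : ℝ) (ξ : ℝ) => q ξ * Complex.exp (Complex.I * ξ * x))
    (F' := fun (x : ℝ) (ξ : ℝ) => (Complex.I * ξ * q ξ) * Complex.exp (Complex.I * ξ * x))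
    (bound := fun ξ => ‖Complex.I * ξ * q ξ‖) (x₀ := x) (s := Set.univ) Filter.univ_mem
    (Eventually.of_forall fun y => (IF_integrable hq y).aestronglyMeasurable)
    (IF_integrable hq x) (IF_integrable hq' x).aestronglyMeasurable
    (Eventually.of_forall fun ξ y _ => by rw [norm_mul, norm_cexp_I_mul, mul_one])
    hq'.norm
    (Eventually.of_forall fun ξ y _ => by
      have h1 : HasDerivAt (fun y : ℝ => Complex.I * ξ * (y : ℂ)) (Complex.I * ξ) y := by
        simpa using (Complex.ofRealCLM.hasDerivAt (x := y)).const_mul (Complex.I * (ξ : ℂ))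
      have h2 := (h1.cexp).const_mul (q ξ)
      refine h2.congr_deriv ?_
      ring)
  exact this.2

theorem pairing {q Ψ : ℝ → ℂ} (hq : Integrable q) (hΨ : Integrable Ψ) :
    ∫ x, IF q x * Ψ x = ∫ ξ, q ξ * fourierT Ψ (-ξ) := by
  unfold IF fourierT
  simp_rw [← integral_mul_const, ← integral_const_mul]
  rw [integral_integral_swap]
  · congr 1; funext ξ; congr 1; funext x
    have : Complex.exp (Complex.I * ξ * x) = Complex.exp (-(Complex.I * x * ((-ξ : ℝ) : ℂ))) := by
      congr 1; push_cast; ring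
    rw [this]; ring
  · have h : Integrable (fun p : ℝ × ℝ => Ψ p.1 * q p.2) (volume.prod volume) := hΨ.mul_prod hq
    refine (h.mul_bdd (c := 1)
      (g := fun p : ℝ × ℝ => Complex.exp (Complex.I * p.2 * p.1)) ?_ ?_).congr ?_
    · exact Continuous.aestronglyMeasurable (by fun_prop)
    · exact Eventually.of_forall fun p => (norm_cexp_I_mul p.2 p.1).le
    · exact Eventually.of_forall fun p => by simp only [Function.uncurry]; ring

theorem pairing' {f g : ℝ → ℂ} (hf : Integrable f) (hg : Integrable g) :
    ∫ x, fourierT f x * g x = ∫ ξ, f ξ * fourierT g ξ := by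
  have h := pairing hf hg.comp_neg
  have e1 : ∫ x, IF f x * g (-x) = ∫ x, fourierT f x * g x := by
    rw [← integral_neg_eq_self]; simp [IF_eq]
  rw [← e1, h]
  congr 1; funext ξ; congr 1
  unfold fourierT
  rw [← integral_neg_eq_self]; congr 1; funext x
  simp

open FourierTransform in
theorem inversion_pt {f : ℝ → ℂ} (hf : Integrable f) (hf' : Integrable (fourierT f)) {x : ℝ}
    (hc : ContinuousAt f x) : IF (fourierT f) x = 2 * Real.pi * f x := by
  have hpi : (0:ℝ) < 2 * Real.pi := by positivity
  have h1 : Integrable (𝓕 f) := by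
    have := hf'.comp_mul_left' (R := 2 * Real.pi) hpi.ne'
    refine this.congr (Eventually.of_forall fun ξ => ?_)
    simp only [fourierT_eq]; congr 1; field_simp
  have h2 := hf.fourierInv_fourier_eq h1 hc
  rw [← h2, Real.fourierInv_eq']
  unfold IF
  have := Measure.integral_comp_mul_left
    (fun ξ : ℝ => fourierT f ξ * Complex.exp (Complex.I * ξ * x)) (2 * Real.pi)
  rw [abs_of_pos (inv_pos.2 hpi)] at this
  have h3 : ∫ ξ : ℝ, fourierT f ξ * Complex.exp (Complex.I * ξ * x)
     = (2 * Real.pi : ℝ) • ∫ y : ℝ, fourierT f (2 * Real.pi * y) *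
        Complex.exp (Complex.I * ((2 * Real.pi * y : ℝ) : ℂ) * x) := by
    rw [this, smul_smul, mul_inv_cancel₀ hpi.ne', one_smul]
  rw [h3, Complex.real_smul]
  push_cast
  congr 2; funext y
  rw [fourierT_eq, smul_eq_mul, mul_comm]
  congr 2
  · simp only [RCLike.inner_apply, conj_trivial]; push_cast; ring
  · field_simp

theorem fourierT_IF {q : ℝ → ℂ} (hc : Continuous q) (hq : Integrable q) (h : Integrable (IF q))
    (ξ : ℝ) : fourierT (IF q) ξ = 2 * Real.pi * q ξ := by
  have h1 : Integrable (fourierT q) := by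
    refine h.comp_neg.congr (Eventually.of_forall fun x => ?_); simp [IF_eq]
  rw [← inversion_pt hq h1 hc.continuousAt]
  have e : ∀ x : ℝ, fourierT q x = IF q (-x) := fun x => by rw [IF_eq, neg_neg]
  conv_rhs => unfold IF
  rw [← integral_neg_eq_self]
  conv_lhs => unfold fourierT
  congr 1; funext x
  rw [e, neg_neg]
  congr 2; push_cast; ring

open scoped ContDiff in
theorem inversion_ae {f : ℝ → ℂ} (hf : Integrable f) (hf' : Integrable (fourierT f)) :
    ∀ᵐ x, f x = IF (fun ξ => fourierT f ξ / (2 * Real.pi)) x := by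
  have hpi : (2 * Real.pi : ℂ) ≠ 0 := by exact_mod_cast (by positivity : (2 * Real.pi) ≠ 0)
  have hI : Integrable (fun ξ => fourierT f ξ / (2 * Real.pi)) := hf'.div_const _
  refine ae_eq_of_integral_contDiff_smul_eq hf.locallyIntegrable
    (continuous_IF hI).locallyIntegrable fun g hg hgs => ?_
  set S := hgs.toSchwartzMap hg with hS
  set Ψ : ℝ → ℂ := fun x => (g x : ℂ) with hΨ
  have hΨc : Continuous Ψ := by have := hg.continuous; fun_prop
  have hΨs : HasCompactSupport Ψ := hgs.comp_left (g := fun r : ℝ => (r : ℂ)) (by simp)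
  have hΨd : ContDiff ℝ ∞ Ψ := Complex.ofRealCLM.contDiff.comp hg
  have hΨi : Integrable Ψ := hΨc.integrable_of_hasCompactSupport hΨs
  have hΨt : Integrable (fourierT Ψ) := by
    have h1 := (FourierTransform.fourier (hΨs.toSchwartzMap hΨd)).integrable (μ := volume)
    have := h1.comp_mul_left' (R := (2 * Real.pi)⁻¹) (by positivity)
    refine this.congr (Eventually.of_forall fun ξ => ?_)
    rw [fourierT_eq]
    simp only [SchwartzMap.fourier_coe]
    show FourierTransform.fourier Ψ _ = _; congr 1; ring
  have e1 : ∫ x, g x • IF (fun ξ => fourierT f ξ / (2 * Real.pi)) x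
      = ∫ ξ, fourierT f ξ / (2 * Real.pi) * fourierT Ψ (-ξ) := by
    rw [← pairing hI hΨi]; congr 1; funext x; rw [Complex.real_smul, mul_comm]
  rw [e1]
  have e2 : ∫ ξ, fourierT f ξ / (2 * Real.pi) * fourierT Ψ (-ξ)
      = ∫ ξ, f ξ * fourierT (fun ξ => fourierT Ψ (-ξ) / (2 * Real.pi)) ξ := by
    rw [← pairing' hf (hΨt.comp_neg.div_const _)]
    congr 1; funext ξ; ring
  rw [e2]
  congr 1; funext x
  rw [Complex.real_smul, mul_comm]; congr 1
  have := inversion_pt hΨi hΨt (x := x) hΨc.continuousAt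
  have e3 : fourierT (fun ξ => fourierT Ψ (-ξ) / (2 * Real.pi)) x = IF (fourierT Ψ) x / (2 * Real.pi) := by
    unfold IF; rw [← integral_neg_eq_self, ← integral_div]
    conv_lhs => unfold fourierT
    unfold fourierT
    congr 1; funext ξ
    rw [div_mul_eq_mul_div]; congr 2; congr 1; push_cast; ring
  rw [e3, this]; field_simp; rfl

end

/-! ### Part P1b -/

noncomputable section

open MeasureTheory Filter


theorem cv_eq (a b : ℝ → ℂ) : cv a b = MeasureTheory.convolution a b (ContinuousLinearMap.mul ℝ ℂ) volume := by
  funext ξ; simp [cv, MeasureTheory.convolution]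

theorem cv_integrable {a b : ℝ → ℂ} (ha : Integrable a) (hb : Integrable b) :
    Integrable (cv a b) := by
  rw [cv_eq]; exact ha.integrable_convolution _ hb

theorem IF_cv {a b : ℝ → ℂ} (ha : Integrable a) (hb : Integrable b) (x : ℝ) :
    IF (cv a b) x = IF a x * IF b x := by
  simp only [IF_eq, fourierT_eq]
  rw [← Real.fourier_mul_convolution_eq ha hb]
  rfl

theorem fourierT_cv {a b : ℝ → ℂ} (ha : Integrable a) (hb : Integrable b) (x : ℝ) :
    fourierT (cv a b) x = fourierT a x * fourierT b x := by
  have := IF_cv ha hb (-x)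
  simpa [IF_eq] using this

theorem cv_continuous {a b : ℝ → ℂ} (ha : Integrable a) (hb : Continuous b) {C : ℝ}
    (hC : ∀ x, ‖b x‖ ≤ C) : Continuous (cv a b) := by
  rw [cv_eq]
  refine BddAbove.continuous_convolution_right_of_integrable _ ?_ ha hb
  exact ⟨C, by rintro _ ⟨x, rfl⟩; exact hC x⟩

open FourierTransform in
open scoped ContDiff in
theorem fourier_L2_ae {f : ℝ → ℂ} (hf : Integrable f) (h2 : MemLp f 2) :
    (𝓕 (h2.toLp f) : Lp ℂ 2 (volume : Measure ℝ)) =ᵐ[volume] 𝓕 f := by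
  have hcont : Continuous (𝓕 f) := VectorFourier.fourierIntegral_continuous Real.continuous_fourierChar
      (by fun_prop) hf
  refine ae_eq_of_integral_contDiff_smul_eq ((Lp.memLp _).locallyIntegrable (by norm_num))
    hcont.locallyIntegrable fun g hg hgs => ?_
  set Ψ : ℝ → ℂ := fun x => (g x : ℂ) with hΨ
  have hΨs : HasCompactSupport Ψ := hgs.comp_left (g := fun r : ℝ => (r : ℂ)) (by simp)
  have hΨd : ContDiff ℝ ∞ Ψ := Complex.ofRealCLM.contDiff.comp hg
  set S := hΨs.toSchwartzMap hΨd with hS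
  have hd := congrArg (fun D => D S) (Lp.fourier_toTemperedDistribution_eq (h2.toLp f))
  simp only [TemperedDistribution.fourier_apply, Lp.toTemperedDistribution_apply] at hd
  have hSΨ : ∀ x, S x = Ψ x := fun x => rfl
  have e1 : ∫ x, g x • ((𝓕 (h2.toLp f) : Lp ℂ 2 (volume : Measure ℝ)) : ℝ → ℂ) x
     = ∫ x, S x • ((𝓕 (h2.toLp f) : Lp ℂ 2 (volume : Measure ℝ)) : ℝ → ℂ) x := by
    congr 1
  rw [e1, ← hd]
  have e2 : ∫ x, (𝓕 S) x • (h2.toLp f) x = ∫ x, (𝓕 Ψ) x • f x := by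
    refine integral_congr_ae ?_
    filter_upwards [h2.coeFn_toLp] with x hx
    rw [hx]; rfl
  rw [e2]
  have hΨi : Integrable Ψ := S.integrable
  have := VectorFourier.integral_fourierIntegral_smul_eq_flip (L := innerₗ ℝ) (μ := volume) (ν := volume)
    (e := Real.fourierChar) Real.continuous_fourierChar (by fun_prop) hΨi hf
  refine Eq.trans this ?_
  have hfl : (innerₗ ℝ).flip = innerₗ ℝ := by ext; simp
  rw [hfl]
  rfl

open FourierTransform in
theorem plancherel {f : ℝ → ℂ} (hf : Integrable f) :
    ∫⁻ ξ, ‖fourierT f ξ‖ₑ ^ 2 ≤ ENNReal.ofReal (2 * Real.pi) * ∫⁻ x, ‖f x‖ₑ ^ 2 := by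
  have hpi : (0:ℝ) < 2 * Real.pi := by positivity
  by_cases hfin : ∫⁻ x, ‖f x‖ₑ ^ 2 = ⊤
  · rw [hfin, ENNReal.mul_top]
    · exact le_top
    · simpa using hpi
  have key : ∀ g : ℝ → ℂ, eLpNorm g 2 volume ^ 2 = ∫⁻ x, ‖g x‖ₑ ^ 2 := by
    intro g
    rw [eLpNorm_eq_lintegral_rpow_enorm_toReal (by norm_num) (by norm_num)]
    simp only [ENNReal.toReal_ofNat, ENNReal.rpow_ofNat, one_div]
    rw [← ENNReal.rpow_natCast, ← ENNReal.rpow_mul]; norm_num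
  have h2 : MemLp f 2 := by
    refine ⟨hf.1, ?_⟩
    rw [lt_top_iff_ne_top]; intro h
    rw [← key, h] at hfin; simp at hfin
  have h3 := Lp.norm_fourier_eq (h2.toLp f)
  rw [Lp.norm_def, Lp.norm_def, ENNReal.toReal_eq_toReal_iff' (Lp.eLpNorm_ne_top _)
    (Lp.eLpNorm_ne_top _), eLpNorm_congr_ae (fourier_L2_ae hf h2),
    eLpNorm_congr_ae h2.coeFn_toLp] at h3
  have h4 : ∫⁻ x, ‖𝓕 f x‖ₑ ^ 2 = ∫⁻ x, ‖f x‖ₑ ^ 2 := by rw [← key, ← key, h3]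
  rw [← h4]
  simp_rw [fourierT_eq]
  have hc : Continuous (𝓕 f) := VectorFourier.fourierIntegral_continuous Real.continuous_fourierChar
      (by fun_prop) hf
  have h5 : ∫⁻ x : ℝ, ‖𝓕 f (x * (2 * Real.pi)⁻¹)‖ₑ ^ 2
      = ∫⁻ y, ‖𝓕 f y‖ₑ ^ 2 ∂(Measure.map (· * (2 * Real.pi)⁻¹) volume) := by
    rw [lintegral_map (by fun_prop) (by fun_prop)]
  simp only [div_eq_mul_inv]
  rw [h5, Real.map_volume_mul_right (by positivity), lintegral_smul_measure, smul_eq_mul,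
    inv_inv, abs_of_pos hpi]

theorem plancherel_IF {f : ℝ → ℂ} (hf : Integrable f) :
    ∫⁻ ξ, ‖IF f ξ‖ₑ ^ 2 ≤ ENNReal.ofReal (2 * Real.pi) * ∫⁻ x, ‖f x‖ₑ ^ 2 := by
  refine le_trans (le_of_eq ?_) (plancherel hf)
  simp_rw [IF_eq]
  exact lintegral_neg_eq_self (fun ξ => ‖fourierT f ξ‖ₑ ^ 2)

end

/-! ### Part P2 -/

noncomputable section

open MeasureTheory Filter
open scoped ENNReal


/-- weight -/
def wt (σ ξ : ℝ) : ℝ≥0∞ := ENNReal.ofReal ((1 + ξ ^ 2) ^ σ)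
/-- squared weighted L2 norm -/
def N2 (σ : ℝ) (q : ℝ → ℂ) : ℝ≥0∞ := ∫⁻ ξ, wt σ ξ * ‖q ξ‖ₑ ^ 2
/-- weighted L1 norm -/
def L1 (m : ℝ) (q : ℝ → ℂ) : ℝ≥0∞ := ∫⁻ ξ, wt (m / 2) ξ * ‖q ξ‖ₑ

theorem jp_pos (ξ : ℝ) : 0 < 1 + ξ ^ 2 := by positivity
theorem one_le_jp (ξ : ℝ) : 1 ≤ 1 + ξ ^ 2 := by nlinarith [sq_nonneg ξ]

@[fun_prop] theorem measurable_wt (σ : ℝ) : Measurable (wt σ) := by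
  unfold wt; fun_prop

theorem wt_zero (ξ : ℝ) : wt 0 ξ = 1 := by simp [wt]
theorem wt_add (σ τ ξ : ℝ) : wt (σ + τ) ξ = wt σ ξ * wt τ ξ := by
  unfold wt; rw [Real.rpow_add (jp_pos ξ), ENNReal.ofReal_mul (by positivity)]
theorem wt_half_sq (σ ξ : ℝ) : wt (σ / 2) ξ ^ 2 = wt σ ξ := by
  rw [sq, ← wt_add]; congr 1; ring
theorem wt_mono {σ τ : ℝ} (h : σ ≤ τ) (ξ : ℝ) : wt σ ξ ≤ wt τ ξ :=
  ENNReal.ofReal_le_ofReal (Real.rpow_le_rpow_of_exponent_le (one_le_jp ξ) h)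
theorem wt_ne_top (σ ξ : ℝ) : wt σ ξ ≠ ⊤ := ENNReal.ofReal_ne_top
theorem wt_neg_mul (σ ξ : ℝ) : wt (-σ) ξ * wt σ ξ = 1 := by rw [← wt_add]; simp [wt_zero]

theorem L1_zero (q : ℝ → ℂ) : L1 0 q = ∫⁻ ξ, ‖q ξ‖ₑ := by simp [L1, wt_zero]
theorem N2_zero (q : ℝ → ℂ) : N2 0 q = ∫⁻ ξ, ‖q ξ‖ₑ ^ 2 := by simp [N2, wt_zero]

theorem N2_mono {σ τ : ℝ} (h : σ ≤ τ) (q : ℝ → ℂ) : N2 σ q ≤ N2 τ q :=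
  lintegral_mono fun ξ => by gcongr; exact wt_mono h ξ
theorem L1_mono {σ τ : ℝ} (h : σ ≤ τ) (q : ℝ → ℂ) : L1 σ q ≤ L1 τ q :=
  lintegral_mono fun ξ => by gcongr; exact wt_mono (by linarith) ξ

theorem integrable_of_L1 {q : ℝ → ℂ} (hq : Measurable q) {m : ℝ} (hm : 0 ≤ m) (h : L1 m q ≠ ⊤) :
    Integrable q := by
  refine ⟨hq.aestronglyMeasurable, ?_⟩
  rw [hasFiniteIntegral_iff_enorm, ← L1_zero]
  exact lt_of_le_of_lt (L1_mono hm q) (lt_top_iff_ne_top.2 h)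

theorem wt_sub (σ : ℝ) (hσ : 0 ≤ σ) (ξ ζ : ℝ) :
    wt σ ξ ≤ ENNReal.ofReal (4 ^ σ) * (wt σ ζ + wt σ (ξ - ζ)) := by
  unfold wt
  rw [← ENNReal.ofReal_add (by positivity) (by positivity), ← ENNReal.ofReal_mul (by positivity)]
  refine ENNReal.ofReal_le_ofReal ?_
  have h1 : ∀ x y : ℝ, 0 ≤ x → 0 ≤ y → (2 * x + 2 * y) ^ σ ≤ 4 ^ σ * (x ^ σ + y ^ σ) := by
    intro x y hx hy
    rcases le_total x y with h | h
    · calc (2 * x + 2 * y) ^ σ ≤ (4 * y) ^ σ := Real.rpow_le_rpow (by positivity) (by linarith) hσ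
        _ = 4 ^ σ * y ^ σ := Real.mul_rpow (by norm_num) hy
        _ ≤ _ := by gcongr; linarith [Real.rpow_nonneg hx σ]
    · calc (2 * x + 2 * y) ^ σ ≤ (4 * x) ^ σ := Real.rpow_le_rpow (by positivity) (by linarith) hσ
        _ = 4 ^ σ * x ^ σ := Real.mul_rpow (by norm_num) hx
        _ ≤ _ := by gcongr; linarith [Real.rpow_nonneg hy σ]
  refine le_trans (Real.rpow_le_rpow (by positivity) ?_ hσ) (h1 _ _ (jp_pos ζ).le (jp_pos (ξ - ζ)).le)
  nlinarith [sq_nonneg (ξ - 2 * ζ)]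

theorem enorm_cv_le (a b : ℝ → ℂ) (ξ : ℝ) : ‖cv a b ξ‖ₑ ≤ ∫⁻ ζ, ‖a ζ‖ₑ * ‖b (ξ - ζ)‖ₑ := by
  refine (enorm_integral_le_lintegral_enorm _).trans (le_of_eq ?_)
  simp_rw [enorm_mul]

theorem measurable_cv {a b : ℝ → ℂ} (ha : Measurable a) (hb : Measurable b) :
    Measurable (cv a b) := by
  have : StronglyMeasurable (fun p : ℝ × ℝ => a p.2 * b (p.1 - p.2)) :=
    Measurable.stronglyMeasurable (by fun_prop)
  exact this.integral_prod_right.measurable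

/-- scalar convolution in ENNReal, L1 -/
theorem lconv_L1 {A B : ℝ → ℝ≥0∞} (hA : Measurable A) (hB : Measurable B) :
    ∫⁻ ξ, ∫⁻ ζ, A ζ * B (ξ - ζ) = (∫⁻ ζ, A ζ) * ∫⁻ ζ, B ζ := by
  rw [lintegral_lintegral_swap (by fun_prop)]
  have : ∀ ζ, ∫⁻ ξ, A ζ * B (ξ - ζ) = A ζ * ∫⁻ ζ, B ζ := fun ζ => by
    rw [lintegral_const_mul _ (by fun_prop), lintegral_sub_right_eq_self B ζ]
  simp_rw [this]
  rw [lintegral_mul_const _ hA]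

theorem lintegral_CS {f g : ℝ → ℝ≥0∞} (hf : AEMeasurable f) (hg : AEMeasurable g) :
    (∫⁻ x, f x * g x) ^ 2 ≤ (∫⁻ x, f x ^ 2) * ∫⁻ x, g x ^ 2 := by
  have := ENNReal.lintegral_mul_le_Lp_mul_Lq volume Real.HolderConjugate.two_two hf hg
  calc (∫⁻ x, f x * g x) ^ 2
      ≤ ((∫⁻ x, f x ^ (2:ℝ)) ^ (1 / 2 : ℝ) * (∫⁻ x, g x ^ (2:ℝ)) ^ (1 / 2 : ℝ)) ^ 2 := by
        gcongr; exact this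
    _ = _ := by
        rw [mul_pow, ← ENNReal.rpow_natCast, ← ENNReal.rpow_natCast, ← ENNReal.rpow_mul,
          ← ENNReal.rpow_mul]
        norm_num

theorem lconv_L2 {A B : ℝ → ℝ≥0∞} (hA : Measurable A) (hB : Measurable B) :
    ∫⁻ ξ, (∫⁻ ζ, A ζ * B (ξ - ζ)) ^ 2 ≤ (∫⁻ ζ, A ζ ^ 2) * (∫⁻ ζ, B ζ) ^ 2 := by
  have h1 : ∀ ξ, (∫⁻ ζ, A ζ * B (ξ - ζ)) ^ 2 ≤ (∫⁻ ζ, A ζ ^ 2 * B (ξ - ζ)) * ∫⁻ ζ, B ζ := by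
    intro ξ
    have hs : ∀ x : ℝ≥0∞, x ^ (1 / 2 : ℝ) * x ^ (1 / 2 : ℝ) = x := fun x => by
      rw [← ENNReal.rpow_add_of_nonneg _ _ (by norm_num) (by norm_num)]; norm_num
    have := lintegral_CS (f := fun ζ => A ζ * B (ξ - ζ) ^ (1 / 2 : ℝ))
      (g := fun ζ => B (ξ - ζ) ^ (1 / 2 : ℝ)) (by fun_prop) (by fun_prop)
    simp only [mul_pow] at this
    simp_rw [sq (_ ^ (1 / 2 : ℝ)), hs, mul_assoc, hs] at this
    rwa [lintegral_sub_left_eq_self B ξ] at this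
  calc ∫⁻ ξ, (∫⁻ ζ, A ζ * B (ξ - ζ)) ^ 2
      ≤ ∫⁻ ξ, (∫⁻ ζ, A ζ ^ 2 * B (ξ - ζ)) * ∫⁻ ζ, B ζ := lintegral_mono h1
    _ = (∫⁻ ξ, ∫⁻ ζ, A ζ ^ 2 * B (ξ - ζ)) * ∫⁻ ζ, B ζ := by
        rw [lintegral_mul_const]
        exact Measurable.lintegral_prod_right' (f := fun p : ℝ × ℝ => A p.2 ^ 2 * B (p.1 - p.2)) (by fun_prop)
    _ = _ := by rw [lconv_L1 (by fun_prop) hB, sq, mul_assoc]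

theorem lconv_comm (A B : ℝ → ℝ≥0∞) (ξ : ℝ) :
    ∫⁻ ζ, A ζ * B (ξ - ζ) = ∫⁻ ζ, B ζ * A (ξ - ζ) := by
  rw [← lintegral_sub_left_eq_self _ ξ]
  congr 1; funext ζ; rw [sub_sub_cancel, mul_comm]

theorem wt_cv_le (σ : ℝ) (hσ : 0 ≤ σ) {a b : ℝ → ℂ} (ha : Measurable a) (hb : Measurable b) (ξ : ℝ) :
    wt σ ξ * ‖cv a b ξ‖ₑ ≤ ENNReal.ofReal (4 ^ σ) *
      ((∫⁻ ζ, (wt σ ζ * ‖a ζ‖ₑ) * ‖b (ξ - ζ)‖ₑ) +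
        ∫⁻ ζ, (wt σ ζ * ‖b ζ‖ₑ) * ‖a (ξ - ζ)‖ₑ) := by
  rw [lconv_comm (fun ζ => wt σ ζ * ‖b ζ‖ₑ) (fun ζ => ‖a ζ‖ₑ) ξ]
  rw [← lintegral_add_left (by fun_prop), ← lintegral_const_mul _ (by fun_prop)]
  calc wt σ ξ * ‖cv a b ξ‖ₑ ≤ wt σ ξ * ∫⁻ ζ, ‖a ζ‖ₑ * ‖b (ξ - ζ)‖ₑ := by gcongr; exact enorm_cv_le a b ξ
    _ = ∫⁻ ζ, wt σ ξ * (‖a ζ‖ₑ * ‖b (ξ - ζ)‖ₑ) := by rw [lintegral_const_mul _ (by fun_prop)]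
    _ ≤ _ := by
      refine lintegral_mono fun ζ => ?_
      calc wt σ ξ * (‖a ζ‖ₑ * ‖b (ξ - ζ)‖ₑ)
          ≤ (ENNReal.ofReal (4 ^ σ) * (wt σ ζ + wt σ (ξ - ζ))) * (‖a ζ‖ₑ * ‖b (ξ - ζ)‖ₑ) := by
            gcongr; exact wt_sub σ hσ ξ ζ
        _ = _ := by ring

theorem L1_cv (m : ℝ) (hm : 0 ≤ m) {a b : ℝ → ℂ} (ha : Measurable a) (hb : Measurable b) :
    L1 m (cv a b) ≤ ENNReal.ofReal (4 ^ (m / 2)) * (L1 m a * L1 0 b + L1 0 a * L1 m b) := by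
  unfold L1
  refine (lintegral_mono fun ξ => wt_cv_le (m / 2) (by positivity) ha hb ξ).trans ?_
  have hm1 : Measurable fun ξ => ∫⁻ ζ, (wt (m / 2) ζ * ‖a ζ‖ₑ) * ‖b (ξ - ζ)‖ₑ :=
    Measurable.lintegral_prod_right'
      (f := fun p : ℝ × ℝ => (wt (m / 2) p.2 * ‖a p.2‖ₑ) * ‖b (p.1 - p.2)‖ₑ) (by fun_prop)
  rw [lintegral_const_mul' _ _ ENNReal.ofReal_ne_top, lintegral_add_left hm1,
    lconv_L1 (A := fun ζ => wt (m/2) ζ * ‖a ζ‖ₑ) (B := fun ζ => ‖b ζ‖ₑ) (by fun_prop) (by fun_prop),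
    lconv_L1 (A := fun ζ => wt (m/2) ζ * ‖b ζ‖ₑ) (B := fun ζ => ‖a ζ‖ₑ) (by fun_prop) (by fun_prop)]
  simp [wt_zero, mul_comm]

theorem add_sq_le' (x y : ℝ≥0∞) : (x + y) ^ 2 ≤ 2 * (x ^ 2 + y ^ 2) := by
  have h := ENNReal.rpow_add_le_mul_rpow_add_rpow x y (p := 2) (by norm_num)
  have h2 : (2 : ℝ≥0∞) ^ ((2:ℝ) - 1) = 2 := by norm_num
  rw [h2] at h
  exact_mod_cast h

theorem N2_cv (σ : ℝ) (hσ : 0 ≤ σ) {a b : ℝ → ℂ} (ha : Measurable a) (hb : Measurable b) :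
    N2 σ (cv a b) ≤ ENNReal.ofReal (2 * 4 ^ σ) * (N2 σ a * L1 0 b ^ 2 + L1 0 a ^ 2 * N2 σ b) := by
  have h1 : ∀ ξ, wt σ ξ * ‖cv a b ξ‖ₑ ^ 2 ≤ ENNReal.ofReal (2 * 4 ^ σ) *
      ((∫⁻ ζ, (wt (σ / 2) ζ * ‖a ζ‖ₑ) * ‖b (ξ - ζ)‖ₑ) ^ 2 +
        (∫⁻ ζ, (wt (σ / 2) ζ * ‖b ζ‖ₑ) * ‖a (ξ - ζ)‖ₑ) ^ 2) := by
    intro ξ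
    rw [← wt_half_sq, ← mul_pow]
    refine (pow_le_pow_left' (wt_cv_le (σ / 2) (by positivity) ha hb ξ) 2).trans ?_
    rw [mul_pow]
    calc _ ≤ ENNReal.ofReal (4 ^ (σ / 2)) ^ 2 * (2 * _) := by gcongr; exact add_sq_le' _ _
      _ = _ := by
        rw [← mul_assoc]; congr 1
        rw [← ENNReal.ofReal_pow (by positivity), ← Real.rpow_natCast, ← Real.rpow_mul (by norm_num),
          mul_comm 2 ((4:ℝ) ^ σ), ENNReal.ofReal_mul (by positivity)]
        norm_num
  unfold N2
  refine (lintegral_mono h1).trans ?_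
  have hm : ∀ c d : ℝ → ℂ, Measurable c → Measurable d →
      Measurable fun ξ => (∫⁻ ζ, (wt (σ / 2) ζ * ‖c ζ‖ₑ) * ‖d (ξ - ζ)‖ₑ) ^ 2 := by
    intro c d hc hd
    refine Measurable.pow_const ?_ 2
    exact Measurable.lintegral_prod_right'
      (f := fun p : ℝ × ℝ => (wt (σ / 2) p.2 * ‖c p.2‖ₑ) * ‖d (p.1 - p.2)‖ₑ) (by fun_prop)
  rw [lintegral_const_mul' _ _ ENNReal.ofReal_ne_top, lintegral_add_left (hm a b ha hb)]
  gcongr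
  · refine (lconv_L2 (A := fun ζ => wt (σ/2) ζ * ‖a ζ‖ₑ) (B := fun ζ => ‖b ζ‖ₑ) (by fun_prop) (by fun_prop)).trans (le_of_eq ?_)
    simp only [mul_pow, wt_half_sq, L1_zero]
  · refine (lconv_L2 (A := fun ζ => wt (σ/2) ζ * ‖b ζ‖ₑ) (B := fun ζ => ‖a ζ‖ₑ) (by fun_prop) (by fun_prop)).trans (le_of_eq ?_)
    simp only [mul_pow, wt_half_sq, L1_zero]
    rw [mul_comm]

theorem L1_le_N2 {m γ : ℝ} (h : m + 1 / 2 < γ) :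
    ∃ C : ℝ, 0 < C ∧ ∀ q : ℝ → ℂ, Measurable q → L1 m q ^ 2 ≤ ENNReal.ofReal C * N2 γ q := by
  have hi : Integrable (fun ξ : ℝ => (1 + ‖ξ‖ ^ 2) ^ (-(2 * (γ - m)) / 2)) :=
    integrable_rpow_neg_one_add_norm_sq (by simp; linarith)
  refine ⟨(∫ ξ : ℝ, (1 + ‖ξ‖ ^ 2) ^ (-(2 * (γ - m)) / 2)) + 1, ?_, fun q hq => ?_⟩
  · have : 0 ≤ ∫ ξ : ℝ, (1 + ‖ξ‖ ^ 2) ^ (-(2 * (γ - m)) / 2) := integral_nonneg fun ξ => by positivity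
    linarith
  have e : L1 m q = ∫⁻ ξ, wt ((m - γ) / 2) ξ * (wt (γ / 2) ξ * ‖q ξ‖ₑ) := by
    unfold L1; congr 1; funext ξ; rw [← mul_assoc, ← wt_add]; congr 2; ring
  rw [e]
  refine (lintegral_CS (by fun_prop) (by fun_prop)).trans ?_
  simp only [mul_pow, wt_half_sq]
  gcongr ?_ * ?_
  · have e2 : ∫⁻ ξ, wt (m - γ) ξ = ENNReal.ofReal (∫ ξ : ℝ, (1 + ‖ξ‖ ^ 2) ^ (-(2 * (γ - m)) / 2)) := by
      rw [ofReal_integral_eq_lintegral_ofReal hi (Eventually.of_forall fun ξ => by positivity)]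
      congr 1; funext ξ; unfold wt
      congr 1
      rw [Real.norm_eq_abs, sq_abs]; congr 1; ring
    rw [e2]; exact ENNReal.ofReal_le_ofReal (by linarith)
  · exact le_rfl

theorem N2_interp {γ γ1 γ2 : ℝ} (h1 : γ1 ≤ γ) (h2 : γ ≤ γ2) {R : ℝ} (hR : 0 < R) (q : ℝ → ℂ)
    (hq : Measurable q) :
    N2 γ q ≤ ENNReal.ofReal (R ^ (γ - γ1)) * N2 γ1 q + ENNReal.ofReal (R ^ (γ - γ2)) * N2 γ2 q := by
  unfold N2
  rw [← lintegral_const_mul' _ _ ENNReal.ofReal_ne_top, ← lintegral_const_mul' _ _ ENNReal.ofReal_ne_top,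
    ← lintegral_add_left (by fun_prop)]
  refine lintegral_mono fun ξ => ?_
  rw [← mul_assoc, ← mul_assoc, ← add_mul]
  gcongr
  unfold wt
  have hp := jp_pos ξ
  rw [← ENNReal.ofReal_mul (by positivity), ← ENNReal.ofReal_mul (by positivity),
    ← ENNReal.ofReal_add (by positivity) (by positivity)]
  refine ENNReal.ofReal_le_ofReal ?_
  rcases le_total (1 + ξ ^ 2) R with h | h
  · have : (1 + ξ ^ 2) ^ γ ≤ R ^ (γ - γ1) * (1 + ξ ^ 2) ^ γ1 := by
      calc (1 + ξ ^ 2) ^ γ = (1 + ξ ^ 2) ^ (γ - γ1) * (1 + ξ ^ 2) ^ γ1 := by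
            rw [← Real.rpow_add hp]; ring_nf
        _ ≤ _ := by gcongr
    have h3 : 0 ≤ R ^ (γ - γ2) * (1 + ξ ^ 2) ^ γ2 := by positivity
    linarith
  · have : (1 + ξ ^ 2) ^ γ ≤ R ^ (γ - γ2) * (1 + ξ ^ 2) ^ γ2 := by
      calc (1 + ξ ^ 2) ^ γ = (1 + ξ ^ 2) ^ (γ - γ2) * (1 + ξ ^ 2) ^ γ2 := by
            rw [← Real.rpow_add hp]; ring_nf
        _ ≤ _ := by
          exact mul_le_mul_of_nonneg_right (Real.rpow_le_rpow_of_nonpos hR h (by linarith)) (by positivity)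
    have h3 : 0 ≤ R ^ (γ - γ1) * (1 + ξ ^ 2) ^ γ1 := by positivity
    linarith

theorem N2_mult {σ k c : ℝ} (hc : 0 ≤ c) {m q : ℝ → ℂ}
    (h : ∀ ξ, ‖m ξ‖ ≤ c * (1 + ξ ^ 2) ^ (k / 2)) :
    N2 σ (fun ξ => m ξ * q ξ) ≤ ENNReal.ofReal (c ^ 2) * N2 (σ + k) q := by
  unfold N2
  rw [← lintegral_const_mul' _ _ ENNReal.ofReal_ne_top]
  refine lintegral_mono fun ξ => ?_
  have : ‖m ξ‖ₑ ≤ ENNReal.ofReal c * wt (k / 2) ξ := by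
    unfold wt
    rw [← ofReal_norm, ← ENNReal.ofReal_mul hc]
    exact ENNReal.ofReal_le_ofReal (h ξ)
  calc wt σ ξ * ‖m ξ * q ξ‖ₑ ^ 2 = wt σ ξ * (‖m ξ‖ₑ ^ 2 * ‖q ξ‖ₑ ^ 2) := by rw [enorm_mul, mul_pow]
    _ ≤ wt σ ξ * ((ENNReal.ofReal c * wt (k / 2) ξ) ^ 2 * ‖q ξ‖ₑ ^ 2) := by gcongr
    _ = _ := by rw [mul_pow, wt_half_sq, wt_add, ENNReal.ofReal_pow hc]; ring

theorem L1_mult {σ k c : ℝ} (hc : 0 ≤ c) {m q : ℝ → ℂ}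
    (h : ∀ ξ, ‖m ξ‖ ≤ c * (1 + ξ ^ 2) ^ (k / 2)) :
    L1 σ (fun ξ => m ξ * q ξ) ≤ ENNReal.ofReal c * L1 (σ + k) q := by
  unfold L1
  rw [← lintegral_const_mul' _ _ ENNReal.ofReal_ne_top]
  refine lintegral_mono fun ξ => ?_
  have : ‖m ξ‖ₑ ≤ ENNReal.ofReal c * wt (k / 2) ξ := by
    unfold wt
    rw [← ofReal_norm, ← ENNReal.ofReal_mul hc]
    exact ENNReal.ofReal_le_ofReal (h ξ)
  calc wt (σ / 2) ξ * ‖m ξ * q ξ‖ₑ = wt (σ / 2) ξ * (‖m ξ‖ₑ * ‖q ξ‖ₑ) := by rw [enorm_mul]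
    _ ≤ wt (σ / 2) ξ * ((ENNReal.ofReal c * wt (k / 2) ξ) * ‖q ξ‖ₑ) := by gcongr
    _ = _ := by rw [add_div, wt_add]; ring

theorem abs_le_jp (ξ : ℝ) : |ξ| ≤ (1 + ξ ^ 2) ^ ((1:ℝ) / 2) := by
  rw [← Real.sqrt_eq_rpow]
  exact Real.le_sqrt_of_sq_le (by rw [sq_abs]; linarith)

end

/-! ### Part P3 -/

noncomputable section

open MeasureTheory Filter
open scoped ENNReal Topology


theorem measurable_right {s : Set ℝ} (h : ∀ t ∈ s, ∃ ε > 0, ∀ t' ∈ Set.Ico t (t + ε), t' ∈ s) :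
    MeasurableSet s := by
  refine MeasurableSet.of_mem_nhdsGT fun t ht => ?_
  obtain ⟨ε, hε, h'⟩ := h t ht
  exact mem_of_superset (Ioo_mem_nhdsGT (show t < t + ε by linarith)) fun t' ht' => h' t' ⟨ht'.1.le, ht'.2⟩

theorem measurable_left {s : Set ℝ} (h : ∀ t ∈ s, ∃ ε > 0, ∀ t' ∈ Set.Ioc (t - ε) t, t' ∈ s) :
    MeasurableSet s := by
  have : MeasurableSet ((fun x : ℝ => -x) ⁻¹' s) := by
    refine measurable_right fun t ht => ?_
    obtain ⟨ε, hε, h'⟩ := h _ ht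
    exact ⟨ε, hε, fun t' ht' => h' _ ⟨by linarith [ht'.2], by linarith [ht'.1]⟩⟩
  have h2 := measurable_neg (this)
  simpa [Set.preimage_preimage] using h2

theorem measurable_halfboxes {S : Set (ℝ × ℝ)}
    (h : ∀ t y, (t, y) ∈ S → ∃ ε > 0,
      (∀ t' ∈ Set.Ico t (t + ε), ∀ y', |y' - y| < ε → (t', y') ∈ S) ∨
      (∀ t' ∈ Set.Ioc (t - ε) t, ∀ y', |y' - y| < ε → (t', y') ∈ S)) : MeasurableSet S := by
  let TR : ℚ → ℚ → Set ℝ := fun a b => {t | ∃ ε > 0, ∀ t' ∈ Set.Ico t (t + ε), ∀ y ∈ Set.Ioo (a:ℝ) b, (t', y) ∈ S}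
  let TL : ℚ → ℚ → Set ℝ := fun a b => {t | ∃ ε > 0, ∀ t' ∈ Set.Ioc (t - ε) t, ∀ y ∈ Set.Ioo (a:ℝ) b, (t', y) ∈ S}
  have hR : ∀ a b, MeasurableSet (TR a b) := fun a b => measurable_right fun t ⟨ε, hε, ht⟩ =>
    ⟨ε, hε, fun t' ht' => ⟨t + ε - t', by linarith [ht'.2], fun t'' ht'' =>
      ht t'' ⟨ht'.1.trans ht''.1, by linarith [ht''.2]⟩⟩⟩
  have hL : ∀ a b, MeasurableSet (TL a b) := fun a b => measurable_left fun t ⟨ε, hε, ht⟩ =>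
    ⟨ε, hε, fun t' ht' => ⟨t' - (t - ε), by linarith [ht'.1], fun t'' ht'' =>
      ht t'' ⟨by linarith [ht''.1], ht''.2.trans ht'.2⟩⟩⟩
  have : S = ⋃ a : ℚ, ⋃ b : ℚ, (TR a b ∪ TL a b) ×ˢ Set.Ioo (a:ℝ) b := by
    ext ⟨t, y⟩
    simp only [Set.mem_iUnion, Set.mem_prod, Set.mem_union]
    constructor
    · intro hp
      obtain ⟨ε, hε, hh⟩ := h t y hp
      obtain ⟨a, ha1, ha2⟩ := exists_rat_btwn (show y - ε < y by linarith)
      obtain ⟨b, hb1, hb2⟩ := exists_rat_btwn (show y < y + ε by linarith)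
      refine ⟨a, b, ?_, ha2, hb1⟩
      refine hh.imp (fun h1 => ⟨ε, hε, fun t' ht' y' hy' => h1 t' ht' y' ?_⟩)
        (fun h1 => ⟨ε, hε, fun t' ht' y' hy' => h1 t' ht' y' ?_⟩) <;>
      · rw [abs_lt]; constructor <;> linarith [hy'.1, hy'.2]
    · rintro ⟨a, b, (⟨ε, hε, h1⟩ | ⟨ε, hε, h1⟩), hy⟩
      · exact h1 t ⟨le_rfl, by linarith⟩ y hy
      · exact h1 t ⟨by linarith, le_rfl⟩ y hy
  rw [this]
  exact MeasurableSet.iUnion fun a => MeasurableSet.iUnion fun b => ((hR a b).union (hL a b)).prod measurableSet_Ioo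

/-- differentiability-with-zero-derivative predicate -/
def Flat (d : ℝ → ℂ) (y : ℝ) : Prop := ∀ c > 0, ∃ ρ > 0, ∀ z, |z - y| < ρ → ‖d z‖ ≤ c * |z - y|

theorem Flat.zero {d : ℝ → ℂ} {y : ℝ} (h : Flat d y) : d y = 0 := by
  obtain ⟨ρ, hρ, h⟩ := h 1 one_pos
  have := h y (by simpa using hρ)
  simpa using this

theorem measurable_flat {d : ℝ → ℝ → ℂ}
    (hd : ∀ t z, ContinuousWithinAt (fun t => d t z) (Set.Ici t) t ∨
      ContinuousWithinAt (fun t => d t z) (Set.Iic t) t) :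
    MeasurableSet {p : ℝ × ℝ | Flat (d p.1) p.2} := by
  let S : ℝ → ℝ → Set (ℝ × ℝ) := fun c ρ => {p | ∃ z, |z - p.2| < ρ ∧ c * |z - p.2| < ‖d p.1 z‖}
  have hS : ∀ c ρ, MeasurableSet (S c ρ) := by
    intro c ρ
    refine measurable_halfboxes ?_
    rintro t y ⟨z, hz1, hz2⟩
    simp only at hz1 hz2
    obtain ⟨m, hm1, hm2⟩ := exists_between hz2
    have hy : ∀ᶠ y' in 𝓝 y, |z - y'| < ρ ∧ c * |z - y'| < m := by
      have c1 : Continuous fun y' : ℝ => |z - y'| := by fun_prop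
      exact ((c1.tendsto y).eventually_lt_const hz1).and
        (((continuous_const.mul c1).tendsto y).eventually_lt_const hm1)
    obtain ⟨ε1, hε1, h1⟩ := Metric.eventually_nhds_iff.1 hy
    have key : ∀ s : Set ℝ, ContinuousWithinAt (fun t => d t z) s t →
        ∃ ε > 0, ε ≤ ε1 ∧ ∀ t' ∈ s, |t' - t| < ε → m < ‖d t' z‖ := by
      intro s hs
      have h2 : ∀ᶠ t' in 𝓝[s] t, m < ‖d t' z‖ := hs.norm.eventually_const_lt hm2
      obtain ⟨ε, hε, h3⟩ := Metric.eventually_nhds_iff.1 (eventually_nhdsWithin_iff.1 h2)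
      exact ⟨min ε ε1, lt_min hε hε1, min_le_right _ _, fun t' ht' h4 =>
        h3 (by rw [Real.dist_eq]; exact h4.trans_le (min_le_left _ _)) ht'⟩
    rcases hd t z with h | h
    · obtain ⟨ε, hε, hle, h3⟩ := key _ h
      refine ⟨ε, hε, Or.inl fun t' ht' y' hy' => ⟨z, ?_⟩⟩
      have h5 := h1 (show dist y' y < ε1 by rw [Real.dist_eq]; linarith)
      exact ⟨h5.1, h5.2.trans (h3 t' ht'.1 (by rw [abs_lt]; constructor <;> linarith [ht'.1, ht'.2]))⟩
    · obtain ⟨ε, hε, hle, h3⟩ := key _ h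
      refine ⟨ε, hε, Or.inr fun t' ht' y' hy' => ⟨z, ?_⟩⟩
      have h5 := h1 (show dist y' y < ε1 by rw [Real.dist_eq]; linarith)
      exact ⟨h5.1, h5.2.trans (h3 t' ht'.2 (by rw [abs_lt]; constructor <;> linarith [ht'.1, ht'.2]))⟩
  have : {p : ℝ × ℝ | Flat (d p.1) p.2} = ⋂ k : ℕ, ⋃ l : ℕ, (S (1 / (k + 1)) (1 / (l + 1)))ᶜ := by
    ext p
    simp only [Set.mem_iInter, Set.mem_iUnion, Set.mem_compl_iff, S, Set.mem_ofPred_eq, not_exists, not_and, not_lt]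
    constructor
    · intro h k
      obtain ⟨ρ, hρ, h1⟩ := h (1 / (k + 1)) (by positivity)
      obtain ⟨l, hl⟩ := exists_nat_one_div_lt hρ
      exact ⟨l, fun z hz => h1 z (hz.trans hl)⟩
    · intro h c hc
      obtain ⟨k, hk⟩ := exists_nat_one_div_lt hc
      obtain ⟨l, hl⟩ := h k
      exact ⟨1 / (l + 1), by positivity, fun z hz => (hl z hz).trans (by gcongr)⟩
  rw [this]
  exact MeasurableSet.iInter fun k => MeasurableSet.iUnion fun l => (hS _ _).compl

end

/-! ### Part P3b -/

noncomputable section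

open MeasureTheory Filter
open scoped ENNReal Topology


theorem rigid_one {S C : ℝ} (hC : 0 ≤ C) {Y g : ℝ → ℂ}
    (hYc : ContinuousOn Y (Set.Icc 0 S)) (hgc : ContinuousOn g (Set.Icc 0 S)) (h0 : Y 0 = g 0)
    (H1 : ∀ t0 ∈ Set.Icc 0 S, ∀ t1 ∈ Set.Icc 0 S, t0 ≤ t1 →
      ‖Y t1 - Y t0‖ ≤ C * ((Y t0).re - (Y t1).re))
    (H1' : ∀ t0 ∈ Set.Icc 0 S, ∀ t1 ∈ Set.Icc 0 S, t0 ≤ t1 → (Y t1).re ≤ (Y t0).re)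
    (H2 : ∀ t0 ∈ Set.Icc 0 S, ∀ t1 ∈ Set.Icc 0 S, t0 ≤ t1 →
      (∀ t ∈ Set.Ioo t0 t1, Y t ≠ g t) → g t1 = g t0)
    {t t1 : ℝ} (ht : t ∈ Set.Icc 0 S) (ht1 : t1 ∈ Set.Icc 0 S) (hle : t ≤ t1) :
    ‖Y t - g t‖ ≤ C * ‖Y t1 - g t1‖ := by
  by_cases hd : Y t = g t
  · rw [hd, sub_self, norm_zero]; positivity
  have hdc : ContinuousOn (fun s => Y s - g s) (Set.Icc 0 S) := hYc.sub hgc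
  have hcl : ∀ a b, 0 ≤ a → b ≤ S → IsCompact (Set.Icc a b ∩ {s | Y s - g s = 0}) := by
    intro a b ha hb
    have := (hdc.mono (Set.Icc_subset_Icc ha hb)).preimage_isClosed_of_isClosed isClosed_Icc
      (isClosed_singleton (x := (0:ℂ)))
    exact isCompact_Icc.of_isClosed_subset this Set.inter_subset_left
  obtain ⟨t', ht'm, ht'g⟩ := (hcl 0 t le_rfl ht.2).exists_isGreatest ⟨0, ⟨le_rfl, ht.1⟩, by simp [h0]⟩
  have ht'0 : Y t' = g t' := sub_eq_zero.1 ht'm.2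
  have ht'S : t' ∈ Set.Icc 0 S := ⟨ht'm.1.1, ht'm.1.2.trans ht.2⟩
  have ht'lt : t' < t := lt_of_le_of_ne ht'm.1.2 (fun h => hd (h ▸ ht'0))
  have hne1 : ∀ s, t' < s → s ≤ t → Y s ≠ g s := fun s hs1 hs2 h =>
    absurd (ht'g ⟨⟨ht'S.1.trans hs1.le, hs2⟩, sub_eq_zero.2 h⟩) (not_le.2 hs1)
  have hgt : g t = g t' := H2 t' ht'S t ht ht'lt.le fun s hs => hne1 s hs.1 hs.2.le
  have hne2 : ∀ s, t ≤ s → s ≤ t1 → Y s ≠ g s := by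
    intro s hs1 hs2 h
    obtain ⟨t2, ht2m, ht2l⟩ := (hcl t t1 ht.1 ht1.2).exists_isLeast ⟨s, ⟨hs1, hs2⟩, sub_eq_zero.2 h⟩
    have ht2S : t2 ∈ Set.Icc 0 S := ⟨ht.1.trans ht2m.1.1, ht2m.1.2.trans ht1.2⟩
    have hg2 : g t2 = g t' := by
      refine H2 t' ht'S t2 ht2S (ht'lt.le.trans ht2m.1.1) fun r hr => ?_
      rcases le_or_gt r t with h1 | h1
      · exact hne1 r hr.1 h1
      · intro h2
        exact absurd (ht2l ⟨⟨h1.le, hr.2.le.trans ht2m.1.2⟩, sub_eq_zero.2 h2⟩) (not_le.2 hr.2)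
    have hY2 : Y t2 = Y t' := by rw [sub_eq_zero.1 ht2m.2, hg2, ht'0]
    have e1 := H1 t' ht'S t ht ht'lt.le
    have e2 := H1' t ht t2 ht2S ht2m.1.1
    have e3 := H1' t' ht'S t ht ht'lt.le
    rw [hY2] at e2
    have e4 : (Y t').re - (Y t).re = 0 := by linarith
    rw [e4, mul_zero] at e1
    have e5 : Y t - Y t' = 0 := norm_le_zero_iff.1 e1
    exact hd (by rw [sub_eq_zero.1 e5, hgt, ht'0])
  have hg1 : g t1 = g t' := by
    refine H2 t' ht'S t1 ht1 (ht'lt.le.trans hle) fun r hr => ?_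
    rcases le_or_gt r t with h1 | h1
    · exact hne1 r hr.1 h1
    · exact hne2 r h1.le hr.2.le
  rw [hgt, hg1, ← ht'0]
  calc ‖Y t - Y t'‖ ≤ C * ((Y t').re - (Y t).re) := H1 t' ht'S t ht ht'lt.le
    _ ≤ C * ‖Y t1 - Y t'‖ := by
      gcongr
      have e2 := H1' t ht t1 ht1 hle
      have e3 : |(Y t1 - Y t').re| ≤ _ := Complex.abs_re_le_norm _
      rw [Complex.sub_re] at e3
      linarith [neg_abs_le ((Y t1).re - (Y t').re)]

/-- quadratic modulus on a dense set implies constant -/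
theorem const_of_quad {x0 x1 C : ℝ} (hC : 0 ≤ C) {G : Set ℝ} (hG : Dense G) {f : ℝ → ℝ}
    (hf : ∀ y ∈ Set.Ioo x0 x1, ∀ y' ∈ Set.Ioo x0 x1, y ∈ G → y' ∈ G → |f y - f y'| ≤ C * (y - y') ^ 2)
    {y y' : ℝ} (hy : y ∈ Set.Ioo x0 x1) (hy' : y' ∈ Set.Ioo x0 x1) (hyG : y ∈ G) (hyG' : y' ∈ G) :
    f y = f y' := by
  wlog hlt : y < y' generalizing y y'
  · rcases eq_or_lt_of_le (not_lt.1 hlt) with h | h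
    · rw [h]
    · exact (this hy' hy hyG' hyG h).symm
  have key : ∀ N : ℕ, |f y - f y'| ≤ (C * 4 * (y' - y) ^ 2 * 3) / (N + 1) := by
    intro N
    set δ := (y' - y) / (N + 1) with hδ
    have hNp : (0:ℝ) < N + 1 := by positivity
    have hδp : 0 < δ := by apply div_pos <;> linarith
    have hNδ : (N + 1) * δ = y' - y := by rw [hδ]; field_simp
    have hex : ∀ i : ℕ, ∃ p ∈ G, y + i * δ < p ∧ p < y + (i + 1) * δ := fun i => by
      obtain ⟨p, hp, hpG⟩ := hG.exists_between (show y + i * δ < y + (i + 1) * δ by linarith)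
      exact ⟨p, hp, hpG.1, hpG.2⟩
    choose p hpG hp1 hp2 using hex
    have hpI : ∀ i ≤ N, p i ∈ Set.Ioo x0 x1 := fun i hi => by
      have hi' : (i:ℝ) ≤ N := by exact_mod_cast hi
      have : (0:ℝ) ≤ i := by positivity
      refine ⟨lt_of_lt_of_le hy.1 ?_, lt_of_le_of_lt ?_ hy'.2⟩
      · nlinarith [hp1 i]
      · nlinarith [hp2 i]
    have hstep : ∀ i < N, |f (p i) - f (p (i + 1))| ≤ C * 4 * δ ^ 2 := fun i hi => by
      refine (hf _ (hpI i hi.le) _ (hpI (i + 1) hi) (hpG _) (hpG _)).trans ?_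
      have a1 := hp1 i
      have a2 := hp2 i
      have a3 := hp1 (i + 1)
      have a4 := hp2 (i + 1)
      push_cast at a3 a4
      rw [mul_assoc]; gcongr
      have : (p i - p (i+1)) ^ 2 ≤ (2 * δ) ^ 2 := by
        apply sq_le_sq'
        · nlinarith
        · nlinarith
      linarith
    have hsum : |f (p 0) - f (p N)| ≤ N * (C * 4 * δ ^ 2) := by
      have := dist_le_range_sum_of_dist_le (f := fun i => f (p i)) (d := fun _ => C * 4 * δ ^ 2) N
        (fun {i} hi => by rw [Real.dist_eq]; exact hstep i hi)
      simpa [Real.dist_eq] using this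
    have h1 : |f y - f (p 0)| ≤ C * 4 * δ ^ 2 := by
      refine (hf _ hy _ (hpI 0 (Nat.zero_le _)) hyG (hpG 0)).trans ?_
      have a1 := hp1 0
      have a2 := hp2 0
      push_cast at a1 a2
      rw [mul_assoc]; gcongr
      nlinarith
    have h2 : |f (p N) - f y'| ≤ C * 4 * δ ^ 2 := by
      refine (hf _ (hpI N le_rfl) _ hy' (hpG N) hyG').trans ?_
      have a1 := hp1 N
      have a2 := hp2 N
      rw [mul_assoc]; gcongr
      have : y' = y + (N + 1) * δ := by linarith
      nlinarith
    have h3 : |f y - f y'| ≤ |f y - f (p 0)| + |f (p 0) - f (p N)| + |f (p N) - f y'| := by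
      have := abs_sub_le (f y) (f (p 0)) (f (p N))
      have := abs_sub_le (f y) (f (p N)) (f y')
      linarith
    refine (h3.trans (add_le_add (add_le_add h1 hsum) h2)).trans ?_
    rw [le_div_iff₀ hNp, ← hNδ]
    have : (0:ℝ) ≤ N := by positivity
    have e : 0 ≤ C * 4 * δ ^ 2 := by positivity
    nlinarith [mul_nonneg e this, mul_nonneg (mul_nonneg e this) this]
  have : |f y - f y'| ≤ 0 := by
    refine ge_of_tendsto' (x := atTop) ?_ key
    have := tendsto_const_div_atTop_nhds_zero_nat (C * 4 * (y' - y) ^ 2 * 3)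
    have := (tendsto_add_atTop_iff_nat 1).2 this
    simpa using this
  exact sub_eq_zero.1 (abs_nonpos_iff.1 this)

end

/-! ### Part P3c -/

noncomputable section

open MeasureTheory Filter
open scoped ENNReal Topology


theorem dense_le {G U : Set ℝ} (hG : Dense G) (hU : IsOpen U) {f g : ℝ → ℝ} (hf : ContinuousOn f U)
    (hg : ContinuousOn g U) (h : ∀ z ∈ G, z ∈ U → f z ≤ g z) {y : ℝ} (hy : y ∈ U) : f y ≤ g y := by
  have : (𝓝[G] y).NeBot := mem_closure_iff_nhdsWithin_neBot.1 (hG y)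
  have hUn := hU.mem_nhds hy
  refine le_of_tendsto_of_tendsto (b := 𝓝[G] y)
    ((hf.continuousAt hUn).tendsto.mono_left nhdsWithin_le_nhds)
    ((hg.continuousAt hUn).tendsto.mono_left nhdsWithin_le_nhds) ?_
  filter_upwards [self_mem_nhdsWithin, nhdsWithin_le_nhds hUn] with z h1 h2 using h z h1 h2

theorem ii_congr_Ioo {E : Type*} [NormedAddCommGroup E] [NormedSpace ℝ E] {f g : ℝ → E} {a b : ℝ} (hab : a ≤ b)
    (h : ∀ t ∈ Set.Ioo a b, f t = g t) : ∫ t in a..b, f t = ∫ t in a..b, g t := by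
  rw [intervalIntegral.integral_of_le hab, intervalIntegral.integral_of_le hab,
    integral_Ioc_eq_integral_Ioo, integral_Ioc_eq_integral_Ioo]
  exact setIntegral_congr_fun measurableSet_Ioo h

theorem rigidity {x0 x1 S κ M K : ℝ} (hS : 0 ≤ S) (hκ : 0 < κ) (hK0 : 0 ≤ K) (hM0 : 0 ≤ M)
    (hx : x0 < x1)
    {h Y d : ℝ → ℝ → ℂ} {th ℓ : ℝ → ℝ → ℝ} {G : Set ℝ} (hG : ∀ᵐ x, x ∈ G)
    (hth01 : ∀ t y, th t y = 0 ∨ th t y = 1)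
    (hflat : ∀ t ∈ Set.Icc 0 S, ∀ y ∈ Set.Ioo x0 x1, th t y = 1 ↔ Flat (d t) y)
    (hthm : ∀ y, Measurable (fun t => th t y))
    (hhc : ∀ y, Continuous (fun t => h t y))
    (hhκ : ∀ t ∈ Set.Icc 0 S, ∀ y ∈ Set.Ioo x0 x1, κ ≤ -(h t y).re)
    (hhM : ∀ t ∈ Set.Icc 0 S, ∀ y ∈ Set.Ioo x0 x1, ‖h t y‖ ≤ M)
    (hYt : ∀ y, Continuous (fun t => Y t y)) (hYx : ∀ t, Continuous (Y t))
    (hd : ∀ t ∈ Set.Icc 0 S, ∀ y ∈ Set.Ioo x0 x1, d t y = Y t y - ∫ τ in (0:ℝ)..t, th τ y * h τ y)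
    (hGd : ∀ z ∈ G, ∀ t ∈ Set.Icc 0 S, d t z = 0)
    (hY0 : ∀ y, Y 0 y = 0)
    (hℓi : ∀ t ∈ Set.Icc 0 S, ∀ y y' , IntervalIntegrable (ℓ t) volume y y')
    (hℓ : ∀ t ∈ Set.Icc 0 S, ∀ y ∈ Set.Ioo x0 x1, ∀ y' ∈ Set.Ioo x0 x1,
      ((Y t y).re - (∫ τ in (0:ℝ)..t, h τ y).re) - ((Y t y').re - (∫ τ in (0:ℝ)..t, h τ y').re)
        = ∫ x in y'..y, ℓ t x)
    (hK : ∀ t ∈ Set.Icc 0 S, ∀ x ∈ Set.Ioo x0 x1, |ℓ t x| ≤ K)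
    (hKL : ∀ t ∈ Set.Icc 0 S, ∀ x ∈ Set.Ioo x0 x1, ∀ x' ∈ Set.Ioo x0 x1, x ∈ G → x' ∈ G →
      |ℓ t x - ℓ t x'| ≤ K * (|x - x'| + (∫ τ in (0:ℝ)..t, (1 - th τ x)) + ∫ τ in (0:ℝ)..t, (1 - th τ x'))) :
    ∃ b ∈ Set.Icc 0 S, ∀ z ∈ Set.Ioo x0 x1, z ∈ G → ∀ t ∈ Set.Icc 0 S,
      (t < b → th t z = 1) ∧ (b < t → th t z = 0) := by
  have hGd' : Dense G := Measure.dense_of_ae hG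
  have hth0 : ∀ t y, 0 ≤ th t y := fun t y => by rcases hth01 t y with h | h <;> simp [h]
  have hth1 : ∀ t y, th t y ≤ 1 := fun t y => by rcases hth01 t y with h | h <;> simp [h]
  have hthi : ∀ y a b, IntervalIntegrable (fun t => th t y) volume a b := fun y a b => by
    refine (intervalIntegrable_const (c := (1:ℝ))).mono_fun' (hthm y).aestronglyMeasurable ?_
    refine Eventually.of_forall fun t => ?_
    simp only [Real.norm_eq_abs]
    rw [abs_of_nonneg (hth0 t y)]; exact hth1 t y
  have hthhi : ∀ y a b, IntervalIntegrable (fun t => (th t y : ℂ) * h t y) volume a b := fun y a b => by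
    refine ((hhc y).norm.intervalIntegrable a b).mono_fun' ?_ ?_
    · exact ((Complex.measurable_ofReal.comp (hthm y)).mul (hhc y).measurable).aestronglyMeasurable
    · refine Eventually.of_forall fun t => ?_
      simp only [norm_mul, Complex.norm_real, Real.norm_eq_abs]
      rw [abs_of_nonneg (hth0 t y)]
      exact mul_le_of_le_one_left (norm_nonneg _) (hth1 t y)
  set g : ℝ → ℝ → ℂ := fun t y => ∫ τ in (0:ℝ)..t, th τ y * h τ y with hg
  have hgsub : ∀ y t0 t1, g t1 y - g t0 y = ∫ τ in t0..t1, th τ y * h τ y := fun y t0 t1 => by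
    simp only [hg]
    rw [intervalIntegral.integral_interval_sub_left (hthhi y _ _) (hthhi y _ _)]
  have h0S : (0:ℝ) ∈ Set.Icc 0 S := ⟨le_rfl, hS⟩
  have hYg : ∀ z ∈ G, z ∈ Set.Ioo x0 x1 → ∀ t ∈ Set.Icc 0 S, Y t z = g t z := fun z hz hzI t ht => by
    have := hd t ht z hzI
    rw [hGd z hz t ht] at this
    exact (sub_eq_zero.1 this.symm)
  -- real part of integrals
  have hre : ∀ y t0 t1, (∫ τ in t0..t1, (th τ y : ℂ) * h τ y).re = ∫ τ in t0..t1, th τ y * (h τ y).re := by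
    intro y t0 t1
    have := intervalIntegral.intervalIntegral_re (𝕜 := ℂ) (hthhi y t0 t1)
    simp only [RCLike.re_eq_complex_re] at this
    rw [← this]; congr 1; funext τ; simp
  have hrei : ∀ y a b, IntervalIntegrable (fun t => th t y * (h t y).re) volume a b := fun y a b => by
    have := (hthhi y a b).norm
    refine this.mono_fun' ((hthm y).mul (Complex.measurable_re.comp (hhc y).measurable)).aestronglyMeasurable ?_
    refine Eventually.of_forall fun t => ?_
    simp only [norm_mul, Complex.norm_real]
    gcongr
    exact Complex.abs_re_le_norm _
  have hsubI : ∀ {a b : ℝ}, a ∈ Set.Icc 0 S → b ∈ Set.Icc 0 S → ∀ τ ∈ Set.Icc a b, τ ∈ Set.Icc 0 S :=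
    fun ha hb τ hτ => ⟨ha.1.trans hτ.1, hτ.2.trans hb.2⟩
  have H1G : ∀ y ∈ Set.Ioo x0 x1, ∀ t0 ∈ Set.Icc 0 S, ∀ t1 ∈ Set.Icc 0 S, t0 ≤ t1 →
      ‖g t1 y - g t0 y‖ ≤ (M / κ) * ((g t0 y).re - (g t1 y).re) := by
    intro y hy t0 ht0 t1 ht1 hle
    have e1 : (g t0 y).re - (g t1 y).re = ∫ τ in t0..t1, -(th τ y * (h τ y).re) := by
      have := congrArg Complex.re (hgsub y t0 t1)
      rw [hre, Complex.sub_re] at this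
      rw [intervalIntegral.integral_neg]; linarith
    rw [e1, hgsub, ← intervalIntegral.integral_const_mul]
    refine (intervalIntegral.norm_integral_le_integral_norm hle).trans ?_
    refine intervalIntegral.integral_mono_on hle (hthhi y _ _).norm ((hrei y _ _).neg.const_mul _) fun τ hτ => ?_
    have hτ' := hsubI ht0 ht1 τ hτ
    rw [norm_mul, Complex.norm_real, Real.norm_eq_abs, abs_of_nonneg (hth0 τ y)]
    have a1 := hhκ τ hτ' y hy
    have a2 := hhM τ hτ' y hy
    have : ‖h τ y‖ ≤ M / κ * (-(h τ y).re) := by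
      rw [div_mul_eq_mul_div, le_div_iff₀ hκ]
      nlinarith [norm_nonneg (h τ y)]
    nlinarith [mul_le_mul_of_nonneg_left this (hth0 τ y)]
  have hMκ : 0 ≤ M / κ := by positivity
  have H1 : ∀ y ∈ Set.Ioo x0 x1, ∀ t0 ∈ Set.Icc 0 S, ∀ t1 ∈ Set.Icc 0 S, t0 ≤ t1 →
      ‖Y t1 y - Y t0 y‖ ≤ (M / κ) * ((Y t0 y).re - (Y t1 y).re) := by
    intro y hy t0 ht0 t1 ht1 hle
    have hc1 := hYx t0
    have hc2 := hYx t1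
    refine dense_le (f := fun y => ‖Y t1 y - Y t0 y‖) (g := fun y => (M / κ) * ((Y t0 y).re - (Y t1 y).re))
      hGd' isOpen_Ioo (by fun_prop) ?_ (fun z hz hzI => ?_) hy
    · exact ((Complex.continuous_re.comp hc1).sub (Complex.continuous_re.comp hc2)).const_smul (M/κ) |>.continuousOn
    · simp only [hYg z hz hzI t0 ht0, hYg z hz hzI t1 ht1]
      exact H1G z hzI t0 ht0 t1 ht1 hle
  have H1' : ∀ y ∈ Set.Ioo x0 x1, ∀ t0 ∈ Set.Icc 0 S, ∀ t1 ∈ Set.Icc 0 S, t0 ≤ t1 →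
      (Y t1 y).re ≤ (Y t0 y).re := by
    intro y hy t0 ht0 t1 ht1 hle
    have hc1 := hYx t0
    have hc2 := hYx t1
    refine dense_le (f := fun y => (Y t1 y).re) (g := fun y => (Y t0 y).re)
      hGd' isOpen_Ioo (Complex.continuous_re.comp hc2).continuousOn (Complex.continuous_re.comp hc1).continuousOn
       (fun z hz hzI => ?_) hy
    simp only [hYg z hz hzI t0 ht0, hYg z hz hzI t1 ht1]
    have := congrArg Complex.re (hgsub z t0 t1)
    rw [hre, Complex.sub_re] at this
    have h2 : ∫ τ in t0..t1, th τ z * (h τ z).re ≤ 0 := by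
      have := intervalIntegral.integral_nonneg (μ := volume) hle (f := fun τ => -(th τ z * (h τ z).re)) fun τ hτ => by
        have a1 := hhκ τ (hsubI ht0 ht1 τ hτ) z hzI
        nlinarith [mul_nonneg (hth0 τ z) (hκ.le.trans a1)]
      rw [intervalIntegral.integral_neg] at this
      linarith
    linarith
  have R1a : ∀ y ∈ Set.Ioo x0 x1, ∀ t ∈ Set.Icc 0 S, ∀ t1 ∈ Set.Icc 0 S, t ≤ t1 →
      ‖d t y‖ ≤ M / κ * ‖d t1 y‖ := by
    intro y hy t ht t1 ht1 hle
    rw [hd t ht y hy, hd t1 ht1 y hy]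
    refine rigid_one hMκ (Y := fun t => Y t y) (g := fun t => g t y) (hYt y).continuousOn ?_ ?_
      (H1 y hy) (H1' y hy) ?_ ht ht1 hle
    · exact (intervalIntegral.continuous_primitive (fun a b => hthhi y a b) 0).continuousOn
    · simp [hY0, hg]
    · intro t0 ht0 t1 ht1 hle hne
      rw [← sub_eq_zero, hgsub]
      rw [ii_congr_Ioo (g := fun _ => (0:ℂ)) hle]
      · simp
      · intro τ hτ
        have hτS := hsubI ht0 ht1 τ ⟨hτ.1.le, hτ.2.le⟩
        rcases hth01 τ y with h0 | h1
        · simp [h0]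
        · exfalso
          have := ((hflat τ hτS y hy).1 h1).zero
          rw [hd τ hτS y hy] at this
          exact hne τ hτ (sub_eq_zero.1 this)
  have hmono : ∀ y ∈ Set.Ioo x0 x1, ∀ t ∈ Set.Icc 0 S, ∀ t1 ∈ Set.Icc 0 S, t ≤ t1 →
      th t1 y = 1 → th t y = 1 := by
    intro y hy t ht t1 ht1 hle h1
    rw [hflat t ht y hy]
    have hF := (hflat t1 ht1 y hy).1 h1
    intro c hc
    obtain ⟨ρ, hρ, h2⟩ := hF (c / (M / κ + 1)) (by positivity)
    refine ⟨min ρ (min (y - x0) (x1 - y)), lt_min hρ (lt_min (by linarith [hy.1]) (by linarith [hy.2])),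
      fun z hz => ?_⟩
    have hz1 := hz.trans_le (min_le_left _ _)
    have hz2 := (hz.trans_le (min_le_right _ _)).trans_le (min_le_left _ _)
    have hz3 := (hz.trans_le (min_le_right _ _)).trans_le (min_le_right _ _)
    have hzI : z ∈ Set.Ioo x0 x1 := ⟨by linarith [neg_abs_le (z - y)], by linarith [le_abs_self (z - y)]⟩
    calc ‖d t z‖ ≤ M / κ * ‖d t1 z‖ := R1a z hzI t ht t1 ht1 hle
      _ ≤ M / κ * (c / (M / κ + 1) * |z - y|) := by gcongr; exact h2 z hz1
      _ = (M / κ) / (M / κ + 1) * (c * |z - y|) := by ring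
      _ ≤ 1 * (c * |z - y|) := by
        gcongr
        rw [div_le_one (by positivity)]; linarith
      _ = _ := one_mul _
  -- switching times
  set τ : ℝ → ℝ := fun y => sSup {t | t ∈ Set.Icc 0 S ∧ (t = 0 ∨ th t y = 1)} with hτdef
  have hbdd : ∀ y, BddAbove {t | t ∈ Set.Icc 0 S ∧ (t = 0 ∨ th t y = 1)} := fun y => ⟨S, fun t ht => ht.1.2⟩
  have hτI : ∀ y, τ y ∈ Set.Icc 0 S := fun y =>
    ⟨le_csSup (hbdd y) ⟨h0S, Or.inl rfl⟩, csSup_le ⟨0, h0S, Or.inl rfl⟩ fun t ht => ht.1.2⟩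
  have hτ1 : ∀ y ∈ Set.Ioo x0 x1, ∀ t ∈ Set.Icc 0 S, t < τ y → th t y = 1 := by
    intro y hy t ht hlt
    obtain ⟨t1, ht1, hlt1⟩ := exists_lt_of_lt_csSup (s := {t | t ∈ Set.Icc 0 S ∧ (t = 0 ∨ th t y = 1)}) ⟨0, h0S, Or.inl rfl⟩ hlt
    rcases ht1.2 with h | h
    · exact absurd hlt1 (by rw [h]; exact not_lt.2 ht.1)
    · exact hmono y hy t ht t1 ht1.1 hlt1.le h
  have hτ0 : ∀ y, ∀ t ∈ Set.Icc 0 S, τ y < t → th t y = 0 := by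
    intro y t ht hlt
    rcases hth01 t y with h | h
    · exact h
    · exact absurd (le_csSup (hbdd y) ⟨ht, Or.inr h⟩) (not_le.2 hlt)
  -- the defect q
  set off : ℝ → ℝ → ℝ := fun t y => ∫ τ in (0:ℝ)..t, (1 - th τ y) with hoff
  have hoffi : ∀ y a b, IntervalIntegrable (fun t => 1 - th t y) volume a b := fun y a b =>
    intervalIntegrable_const.sub (hthi y a b)
  have hoff0 : ∀ t ∈ Set.Icc 0 S, ∀ y, 0 ≤ off t y := fun t ht y =>
    intervalIntegral.integral_nonneg ht.1 fun r _ => by linarith [hth1 r y]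
  set q : ℝ → ℝ → ℝ := fun t y => (Y t y).re - (∫ τ in (0:ℝ)..t, h τ y).re with hq
  have hhre : ∀ y t, (∫ τ in (0:ℝ)..t, h τ y).re = ∫ τ in (0:ℝ)..t, (h τ y).re := by
    intro y t
    have := intervalIntegral.intervalIntegral_re (𝕜 := ℂ) ((hhc y).intervalIntegrable (μ := volume) 0 t)
    simp only [RCLike.re_eq_complex_re] at this
    exact this.symm
  have hrec : ∀ y, Continuous fun t => (h t y).re := fun y => Complex.continuous_re.comp (hhc y)
  have hqeq : ∀ z ∈ G, z ∈ Set.Ioo x0 x1 → ∀ t ∈ Set.Icc 0 S,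
      q t z = ∫ r in (0:ℝ)..t, (1 - th r z) * (-(h r z).re) := by
    intro z hz hzI t ht
    simp only [hq]
    rw [hYg z hz hzI t ht, hhre]
    simp only [hg]
    rw [hre, ← intervalIntegral.integral_sub (hrei z _ _) ((hrec z).intervalIntegrable _ _)]
    congr 1; funext r; ring
  have hqi : ∀ y a b, IntervalIntegrable (fun r => (1 - th r y) * (-(h r y).re)) volume a b := fun y a b => by
    have := (hrei y a b).sub ((hrec y).intervalIntegrable (μ := volume) a b)
    refine this.congr ?_
    exact fun r _ => by ring
  have hqoff : ∀ z ∈ G, z ∈ Set.Ioo x0 x1 → ∀ t ∈ Set.Icc 0 S, κ * off t z ≤ q t z := by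
    intro z hz hzI t ht
    rw [hqeq z hz hzI t ht]
    simp only [hoff]
    rw [← intervalIntegral.integral_const_mul]
    refine intervalIntegral.integral_mono_on ht.1 ((hoffi z _ _).const_mul κ) (hqi z _ _) fun r hr => ?_
    have a1 := hhκ r (hsubI h0S ht r hr) z hzI
    nlinarith [hth1 r z]
  have hq0 : ∀ z ∈ G, z ∈ Set.Ioo x0 x1 → ∀ t ∈ Set.Icc 0 S, 0 ≤ q t z := fun z hz hzI t ht =>
    (mul_nonneg hκ.le (hoff0 t ht z)).trans (hqoff z hz hzI t ht)
  have hth1on : ∀ z ∈ Set.Ioo x0 x1, ∀ r ∈ Set.Ioo 0 (τ z), th r z = 1 := fun z hzI r hr =>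
    hτ1 z hzI r (hsubI h0S (hτI z) r ⟨hr.1.le, hr.2.le⟩) hr.2
  have hqτ : ∀ z ∈ G, z ∈ Set.Ioo x0 x1 → q (τ z) z = 0 := fun z hz hzI => by
    rw [hqeq z hz hzI _ (hτI z), ii_congr_Ioo (g := fun _ => (0:ℝ)) (hτI z).1]
    · simp
    · intro r hr; rw [hth1on z hzI r hr]; ring
  have hoffτ : ∀ z ∈ Set.Ioo x0 x1, off (τ z) z = 0 := fun z hzI => by
    simp only [hoff]
    rw [ii_congr_Ioo (g := fun _ => (0:ℝ)) (hτI z).1]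
    · simp
    · intro r hr; rw [hth1on z hzI r hr]; ring
  have hofflb : ∀ z, ∀ t ∈ Set.Icc 0 S, t - τ z ≤ off t z := by
    intro z t ht
    rcases le_total t (τ z) with h1 | h1
    · linarith [hoff0 t ht z]
    · have e : off t z = off (τ z) z + ∫ r in (τ z)..t, (1 - th r z) :=
        (intervalIntegral.integral_add_adjacent_intervals (hoffi z _ _) (hoffi z _ _)).symm
      have e2 : ∫ r in (τ z)..t, (1 - th r z) = t - τ z := by
        rw [ii_congr_Ioo (g := fun _ => (1:ℝ)) h1]
        · simp
        · intro r hr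
          rw [hτ0 z r (hsubI (hτI z) ht r ⟨hr.1.le, hr.2.le⟩) hr.1]; ring
      linarith [hoff0 _ (hτI z) z]
  set K1 := K * (1 + K / κ) with hK1
  have hK1p : 0 ≤ K1 := by positivity
  have quad : ∀ y1 ∈ Set.Ioo x0 x1, ∀ y2 ∈ Set.Ioo x0 x1, y1 ∈ G → y2 ∈ G →
      τ y2 - τ y1 ≤ K1 / κ * (y1 - y2) ^ 2 := by
    intro y1 hy1 y2 hy2 hy1G hy2G
    set t := τ y2 with htdef
    have ht : t ∈ Set.Icc 0 S := hτI y2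
    have hbet : ∀ {y : ℝ}, y ∈ Set.Ioo x0 x1 → ∀ x ∈ Set.uIoc y2 y, x ∈ Set.Ioo x0 x1 := by
      intro y hy x hx
      have := Set.uIoc_subset_uIcc hx
      exact (Set.ordConnected_Ioo.uIcc_subset hy2 hy) this
    have ha : ∀ x ∈ Set.Ioo x0 x1, q t x = ∫ r in y2..x, ℓ t r := fun x hxI => by
      have := hℓ t ht x hxI y2 hy2
      have h0 := hqτ y2 hy2G hy2
      simp only [hq, ← htdef] at h0 ⊢
      rw [h0, sub_zero] at this
      exact this
    have hb : ∀ x ∈ Set.Ioo x0 x1, q t x ≤ K * |x - y2| := fun x hxI => by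
      rw [ha x hxI]
      refine (Real.le_norm_self _).trans ?_
      exact intervalIntegral.norm_integral_le_of_norm_le_const (f := ℓ t) fun r hr => hK t ht r (hbet hxI r hr)
    have hc : ∀ x ∈ Set.Ioo x0 x1, x ∈ G → |ℓ t x - ℓ t y2| ≤ K1 * |x - y2| := fun x hxI hxG => by
      refine (hKL t ht x hxI y2 hy2 hxG hy2G).trans ?_
      have e1 : ∫ r in (0:ℝ)..t, (1 - th r y2) = 0 := hoffτ y2 hy2
      have e2 : off t x ≤ K / κ * |x - y2| := by
        rw [div_mul_eq_mul_div, le_div_iff₀ hκ]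
        linarith [hqoff x hxG hxI t ht, hb x hxI]
      rw [e1, add_zero, hK1, mul_assoc]
      gcongr
      linarith
    have hdq : ∀ y ∈ Set.Ioo x0 x1, |q t y - ℓ t y2 * (y - y2)| ≤ K1 * (y - y2) ^ 2 := fun y hy => by
      have e : q t y - ℓ t y2 * (y - y2) = ∫ r in y2..y, (ℓ t r - ℓ t y2) := by
        rw [intervalIntegral.integral_sub (hℓi t ht _ _) intervalIntegrable_const, ha y hy]
        simp; ring
      rw [e]
      have := intervalIntegral.norm_integral_le_of_norm_le_const_ae (a := y2) (b := y) (C := K1 * |y - y2|)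
        (f := fun r => ℓ t r - ℓ t y2) (by
          filter_upwards [hG] with r hrG hr
          refine (hc r (hbet hy r hr) hrG).trans ?_
          have := Set.uIoc_subset_uIcc hr
          exact mul_le_mul_of_nonneg_left (Set.abs_sub_left_of_mem_uIcc this) hK1p)
      rw [Real.norm_eq_abs] at this
      refine this.trans (le_of_eq ?_)
      rw [mul_assoc, abs_mul_abs_self, sq]
    have hl0 : ℓ t y2 = 0 := by
      rcases lt_trichotomy (ℓ t y2) 0 with hn | h0 | hp
      · exfalso
        have hr : 0 < min (x1 - y2) (-ℓ t y2 / (K1 + 1)) :=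
          lt_min (by linarith [hy2.2]) (div_pos (by linarith) (by linarith))
        obtain ⟨y, hyG, hyl, hyr⟩ := hGd'.exists_between (show y2 < y2 + min (x1 - y2) (-ℓ t y2 / (K1 + 1)) by linarith)
        have b1 := min_le_left (x1 - y2) (-ℓ t y2 / (K1 + 1))
        have b2 := min_le_right (x1 - y2) (-ℓ t y2 / (K1 + 1))
        have hyI : y ∈ Set.Ioo x0 x1 := ⟨by linarith [hy2.1], by linarith⟩
        have c1 := hdq y hyI
        have c2 := hq0 y hyG hyI t ht
        have c3 : (y - y2) * (K1 + 1) < -ℓ t y2 := by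
          rw [← lt_div_iff₀ (by linarith)]; linarith
        have c4 := (abs_le.1 c1).2
        have c5 : 0 < y - y2 := by linarith
        nlinarith
      · exact h0
      · exfalso
        have hr : 0 < min (y2 - x0) (ℓ t y2 / (K1 + 1)) :=
          lt_min (by linarith [hy2.1]) (div_pos (by linarith) (by linarith))
        obtain ⟨y, hyG, hyl, hyr⟩ := hGd'.exists_between (show y2 - min (y2 - x0) (ℓ t y2 / (K1 + 1)) < y2 by linarith)
        have b1 := min_le_left (y2 - x0) (ℓ t y2 / (K1 + 1))
        have b2 := min_le_right (y2 - x0) (ℓ t y2 / (K1 + 1))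
        have hyI : y ∈ Set.Ioo x0 x1 := ⟨by linarith, by linarith [hy2.2]⟩
        have c1 := hdq y hyI
        have c2 := hq0 y hyG hyI t ht
        have c3 : (y2 - y) * (K1 + 1) < ℓ t y2 := by
          rw [← lt_div_iff₀ (by linarith)]; linarith
        have c4 := (abs_le.1 c1).2
        have c5 : 0 < y2 - y := by linarith
        nlinarith
    have f1 := hdq y1 hy1
    rw [hl0, zero_mul, sub_zero] at f1
    have f2 := (le_abs_self _).trans f1
    have f3 := hqoff y1 hy1G hy1 t ht
    have f4 := hofflb y1 t ht
    rw [div_mul_eq_mul_div, le_div_iff₀ hκ]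
    nlinarith
  obtain ⟨z0, hz0G, hz01, hz02⟩ := hGd'.exists_between hx
  have hconst : ∀ z ∈ Set.Ioo x0 x1, z ∈ G → τ z = τ z0 := fun z hz hzG =>
    const_of_quad (C := K1 / κ) (by positivity) hGd' (f := τ) (fun y hy y' hy' hyG hyG' => by
      rw [abs_le]
      have a1 := quad y hy y' hy' hyG hyG'
      have a2 := quad y' hy' y hy hyG' hyG
      have : (y' - y) ^ 2 = (y - y') ^ 2 := by ring
      rw [this] at a2
      constructor <;> linarith) hz ⟨hz01, hz02⟩ hzG hz0G
  refine ⟨τ z0, hτI z0, fun z hz hzG t ht => ⟨fun hlt => hτ1 z hz t ht ?_, fun hlt => hτ0 z t ht ?_⟩⟩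
  · rw [hconst z hz hzG]; exact hlt
  · rw [hconst z hz hzG]; exact hlt

end

/-! ### Part P4 -/

noncomputable section

open MeasureTheory Filter
open scoped ENNReal Topology


/-- the kernel `g_α` -/
def gg (α x : ℝ) : ℝ := 1 / (2 * α) * Real.exp (-|x| / α)
/-- the kernel `α² g_α'` -/
def kk (α x : ℝ) : ℝ := if 0 < x then -(1 / 2) * Real.exp (-x / α) else 1 / 2 * Real.exp (x / α)

theorem gg_nonneg {α : ℝ} (hα : 0 < α) (x : ℝ) : 0 ≤ gg α x := by unfold gg; positivity
theorem gg_le {α : ℝ} (hα : 0 < α) (x : ℝ) : gg α x ≤ 1 / (2 * α) := by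
  unfold gg
  have : Real.exp (-|x| / α) ≤ 1 := Real.exp_le_one_iff.2 (div_nonpos_of_nonpos_of_nonneg (by simp) hα.le)
  exact mul_le_of_le_one_right (by positivity) this
theorem continuous_gg (α : ℝ) : Continuous (gg α) := by unfold gg; fun_prop
theorem measurable_kk (α : ℝ) : Measurable (kk α) := by
  unfold kk
  exact Measurable.ite measurableSet_Ioi (by fun_prop) (by fun_prop)
theorem abs_kk {α : ℝ} (x : ℝ) : |kk α x| = 1 / 2 * Real.exp (-|x| / α) := by
  unfold kk; split_ifs with h
  · rw [abs_mul, Real.abs_exp, abs_of_pos h]; norm_num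
  · rw [abs_mul, Real.abs_exp, abs_of_nonpos (not_lt.1 h)]; norm_num
theorem abs_kk_gg {α : ℝ} (hα : 0 < α) (x : ℝ) : |kk α x| = α * gg α x := by
  rw [abs_kk, gg]; field_simp
theorem abs_kk_le {α : ℝ} (hα : 0 < α) (x : ℝ) : |kk α x| ≤ 1 / 2 := by
  rw [abs_kk_gg hα]
  calc _ ≤ α * (1 / (2 * α)) := mul_le_mul_of_nonneg_left (gg_le hα x) hα.le
    _ = _ := by field_simp

theorem gg_eq_pos {α : ℝ} {x : ℝ} (hx : 0 ≤ x) : gg α x = 1 / (2 * α) * Real.exp ((-1/α) * x) := by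
  unfold gg; rw [abs_of_nonneg hx]; ring_nf
theorem gg_eq_neg {α : ℝ} {x : ℝ} (hx : x ≤ 0) : gg α x = 1 / (2 * α) * Real.exp ((1/α) * x) := by
  unfold gg; rw [abs_of_nonpos hx]; ring_nf

theorem integrable_gg {α : ℝ} (hα : 0 < α) : Integrable (gg α) := by
  rw [← integrableOn_univ, ← Set.Iic_union_Ioi (a := (0:ℝ))]
  refine IntegrableOn.union ?_ ?_
  · refine IntegrableOn.congr_fun ((integrableOn_exp_mul_Iic (a := 1/α) (by positivity) 0).const_mul (1/(2*α))) ?_ measurableSet_Iic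
    intro x hx; exact (gg_eq_neg hx).symm
  · refine IntegrableOn.congr_fun ((integrableOn_exp_mul_Ioi (a := -1/α) (div_neg_of_neg_of_pos (by norm_num) hα) 0).const_mul (1/(2*α))) ?_ measurableSet_Ioi
    intro x hx; exact (gg_eq_pos (le_of_lt hx)).symm

theorem integral_gg {α : ℝ} (hα : 0 < α) : ∫ x, gg α x = 1 := by
  rw [← intervalIntegral.integral_Iic_add_Ioi (integrable_gg hα).integrableOn (integrable_gg hα).integrableOn (b := 0)]
  have e1 : ∫ x in Set.Iic 0, gg α x = 1/2 := by
    rw [setIntegral_congr_fun measurableSet_Iic (fun x hx => gg_eq_neg hx), integral_const_mul,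
      integral_exp_mul_Iic (by positivity)]
    simp; field_simp
  have e2 : ∫ x in Set.Ioi 0, gg α x = 1/2 := by
    rw [setIntegral_congr_fun measurableSet_Ioi (fun x hx => gg_eq_pos (le_of_lt hx)), integral_const_mul,
      integral_exp_mul_Ioi (div_neg_of_neg_of_pos (by norm_num) hα)]
    simp; field_simp
  rw [e1, e2]; norm_num

theorem integrable_kk {α : ℝ} (hα : 0 < α) : Integrable (kk α) := by
  refine ((integrable_gg hα).const_mul α).mono' (measurable_kk α).aestronglyMeasurable ?_
  exact Eventually.of_forall fun x => by rw [Real.norm_eq_abs, abs_kk_gg hα]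

theorem intGG {α : ℝ} (hα : 0 < α) (x : ℝ) :
    ∫ y in (0:ℝ)..x, gg α y = if 0 < x then 1/2 + kk α x else kk α x - 1/2 := by
  unfold kk
  split_ifs with h
  · have : ∫ y in (0:ℝ)..x, gg α y = ∫ y in (0:ℝ)..x, 1 / (2 * α) * Real.exp ((-1/α) * y) := by
      refine intervalIntegral.integral_congr fun y hy => ?_
      rw [Set.uIcc_of_le h.le] at hy; exact gg_eq_pos hy.1
    rw [this, intervalIntegral.integral_const_mul,
      intervalIntegral.integral_comp_mul_left (f := Real.exp) (by simp [hα.ne'] : -1/α ≠ 0), integral_exp]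
    have : -1 / α * x = -x/α := by ring
    rw [this]
    simp; field_simp; ring
  · push Not at h
    have : ∫ y in (0:ℝ)..x, gg α y = ∫ y in (0:ℝ)..x, 1 / (2 * α) * Real.exp ((1/α) * y) := by
      refine intervalIntegral.integral_congr fun y hy => ?_
      rw [Set.uIcc_of_ge h] at hy; exact gg_eq_neg hy.2
    rw [this, intervalIntegral.integral_const_mul,
      intervalIntegral.integral_comp_mul_left (f := Real.exp) (by simp [hα.ne'] : 1/α ≠ 0), integral_exp]
    have : 1 / α * x = x/α := by ring
    rw [this]
    simp; field_simp

theorem kk_sub {α : ℝ} (hα : 0 < α) {a b : ℝ} (hab : a ≤ b) :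
    kk α b - kk α a = (∫ y in a..b, gg α y) - if a ≤ 0 ∧ 0 < b then 1 else 0 := by
  have : ∫ y in a..b, gg α y = (∫ y in (0:ℝ)..b, gg α y) - ∫ y in (0:ℝ)..a, gg α y := by
    rw [intervalIntegral.integral_interval_sub_left] <;> exact (continuous_gg α).intervalIntegrable _ _
  rw [this, intGG hα, intGG hα]
  split_ifs <;> grind

theorem fourierT_kk {α : ℝ} (hα : 0 < α) (ξ : ℝ) :
    fourierT (fun x => (kk α x : ℂ)) ξ = Complex.I * (α : ℂ) ^ 2 * (ξ : ℂ) /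
          (1 + (α : ℂ) ^ 2 * (ξ : ℂ) ^ 2) := by
  unfold fourierT
  have hi : Integrable (fun x : ℝ => (kk α x : ℂ) * Complex.exp (-(Complex.I * x * ξ))) :=
    fourierT_integrable (integrable_kk hα).ofReal ξ
  rw [← intervalIntegral.integral_Iic_add_Ioi hi.integrableOn hi.integrableOn (b := 0)]
  have hαc : (α:ℂ) ≠ 0 := by exact_mod_cast hα.ne'
  have e1 : ∫ x in Set.Iic (0:ℝ), (kk α x : ℂ) * Complex.exp (-(Complex.I * x * ξ)) =
      1/2 * (1 / ((1/α:ℂ) - Complex.I * ξ)) := by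
    have : ∀ x ∈ Set.Iic (0:ℝ), (kk α x : ℂ) * Complex.exp (-(Complex.I * x * ξ)) =
        1/2 * Complex.exp (((1/α:ℂ) - Complex.I * ξ) * x) := fun x hx => by
      unfold kk; rw [if_neg (not_lt.2 hx)]; push_cast
      rw [mul_assoc, ← Complex.exp_add]; congr 2; ring
    rw [setIntegral_congr_fun measurableSet_Iic this, integral_const_mul,
      integral_exp_mul_complex_Iic (by
        have : (1/α:ℂ) = ((1/α:ℝ):ℂ) := by push_cast; rfl
        rw [this]; simp [hα])]
    simp
  have e2 : ∫ x in Set.Ioi (0:ℝ), (kk α x : ℂ) * Complex.exp (-(Complex.I * x * ξ)) =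
      -(1/2) * (-1 / (-(1/α:ℂ) - Complex.I * ξ)) := by
    have : ∀ x ∈ Set.Ioi (0:ℝ), (kk α x : ℂ) * Complex.exp (-(Complex.I * x * ξ)) =
        -(1/2) * Complex.exp ((-(1/α:ℂ) - Complex.I * ξ) * x) := fun x hx => by
      unfold kk; rw [if_pos (Set.mem_Ioi.1 hx)]; push_cast
      rw [mul_assoc, ← Complex.exp_add]; congr 2; ring
    rw [setIntegral_congr_fun measurableSet_Ioi this, integral_const_mul,
      integral_exp_mul_complex_Ioi (by
        have : (1/α:ℂ) = ((1/α:ℝ):ℂ) := by push_cast; rfl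
        rw [this]; simp [hα])]
    simp
  rw [e1, e2]
  have h1 : (1:ℂ) - Complex.I * ξ * α ≠ 0 := fun h => by have := congrArg Complex.re h; simp at this
  have h2 : (1:ℂ) + Complex.I * ξ * α ≠ 0 := fun h => by have := congrArg Complex.re h; simp at this
  have h3 : (1 + (α : ℂ) ^ 2 * (ξ : ℂ) ^ 2) = (1 - Complex.I * ξ * α) * (1 + Complex.I * ξ * α) := by
    ring_nf; rw [Complex.I_sq]; ring
  have h4 : (1/α:ℂ) - Complex.I * ξ = (1 - Complex.I * ξ * α)/α := by field_simp
  have h5 : -(1/α:ℂ) - Complex.I * ξ = -(1 + Complex.I * ξ * α)/α := by field_simp; ring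
  rw [h3, h4, h5]
  field_simp
  ring

theorem kconv_diff {α : ℝ} (hα : 0 < α) {D : ℝ → ℂ} (hD : Integrable D) (y y' : ℝ) :
    cv D (fun x => (kk α x : ℂ)) y - cv D (fun x => (kk α x : ℂ)) y' =
      ∫ x in y'..y, (cv D (fun x => (gg α x : ℂ)) x - D x) := by
  wlog h : y' ≤ y generalizing y y'
  · rw [intervalIntegral.integral_symm, ← this y' y (le_of_lt (not_le.1 h))]; ring
  have hk : ∀ y, Integrable (fun z => D z * (kk α (y - z) : ℂ)) := fun y =>
    hD.mul_bdd (c := 1/2) (Complex.measurable_ofReal.comp ((measurable_kk α).comp (by fun_prop))).aestronglyMeasurable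
      (Eventually.of_forall fun z => by rw [Complex.norm_real]; exact abs_kk_le hα _)
  have : IsFiniteMeasure (volume.restrict (Set.uIoc y' y)) := by rw [Set.uIoc]; infer_instance
  have hgi : Integrable (Function.uncurry fun (x z : ℝ) => D z * (gg α (x - z) : ℂ))
      ((volume.restrict (Set.uIoc y' y)).prod volume) := by
    have h1 : Integrable (fun p : ℝ × ℝ => (1:ℂ) * D p.2) ((volume.restrict (Set.uIoc y' y)).prod volume) :=
      Integrable.mul_prod (f := fun _ => (1:ℂ)) (integrable_const _) hD
    refine Integrable.mul_bdd (c := 1/(2*α)) (by simpa using h1) ?_ ?_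
    · exact (Complex.continuous_ofReal.comp ((continuous_gg α).comp (by fun_prop))).aestronglyMeasurable
    · refine Eventually.of_forall fun p => ?_
      rw [Complex.norm_real, Real.norm_eq_abs, abs_of_nonneg (gg_nonneg hα _)]; exact gg_le hα _
  have hgc : IntervalIntegrable (cv D (fun x => (gg α x : ℂ))) volume y' y :=
    (cv_continuous hD (Complex.continuous_ofReal.comp (continuous_gg α)) (C := 1/(2*α)) fun x => by
      simp only [Function.comp]
      rw [Complex.norm_real, Real.norm_eq_abs, abs_of_nonneg (gg_nonneg hα _)]; exact gg_le hα _).intervalIntegrable _ _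
  rw [intervalIntegral.integral_sub hgc hD.intervalIntegrable]
  have e1 : ∫ x in y'..y, cv D (fun x => (gg α x : ℂ)) x = ∫ z, (∫ x in y'..y, D z * (gg α (x - z) : ℂ)) :=
    intervalIntegral_integral_swap hgi
  have e1i : Integrable (fun z => (∫ x in y'..y, D z * (gg α (x - z) : ℂ))) := by
    simp only [intervalIntegral.intervalIntegral_eq_integral_uIoc]
    exact Integrable.smul _ hgi.integral_prod_right
  have e2 : ∫ x in y'..y, D x = ∫ z, Set.indicator (Set.Ico y' y) D z := by
    rw [intervalIntegral.integral_of_le h, ← integral_Ico_eq_integral_Ioc, integral_indicator measurableSet_Ico]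
  rw [e1, e2, ← integral_sub e1i (hD.indicator measurableSet_Ico)]
  unfold cv
  rw [← integral_sub (hk y) (hk y')]
  congr 1; funext z
  rw [← mul_sub, ← Complex.ofReal_sub, kk_sub hα (by linarith), intervalIntegral.integral_const_mul,
    intervalIntegral.integral_ofReal, intervalIntegral.integral_comp_sub_right (fun x => gg α x) z]
  by_cases hz : z ∈ Set.Ico y' y
  · rw [Set.indicator_of_mem hz, if_pos ⟨by linarith [hz.1], by linarith [hz.2]⟩]; push_cast; ring
  · rw [Set.indicator_of_notMem hz, if_neg (fun hh => hz ⟨by linarith [hh.1], by linarith [hh.2]⟩)]; simp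

theorem norm_cv_le_sup {D k : ℝ → ℂ} {M : ℝ} (hM : ∀ x, ‖D x‖ ≤ M) (hk : Integrable k) (x : ℝ) :
    ‖cv D k x‖ ≤ M * ∫ y, ‖k y‖ := by
  unfold cv
  have h1 : Integrable (fun z => ‖k (x - z)‖) := (hk.comp_sub_left x).norm
  calc _ ≤ ∫ z, M * ‖k (x - z)‖ := norm_integral_le_of_norm_le (h1.const_mul M) (Eventually.of_forall fun z => by
          rw [norm_mul]; exact mul_le_mul_of_nonneg_right (hM z) (norm_nonneg _))
    _ = _ := by rw [integral_const_mul, integral_sub_left_eq_self (fun y => ‖k y‖)]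

theorem integral_norm_gg {α : ℝ} (hα : 0 < α) : ∫ y, ‖(gg α y : ℂ)‖ = 1 := by
  rw [← integral_gg hα]; congr 1; funext y
  rw [Complex.norm_real, Real.norm_eq_abs, abs_of_nonneg (gg_nonneg hα _)]

theorem integral_norm_kk {α : ℝ} (hα : 0 < α) : ∫ y, ‖(kk α y : ℂ)‖ = α := by
  have : ∀ y, ‖(kk α y : ℂ)‖ = α * gg α y := fun y => by
    rw [Complex.norm_real, Real.norm_eq_abs, abs_kk_gg hα]
  simp_rw [this]; rw [integral_const_mul, integral_gg hα, mul_one]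

theorem kconv_lip {α : ℝ} (hα : 0 < α) {D : ℝ → ℂ} (hD : Integrable D) {M : ℝ} (hM : ∀ x, ‖D x‖ ≤ M) (y y' : ℝ) :
    ‖cv D (fun x => (kk α x : ℂ)) y - cv D (fun x => (kk α x : ℂ)) y'‖ ≤ 2 * M * |y - y'| := by
  rw [kconv_diff hα hD]
  refine intervalIntegral.norm_integral_le_of_norm_le_const fun x _ => ?_
  refine (norm_sub_le _ _).trans ?_
  have := norm_cv_le_sup hM (integrable_gg hα).ofReal (k := fun x => (gg α x : ℂ)) x
  rw [integral_norm_gg hα] at this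
  linarith [hM x]

theorem kconv_continuous {α : ℝ} (hα : 0 < α) {D : ℝ → ℂ} (hD : Integrable D) {M : ℝ} (hM : ∀ x, ‖D x‖ ≤ M) :
    Continuous (cv D (fun x => (kk α x : ℂ))) := by
  refine (LipschitzWith.of_dist_le_mul (K := (2 * M).toNNReal) fun y y' => ?_).continuous
  rw [dist_eq_norm, Real.coe_toNNReal _ (by linarith [norm_nonneg (D 0), hM 0])]
  exact kconv_lip hα hD hM y y'

theorem m2_norm_le {α : ℝ} (hα : 0 < α) (ξ : ℝ) : ‖Complex.I * (α : ℂ) ^ 2 * (ξ : ℂ) /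
          (1 + (α : ℂ) ^ 2 * (ξ : ℂ) ^ 2)‖ ≤ α := by
  rw [← fourierT_kk hα]
  exact (norm_fourierT_le _ _).trans (integral_norm_kk hα).le

theorem mult_k {α : ℝ} (hα : 0 < α) {D : ℝ → ℂ} (hD : Integrable D) {M : ℝ} (hM : ∀ x, ‖D x‖ ≤ M) (x : ℝ) :
    fourierMult (fun ξ : ℝ => Complex.I * (α : ℂ) ^ 2 * (ξ : ℂ) /
          (1 + (α : ℂ) ^ 2 * (ξ : ℂ) ^ 2)) D x = cv D (fun x => (kk α x : ℂ)) x := by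
  have hk : Integrable (fun x => (kk α x : ℂ)) := (integrable_kk hα).ofReal
  have e : ∀ ξ, fourierT (cv D (fun x => (kk α x : ℂ))) ξ = Complex.I * (α : ℂ) ^ 2 * (ξ : ℂ) /
          (1 + (α : ℂ) ^ 2 * (ξ : ℂ) ^ 2) * fourierT D ξ := fun ξ => by
    rw [fourierT_cv hD hk, mul_comm]; congr 1; exact fourierT_kk hα ξ
  have hM0 : 0 ≤ M := (norm_nonneg (D 0)).trans (hM 0)
  have hL2 : ∀ {f : ℝ → ℂ} {M : ℝ}, Integrable f → (∀ x, ‖f x‖ ≤ M) → MemLp (fourierT f) 2 := by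
    intro f M hf hM
    refine ⟨(continuous_fourierT hf).aestronglyMeasurable, ?_⟩
    rw [eLpNorm_lt_top_iff_lintegral_rpow_enorm_lt_top (by norm_num) (by norm_num)]
    have : ∫⁻ x, ‖f x‖ₑ ^ 2 ≤ ENNReal.ofReal M * ∫⁻ x, ‖f x‖ₑ := by
      rw [← lintegral_const_mul' _ _ ENNReal.ofReal_ne_top]
      refine lintegral_mono fun x => ?_
      rw [sq]; gcongr
      rw [← ofReal_norm]; exact ENNReal.ofReal_le_ofReal (hM x)
    have h2 := (plancherel hf).trans (mul_le_mul_right this _)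
    simp only [ENNReal.toReal_ofNat, ENNReal.rpow_ofNat]
    exact h2.trans_lt (ENNReal.mul_lt_top ENNReal.ofReal_lt_top (ENNReal.mul_lt_top ENNReal.ofReal_lt_top hf.2))
  have hfi : Integrable (fourierT (cv D (fun x => (kk α x : ℂ)))) := by
    have : fourierT (cv D (fun x => (kk α x : ℂ))) = fun ξ => fourierT (fun x => (kk α x : ℂ)) ξ * fourierT D ξ := by
      funext ξ; rw [fourierT_cv hD hk, mul_comm]
    rw [this]
    exact MemLp.integrable_mul (p := 2) (q := 2) (hL2 (M := 1/2) hk fun x => by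
      rw [Complex.norm_real]; exact abs_kk_le hα _) (hL2 hD hM)
  have h := inversion_pt (cv_integrable hD hk) hfi (kconv_continuous hα hD hM).continuousAt (x := x)
  have hp : (Real.pi:ℂ) ≠ 0 := by exact_mod_cast Real.pi_ne_zero
  unfold fourierMult
  have : ∫ ξ : ℝ, Complex.I * (α : ℂ) ^ 2 * (ξ : ℂ) /
          (1 + (α : ℂ) ^ 2 * (ξ : ℂ) ^ 2) * fourierT D ξ * Complex.exp (Complex.I * ξ * x) =
      IF (fourierT (cv D (fun x => (kk α x : ℂ)))) x := by
    unfold IF; congr 1; funext ξ; rw [e]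
  rw [this]
  rw [h]
  push_cast; field_simp

end

/-! ### Part P5 -/

noncomputable section

open MeasureTheory Filter
open scoped ENNReal Topology


theorem L1_add_le (m : ℝ) {a b : ℝ → ℂ} (ha : Measurable a) :
    L1 m (fun ξ => a ξ + b ξ) ≤ L1 m a + L1 m b := by
  unfold L1
  rw [← lintegral_add_left (by fun_prop)]
  refine lintegral_mono fun ξ => ?_
  rw [← mul_add]; gcongr; exact enorm_add_le _ _

theorem L1_congr (m : ℝ) {a b : ℝ → ℂ} (h : ∀ᵐ ξ, a ξ = b ξ) : L1 m a = L1 m b := by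
  unfold L1; refine lintegral_congr_ae ?_
  filter_upwards [h] with ξ hξ; rw [hξ]
theorem N2_congr (m : ℝ) {a b : ℝ → ℂ} (h : ∀ᵐ ξ, a ξ = b ξ) : N2 m a = N2 m b := by
  unfold N2; refine lintegral_congr_ae ?_
  filter_upwards [h] with ξ hξ; rw [hξ]

theorem cv_exists_ae {a b : ℝ → ℂ} (ha : Integrable a) (hb : Integrable b) :
    ∀ᵐ ξ, Integrable (fun ζ => a ζ * b (ξ - ζ)) := by
  have := ha.ae_convolution_exists (ContinuousLinearMap.mul ℝ ℂ) hb
  filter_upwards [this] with ξ hξ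
  simpa [ConvolutionExistsAt] using hξ

/-- time-continuous families in weighted `L¹` -/
structure TF (m : ℝ) (q : ℝ → ℝ → ℂ) : Prop where
  meas : ∀ t, Measurable (q t)
  fin : ∀ t, L1 m (q t) ≠ ⊤
  cont : ∀ t0, Tendsto (fun t => L1 m (fun ξ => q t ξ - q t0 ξ)) (𝓝 t0) (𝓝 0)

theorem TF.mono {m m' : ℝ} (h : m' ≤ m) {q : ℝ → ℝ → ℂ} (hq : TF m q) : TF m' q :=
  ⟨hq.meas, fun t => ne_top_of_le_ne_top (hq.fin t) (L1_mono h _), fun t0 =>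
    tendsto_of_tendsto_of_tendsto_of_le_of_le tendsto_const_nhds (hq.cont t0) (fun _ => zero_le)
      fun _ => L1_mono h _⟩

theorem TF.mult {m k c : ℝ} (hc : 0 ≤ c) {M : ℝ → ℂ} (hM : Measurable M)
    (h : ∀ ξ, ‖M ξ‖ ≤ c * (1 + ξ ^ 2) ^ (k / 2)) {q : ℝ → ℝ → ℂ} (hq : TF (m + k) q) :
    TF m (fun t ξ => M ξ * q t ξ) := by
  refine ⟨fun t => hM.mul (hq.meas t), fun t => ?_, fun t0 => ?_⟩
  · exact ne_top_of_le_ne_top (ENNReal.mul_ne_top ENNReal.ofReal_ne_top (hq.fin t)) (L1_mult hc h)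
  · have h0 : Tendsto (fun t => ENNReal.ofReal c * L1 (m + k) (fun ξ => q t ξ - q t0 ξ)) (𝓝 t0) (𝓝 0) := by
      have := ENNReal.Tendsto.const_mul (hq.cont t0) (Or.inr (ENNReal.ofReal_ne_top (r := c)))
      simpa using this
    refine tendsto_of_tendsto_of_tendsto_of_le_of_le tendsto_const_nhds h0 (fun _ => zero_le) fun t => ?_
    have := L1_mult (σ := m) (q := fun ξ => q t ξ - q t0 ξ) hc h
    simpa [mul_sub] using this

theorem TF.cv {m : ℝ} (hm : 0 ≤ m) {a b : ℝ → ℝ → ℂ} (ha : TF m a) (hb : TF m b) :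
    TF m (fun t => cv (a t) (b t)) := by
  have hC : ENNReal.ofReal (4 ^ (m / 2)) ≠ ⊤ := ENNReal.ofReal_ne_top
  have key : ∀ {p q : ℝ → ℂ}, Measurable p → Measurable q →
      L1 m (_root_.cv p q) ≤ ENNReal.ofReal (4 ^ (m / 2)) * (2 * (L1 m p * L1 m q)) := by
    intro p q hp hq
    refine (L1_cv m hm hp hq).trans ?_
    gcongr
    rw [two_mul]; gcongr
    · exact L1_mono hm _
    · exact L1_mono hm _
  refine ⟨fun t => measurable_cv (ha.meas t) (hb.meas t), fun t => ?_, fun t0 => ?_⟩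
  · exact ne_top_of_le_ne_top (ENNReal.mul_ne_top hC (ENNReal.mul_ne_top (by simp)
      (ENNReal.mul_ne_top (ha.fin t) (hb.fin t)))) (key (ha.meas t) (hb.meas t))
  · have hle : ∀ t, L1 m (fun ξ => _root_.cv (a t) (b t) ξ - _root_.cv (a t0) (b t0) ξ) ≤
        ENNReal.ofReal (4 ^ (m / 2)) * (2 * (L1 m (fun ξ => a t ξ - a t0 ξ) * (L1 m (fun ξ => b t ξ - b t0 ξ) + L1 m (b t0)))) +
        ENNReal.ofReal (4 ^ (m / 2)) * (2 * (L1 m (a t0) * L1 m (fun ξ => b t ξ - b t0 ξ))) := by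
      intro t
      have hi : ∀ t, Integrable (a t) := fun t => integrable_of_L1 (ha.meas t) hm (ha.fin t)
      have hi' : ∀ t, Integrable (b t) := fun t => integrable_of_L1 (hb.meas t) hm (hb.fin t)
      have m1 : Measurable (fun ξ => a t ξ - a t0 ξ) := (ha.meas t).sub (ha.meas t0)
      have m2 : Measurable (fun ξ => b t ξ - b t0 ξ) := (hb.meas t).sub (hb.meas t0)
      have e : ∀ᵐ ξ, _root_.cv (a t) (b t) ξ - _root_.cv (a t0) (b t0) ξ =
          _root_.cv (fun ξ => a t ξ - a t0 ξ) (b t) ξ + _root_.cv (a t0) (fun ξ => b t ξ - b t0 ξ) ξ := by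
        filter_upwards [cv_exists_ae (hi t) (hi' t), cv_exists_ae (hi t0) (hi' t0),
          cv_exists_ae (hi t0) (hi' t)] with ξ h1 h2 h3
        simp only [_root_.cv, sub_mul, mul_sub]
        rw [integral_sub h1 h3, integral_sub h3 h2]; ring
      rw [L1_congr m e]
      refine (L1_add_le m (measurable_cv m1 (hb.meas t))).trans ?_
      refine add_le_add ((key m1 (hb.meas t)).trans ?_) (key (ha.meas t0) m2)
      gcongr
      have := L1_add_le m (a := fun ξ => b t ξ - b t0 ξ) (b := b t0) m2
      simpa using this
    refine tendsto_of_tendsto_of_tendsto_of_le_of_le tendsto_const_nhds ?_ (fun _ => zero_le) hle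
    have t1 := ENNReal.Tendsto.mul (ha.cont t0) (Or.inr (by simpa using hb.fin t0))
      ((hb.cont t0).add (tendsto_const_nhds (x := L1 m (b t0)))) (Or.inr (by simp))
    have t2 := ENNReal.Tendsto.const_mul (hb.cont t0) (Or.inr (ha.fin t0))
    have t3 := ENNReal.Tendsto.const_mul (ENNReal.Tendsto.const_mul t1 (Or.inr (by simp : (2:ℝ≥0∞) ≠ ⊤))) (Or.inr hC)
    have t4 := ENNReal.Tendsto.const_mul (ENNReal.Tendsto.const_mul t2 (Or.inr (by simp : (2:ℝ≥0∞) ≠ ⊤))) (Or.inr hC)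
    simpa using t3.add t4

theorem TF.integrable {m : ℝ} (hm : 0 ≤ m) {q : ℝ → ℝ → ℂ} (hq : TF m q) (t : ℝ) : Integrable (q t) :=
  integrable_of_L1 (hq.meas t) hm (hq.fin t)

theorem IF_sub {p q : ℝ → ℂ} (hp : Integrable p) (hq : Integrable q) (x : ℝ) :
    IF (fun ξ => p ξ - q ξ) x = IF p x - IF q x := by
  unfold IF; rw [← integral_sub (IF_integrable hp x) (IF_integrable hq x)]
  congr 1; funext ξ; ring
theorem IF_add {p q : ℝ → ℂ} (hp : Integrable p) (hq : Integrable q) (x : ℝ) :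
    IF (fun ξ => p ξ + q ξ) x = IF p x + IF q x := by
  unfold IF; rw [← integral_add (IF_integrable hp x) (IF_integrable hq x)]
  congr 1; funext ξ; ring
theorem IF_smul (c : ℂ) (q : ℝ → ℂ) (x : ℝ) : IF (fun ξ => c * q ξ) x = c * IF q x := by
  unfold IF; rw [← integral_const_mul]; congr 1; funext ξ; ring

theorem TF.dist {q : ℝ → ℝ → ℂ} (hq : TF 0 q) (t0 : ℝ) {ε : ℝ} (hε : 0 < ε) :
    ∀ᶠ t in 𝓝 t0, ∀ x, ‖IF (q t) x - IF (q t0) x‖ < ε := by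
  have h := (hq.cont t0).eventually (gt_mem_nhds (ENNReal.ofReal_pos.2 hε))
  filter_upwards [h] with t ht x
  rw [← IF_sub (hq.integrable le_rfl t) (hq.integrable le_rfl t0)]
  have := enorm_IF_le (fun ξ => q t ξ - q t0 ξ) x
  rw [← L1_zero] at this
  have h2 := this.trans_lt ht
  rw [← ofReal_norm] at h2
  exact (ENNReal.ofReal_lt_ofReal_iff hε).1 h2

theorem TF.continuous {q : ℝ → ℝ → ℂ} (hq : TF 0 q) : Continuous (fun p : ℝ × ℝ => IF (q p.1) p.2) := by
  rw [continuous_iff_continuousAt]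
  rintro ⟨t0, x0⟩
  rw [Metric.continuousAt_iff']
  intro ε hε
  have h1 := hq.dist t0 (half_pos hε)
  have h2 := Metric.continuousAt_iff'.1 ((continuous_IF (hq.integrable le_rfl t0)).continuousAt (x := x0)) (ε/2) (half_pos hε)
  rw [nhds_prod_eq]
  filter_upwards [h1.prod_mk h2] with p hp
  have ha := hp.1 p.2
  have hb := hp.2
  rw [dist_eq_norm] at hb ⊢
  calc _ = ‖(IF (q p.1) p.2 - IF (q t0) p.2) + (IF (q t0) p.2 - IF (q t0) x0)‖ := by congr 1; ring
    _ ≤ _ := norm_add_le _ _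
    _ < ε := by linarith

theorem norm_iξ_le (ξ : ℝ) : ‖Complex.I * (ξ:ℂ)‖ ≤ 1 * (1 + ξ ^ 2) ^ ((1:ℝ) / 2) := by
  rw [norm_mul, Complex.norm_I, Complex.norm_real, one_mul, one_mul]; exact abs_le_jp ξ

theorem TF.deriv {m : ℝ} {q : ℝ → ℝ → ℂ} (hq : TF (m + 1) q) :
    TF m (fun t ξ => Complex.I * ξ * q t ξ) :=
  hq.mult (k := 1) zero_le_one (by fun_prop) norm_iξ_le

theorem TF.hasDerivAt {q : ℝ → ℝ → ℂ} (hq : TF 1 q) (t x : ℝ) :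
    HasDerivAt (IF (q t)) (IF (fun ξ => Complex.I * ξ * q t ξ) x) x :=
  IF_hasDerivAt (hq.integrable zero_le_one t) ((TF.deriv (m := 0) (by simpa using hq)).integrable le_rfl t) x

theorem TF.ftc {q : ℝ → ℝ → ℂ} (hq : TF 1 q) (t y y' : ℝ) :
    IF (q t) y - IF (q t) y' = ∫ x in y'..y, IF (fun ξ => Complex.I * ξ * q t ξ) x := by
  rw [intervalIntegral.integral_eq_sub_of_hasDerivAt (fun x _ => hq.hasDerivAt t x)]
  exact (continuous_IF ((TF.deriv (m := 0) (by simpa using hq)).integrable le_rfl t)).intervalIntegrable _ _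

theorem TF.time_ftc {q : ℝ → ℝ → ℂ} (hq : TF 1 q) (t y y' : ℝ) :
    (∫ τ in (0:ℝ)..t, IF (q τ) y) - ∫ τ in (0:ℝ)..t, IF (q τ) y' =
      ∫ x in y'..y, ∫ τ in (0:ℝ)..t, IF (fun ξ => Complex.I * ξ * q τ ξ) x := by
  have hc : Continuous (fun p : ℝ × ℝ => IF (q p.1) p.2) := (hq.mono (by norm_num)).continuous
  have hc' := (TF.deriv (m := 0) (by simpa using hq)).continuous
  rw [← intervalIntegral.integral_sub]
  · simp_rw [hq.ftc]
    exact intervalIntegral_intervalIntegral_swap ((hc'.continuousOn (s := Set.uIcc 0 t ×ˢ Set.uIcc y' y)).integrableOn_compact (isCompact_uIcc.prod isCompact_uIcc) |>.mono_set (Set.prod_mono Set.uIoc_subset_uIcc Set.uIoc_subset_uIcc))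
  · exact (hc.comp (by fun_prop : Continuous fun τ : ℝ => (τ, y))).intervalIntegrable _ _
  · exact (hc.comp (by fun_prop : Continuous fun τ : ℝ => (τ, y'))).intervalIntegrable _ _

end

/-! ### Part P5b -/

noncomputable section

open MeasureTheory Filter
open scoped ENNReal Topology


theorem memSob_L2 {σ : ℝ} {f : ℝ → ℂ} (hf : MemSobolev σ f) :
    N2 σ (fourierT f) = ENNReal.ofReal (sobolevNorm σ f ^ 2) := by
  have h0 : ∀ ξ : ℝ, 0 ≤ (1 + ξ ^ 2) ^ σ * ‖fourierT f ξ‖ ^ 2 := fun ξ => by positivity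
  rw [sobolevNorm, Real.sq_sqrt (integral_nonneg h0),
    ofReal_integral_eq_lintegral_ofReal hf.2 (Eventually.of_forall h0)]
  unfold N2 wt
  congr 1; funext ξ
  rw [ENNReal.ofReal_mul (by positivity), ← ofReal_norm, ENNReal.ofReal_pow (norm_nonneg _)]

theorem memSob_of_N2 {σ : ℝ} {f : ℝ → ℂ} (hf : Integrable f) (h : N2 σ (fourierT f) ≠ ⊤) : MemSobolev σ f := by
  refine ⟨hf, ⟨?_, ?_⟩⟩
  · have := continuous_fourierT hf
    have : Measurable (fourierT f) := this.measurable
    exact Measurable.aestronglyMeasurable (by fun_prop)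
  · refine lt_of_eq_of_lt ?_ (lt_top_iff_ne_top.2 h)
    unfold N2 wt; congr 1; funext ξ
    rw [← ofReal_norm, Real.norm_of_nonneg (by positivity), ENNReal.ofReal_mul (by positivity), ← ofReal_norm, ENNReal.ofReal_pow (norm_nonneg _)]

theorem fourierT_sub {f g : ℝ → ℂ} (hf : Integrable f) (hg : Integrable g) (ξ : ℝ) :
    fourierT (fun x => f x - g x) ξ = fourierT f ξ - fourierT g ξ := by
  unfold fourierT
  rw [← integral_sub (fourierT_integrable hf ξ) (fourierT_integrable hg ξ)]
  congr 1; funext x; ring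

theorem N2_sub_le (σ : ℝ) {a b : ℝ → ℂ} (ha : Measurable a) :
    N2 σ (fun ξ => a ξ - b ξ) ≤ 2 * (N2 σ a + N2 σ b) := by
  unfold N2
  rw [← lintegral_add_left (by fun_prop), ← lintegral_const_mul' _ _ (by simp)]
  refine lintegral_mono fun ξ => ?_
  rw [← mul_add, mul_left_comm]
  gcongr
  refine le_trans ?_ (add_sq_le' _ _)
  gcongr
  exact enorm_sub_le

theorem MemSobolev.sub' {σ : ℝ} {f g : ℝ → ℂ} (hf : MemSobolev σ f) (hg : MemSobolev σ g) :
    MemSobolev σ (fun x => f x - g x) := by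
  refine memSob_of_N2 (hf.1.sub hg.1) ?_
  have e : fourierT (fun x => f x - g x) = fun ξ => fourierT f ξ - fourierT g ξ := by
    funext ξ; exact fourierT_sub hf.1 hg.1 ξ
  rw [e]
  refine ne_top_of_le_ne_top ?_ (N2_sub_le σ (continuous_fourierT hf.1).measurable)
  rw [memSob_L2 hf, memSob_L2 hg]
  exact ENNReal.mul_ne_top (by simp) (by simp)

theorem memSob_mono {σ τ : ℝ} (h : σ ≤ τ) {f : ℝ → ℂ} (hf : MemSobolev τ f) : MemSobolev σ f :=
  memSob_of_N2 hf.1 (ne_top_of_le_ne_top (by rw [memSob_L2 hf]; simp) (N2_mono h _))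

/-- symbols -/
def m1 (α ξ : ℝ) : ℂ := -(Complex.I * (α : ℂ) ^ 2 * (ξ : ℂ) ^ 3) / (1 + (α : ℂ) ^ 2 * (ξ : ℂ) ^ 2)
def m2 (α ξ : ℝ) : ℂ := Complex.I * (α : ℂ) ^ 2 * (ξ : ℂ) / (1 + (α : ℂ) ^ 2 * (ξ : ℂ) ^ 2)

theorem m1_norm_le (α ξ : ℝ) : ‖m1 α ξ‖ ≤ |ξ| := by
  have h : (1 + (α : ℂ) ^ 2 * (ξ : ℂ) ^ 2) = ((1 + α ^ 2 * ξ ^ 2 : ℝ) : ℂ) := by push_cast; ring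
  unfold m1
  have hp : 0 < 1 + α ^ 2 * ξ ^ 2 := by positivity
  rw [norm_div, norm_neg, norm_mul, norm_mul, Complex.norm_I, norm_pow, norm_pow, h, Complex.norm_real, Complex.norm_real,
    Complex.norm_real, Real.norm_eq_abs, Real.norm_eq_abs, Real.norm_eq_abs, abs_of_pos hp, div_le_iff₀ hp, sq_abs, one_mul]
  have : |ξ| ^ 3 = |ξ| * ξ ^ 2 := by rw [pow_succ', sq_abs]
  rw [this]; nlinarith [abs_nonneg ξ]

theorem measurable_m1 (α : ℝ) : Measurable (m1 α) := by unfold m1; fun_prop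
theorem measurable_m2 (α : ℝ) : Measurable (m2 α) := by unfold m2; fun_prop

/-- A solution, with time clamped. -/
structure Sol (s T α e : ℝ) (u0 : ℝ → ℂ) (w : ℝ → ℝ → ℂ) : Prop where
  hs : 3 / 2 < s
  hT : 0 < T
  hα : 0 < α
  he : e = 0 ∨ e = 1
  u0c : Continuous u0
  mem : ∀ t, MemSobolev (s + 2) (w t)
  cont : ∀ t0, Tendsto (fun t => sobolevNorm (s + 2) (fun x => w t x - w t0 x)) (𝓝 t0) (𝓝 0)
  eq : ∀ t ∈ Set.Icc 0 T, ∀ x, w t x = u0 x - ∫ τ in (0:ℝ)..t, (3 * w τ x * deriv (w τ) x +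
    e * (fourierMult (m1 α) (fun y => w τ y ^ 2) x + (1 / 2) * fourierMult (m2 α) (fun y => deriv (w τ) y ^ 2) x))
  left : ∀ t ≤ 0, w t = w 0
  right : ∀ t, T ≤ t → w t = w T

def ah (w : ℝ → ℝ → ℂ) (t ξ : ℝ) : ℂ := fourierT (w t) ξ / (2 * Real.pi)
def dx (q : ℝ → ℝ → ℂ) (t ξ : ℝ) : ℂ := Complex.I * ξ * q t ξ
def Pq (w : ℝ → ℝ → ℂ) (t : ℝ) : ℝ → ℂ := cv (ah w t) (ah w t)
def dd (w : ℝ → ℝ → ℂ) (t x : ℝ) : ℂ := w t x - IF (ah w t) x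
open Classical in
def th (w : ℝ → ℝ → ℂ) (t y : ℝ) : ℝ := if Flat (dd w t) y then 1 else 0

theorem TF.dx {m : ℝ} {q : ℝ → ℝ → ℂ} (hq : TF (m + 1) q) : TF m (dx q) := TF.deriv hq

variable {s T α e : ℝ} {u0 : ℝ → ℂ} {w : ℝ → ℝ → ℂ}

theorem two_pi_ne : (2 * Real.pi : ℂ) ≠ 0 := by
  have : (Real.pi:ℂ) ≠ 0 := by exact_mod_cast Real.pi_ne_zero
  simpa using this

theorem norm_two_pi : ‖(2 * Real.pi : ℂ)‖ = 2 * Real.pi := by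
  rw [norm_mul, Complex.norm_real, Real.norm_of_nonneg Real.pi_pos.le]; simp

theorem N2_div (σ : ℝ) (q : ℝ → ℂ) : N2 σ (fun ξ => q ξ / (2 * Real.pi)) =
    ENNReal.ofReal ((1/(2*Real.pi))^2) * N2 σ q := by
  unfold N2
  rw [← lintegral_const_mul' _ _ ENNReal.ofReal_ne_top]
  congr 1; funext ξ
  rw [← ofReal_norm (q ξ / _), norm_div, norm_two_pi, div_eq_inv_mul, ENNReal.ofReal_mul (by positivity), ofReal_norm, mul_pow,
   ← ENNReal.ofReal_pow (by positivity)]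
  rw [one_div]; ring

theorem Sol.ah_cont (S : Sol s T α e u0 w) (t : ℝ) : Continuous (ah w t) :=
  (continuous_fourierT (S.mem t).1).div_const _

theorem Sol.ah_N2 (S : Sol s T α e u0 w) (t : ℝ) {γ : ℝ} (h : γ ≤ s + 2) :
    N2 γ (ah w t) = ENNReal.ofReal ((sobolevNorm γ (w t) / (2 * Real.pi)) ^ 2) := by
  have := N2_div γ (fourierT (w t))
  unfold ah
  rw [this, memSob_L2 (memSob_mono h (S.mem t)), ← ENNReal.ofReal_mul (by positivity)]
  congr 1; ring

theorem Sol.tf (S : Sol s T α e u0 w) : TF 3 (ah w) := by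
  obtain ⟨C, hC, h⟩ := L1_le_N2 (m := 3) (γ := s + 2) (by linarith [S.hs])
  refine ⟨fun t => (S.ah_cont t).measurable, fun t => ?_, fun t0 => ?_⟩
  · have := h _ (S.ah_cont t).measurable
    rw [S.ah_N2 t le_rfl] at this
    intro htop
    rw [htop] at this
    simp at this
    exact absurd this (ENNReal.mul_ne_top ENNReal.ofReal_ne_top ENNReal.ofReal_ne_top)
  · have hle : ∀ t, L1 3 (fun ξ => ah w t ξ - ah w t0 ξ) ≤
        (ENNReal.ofReal (C * (sobolevNorm (s+2) (fun x => w t x - w t0 x) / (2 * Real.pi)) ^ 2)) ^ ((1:ℝ)/2) := by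
      intro t
      have h1 := h (fun ξ => ah w t ξ - ah w t0 ξ) ((S.ah_cont t).measurable.sub (S.ah_cont t0).measurable)
      have e1 : (fun ξ => ah w t ξ - ah w t0 ξ) = fun ξ => fourierT (fun x => w t x - w t0 x) ξ / (2 * Real.pi) := by
        funext ξ; rw [fourierT_sub (S.mem t).1 (S.mem t0).1]; unfold ah; ring
      rw [e1, N2_div, memSob_L2 ((S.mem t).sub' (S.mem t0)), ← ENNReal.ofReal_mul (by positivity), ← ENNReal.ofReal_mul hC.le] at h1
      rw [e1]
      have h2 := ENNReal.rpow_le_rpow h1 (by norm_num : (0:ℝ) ≤ 1/2)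
      rw [← ENNReal.rpow_natCast, ← ENNReal.rpow_mul] at h2
      norm_num at h2
      refine h2.trans (le_of_eq ?_)
      congr 2; field_simp
    refine tendsto_of_tendsto_of_tendsto_of_le_of_le tendsto_const_nhds ?_ (fun _ => zero_le) hle
    have t1 : Tendsto (fun t => C * (sobolevNorm (s+2) (fun x => w t x - w t0 x) / (2 * Real.pi)) ^ 2) (𝓝 t0) (𝓝 (C * (0 / (2*Real.pi))^2)) :=
      (((S.cont t0).div_const _).pow 2).const_mul _
    have t2 := (ENNReal.tendsto_ofReal t1)
    have t3 := (ENNReal.continuous_rpow_const (y := (1:ℝ)/2)).tendsto _ |>.comp t2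
    simpa [Function.comp_def] using t3

theorem Sol.ah_int (S : Sol s T α e u0 w) (t : ℝ) : Integrable (ah w t) := S.tf.integrable (by norm_num) t

theorem Sol.ae_eq (S : Sol s T α e u0 w) (t : ℝ) : ∀ᵐ x, w t x = IF (ah w t) x := by
  refine inversion_ae (S.mem t).1 ?_
  have := (S.ah_int t).mul_const (2 * Real.pi : ℂ)
  refine this.congr (Eventually.of_forall fun ξ => ?_)
  simp only [ah]; exact div_mul_cancel₀ _ two_pi_ne

theorem Sol.tf0 (S : Sol s T α e u0 w) : TF 0 (ah w) := S.tf.mono (by norm_num)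
theorem Sol.tf1 (S : Sol s T α e u0 w) : TF 2 (dx (ah w)) := TF.dx (m := 2) (by norm_num; exact S.tf)
theorem Sol.tf2 (S : Sol s T α e u0 w) : TF 1 (dx (dx (ah w))) := TF.dx (m := 1) (by norm_num; exact S.tf1)
theorem Sol.tf3 (S : Sol s T α e u0 w) : TF 0 (dx (dx (dx (ah w)))) := TF.dx (m := 0) (by norm_num; exact S.tf2)
theorem Sol.tfP (S : Sol s T α e u0 w) : TF 3 (Pq w) := TF.cv (by norm_num) S.tf S.tf

theorem Sol.w0 (S : Sol s T α e u0 w) : w 0 = u0 := by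
  funext x
  have := S.eq 0 ⟨le_rfl, S.hT.le⟩ x
  simpa using this

theorem Sol.W0 (S : Sol s T α e u0 w) : IF (ah w 0) = u0 := by
  have h := S.ae_eq 0
  rw [S.w0] at h
  exact (Continuous.ae_eq_iff_eq (μ := volume) (continuous_IF (S.ah_int 0)) S.u0c).1 (h.mono fun x hx => hx.symm)

theorem flat_iff {d : ℝ → ℂ} {y : ℝ} : Flat d y ↔ d y = 0 ∧ HasDerivAt d 0 y := by
  constructor
  · intro h
    refine ⟨h.zero, ?_⟩
    rw [hasDerivAt_iff_isLittleO, Asymptotics.isLittleO_iff]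
    intro c hc
    obtain ⟨ρ, hρ, h1⟩ := h c hc
    filter_upwards [Metric.ball_mem_nhds y hρ] with z hz
    rw [h.zero]; simpa using h1 z hz
  · rintro ⟨h0, h⟩ c hc
    rw [hasDerivAt_iff_isLittleO, Asymptotics.isLittleO_iff] at h
    obtain ⟨ρ, hρ, h1⟩ := Metric.eventually_nhds_iff.1 (h hc)
    refine ⟨ρ, hρ, fun z hz => ?_⟩
    have := h1 (y := z) hz
    rw [h0] at this; simpa using this

theorem ae_zero_diff {d : ℝ → ℂ} (h : ∀ᵐ x, d x = 0) {y : ℝ} (hd : DifferentiableAt ℝ d y) : Flat d y := by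
  have hdense : Dense {x | d x = 0} := Measure.dense_of_ae h
  have h0 : d y = 0 := by
    by_contra hne
    have := hd.continuousAt.eventually_ne hne
    obtain ⟨z, hz, hz'⟩ := (mem_closure_iff_nhds.1 (hdense y)) _ this
    exact hz hz'
  refine flat_iff.2 ⟨h0, ?_⟩
  have hD := hd.hasDerivAt
  suffices deriv d y = 0 by rwa [this] at hD
  have hsl := hasDerivAt_iff_tendsto_slope.1 hD
  by_contra hne
  have hev := hsl.eventually_ne hne
  rw [eventually_nhdsWithin_iff, Metric.eventually_nhds_iff] at hev
  obtain ⟨ρ, hρ, h1⟩ := hev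
  obtain ⟨z, hz, hz'⟩ := hdense.exists_mem_open (isOpen_Ioo (a := y) (b := y + ρ)) ⟨y + ρ/2, by constructor <;> linarith⟩
  refine h1 (y := z) ?_ (ne_of_gt hz'.1) ?_
  · rw [Real.dist_eq, abs_of_pos (by linarith [hz'.1])]; linarith [hz'.2]
  · rw [slope_def_module, h0]; simp [show d z = 0 from hz]

theorem th01 (w : ℝ → ℝ → ℂ) (t y : ℝ) : th w t y = 0 ∨ th w t y = 1 := by
  unfold th; split_ifs <;> simp
theorem th_eq_one {t y : ℝ} : th w t y = 1 ↔ Flat (dd w t) y := by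
  unfold th; split_ifs with h <;> simp [h]

theorem Sol.hW1 (S : Sol s T α e u0 w) (t y : ℝ) : HasDerivAt (IF (ah w t)) (IF (dx (ah w) t) y) y :=
  TF.hasDerivAt (S.tf.mono (by norm_num)) t y

theorem Sol.deriv_w (S : Sol s T α e u0 w) (t y : ℝ) : deriv (w t) y = th w t y * IF (dx (ah w) t) y := by
  by_cases h : Flat (dd w t) y
  · rw [th_eq_one.2 h]
    have h2 := (flat_iff.1 h).2.add (S.hW1 t y)
    have e : (dd w t + IF (ah w t)) = w t := by funext x; simp [dd]
    rw [e] at h2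
    rw [h2.deriv]; simp
  · have : th w t y = 0 := by unfold th; rw [if_neg h]
    rw [this]
    have hnd : ¬ DifferentiableAt ℝ (w t) y := fun hd => h (by
      refine ae_zero_diff ?_ (hd.sub (S.hW1 t y).differentiableAt)
      filter_upwards [S.ae_eq t] with x hx
      show w t x - IF (ah w t) x = 0
      rw [hx, sub_self])
    rw [deriv_zero_of_not_differentiableAt hnd]; simp

theorem Sol.w_deriv_w (S : Sol s T α e u0 w) (t y : ℝ) :
    w t y * deriv (w t) y = th w t y * (IF (ah w t) y * IF (dx (ah w) t) y) := by
  rw [S.deriv_w]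
  by_cases h : Flat (dd w t) y
  · have := h.zero
    rw [th_eq_one.2 h, show w t y = IF (ah w t) y from sub_eq_zero.1 this]; simp
  · have : th w t y = 0 := by unfold th; rw [if_neg h]
    rw [this]; simp

end

/-! ### Part P5c -/

noncomputable section

open MeasureTheory Filter
open scoped ENNReal Topology

variable {s T α e : ℝ} {u0 : ℝ → ℂ} {w : ℝ → ℝ → ℂ}

def hq (w : ℝ → ℝ → ℂ) (t ξ : ℝ) : ℂ := (3/2) * dx (Pq w) t ξ
def Aq (α : ℝ) (w : ℝ → ℝ → ℂ) (t ξ : ℝ) : ℂ := m1 α ξ * Pq w t ξ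
/-- `(∂ₓ w)²` -/
def DD (w : ℝ → ℝ → ℂ) (t x : ℝ) : ℂ := th w t x * IF (dx (ah w) t) x ^ 2
def BB (α : ℝ) (w : ℝ → ℝ → ℂ) (t x : ℝ) : ℂ := (1/2) * cv (DD w t) (fun x => (kk α x : ℂ)) x

theorem TF.const_mul {m : ℝ} (c : ℂ) {q : ℝ → ℝ → ℂ} (hq : TF m q) : TF m (fun t ξ => c * q t ξ) := by
  refine TF.mult (k := 0) (c := ‖c‖) (norm_nonneg c) measurable_const (fun ξ => ?_) (by simpa using hq)
  simp

theorem Sol.tfh (S : Sol s T α e u0 w) : TF 2 (hq w) := (TF.dx (m := 2) (by norm_num; exact S.tfP)).const_mul _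
theorem Sol.tfA (S : Sol s T α e u0 w) : TF 2 (Aq α w) :=
  TF.mult (k := 1) zero_le_one (measurable_m1 α) (fun ξ => by
    rw [one_mul]; exact (m1_norm_le α ξ).trans (abs_le_jp ξ)) (by norm_num; exact S.tfP)

theorem Sol.P_eq (S : Sol s T α e u0 w) (t x : ℝ) : IF (Pq w t) x = IF (ah w t) x ^ 2 := by
  unfold Pq; rw [IF_cv (S.ah_int t) (S.ah_int t), sq]

theorem Sol.h_eq (S : Sol s T α e u0 w) (t x : ℝ) :
    IF (hq w t) x = 3 * (IF (ah w t) x * IF (dx (ah w) t) x) := by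
  unfold hq
  rw [IF_smul]
  have h1 := TF.hasDerivAt (S.tfP.mono (by norm_num : (1:ℝ) ≤ 3)) t x
  have h2 := (S.hW1 t x).pow 2
  have e : IF (Pq w t) = IF (ah w t) ^ 2 := by funext x; exact S.P_eq t x
  rw [e] at h1
  have := h1.unique h2
  have e2 : IF (dx (Pq w) t) x = _ := this
  rw [e2]; push_cast; simp; ring

theorem Sol.wsq_int (S : Sol s T α e u0 w) (t : ℝ) : Integrable (fun x => IF (ah w t) x ^ 2) := by
  have h : Integrable (IF (ah w t)) := (S.mem t).1.congr (S.ae_eq t)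
  simp_rw [sq]
  exact h.mul_bdd (c := ∫ ξ, ‖ah w t ξ‖) (continuous_IF (S.ah_int t)).aestronglyMeasurable
    (Eventually.of_forall fun x => norm_IF_le _ x)

theorem Sol.ah_bdd (S : Sol s T α e u0 w) (t ξ : ℝ) : ‖ah w t ξ‖ ≤ (∫ x, ‖w t x‖) / (2 * Real.pi) := by
  unfold ah; rw [norm_div, norm_two_pi]; gcongr; exact norm_fourierT_le _ _

theorem Sol.A_eq (S : Sol s T α e u0 w) (t x : ℝ) :
    fourierMult (m1 α) (fun y => w t y ^ 2) x = IF (Aq α w t) x := by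
  have hP : Integrable (Pq w t) := S.tfP.integrable (by norm_num) t
  have hc : Continuous (Pq w t) := cv_continuous (S.ah_int t) (S.ah_cont t) (S.ah_bdd t)
  have e1 : ∀ ξ, fourierT (fun y => w t y ^ 2) ξ = 2 * Real.pi * Pq w t ξ := fun ξ => by
    rw [← fourierT_IF hc hP]
    · unfold fourierT; refine integral_congr_ae ?_
      filter_upwards [S.ae_eq t] with x hx
      rw [hx, S.P_eq]
    · refine (S.wsq_int t).congr (Eventually.of_forall fun x => (S.P_eq t x).symm)
  unfold fourierMult IF
  rw [← integral_const_mul]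
  congr 1; funext ξ; rw [e1]; unfold Aq; push_cast
  have := two_pi_ne
  field_simp

/-- one-sided continuity in time of the representative -/
theorem Sol.onesided (S : Sol s T α e u0 w) (t z : ℝ) :
    ContinuousWithinAt (fun t => dd w t z) (Set.Ici t) t ∨ ContinuousWithinAt (fun t => dd w t z) (Set.Iic t) t := by
  have hW : Continuous (fun t => IF (ah w t) z) :=
    S.tf0.continuous.comp (by fun_prop : Continuous fun t : ℝ => (t, z))
  suffices h : ContinuousWithinAt (fun t => w t z) (Set.Ici t) t ∨ ContinuousWithinAt (fun t => w t z) (Set.Iic t) t by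
    rcases h with h | h
    · exact Or.inl (h.sub hW.continuousWithinAt)
    · exact Or.inr (h.sub hW.continuousWithinAt)
  rcases le_or_gt t 0 with h0 | h0
  · right
    refine (continuousWithinAt_const (b := w 0 z)).congr (fun t' ht' => ?_) ?_
    · rw [S.left t' (le_trans ht' h0)]
    · rw [S.left t h0]
  rcases le_or_gt T t with hT | hT
  · left
    refine (continuousWithinAt_const (b := w T z)).congr (fun t' ht' => ?_) ?_
    · rw [S.right t' (le_trans hT ht')]
    · rw [S.right t hT]
  set f : ℝ → ℂ := fun τ => (3 * w τ z * deriv (w τ) z +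
    e * (fourierMult (m1 α) (fun y => w τ y ^ 2) z + (1 / 2) * fourierMult (m2 α) (fun y => deriv (w τ) y ^ 2) z)) with hf
  have heq : ∀ t ∈ Set.Icc 0 T, w t z = u0 z - ∫ τ in (0:ℝ)..t, f τ := fun t ht => S.eq t ht z
  by_cases hi : IntervalIntegrable f volume 0 t
  · right
    have hc : ContinuousOn (fun t => u0 z - ∫ τ in (0:ℝ)..t, f τ) (Set.uIcc 0 t) :=
      continuousOn_const.sub (intervalIntegral.continuousOn_primitive_interval (by
        rw [Set.uIcc_of_le h0.le, integrableOn_Icc_iff_integrableOn_Ioc]; exact hi.1))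
    rw [Set.uIcc_of_le h0.le] at hc
    have h1 := (hc t ⟨h0.le, le_rfl⟩)
    have h2 : ContinuousWithinAt (fun t => u0 z - ∫ τ in (0:ℝ)..t, f τ) (Set.Iic t) t := by
      refine h1.mono_of_mem_nhdsWithin ?_
      exact mem_nhdsWithin.2 ⟨Set.Ioi 0, isOpen_Ioi, h0, fun x hx => ⟨hx.1.le, hx.2⟩⟩
    refine h2.congr_of_eventuallyEq ?_ (heq t ⟨h0.le, hT.le⟩)
    exact mem_nhdsWithin.2 ⟨Set.Ioi 0, isOpen_Ioi, h0, fun x hx => heq x ⟨hx.1.le, le_trans hx.2 hT.le⟩⟩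
  · left
    have hz : ∀ t' ≥ t, t' ≤ T → w t' z = u0 z := fun t' ht' hT' => by
      rw [heq t' ⟨h0.le.trans ht', hT'⟩, intervalIntegral.integral_undef, sub_zero]
      intro hc; exact hi (hc.mono_set (by
        rw [Set.uIcc_of_le h0.le, Set.uIcc_of_le (h0.le.trans ht')]; exact Set.Icc_subset_Icc_right ht'))
    refine (continuousWithinAt_const (b := u0 z)).congr (fun t' ht' => ?_) (hz t le_rfl hT.le)
    rcases le_or_gt t' T with h | h
    · exact hz t' ht' h
    · rw [S.right t' h.le]; exact hz T hT.le le_rfl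

theorem Sol.th_meas (S : Sol s T α e u0 w) : Measurable (fun p : ℝ × ℝ => th w p.1 p.2) := by
  unfold th
  exact Measurable.ite (measurable_flat S.onesided) measurable_const measurable_const

theorem Sol.W1c (S : Sol s T α e u0 w) : Continuous (fun p : ℝ × ℝ => IF (dx (ah w) p.1) p.2) :=
  (S.tf1.mono (by norm_num)).continuous

theorem Sol.DD_meas (S : Sol s T α e u0 w) : Measurable (fun p : ℝ × ℝ => DD w p.1 p.2) := by
  unfold DD
  exact (Complex.measurable_ofReal.comp S.th_meas).mul (S.W1c.measurable.pow_const 2)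

theorem th_nonneg (w : ℝ → ℝ → ℂ) (t y : ℝ) : 0 ≤ th w t y := by rcases th01 w t y with h | h <;> simp [h]
theorem th_le_one (w : ℝ → ℝ → ℂ) (t y : ℝ) : th w t y ≤ 1 := by rcases th01 w t y with h | h <;> simp [h]

theorem norm_th_mul_le (w : ℝ → ℝ → ℂ) (t y : ℝ) (z : ℂ) : ‖(th w t y : ℂ) * z‖ ≤ ‖z‖ := by
  rw [norm_mul, Complex.norm_real, Real.norm_of_nonneg (th_nonneg w t y)]
  exact mul_le_of_le_one_left (norm_nonneg _) (th_le_one w t y)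

/-- uniform sup bound for TF families -/
theorem TF.bdd {q : ℝ → ℝ → ℂ} (hq : TF 0 q) (a b : ℝ) : ∃ M, 0 ≤ M ∧ ∀ t ∈ Set.Icc a b, ∀ x, ‖IF (q t) x‖ ≤ M := by
  have key : ∀ t0 ∈ Set.Icc a b, ∃ U ∈ 𝓝[Set.Icc a b] t0, ∃ M, ∀ t ∈ U, ∀ x, ‖IF (q t) x‖ ≤ M := by
    intro t0 _
    refine ⟨_, mem_nhdsWithin_of_mem_nhds (hq.dist t0 one_pos), (∫ ξ, ‖q t0 ξ‖) + 1, fun t ht x => ?_⟩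
    have h1 := ht x
    have h2 := norm_IF_le (q t0) x
    have h3 := norm_sub_norm_le (IF (q t) x) (IF (q t0) x)
    linarith
  obtain ⟨M, hM⟩ : ∃ M, ∀ t ∈ Set.Icc a b, ∀ x, ‖IF (q t) x‖ ≤ M := by
    refine isCompact_Icc.induction_on (p := fun U => ∃ M, ∀ t ∈ U, ∀ x, ‖IF (q t) x‖ ≤ M) ⟨0, by simp⟩
      (fun U V hUV ⟨M, hM⟩ => ⟨M, fun t ht => hM t (hUV ht)⟩) ?_ key
    rintro U V ⟨M, hM⟩ ⟨M', hM'⟩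
    refine ⟨max M M', fun t ht x => ?_⟩
    rcases ht with ht | ht
    · exact (hM t ht x).trans (le_max_left _ _)
    · exact (hM' t ht x).trans (le_max_right _ _)
  exact ⟨max M 0, le_max_right _ _, fun t ht x => (hM t ht x).trans (le_max_left _ _)⟩

theorem Sol.DD_bdd (S : Sol s T α e u0 w) (t : ℝ) : ∃ M, 0 ≤ M ∧ ∀ x, ‖DD w t x‖ ≤ M := by
  refine ⟨(∫ ξ, ‖dx (ah w) t ξ‖) ^ 2, by positivity, fun x => (norm_th_mul_le w t x _).trans ?_⟩
  rw [norm_pow]; gcongr; exact norm_IF_le _ _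

theorem sq_integrable_IF {q : ℝ → ℂ} (hq : Integrable q) (h2 : N2 0 q ≠ ⊤) : Integrable (fun x => IF q x ^ 2) := by
  refine ⟨((continuous_IF hq).pow 2).aestronglyMeasurable, ?_⟩
  have := plancherel_IF hq
  rw [← N2_zero q] at this
  refine lt_of_le_of_lt (le_of_eq ?_) (this.trans_lt (ENNReal.mul_lt_top ENNReal.ofReal_lt_top (lt_top_iff_ne_top.2 h2)))
  congr 1; funext x; rw [enorm_pow]

theorem Sol.W1_N2 (S : Sol s T α e u0 w) (t : ℝ) {σ : ℝ} (hσ : σ + 1 ≤ s + 2) : N2 σ (dx (ah w) t) ≠ ⊤ := by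
  have := N2_mult (σ := σ) (k := 1) (m := fun ξ : ℝ => Complex.I * (ξ:ℂ)) (q := ah w t) zero_le_one norm_iξ_le
  refine ne_top_of_le_ne_top (ENNReal.mul_ne_top ENNReal.ofReal_ne_top ?_) this
  rw [S.ah_N2 t hσ]; simp

theorem Sol.W1sq_int (S : Sol s T α e u0 w) (t : ℝ) : Integrable (fun x => IF (dx (ah w) t) x ^ 2) :=
  sq_integrable_IF (S.tf1.integrable (by norm_num) t) (S.W1_N2 t (by linarith [S.hs]))

theorem Sol.DD_int (S : Sol s T α e u0 w) (t : ℝ) : Integrable (DD w t) := by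
  refine (S.W1sq_int t).norm.mono' (S.DD_meas.comp (by fun_prop : Measurable fun x : ℝ => (t, x))).aestronglyMeasurable ?_
  exact Eventually.of_forall fun x => norm_th_mul_le w t x _

theorem Sol.deriv_sq (S : Sol s T α e u0 w) (t : ℝ) : (fun y => deriv (w t) y ^ 2) = DD w t := by
  funext y; rw [S.deriv_w]; unfold DD
  rcases th01 w t y with h | h <;> simp [h]

theorem Sol.B_eq (S : Sol s T α e u0 w) (t x : ℝ) :
    (1/2) * fourierMult (m2 α) (fun y => deriv (w t) y ^ 2) x = BB α w t x := by
  obtain ⟨M, _, hM⟩ := S.DD_bdd t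
  rw [S.deriv_sq]; unfold BB; congr 1
  exact mult_k S.hα (S.DD_int t) hM x

theorem Sol.BB_meas (S : Sol s T α e u0 w) : Measurable (fun p : ℝ × ℝ => BB α w p.1 p.2) := by
  unfold BB cv
  refine Measurable.const_mul ?_ _
  refine StronglyMeasurable.measurable ?_
  refine StronglyMeasurable.integral_prod_right (f := fun (p : ℝ × ℝ) (z : ℝ) => DD w p.1 z * (kk α (p.2 - z) : ℂ)) ?_
  refine Measurable.stronglyMeasurable ?_
  refine Measurable.mul (S.DD_meas.comp (by fun_prop : Measurable fun p : (ℝ × ℝ) × ℝ => (p.1.1, p.2))) ?_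
  exact Complex.measurable_ofReal.comp ((measurable_kk α).comp (by fun_prop))

theorem Sol.DD_bddI (S : Sol s T α e u0 w) (a b : ℝ) : ∃ M, 0 ≤ M ∧ ∀ t ∈ Set.Icc a b, ∀ x, ‖DD w t x‖ ≤ M := by
  obtain ⟨M, hM, h⟩ := (S.tf1.mono (by norm_num : (0:ℝ) ≤ 2)).bdd a b
  refine ⟨M ^ 2, by positivity, fun t ht x => (norm_th_mul_le w t x _).trans ?_⟩
  rw [norm_pow]; gcongr; exact h t ht x

theorem Sol.BB_bddI (S : Sol s T α e u0 w) (a b : ℝ) : ∃ M, 0 ≤ M ∧ ∀ t ∈ Set.Icc a b, ∀ x, ‖BB α w t x‖ ≤ M := by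
  obtain ⟨M, hM, h⟩ := S.DD_bddI a b
  refine ⟨M * α, mul_nonneg hM S.hα.le, fun t ht x => ?_⟩
  have := norm_cv_le_sup (h t ht) (integrable_kk S.hα).ofReal (k := fun x => (kk α x : ℂ)) x
  rw [integral_norm_kk S.hα] at this
  unfold BB; rw [norm_mul]
  have h2 : ‖(1/2:ℂ)‖ = 1/2 := by norm_num
  rw [h2]
  have : 0 ≤ M * α := mul_nonneg hM S.hα.le
  linarith [norm_nonneg (cv (DD w t) (fun x => (kk α x : ℂ)) x)]

/-- The integrand, in terms of smooth representatives. -/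
theorem Sol.eq' (S : Sol s T α e u0 w) {t : ℝ} (ht : t ∈ Set.Icc 0 T) (x : ℝ) :
    w t x = u0 x - ∫ τ in (0:ℝ)..t, (th w τ x * IF (hq w τ) x + e * (IF (Aq α w τ) x + BB α w τ x)) := by
  rw [S.eq t ht x]; congr 1
  refine intervalIntegral.integral_congr fun τ _ => ?_
  beta_reduce
  rw [S.A_eq, S.B_eq, S.h_eq, mul_assoc 3, S.w_deriv_w]; ring

theorem ii_bdd {f : ℝ → ℂ} (hf : Measurable f) {M a b : ℝ} (h : ∀ t ∈ Set.uIcc a b, ‖f t‖ ≤ M) :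
    IntervalIntegrable f volume a b := by
  rw [intervalIntegrable_iff]
  refine IntegrableOn.of_bound (C := M) (by simp [Set.uIoc]) hf.aestronglyMeasurable ?_
  filter_upwards [ae_restrict_mem measurableSet_uIoc] with t ht
  exact h t (Set.uIoc_subset_uIcc ht)

theorem TF.tcont {q : ℝ → ℝ → ℂ} (hq : TF 0 q) (x : ℝ) : Continuous (fun t => IF (q t) x) :=
  hq.continuous.comp (by fun_prop : Continuous fun t : ℝ => (t, x))

theorem Sol.thm (S : Sol s T α e u0 w) (x : ℝ) : Measurable (fun t => th w t x) :=
  S.th_meas.comp (by fun_prop : Measurable fun t : ℝ => (t, x))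

theorem Sol.thh_ii (S : Sol s T α e u0 w) {q : ℝ → ℝ → ℂ} (hq : TF 0 q) (x a b : ℝ) :
    IntervalIntegrable (fun τ => (th w τ x : ℂ) * IF (q τ) x) volume a b := by
  refine ((hq.tcont x).norm.intervalIntegrable a b).mono_fun' ?_ ?_
  · exact ((Complex.measurable_ofReal.comp (S.thm x)).mul (hq.tcont x).measurable).aestronglyMeasurable
  · exact Eventually.of_forall fun τ => norm_th_mul_le w τ x _

theorem Sol.BB_ii (S : Sol s T α e u0 w) (x a b : ℝ) : IntervalIntegrable (fun τ => BB α w τ x) volume a b := by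
  obtain ⟨M, _, h⟩ := S.BB_bddI (min a b) (max a b)
  exact ii_bdd (S.BB_meas.comp (by fun_prop : Measurable fun t : ℝ => (t, x))) fun t ht => h t ht x

theorem Sol.F_ii (S : Sol s T α e u0 w) (x a b : ℝ) :
    IntervalIntegrable (fun τ => (th w τ x : ℂ) * IF (hq w τ) x + e * (IF (Aq α w τ) x + BB α w τ x)) volume a b := by
  refine (S.thh_ii (S.tfh.mono (by norm_num)) x a b).add (IntervalIntegrable.const_mul (IntervalIntegrable.add ?_ (S.BB_ii x a b)) _)
  exact ((S.tfA.mono (by norm_num)).tcont x).intervalIntegrable _ _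

theorem Sol.w_tcont (S : Sol s T α e u0 w) (x : ℝ) : ContinuousOn (fun t => w t x) (Set.Icc 0 T) := by
  have : ContinuousOn (fun t => u0 x - ∫ τ in (0:ℝ)..t, ((th w τ x : ℂ) * IF (hq w τ) x + e * (IF (Aq α w τ) x + BB α w τ x))) (Set.Icc 0 T) :=
    continuousOn_const.sub (intervalIntegral.continuous_primitive (S.F_ii x) 0).continuousOn
  exact this.congr fun t ht => S.eq' ht x

/-- good set -/
def GG (T : ℝ) (w : ℝ → ℝ → ℂ) : Set ℝ := {x | ∀ t ∈ Set.Icc 0 T, dd w t x = 0}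

theorem Sol.GG_ae (S : Sol s T α e u0 w) : ∀ᵐ x, x ∈ GG T w := by
  have h : ∀ᵐ x, ∀ r : ℚ, w (r:ℝ) x = IF (ah w r) x := by
    rw [ae_all_iff]; intro r; exact S.ae_eq r
  filter_upwards [h] with x hx t ht
  have hc : ContinuousOn (fun t => dd w t x) (Set.Icc 0 T) :=
    (S.w_tcont x).sub (S.tf0.tcont x).continuousOn
  have hcl : Set.Icc 0 T ⊆ closure (Set.Ioo 0 T ∩ Set.range ((↑) : ℚ → ℝ)) := by
    rw [← closure_Ioo S.hT.ne]
    exact closure_minimal (Rat.isDenseEmbedding_coe_real.dense.open_subset_closure_inter isOpen_Ioo) isClosed_closure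
  have hz : Set.EqOn (fun t => dd w t x) (fun _ => 0) (Set.Ioo 0 T ∩ Set.range ((↑) : ℚ → ℝ)) := by
    rintro _ ⟨_, r, rfl⟩
    simp [dd, hx r]
  exact (hz.of_subset_closure hc continuousOn_const (fun t ht => Set.Ioo_subset_Icc_self ht.1) hcl) ht

end

/-! ### Part P6 -/

noncomputable section

open MeasureTheory Filter
open scoped ENNReal Topology

variable {s T α e : ℝ} {u0 : ℝ → ℂ} {w : ℝ → ℝ → ℂ}

def Gc (α : ℝ) (w : ℝ → ℝ → ℂ) (t x : ℝ) : ℂ := cv (DD w t) (fun x => (gg α x : ℂ)) x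
def bt (α : ℝ) (w : ℝ → ℝ → ℂ) (t y : ℝ) : ℂ := ∫ τ in (0:ℝ)..t, BB α w τ y
def bx (α : ℝ) (w : ℝ → ℝ → ℂ) (t x : ℝ) : ℂ :=
  ∫ τ in (0:ℝ)..t, (1/2) * (Gc α w τ x - DD w τ x)

theorem Sol.Gc_meas (S : Sol s T α e u0 w) : Measurable (fun p : ℝ × ℝ => Gc α w p.1 p.2) := by
  unfold Gc cv
  refine StronglyMeasurable.measurable ?_
  refine StronglyMeasurable.integral_prod_right (f := fun (p : ℝ × ℝ) (z : ℝ) => DD w p.1 z * (gg α (p.2 - z) : ℂ)) ?_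
  refine Measurable.stronglyMeasurable ?_
  refine Measurable.mul (S.DD_meas.comp (by fun_prop : Measurable fun p : (ℝ × ℝ) × ℝ => (p.1.1, p.2))) ?_
  exact Complex.measurable_ofReal.comp ((continuous_gg α).measurable.comp (by fun_prop))

theorem Sol.Gc_bdd (S : Sol s T α e u0 w) {t M : ℝ} (h : ∀ x, ‖DD w t x‖ ≤ M) (x : ℝ) : ‖Gc α w t x‖ ≤ M := by
  have := norm_cv_le_sup h (integrable_gg S.hα).ofReal (k := fun x => (gg α x : ℂ)) x
  rwa [integral_norm_gg S.hα, mul_one] at this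

theorem swap_bdd {f : ℝ → ℝ → ℂ} (hf : Measurable (fun p : ℝ × ℝ => f p.1 p.2)) {a b c d M : ℝ}
    (hM : ∀ t ∈ Set.uIcc a b, ∀ x, ‖f t x‖ ≤ M) :
    ∫ t in a..b, ∫ x in c..d, f t x = ∫ x in c..d, ∫ t in a..b, f t x := by
  refine intervalIntegral_intervalIntegral_swap ?_
  refine IntegrableOn.of_bound (C := M) ?_ hf.aestronglyMeasurable ?_
  · rw [Measure.volume_eq_prod, Measure.prod_prod]
    exact ENNReal.mul_lt_top (by simp [Set.uIoc]) (by simp [Set.uIoc])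
  · filter_upwards [ae_restrict_mem (measurableSet_uIoc.prod measurableSet_uIoc)] with p hp
    exact hM _ (Set.uIoc_subset_uIcc hp.1) _

theorem Sol.BBx_meas (S : Sol s T α e u0 w) : Measurable (fun p : ℝ × ℝ => (1/2:ℂ) * (Gc α w p.1 p.2 - DD w p.1 p.2)) :=
  (S.Gc_meas.sub S.DD_meas).const_mul _

theorem Sol.BBx_bdd (S : Sol s T α e u0 w) {t M : ℝ} (h : ∀ x, ‖DD w t x‖ ≤ M) (x : ℝ) :
    ‖(1/2:ℂ) * (Gc α w t x - DD w t x)‖ ≤ M := by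
  have h1 := S.Gc_bdd h x
  have h2 := norm_sub_le (Gc α w t x) (DD w t x)
  have h3 := h x
  rw [norm_mul]; norm_num; linarith

theorem Sol.bt_diff (S : Sol s T α e u0 w) (t y y' : ℝ) :
    bt α w t y - bt α w t y' = ∫ x in y'..y, bx α w t x := by
  unfold bt bx
  obtain ⟨M, hM0, hM⟩ := S.DD_bddI (min 0 t) (max 0 t)
  rw [← swap_bdd S.BBx_meas (M := M) (fun τ hτ x => S.BBx_bdd (hM τ hτ) x),
    ← intervalIntegral.integral_sub (S.BB_ii _ _ _) (S.BB_ii _ _ _)]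
  refine intervalIntegral.integral_congr fun τ _ => ?_
  beta_reduce
  unfold BB
  rw [← mul_sub, kconv_diff S.hα (S.DD_int τ), intervalIntegral.integral_const_mul]
  rfl

theorem ii_sec {f : ℝ → ℝ → ℂ} (hf : Measurable (fun p : ℝ × ℝ => f p.1 p.2)) {M a b : ℝ} (x : ℝ)
    (hM : ∀ t ∈ Set.uIcc a b, ∀ x, ‖f t x‖ ≤ M) : IntervalIntegrable (fun t => f t x) volume a b :=
  ii_bdd (hf.comp (by fun_prop : Measurable fun t : ℝ => (t, x))) (M := M) fun t ht => hM t ht x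

theorem meas_tint {f : ℝ → ℝ → ℂ} (hf : Measurable (fun p : ℝ × ℝ => f p.1 p.2)) (a b : ℝ) :
    Measurable (fun x => ∫ t in a..b, f t x) := by
  unfold intervalIntegral
  refine Measurable.sub ?_ ?_ <;>
  exact (StronglyMeasurable.integral_prod_right (f := fun x t => f t x) (Measurable.stronglyMeasurable (hf.comp measurable_swap))).measurable

theorem Sol.bx_meas (S : Sol s T α e u0 w) (t : ℝ) : Measurable (bx α w t) := meas_tint S.BBx_meas _ _

theorem norm_tint_le {f : ℝ → ℂ} {M t S : ℝ} (ht : t ∈ Set.Icc 0 S) (hM0 : 0 ≤ M) (hM : ∀ τ ∈ Set.Icc 0 S, ‖f τ‖ ≤ M) :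
    ‖∫ τ in (0:ℝ)..t, f τ‖ ≤ M * S := by
  refine (intervalIntegral.norm_integral_le_of_norm_le_const (C := M) fun τ hτ => ?_).trans ?_
  · rw [Set.uIoc_of_le ht.1] at hτ; exact hM _ ⟨hτ.1.le, hτ.2.trans ht.2⟩
  · rw [sub_zero, abs_of_nonneg ht.1]; gcongr; exact ht.2

theorem gg_lip {α : ℝ} (hα : 0 < α) (x x' : ℝ) : |gg α x - gg α x'| ≤ |x - x'| / α * (gg α x + gg α x') := by
  have key : ∀ a b : ℝ, Real.exp a - Real.exp b ≤ |a - b| * (Real.exp a + Real.exp b) := fun a b => by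
    have h1 : Real.exp a * (1 - (a - b)) ≤ Real.exp b := by
      have := Real.add_one_le_exp (b - a)
      calc _ = Real.exp a * ((b - a) + 1) := by ring
        _ ≤ Real.exp a * Real.exp (b - a) := by gcongr
        _ = _ := by rw [← Real.exp_add]; congr 1; ring
    have h2 : Real.exp a * (a - b) ≤ Real.exp a * |a - b| := by gcongr; exact le_abs_self _
    nlinarith [Real.exp_pos a, Real.exp_pos b, abs_nonneg (a - b), mul_nonneg (abs_nonneg (a-b)) (Real.exp_pos b).le]
  have hd : |-|x| / α - -|x'| / α| ≤ |x - x'| / α := by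
    rw [← sub_div, abs_div, abs_of_pos hα]; refine div_le_div_of_nonneg_right ?_ hα.le
    rw [show -|x| - -|x'| = |x'| - |x| by ring, abs_sub_comm x x']
    exact abs_abs_sub_abs_le _ _
  have k1 := key (-|x| / α) (-|x'| / α)
  have k2 := key (-|x'| / α) (-|x| / α)
  rw [abs_sub_comm] at k2
  have hs : 0 ≤ Real.exp (-|x| / α) + Real.exp (-|x'| / α) := by positivity
  have h3 := mul_le_mul_of_nonneg_right hd hs
  unfold gg
  rw [← mul_sub, abs_mul, abs_of_nonneg (by positivity : 0 ≤ 1 / (2 * α)), ← mul_add, mul_left_comm]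
  gcongr
  rw [abs_le]; constructor <;> linarith

theorem gconv_lip {α : ℝ} (hα : 0 < α) {D : ℝ → ℂ} (hD : Integrable D) {M : ℝ} (hM : ∀ x, ‖D x‖ ≤ M) (y y' : ℝ) :
    ‖cv D (fun x => (gg α x : ℂ)) y - cv D (fun x => (gg α x : ℂ)) y'‖ ≤ 2 * M / α * |y - y'| := by
  have hM0 : 0 ≤ M := (norm_nonneg _).trans (hM 0)
  have hi : ∀ y, Integrable (fun ζ => D ζ * (gg α (y - ζ) : ℂ)) := fun y => by
    refine hD.mul_bdd (c := 1 / (2 * α)) ?_ (Eventually.of_forall fun ζ => ?_)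
    · exact (Complex.measurable_ofReal.comp ((continuous_gg α).measurable.comp (by fun_prop))).aestronglyMeasurable
    · rw [Complex.norm_real, Real.norm_eq_abs, abs_of_nonneg (gg_nonneg hα _)]; exact gg_le hα _
  have hg : ∀ y, Integrable (fun ζ => gg α (y - ζ)) := fun y => (integrable_gg hα).comp_sub_left y
  have hgi : ∀ y, ∫ ζ, gg α (y - ζ) = 1 := fun y => by rw [integral_sub_left_eq_self (gg α) volume y, integral_gg hα]
  unfold cv
  rw [← integral_sub (hi y) (hi y')]
  refine (norm_integral_le_of_norm_le (g := fun ζ => M * (|y - y'| / α) * (gg α (y - ζ) + gg α (y' - ζ)))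
    (((hg y).add (hg y')).const_mul _) (Eventually.of_forall fun ζ => ?_)).trans ?_
  · rw [← mul_sub, norm_mul, ← Complex.ofReal_sub, Complex.norm_real, Real.norm_eq_abs, mul_assoc]
    have := gg_lip hα (y - ζ) (y' - ζ)
    rw [sub_sub_sub_cancel_right] at this
    exact mul_le_mul (hM _) this (abs_nonneg _) hM0
  · rw [integral_const_mul, integral_add (hg y) (hg y'), hgi, hgi]
    apply le_of_eq; ring

end

/-! ### Part P6b -/

noncomputable section

open MeasureTheory Filter
open scoped ENNReal Topology

variable {s T α e : ℝ} {u0 : ℝ → ℂ} {w : ℝ → ℝ → ℂ}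

theorem TF.lip {q : ℝ → ℝ → ℂ} (hq : TF 1 q) {t M : ℝ} (hM : ∀ x, ‖IF (_root_.dx q t) x‖ ≤ M) (y y' : ℝ) :
    ‖IF (q t) y - IF (q t) y'‖ ≤ M * |y - y'| := by
  rw [hq.ftc]
  exact intervalIntegral.norm_integral_le_of_norm_le_const fun x _ => hM x

theorem TF.tint_cont {q : ℝ → ℝ → ℂ} (hq : TF 0 q) (t : ℝ) : Continuous (fun x => ∫ τ in (0:ℝ)..t, IF (q τ) x) := by
  have h := hq.continuous.comp (continuous_swap (X := ℝ) (Y := ℝ))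
  exact intervalIntegral.continuous_parametric_intervalIntegral_of_continuous' (f := fun x τ => IF (q τ) x) h 0 t

def Yy (α e : ℝ) (w : ℝ → ℝ → ℂ) (t y : ℝ) : ℂ :=
  IF (ah w 0) y - IF (ah w t) y - e * ((∫ τ in (0:ℝ)..t, IF (Aq α w τ) y) + bt α w t y)

def Yx (α e : ℝ) (w : ℝ → ℝ → ℂ) (t y : ℝ) : ℂ :=
  IF (dx (ah w) 0) y - IF (dx (ah w) t) y - e * ((∫ τ in (0:ℝ)..t, IF (dx (Aq α w) τ) y) + bx α w t y)

theorem Sol.dd_eq (S : Sol s T α e u0 w) {t : ℝ} (ht : t ∈ Set.Icc 0 T) (y : ℝ) :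
    dd w t y = Yy α e w t y - ∫ τ in (0:ℝ)..t, th w τ y * IF (hq w τ) y := by
  have hA := (S.tfA.mono (by norm_num : (0:ℝ) ≤ 2)).tcont y
  unfold dd Yy bt
  rw [S.eq' ht, intervalIntegral.integral_add (S.thh_ii (S.tfh.mono (by norm_num)) _ _ _)
    (((hA.intervalIntegrable _ _).add (S.BB_ii _ _ _)).const_mul _),
    intervalIntegral.integral_const_mul, intervalIntegral.integral_add (hA.intervalIntegrable _ _) (S.BB_ii _ _ _), S.W0]
  ring

theorem Sol.Yy_tcont (S : Sol s T α e u0 w) (y : ℝ) : Continuous (fun t => Yy α e w t y) := by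
  unfold Yy bt
  have hA := (S.tfA.mono (by norm_num : (0:ℝ) ≤ 2)).tcont y
  refine (continuous_const.sub (S.tf0.tcont y)).sub (continuous_const.mul (Continuous.add ?_ ?_))
  · exact intervalIntegral.continuous_primitive (fun a b => hA.intervalIntegrable a b) 0
  · exact intervalIntegral.continuous_primitive (fun a b => S.BB_ii y a b) 0

theorem Sol.bx_bdd (S : Sol s T α e u0 w) {t M : ℝ} (hM0 : 0 ≤ M) (hM : ∀ τ ∈ Set.uIcc 0 t, ∀ x, ‖DD w τ x‖ ≤ M) (x : ℝ) :
    ‖bx α w t x‖ ≤ M * |t| := by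
  unfold bx
  have := intervalIntegral.norm_integral_le_of_norm_le_const (a := 0) (b := t) (C := M)
    (f := fun τ => (1/2:ℂ) * (Gc α w τ x - DD w τ x)) fun τ hτ => S.BBx_bdd (hM τ (Set.uIoc_subset_uIcc hτ)) x
  simpa using this

theorem Sol.bx_ii (S : Sol s T α e u0 w) (t y y' : ℝ) : IntervalIntegrable (bx α w t) volume y y' := by
  obtain ⟨M, hM0, hM⟩ := S.DD_bddI (min 0 t) (max 0 t)
  exact ii_bdd (S.bx_meas t) (M := M * |t|) fun x _ => S.bx_bdd hM0 hM x

theorem Sol.Yy_diff (S : Sol s T α e u0 w) (t y y' : ℝ) :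
    Yy α e w t y - Yy α e w t y' = ∫ x in y'..y, Yx α e w t x := by
  unfold Yy Yx
  have c1 : Continuous (fun x => IF (dx (ah w) 0) x) := continuous_IF (S.tf1.integrable (by norm_num) 0)
  have c2 : Continuous (fun x => IF (dx (ah w) t) x) := continuous_IF (S.tf1.integrable (by norm_num) t)
  have hA : TF 0 (dx (Aq α w)) := TF.mono (m := 1) (by norm_num) (TF.dx (by norm_num; exact S.tfA))
  have c3 : Continuous (fun x => ∫ τ in (0:ℝ)..t, IF (dx (Aq α w) τ) x) :=
    hA.tint_cont t
  have i1 : IntervalIntegrable (fun x => IF (dx (ah w) 0) x - IF (dx (ah w) t) x) volume y' y := (c1.sub c2).intervalIntegrable _ _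
  rw [intervalIntegral.integral_sub i1 (((c3.intervalIntegrable _ _).add (S.bx_ii _ _ _)).const_mul _),
    intervalIntegral.integral_sub (c1.intervalIntegrable _ _) (c2.intervalIntegrable _ _), intervalIntegral.integral_const_mul,
    intervalIntegral.integral_add (c3.intervalIntegrable _ _) (S.bx_ii _ _ _), ← S.bt_diff]
  have h1 := (S.tf.mono (by norm_num : (1:ℝ) ≤ 3)).ftc 0 y y'
  have h2 := (S.tf.mono (by norm_num : (1:ℝ) ≤ 3)).ftc t y y'
  have h3 := (S.tfA.mono (by norm_num : (1:ℝ) ≤ 2)).time_ftc t y y'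
  unfold dx
  rw [← h1, ← h2, ← h3]; ring

theorem Sol.Yx_bdd (S : Sol s T α e u0 w) (S1 : ℝ) : ∃ M, 0 ≤ M ∧ ∀ t ∈ Set.Icc 0 S1, ∀ x, ‖Yx α e w t x‖ ≤ M := by
  obtain ⟨M, hM0, hM⟩ := S.DD_bddI 0 S1
  obtain ⟨M1, hM10, hM1⟩ := (S.tf1.mono (by norm_num : (0:ℝ) ≤ 2)).bdd 0 S1
  have hA : TF 0 (dx (Aq α w)) := TF.mono (m := 1) (by norm_num) (TF.dx (by norm_num; exact S.tfA))
  obtain ⟨M2, hM20, hM2⟩ := hA.bdd 0 S1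
  rcases lt_or_ge S1 0 with h0 | h0
  · exact ⟨0, le_rfl, fun t ht => absurd (ht.1.trans ht.2) (by linarith)⟩
  refine ⟨M1 + M1 + (M2 * S1 + M * S1), by positivity, fun t ht x => ?_⟩
  have e1 : ‖(e:ℂ)‖ ≤ 1 := by rcases S.he with h | h <;> simp [h]
  have a1 := hM1 0 ⟨le_rfl, h0⟩ x
  have a2 := hM1 t ht x
  have a3 := norm_tint_le ht hM20 (fun τ hτ => hM2 τ hτ x)
  have a4 := S.bx_bdd (t := t) hM0 (fun τ hτ => hM τ (by rw [Set.uIcc_of_le ht.1] at hτ; exact ⟨hτ.1, hτ.2.trans ht.2⟩)) x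
  rw [abs_of_nonneg ht.1] at a4
  have a5 : M * t ≤ M * S1 := by gcongr; exact ht.2
  unfold Yx
  refine (norm_sub_le _ _).trans (add_le_add ((norm_sub_le _ _).trans (add_le_add a1 a2)) ?_)
  rw [norm_mul]
  refine (mul_le_of_le_one_left (norm_nonneg _) e1).trans ((norm_add_le _ _).trans (add_le_add a3 (a4.trans a5)))

theorem Sol.Yy_xcont (S : Sol s T α e u0 w) {t : ℝ} : Continuous (Yy α e w t) := by
  have : Yy α e w t = fun y => Yy α e w t 0 + ∫ x in (0:ℝ)..y, Yx α e w t x := by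
    funext y; rw [← S.Yy_diff]; ring
  rw [this]
  refine continuous_const.add (intervalIntegral.continuous_primitive (fun a b => ?_) 0)
  unfold Yx
  have c1 : Continuous (fun x => IF (dx (ah w) 0) x) := continuous_IF (S.tf1.integrable (by norm_num) 0)
  have c2 : Continuous (fun x => IF (dx (ah w) t) x) := continuous_IF (S.tf1.integrable (by norm_num) t)
  have hA : TF 0 (dx (Aq α w)) := TF.mono (m := 1) (by norm_num) (TF.dx (by norm_num; exact S.tfA))
  have c3 : Continuous (fun x => ∫ τ in (0:ℝ)..t, IF (dx (Aq α w) τ) x) :=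
    hA.tint_cont t
  exact ((c1.sub c2).intervalIntegrable _ _).sub (((c3.intervalIntegrable _ _).add (S.bx_ii _ _ _)).const_mul _)

end

/-! ### Part P6c -/

noncomputable section

open MeasureTheory Filter
open scoped ENNReal Topology

variable {s T α e : ℝ} {u0 : ℝ → ℂ} {w : ℝ → ℝ → ℂ}

theorem Sol.th_ii (S : Sol s T α e u0 w) (x a b : ℝ) : IntervalIntegrable (fun t => 1 - th w t x) volume a b := by
  refine (intervalIntegrable_const (c := (1:ℝ))).mono_fun' (measurable_const.sub (S.thm x)).aestronglyMeasurable ?_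
  refine Eventually.of_forall fun t => ?_
  simp only [Real.norm_eq_abs]
  rcases th01 w t x with h | h <;> simp [h]

theorem DD_sub (t x x' : ℝ) {M1 M2 : ℝ} (hM10 : 0 ≤ M1) (h1 : ∀ x, ‖IF (dx (ah w) t) x‖ ≤ M1)
    (h2 : ‖IF (dx (ah w) t) x - IF (dx (ah w) t) x'‖ ≤ M2 * |x - x'|) :
    ‖DD w t x - DD w t x'‖ ≤ 2 * M1 * M2 * |x - x'| + M1 ^ 2 * ((1 - th w t x) + (1 - th w t x')) := by
  unfold DD
  have a1 := th_le_one w t x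
  have a2 := th_le_one w t x'
  set p := IF (dx (ah w) t) x
  set q := IF (dx (ah w) t) x'
  have hp := h1 x
  have hq := h1 x'
  have e1 : (th w t x : ℂ) * p ^ 2 - th w t x' * q ^ 2 = (p - q) * (p + q) - ((1 - th w t x : ℝ) : ℂ) * p ^ 2 + ((1 - th w t x' : ℝ) : ℂ) * q ^ 2 := by
    push_cast; ring
  rw [e1]
  refine (norm_add_le _ _).trans ((add_le_add_left (norm_sub_le _ _) _).trans ?_)
  simp only [norm_mul, norm_pow, Complex.norm_real, Real.norm_eq_abs]
  rw [abs_of_nonneg (by linarith : 0 ≤ 1 - th w t x), abs_of_nonneg (by linarith : 0 ≤ 1 - th w t x')]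
  have b1 : ‖p - q‖ * ‖p + q‖ ≤ (M2 * |x - x'|) * (M1 + M1) :=
    mul_le_mul h2 ((norm_add_le _ _).trans (add_le_add hp hq)) (norm_nonneg _) ((norm_nonneg _).trans h2)
  have b2 : (1 - th w t x) * ‖p‖ ^ 2 ≤ (1 - th w t x) * M1 ^ 2 := by gcongr
  have b3 : (1 - th w t x') * ‖q‖ ^ 2 ≤ (1 - th w t x') * M1 ^ 2 := by gcongr
  linarith

theorem Sol.bx_lip (S : Sol s T α e u0 w) (S1 : ℝ) : ∃ K, 0 ≤ K ∧ ∀ t ∈ Set.Icc 0 S1, ∀ x x',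
    ‖bx α w t x - bx α w t x'‖ ≤ K * (|x - x'| + (∫ τ in (0:ℝ)..t, (1 - th w τ x)) + ∫ τ in (0:ℝ)..t, (1 - th w τ x')) := by
  obtain ⟨M, hM0, hM⟩ := S.DD_bddI 0 S1
  obtain ⟨M1, hM10, hM1⟩ := (S.tf1.mono (by norm_num : (0:ℝ) ≤ 2)).bdd 0 S1
  obtain ⟨M2, hM20, hM2⟩ := (S.tf2.mono (by norm_num : (0:ℝ) ≤ 1)).bdd 0 S1
  rcases lt_or_ge S1 0 with h0 | h0
  · exact ⟨0, le_rfl, fun t ht => absurd (ht.1.trans ht.2) (by linarith)⟩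
  have hα := S.hα
  refine ⟨(2 * M / α + 2 * M1 * M2) * S1 + M1 ^ 2, by positivity, fun t ht x x' => ?_⟩
  have hsub : ∀ τ ∈ Set.uIcc 0 t, τ ∈ Set.Icc 0 S1 := fun τ hτ => by
    rw [Set.uIcc_of_le ht.1] at hτ; exact ⟨hτ.1, hτ.2.trans ht.2⟩
  have ib : ∀ x, IntervalIntegrable (fun τ => (1/2:ℂ) * (Gc α w τ x - DD w τ x)) volume 0 t := fun x =>
    ii_sec S.BBx_meas x (M := M) fun τ hτ x => S.BBx_bdd (hM τ (hsub τ hτ)) x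
  unfold bx
  rw [← intervalIntegral.integral_sub (ib x) (ib x')]
  have i1 := S.th_ii x 0 t
  have i2 := S.th_ii x' 0 t
  have hn1 : 0 ≤ ∫ τ in (0:ℝ)..t, (1 - th w τ x) :=
    intervalIntegral.integral_nonneg ht.1 fun τ _ => by linarith [th_le_one w τ x]
  have hn2 : 0 ≤ ∫ τ in (0:ℝ)..t, (1 - th w τ x') :=
    intervalIntegral.integral_nonneg ht.1 fun τ _ => by linarith [th_le_one w τ x']
  refine (intervalIntegral.norm_integral_le_of_norm_le (g := fun τ => (2 * M / α + 2 * M1 * M2) * |x - x'| +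
    M1 ^ 2 * ((1 - th w τ x) + (1 - th w τ x'))) ht.1 (Eventually.of_forall fun τ hτ => ?_) ?_).trans ?_
  · have hτ' : τ ∈ Set.Icc 0 S1 := ⟨hτ.1.le, hτ.2.trans ht.2⟩
    have a1 : ‖Gc α w τ x - Gc α w τ x'‖ ≤ 2 * M / α * |x - x'| := gconv_lip S.hα (S.DD_int τ) (hM τ hτ') x x'
    have a2 := DD_sub (w := w) τ x x' hM10 (hM1 τ hτ') (TF.lip (S.tf1.mono (by norm_num)) (hM2 τ hτ') x x')
    rw [show (1/2:ℂ) * (Gc α w τ x - DD w τ x) - (1/2:ℂ) * (Gc α w τ x' - DD w τ x') =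
      (1/2:ℂ) * ((Gc α w τ x - Gc α w τ x') - (DD w τ x - DD w τ x')) by ring, norm_mul]
    have a3 := norm_sub_le (Gc α w τ x - Gc α w τ x') (DD w τ x - DD w τ x')
    have : ‖(1/2:ℂ)‖ = 1/2 := by norm_num
    rw [this]
    have := norm_nonneg ((Gc α w τ x - Gc α w τ x') - (DD w τ x - DD w τ x'))
    linarith
  · exact intervalIntegrable_const.add ((i1.add i2).const_mul _)
  · rw [intervalIntegral.integral_add intervalIntegrable_const ((i1.add i2).const_mul _), intervalIntegral.integral_const, intervalIntegral.integral_const_mul,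
      intervalIntegral.integral_add i1 i2, smul_eq_mul, sub_zero]
    have hL : 0 ≤ (2 * M / α + 2 * M1 * M2) := by positivity
    have : t * ((2 * M / α + 2 * M1 * M2) * |x - x'|) ≤ S1 * ((2 * M / α + 2 * M1 * M2) * |x - x'|) := by
      gcongr; exact ht.2
    have hp := mul_nonneg (mul_nonneg hL h0) (add_nonneg hn1 hn2)
    have hq := mul_nonneg (sq_nonneg M1) (abs_nonneg (x - x'))
    nlinarith

theorem TF.tint_lip {q : ℝ → ℝ → ℂ} (hq : TF 1 q) {S1 M t : ℝ} (ht : t ∈ Set.Icc 0 S1) (hM0 : 0 ≤ M)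
    (hM : ∀ t ∈ Set.Icc 0 S1, ∀ x, ‖IF (_root_.dx q t) x‖ ≤ M) (y y' : ℝ) :
    ‖(∫ τ in (0:ℝ)..t, IF (q τ) y) - ∫ τ in (0:ℝ)..t, IF (q τ) y'‖ ≤ M * S1 * |y - y'| := by
  have hc := (hq.mono (by norm_num : (0:ℝ) ≤ 1)).tcont
  rw [← intervalIntegral.integral_sub ((hc y).intervalIntegrable _ _) ((hc y').intervalIntegrable _ _)]
  refine (norm_tint_le (M := M * |y - y'|) ht (by positivity) fun τ hτ => hq.lip (hM τ hτ) y y').trans (le_of_eq (by ring))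

theorem Sol.rigid (S : Sol s T α e u0 w) {x0 x1 S1 κ : ℝ} (hS1 : S1 ∈ Set.Icc 0 T) (hκ : 0 < κ) (hx : x0 < x1)
    (hh : ∀ t ∈ Set.Icc 0 S1, ∀ y ∈ Set.Ioo x0 x1, κ ≤ -(IF (hq w t) y).re) :
    ∃ b ∈ Set.Icc 0 S1, ∀ z ∈ Set.Ioo x0 x1, z ∈ GG T w → ∀ t ∈ Set.Icc 0 S1,
      (t < b → th w t z = 1) ∧ (b < t → th w t z = 0) := by
  have tA1 : TF 1 (dx (Aq α w)) := TF.dx (by norm_num; exact S.tfA)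
  have tA2 : TF 0 (dx (dx (Aq α w))) := TF.dx (by norm_num; exact tA1)
  have th1 : TF 1 (dx (hq w)) := TF.dx (by norm_num; exact S.tfh)
  have th2 : TF 0 (dx (dx (hq w))) := TF.dx (by norm_num; exact th1)
  have th10 := th1.mono (by norm_num : (0:ℝ) ≤ 1)
  obtain ⟨Mh, hMh0, hMh⟩ := (S.tfh.mono (by norm_num : (0:ℝ) ≤ 2)).bdd 0 S1
  obtain ⟨Mh1, hMh10, hMh1⟩ := th10.bdd 0 S1
  obtain ⟨Mh2, hMh20, hMh2⟩ := th2.bdd 0 S1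
  obtain ⟨MA, hMA0, hMA⟩ := tA2.bdd 0 S1
  obtain ⟨M2, hM20, hM2⟩ := (S.tf2.mono (by norm_num : (0:ℝ) ≤ 1)).bdd 0 S1
  obtain ⟨MY, hMY0, hMY⟩ := S.Yx_bdd S1
  obtain ⟨Kb, hKb0, hKb⟩ := S.bx_lip S1
  have h0S := hS1.1
  have e1 : ‖(e:ℂ)‖ ≤ 1 := by rcases S.he with h | h <;> simp [h]
  have hYxm : ∀ t, Measurable (Yx α e w t) := fun t => by
    unfold Yx
    have c1 := (continuous_IF (S.tf1.integrable (by norm_num) 0)).measurable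
    have c2 := (continuous_IF (S.tf1.integrable (by norm_num) t)).measurable
    have c3 := ((tA1.mono (by norm_num : (0:ℝ) ≤ 1)).tint_cont t).measurable
    exact (c1.sub c2).sub ((c3.add (S.bx_meas t)).const_mul _)
  have hYi : ∀ t ∈ Set.Icc 0 S1, ∀ y y', IntervalIntegrable (Yx α e w t) volume y y' := fun t ht y y' =>
    ii_bdd (hYxm t) (M := MY) fun x _ => hMY t ht x
  refine rigidity (K := MY + Mh1 * S1 + (M2 + M2 + (MA * S1 + Kb) + Mh2 * S1)) (M := Mh) (κ := κ) (S := S1) (x0 := x0) (x1 := x1) (h := fun t => IF (hq w t)) (Y := Yy α e w) (d := dd w)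
    (th := th w) (ℓ := fun t x => (Yx α e w t x - ∫ τ in (0:ℝ)..t, IF (dx (hq w) τ) x).re) (G := GG T w)
    h0S hκ (by positivity) hMh0 hx S.GG_ae (th01 w) (fun t ht y hy => th_eq_one) S.thm
    (fun y => (S.tfh.mono (by norm_num)).tcont y) hh (fun t ht y hy => hMh t ht y) S.Yy_tcont (fun t => S.Yy_xcont)
    (fun t ht y hy => S.dd_eq ⟨ht.1, ht.2.trans hS1.2⟩ y) (fun z hz t ht => hz t ⟨ht.1, ht.2.trans hS1.2⟩) ?_ ?_ ?_ ?_ ?_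
  · intro y; simp [Yy, bt]
  · intro t ht y y'
    have := (hYi t ht y y').sub ((th10.tint_cont t).intervalIntegrable _ _)
    exact ⟨this.1.re, this.2.re⟩
  · intro t ht y _ y' _
    have h1 := S.Yy_diff t y y'
    have h2 := (S.tfh.mono (by norm_num : (1:ℝ) ≤ 2)).time_ftc t y y'
    have i := (hYi t ht y' y).sub ((th10.tint_cont t).intervalIntegrable y' y)
    have h3 : ∫ x in y'..y, (Yx α e w t x - ∫ τ in (0:ℝ)..t, IF (dx (hq w) τ) x).re
        = (∫ x in y'..y, (Yx α e w t x - ∫ τ in (0:ℝ)..t, IF (dx (hq w) τ) x)).re := by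
      exact (Complex.reCLM.intervalIntegral_comp_comm i)
    rw [h3, intervalIntegral.integral_sub (hYi t ht y' y) ((th10.tint_cont t).intervalIntegrable y' y), ← h1]
    unfold dx
    rw [← h2]
    simp only [Complex.sub_re]; ring
  · intro t ht x _
    refine (Complex.abs_re_le_norm _).trans ((norm_sub_le _ _).trans ?_)
    have a1 := hMY t ht x
    have a2 := norm_tint_le ht hMh10 (fun τ hτ => hMh1 τ hτ x)
    have : 0 ≤ M2 + M2 + (MA * S1 + Kb) + Mh2 * S1 := by positivity
    linarith
  · intro t ht x _ x' _ _ _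
    rw [← Complex.sub_re]
    refine (Complex.abs_re_le_norm _).trans ?_
    have n1 : 0 ≤ ∫ τ in (0:ℝ)..t, (1 - th w τ x) :=
      intervalIntegral.integral_nonneg ht.1 fun τ _ => by linarith [th_le_one w τ x]
    have n2 : 0 ≤ ∫ τ in (0:ℝ)..t, (1 - th w τ x') :=
      intervalIntegral.integral_nonneg ht.1 fun τ _ => by linarith [th_le_one w τ x']
    have l0 := TF.lip (S.tf1.mono (by norm_num)) (hM2 0 ⟨le_rfl, h0S⟩) x x'
    have lt := TF.lip (S.tf1.mono (by norm_num)) (hM2 t ht) x x'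
    have lA := TF.tint_lip tA1 ht hMA0 hMA x x'
    have lh := TF.tint_lip th1 ht hMh20 hMh2 x x'
    have lb := hKb t ht x x'
    set O := ∫ τ in (0:ℝ)..t, (1 - th w τ x)
    set O' := ∫ τ in (0:ℝ)..t, (1 - th w τ x')
    have key : ∀ a a' b b' c c' d d' f f' : ℂ, (a - b - e * (c + d) - f) - (a' - b' - e * (c' + d') - f')
      = (a - a') - (b - b') - e * ((c - c') + (d - d')) - (f - f') := fun a a' b b' c c' d d' f f' => by ring
    unfold Yx
    rw [key]
    refine (norm_sub_le _ _).trans ?_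
    refine (add_le_add_left ((norm_sub_le _ _).trans (add_le_add (norm_sub_le _ _) ?_)) _).trans
      ((add_le_add (add_le_add (add_le_add l0 lt) (le_refl (MA * S1 * |x - x'| + Kb * (|x - x'| + O + O')))) lh).trans ?_)
    · rw [norm_mul]
      exact (mul_le_of_le_one_left (norm_nonneg _) e1).trans ((norm_add_le _ _).trans (add_le_add lA lb))
    · have hx0 := abs_nonneg (x - x')
      have : 0 ≤ (MY + Mh1 * S1 + (M2 + M2 + MA * S1 + Mh2 * S1)) * (O + O') := by positivity
      have : 0 ≤ (MY + Mh1 * S1) * |x - x'| := by positivity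
      nlinarith

end

/-! ### Part P6d -/

noncomputable section

open MeasureTheory Filter
open scoped ENNReal Topology

variable {s T α e : ℝ} {u0 : ℝ → ℂ} {w : ℝ → ℝ → ℂ}

/-- switching structure on a cell -/
def Sw (T : ℝ) (w : ℝ → ℝ → ℂ) (x0 x1 S1 b : ℝ) : Prop := b ∈ Set.Icc 0 S1 ∧ ∀ z ∈ Set.Ioo x0 x1, z ∈ GG T w → ∀ t ∈ Set.Icc 0 S1,
      (t < b → th w t z = 1) ∧ (b < t → th w t z = 0)

theorem sw_int {x0 x1 S1 b z t : ℝ} (hb : Sw T w x0 x1 S1 b) (hz : z ∈ Set.Ioo x0 x1) (hG : z ∈ GG T w)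
    (ht : t ∈ Set.Icc 0 S1) {f : ℝ → ℂ} (hf : Continuous f) :
    ∫ τ in (0:ℝ)..t, (th w τ z : ℂ) * f τ = ∫ τ in (0:ℝ)..min t b, f τ := by
  have h0 : 0 ≤ min t b := le_min ht.1 hb.1.1
  have e1 : ∫ τ in (0:ℝ)..min t b, (th w τ z : ℂ) * f τ = ∫ τ in (0:ℝ)..min t b, f τ :=
    ii_congr_Ioo h0 fun τ hτ => by
      rw [(hb.2 z hz hG τ ⟨hτ.1.le, (hτ.2.le.trans (min_le_left _ _)).trans ht.2⟩).1 (hτ.2.trans_le (min_le_right _ _))]; simp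
  have e2 : ∫ τ in (min t b)..t, (th w τ z : ℂ) * f τ = ∫ τ in (min t b)..t, (fun _ => (0:ℂ)) τ :=
    ii_congr_Ioo (min_le_left _ _) fun τ hτ => by
      have hbt : b < τ := by
        rcases min_lt_iff.1 hτ.1 with h | h
        · exact absurd h (not_lt.2 hτ.2.le)
        · exact h
      rw [(hb.2 z hz hG τ ⟨h0.trans hτ.1.le, hτ.2.le.trans ht.2⟩).2 hbt]; simp
  have i2 : IntervalIntegrable (fun τ => (th w τ z : ℂ) * f τ) volume (min t b) t := by
    rw [intervalIntegrable_iff_integrableOn_Ioo_of_le (min_le_left _ _)]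
    refine (integrableOn_zero).congr_fun (fun τ hτ => ?_) measurableSet_Ioo
    have hbt : b < τ := by
      rcases min_lt_iff.1 hτ.1 with h | h
      · exact absurd h (not_lt.2 hτ.2.le)
      · exact h
    simp [(hb.2 z hz hG τ ⟨h0.trans hτ.1.le, hτ.2.le.trans ht.2⟩).2 hbt]
  have i1 : IntervalIntegrable (fun τ => (th w τ z : ℂ) * f τ) volume 0 (min t b) := by
    rw [intervalIntegrable_iff_integrableOn_Ioo_of_le h0]
    refine ((hf.intervalIntegrable 0 (min t b)).1.mono_set Set.Ioo_subset_Ioc_self).congr_fun (fun τ hτ => ?_) measurableSet_Ioo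
    simp [(hb.2 z hz hG τ ⟨hτ.1.le, (hτ.2.le.trans (min_le_left _ _)).trans ht.2⟩).1 (hτ.2.trans_le (min_le_right _ _))]
  rw [← intervalIntegral.integral_add_adjacent_intervals i1 i2, e1, e2]; simp

theorem Sol.formula (S : Sol s T α e u0 w) {x0 x1 S1 b : ℝ} (hS1 : S1 ∈ Set.Icc 0 T) (hb : Sw T w x0 x1 S1 b)
    {t : ℝ} (ht : t ∈ Set.Icc 0 S1) {y : ℝ} (hy : y ∈ Set.Ioo x0 x1) :
    Yy α e w t y = ∫ τ in (0:ℝ)..min t b, IF (hq w τ) y := by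
  have hG : Dense (GG T w) := Measure.dense_of_ae S.GG_ae
  have th0 := S.tfh.mono (by norm_num : (0:ℝ) ≤ 2)
  have key : ∀ z ∈ GG T w, z ∈ Set.Ioo x0 x1 → Yy α e w t z = ∫ τ in (0:ℝ)..min t b, IF (hq w τ) z := fun z hz hzI => by
    have h1 := S.dd_eq ⟨ht.1, ht.2.trans hS1.2⟩ z
    rw [hz t ⟨ht.1, ht.2.trans hS1.2⟩, sw_int hb hzI hz ht (th0.tcont z)] at h1
    exact (sub_eq_zero.1 h1.symm)
  have hle : ‖Yy α e w t y - ∫ τ in (0:ℝ)..min t b, IF (hq w τ) y‖ ≤ 0 :=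
    dense_le hG isOpen_Ioo (f := fun y => ‖Yy α e w t y - ∫ τ in (0:ℝ)..min t b, IF (hq w τ) y‖) (g := fun _ => 0)
      (S.Yy_xcont.sub (th0.tint_cont _)).norm.continuousOn continuousOn_const (fun z hz hzI => by
        simp [key z hz hzI]) hy
  exact sub_eq_zero.1 (norm_le_zero_iff.1 hle)

def Gn (α : ℝ) (w : ℝ → ℝ → ℂ) (τ x : ℝ) : ℝ≥0∞ := ∫⁻ ζ, ‖IF (dx (ah w) τ) ζ‖ₑ ^ 2 * ENNReal.ofReal (gg α (x - ζ))

def Dn (α : ℝ) (w : ℝ → ℝ → ℂ) (τ x : ℝ) : ℝ≥0∞ :=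
  (‖IF (dx (hq w) τ) x‖ₑ + ‖IF (dx (Aq α w) τ) x‖ₑ) + (‖IF (dx (ah w) τ) x‖ₑ ^ 2 + Gn α w τ x)

theorem DD_enorm_le (t x : ℝ) : ‖DD w t x‖ₑ ≤ ‖IF (dx (ah w) t) x‖ₑ ^ 2 := by
  have := norm_th_mul_le w t x (IF (dx (ah w) t) x ^ 2)
  unfold DD
  rw [← enorm_pow]
  exact enorm_le_iff_norm_le.2 this

theorem Sol.Gc_enorm_le (S : Sol s T α e u0 w) (t x : ℝ) : ‖Gc α w t x‖ₑ ≤ Gn α w t x := by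
  refine (enorm_cv_le _ _ _).trans (lintegral_mono fun ζ => ?_)
  refine mul_le_mul' (DD_enorm_le t ζ) ?_
  rw [← ofReal_norm, Complex.norm_real, Real.norm_eq_abs, abs_of_nonneg (gg_nonneg S.hα _)]

theorem Sol.F_le (S : Sol s T α e u0 w) {S1 r t : ℝ} (hr : r ∈ Set.Icc 0 S1) (ht : t ∈ Set.Icc 0 S1) (x : ℝ) :
    ‖(∫ τ in (0:ℝ)..r, IF (dx (hq w) τ) x) + e * ((∫ τ in (0:ℝ)..t, IF (dx (Aq α w) τ) x) + bx α w t x)‖ₑ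
      ≤ ∫⁻ τ in Set.Ioc 0 S1, Dn α w τ x := by
  have e1 : ‖(e:ℂ)‖ₑ ≤ 1 := by rcases S.he with h | h <;> simp [h]
  have hi : ∀ r ∈ Set.Icc 0 S1, ∀ f : ℝ → ℂ, ‖∫ τ in (0:ℝ)..r, f τ‖ₑ ≤ ∫⁻ τ in Set.Ioc 0 S1, ‖f τ‖ₑ := fun r hr f => by
    rw [intervalIntegral.integral_of_le hr.1]
    exact (enorm_integral_le_lintegral_enorm _).trans (lintegral_mono_set (Set.Ioc_subset_Ioc_right hr.2))
  have m1 : Measurable (fun τ => ‖IF (dx (hq w) τ) x‖ₑ) := by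
    have : TF 0 (dx (hq w)) := TF.mono (m := 1) (by norm_num) (TF.dx (by norm_num; exact S.tfh))
    exact (this.tcont x).measurable.enorm
  have m2 : Measurable (fun τ => ‖IF (dx (Aq α w) τ) x‖ₑ) := by
    have : TF 0 (dx (Aq α w)) := TF.mono (m := 1) (by norm_num) (TF.dx (by norm_num; exact S.tfA))
    exact (this.tcont x).measurable.enorm
  have m3 : Measurable (fun τ => ‖IF (dx (hq w) τ) x‖ₑ + ‖IF (dx (Aq α w) τ) x‖ₑ) := m1.add m2
  unfold Dn
  rw [lintegral_add_left m3, lintegral_add_left m1, add_assoc]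
  refine (enorm_add_le _ _).trans (add_le_add (hi r hr _) ?_)
  rw [enorm_mul]
  refine (mul_le_of_le_one_left zero_le e1).trans ((enorm_add_le _ _).trans (add_le_add (hi t ht _) ?_))
  refine (hi t ht _).trans (lintegral_mono fun τ => ?_)
  rw [enorm_mul]
  refine (mul_le_of_le_one_left zero_le ?_).trans ?_
  · rw [← ofReal_norm]; norm_num
  · rw [sub_eq_add_neg, add_comm]
    refine (enorm_add_le _ _).trans (add_le_add ?_ (S.Gc_enorm_le _ _))
    rw [enorm_neg]; exact DD_enorm_le _ _

theorem Sol.W1_diff_le (S : Sol s T α e u0 w) {x0 x1 S1 b B : ℝ} (hS1 : S1 ∈ Set.Icc 0 T) (hb : Sw T w x0 x1 S1 b)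
    (hB0 : 0 ≤ B) (hB : ∀ x ∈ Set.Ioo x0 x1, ∫⁻ τ in Set.Ioc 0 S1, Dn α w τ x ≤ ENNReal.ofReal B)
    {t : ℝ} (ht : t ∈ Set.Icc 0 S1) {y : ℝ} (hy : y ∈ Set.Ioo x0 x1) :
    ‖IF (dx (ah w) t) y - IF (dx (ah w) 0) y‖ ≤ B := by
  refine ((S.hW1 t y).sub (S.hW1 0 y)).le_of_lip' hB0 ?_
  filter_upwards [Ioo_mem_nhds hy.1 hy.2] with z hz
  have hr : min t b ∈ Set.Icc 0 S1 := ⟨le_min ht.1 hb.1.1, (min_le_left _ _).trans ht.2⟩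
  have f1 := S.formula hS1 hb ht hz
  have f2 := S.formula hS1 hb ht hy
  have d1 := (S.tfh.mono (by norm_num : (1:ℝ) ≤ 2)).time_ftc (min t b) z y
  have d2 := (S.tfA.mono (by norm_num : (1:ℝ) ≤ 2)).time_ftc t z y
  have d3 := S.bt_diff t z y
  have th10 : TF 0 (dx (hq w)) := TF.mono (m := 1) (by norm_num) (TF.dx (by norm_num; exact S.tfh))
  have tA10 : TF 0 (dx (Aq α w)) := TF.mono (m := 1) (by norm_num) (TF.dx (by norm_num; exact S.tfA))
  have i1 := (th10.tint_cont (min t b)).intervalIntegrable (μ := volume) y z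
  have i2 := (tA10.tint_cont t).intervalIntegrable (μ := volume) y z
  have i3 := S.bx_ii t y z
  have d4 : ∫ x in y..z, ((∫ τ in (0:ℝ)..min t b, IF (dx (hq w) τ) x) + e * ((∫ τ in (0:ℝ)..t, IF (dx (Aq α w) τ) x) + bx α w t x))
     = -((IF (ah w t) z - IF (ah w 0) z) - (IF (ah w t) y - IF (ah w 0) y)) := by
    rw [intervalIntegral.integral_add i1 ((i2.add i3).const_mul _), intervalIntegral.integral_const_mul,
      intervalIntegral.integral_add i2 i3, ← d3]
    unfold dx
    rw [← d1, ← d2, ← f1, ← f2]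
    unfold Yy; ring
  have d5 : ‖∫ x in y..z, ((∫ τ in (0:ℝ)..min t b, IF (dx (hq w) τ) x) + e * ((∫ τ in (0:ℝ)..t, IF (dx (Aq α w) τ) x) + bx α w t x))‖
     ≤ B * |z - y| := by
    refine intervalIntegral.norm_integral_le_of_norm_le_const fun x hx => ?_
    have hxI : x ∈ Set.Ioo x0 x1 := Set.OrdConnected.uIcc_subset Set.ordConnected_Ioo hy hz (Set.uIoc_subset_uIcc hx)
    have := (S.F_le hr ht x).trans (hB x hxI)
    rw [← ofReal_norm] at this
    exact (ENNReal.ofReal_le_ofReal_iff hB0).1 this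
  rw [d4, norm_neg] at d5
  simpa using d5

theorem Sol.bootstrap (S : Sol s T α e u0 w) {x0 x1 T0 κ δ B : ℝ} (hT0 : T0 ∈ Set.Icc 0 T) (hx : x0 < x1) (hκ : 0 < κ)
    (hB0 : 0 ≤ B) (hBδ : B < δ) (hB : ∀ x ∈ Set.Ioo x0 x1, ∫⁻ τ in Set.Ioc 0 T0, Dn α w τ x ≤ ENNReal.ofReal B)
    (hk : ∀ t ∈ Set.Icc 0 T0, ∀ y ∈ Set.Ioo x0 x1, ‖IF (dx (ah w) t) y - IF (dx (ah w) 0) y‖ ≤ δ → κ ≤ -(IF (hq w t) y).re) :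
    ∃ b, Sw T w x0 x1 T0 b := by
  set P : Set ℝ := {t | ∀ τ ∈ Set.Icc 0 T0, ∀ y ∈ Set.Ioo x0 x1, ‖IF (dx (ah w) (min τ t)) y - IF (dx (ah w) 0) y‖ ≤ δ} with hP
  have tc := fun y => (S.tf1.mono (by norm_num : (0:ℝ) ≤ 2)).tcont y
  have hsub : Set.Icc 0 T0 ⊆ P := by
    refine IsClosed.Icc_subset_of_forall_exists_gt ?_ ?_ ?_
    · refine IsClosed.inter ?_ isClosed_Icc
      simp only [hP, Set.ofPred_forall]
      refine isClosed_iInter fun τ => isClosed_iInter fun _ => isClosed_iInter fun y => isClosed_iInter fun _ => ?_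
      refine isClosed_le (Continuous.norm (Continuous.sub ?_ continuous_const)) continuous_const
      exact (tc y).comp (by fun_prop)
    · intro τ hτ y hy
      rw [min_eq_right hτ.1]; simp; linarith
    · rintro t ⟨htP, ht⟩ y hy
      have ht1 : t ∈ Set.Icc 0 T := ⟨ht.1, ht.2.le.trans hT0.2⟩
      have hW : ∀ τ ∈ Set.Icc 0 t, ∀ y ∈ Set.Ioo x0 x1, ‖IF (dx (ah w) τ) y - IF (dx (ah w) 0) y‖ ≤ δ := fun τ hτ y hy => by
        have := htP τ ⟨hτ.1, hτ.2.trans ht.2.le⟩ y hy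
        rwa [min_eq_left hτ.2] at this
      obtain ⟨b, hb, hbb⟩ := S.rigid ht1 hκ hx fun τ hτ z hz => hk τ ⟨hτ.1, hτ.2.trans ht.2.le⟩ z hz (hW τ hτ z hz)
      have hWB := fun y hy => S.W1_diff_le ht1 ⟨hb, hbb⟩ hB0 (fun x hx => (lintegral_mono_set (Set.Ioc_subset_Ioc_right ht.2.le)).trans (hB x hx))
        (t := t) ⟨ht.1, le_rfl⟩ (y := y) hy
      have hd := (S.tf1.mono (by norm_num : (0:ℝ) ≤ 2)).dist t (sub_pos.2 hBδ)
      obtain ⟨ρ, hρ, hball⟩ := Metric.eventually_nhds_iff.1 hd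
      refine ⟨min (t + ρ / 2) y, ?_, lt_min (by linarith) hy, min_le_right _ _⟩
      intro τ hτ z hz
      rcases le_total τ t with h | h
      · rw [min_eq_left (h.trans (le_min (by linarith) (le_of_lt hy)))]
        exact hW τ ⟨hτ.1, h⟩ z hz
      · have hd2 : dist (min τ (min (t + ρ / 2) y)) t < ρ := by
          rw [Real.dist_eq, abs_lt]
          constructor
          · have : t ≤ min τ (min (t + ρ / 2) y) := le_min h (le_min (by linarith) (le_of_lt hy))
            linarith
          · have : min τ (min (t + ρ / 2) y) ≤ t + ρ / 2 := (min_le_right _ _).trans (min_le_left _ _)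
            linarith
        have h1 := hball hd2 z
        have h2 := hWB z hz
        calc _ = ‖(IF (dx (ah w) (min τ (min (t + ρ / 2) y))) z - IF (dx (ah w) t) z) + (IF (dx (ah w) t) z - IF (dx (ah w) 0) z)‖ := by
              congr 1; ring
          _ ≤ _ := (norm_add_le _ _).trans (by linarith)
  obtain ⟨b, hb, hbb⟩ := S.rigid hT0 hκ hx fun τ hτ z hz => hk τ hτ z hz (by
    have := hsub ⟨hT0.1, le_rfl⟩ τ hτ z hz
    rwa [min_eq_left hτ.2] at this)
  exact ⟨b, hb, hbb⟩

end

/-! ### Part P7 -/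

noncomputable section

open MeasureTheory Filter
open scoped ENNReal Topology ContDiff


def Lap (f : ℝ → ℂ) (l : ℂ) : ℂ := ∫ z : ℝ, f z * Complex.exp (l * z)

structure VV (f : ℝ → ℂ) : Prop where
  smooth : ContDiff ℝ ∞ f
  supp : tsupport f ⊆ Set.Icc (-(1/4)) (1/4)

theorem VV.compact {f : ℝ → ℂ} (h : VV f) : HasCompactSupport f :=
  isCompact_Icc.of_isClosed_subset (isClosed_tsupport f) h.supp

theorem VV.deriv {f : ℝ → ℂ} (h : VV f) : VV (deriv f) :=
  ⟨((contDiff_infty_iff_deriv (𝕜 := ℝ)).1 h.smooth).2, (closure_minimal support_deriv_subset (isClosed_tsupport f)).trans h.supp⟩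

def op (a b : ℝ) (f : ℝ → ℂ) : ℝ → ℂ := fun z => a * deriv f z + b * f z

theorem VV.lin {f g : ℝ → ℂ} (hf : VV f) (hg : VV g) (a b : ℂ) : VV (fun z => a * f z + b * g z) := by
  refine ⟨(contDiff_const.mul hf.smooth).add (contDiff_const.mul hg.smooth), ?_⟩
  refine closure_minimal (fun z hz => ?_) isClosed_Icc
  by_contra hn
  have h1 : f z = 0 := image_eq_zero_of_notMem_tsupport fun h => hn (hf.supp h)
  have h2 : g z = 0 := image_eq_zero_of_notMem_tsupport fun h => hn (hg.supp h)
  simp [h1, h2] at hz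

theorem VV.op {f : ℝ → ℂ} (h : VV f) (a b : ℝ) : VV (op a b f) := h.deriv.lin h a b

theorem VV.iter {f : ℝ → ℂ} (h : VV f) (a b : ℝ) (m : ℕ) : VV ((_root_.op a b)^[m] f) := by
  induction m with
  | zero => exact h
  | succ m ih => rw [Function.iterate_succ_apply']; exact ih.op a b

def ex (a : ℝ) (f : ℝ → ℂ) : ℝ → ℂ := fun z => Complex.exp (a * z) * f z

theorem VV.ex {f : ℝ → ℂ} (h : VV f) (a : ℝ) : VV (ex a f) := by
  refine ⟨?_, ?_⟩
  · refine ContDiff.mul ?_ h.smooth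
    exact (contDiff_const.mul Complex.ofRealCLM.contDiff).cexp
  · exact (closure_mono (fun z hz => by
      simp only [Function.mem_support, _root_.ex, ne_eq, mul_eq_zero, not_or] at hz ⊢; exact hz.2)).trans h.supp

theorem VV.mul_int {f : ℝ → ℂ} (h : VV f) {g : ℝ → ℂ} (hg : Continuous g) : Integrable (fun z => f z * g z) :=
  (h.smooth.continuous.mul hg).integrable_of_hasCompactSupport h.compact.mul_right

theorem VV.integrable {f : ℝ → ℂ} (h : VV f) : Integrable f := h.smooth.continuous.integrable_of_hasCompactSupport h.compact

theorem VV.hd {f : ℝ → ℂ} (h : VV f) (z : ℝ) : HasDerivAt f (_root_.deriv f z) z :=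
  (h.smooth.differentiable (by simp)).differentiableAt.hasDerivAt

theorem hd_exp (l : ℂ) (z : ℝ) : HasDerivAt (fun z : ℝ => Complex.exp (l * z)) (l * Complex.exp (l * z)) z := by
  have h1 : HasDerivAt (fun z : ℝ => l * (z:ℂ)) (l * 1) z := (HasDerivAt.ofReal_comp (hasDerivAt_id z)).const_mul l
  have := h1.cexp
  convert this using 1; ring

theorem cont_exp (l : ℂ) : Continuous (fun z : ℝ => Complex.exp (l * z)) := by fun_prop

theorem Lap_deriv {f : ℝ → ℂ} (h : VV f) (l : ℂ) : Lap (deriv f) l = -l * Lap f l := by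
  have h0 : ∫ z : ℝ, (deriv f z * Complex.exp (l * z) + f z * (l * Complex.exp (l * z))) = 0 :=
    integral_eq_zero_of_hasDerivAt_of_integrable (f := fun z => f z * Complex.exp (l * z))
      (fun z => (h.hd z).mul (hd_exp l z)) ((h.deriv.mul_int (cont_exp l)).add (h.mul_int (continuous_const.mul (cont_exp l))))
      (h.mul_int (cont_exp l))
  have i1 : Integrable (fun z : ℝ => deriv f z * Complex.exp (l * z)) := h.deriv.mul_int (cont_exp l)
  have i2 : Integrable (fun z : ℝ => f z * (l * Complex.exp (l * z))) := h.mul_int (continuous_const.mul (cont_exp l))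
  rw [integral_add i1 i2] at h0
  unfold Lap
  have : ∫ z : ℝ, f z * (l * Complex.exp (l * z)) = l * ∫ z : ℝ, f z * Complex.exp (l * z) := by
    rw [← integral_const_mul]; congr 1; funext z; ring
  rw [this] at h0
  linear_combination h0

theorem Lap_op {f : ℝ → ℂ} (h : VV f) (a b : ℝ) (l : ℂ) : Lap (op a b f) l = (b - a * l) * Lap f l := by
  have : Lap (op a b f) l = a * Lap (deriv f) l + b * Lap f l := by
    unfold Lap op
    rw [← integral_const_mul, ← integral_const_mul, ← integral_add ((h.deriv.mul_int (cont_exp l)).const_mul _) ((h.mul_int (cont_exp l)).const_mul _)]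
    congr 1; funext z; ring
  rw [this, Lap_deriv h]; ring

theorem Lap_iter {f : ℝ → ℂ} (h : VV f) (a b : ℝ) (l : ℂ) (m : ℕ) : Lap ((op a b)^[m] f) l = (b - a * l) ^ m * Lap f l := by
  induction m with
  | zero => simp
  | succ m ih => rw [Function.iterate_succ_apply', Lap_op (h.iter a b m), ih]; ring

theorem Lap_ex (f : ℝ → ℂ) (a : ℝ) (l : ℂ) : Lap (ex a f) l = Lap f (a + l) := by
  unfold Lap ex; congr 1; funext z
  rw [add_mul, Complex.exp_add]; ring

theorem fourierT_Lap (f : ℝ → ℂ) (ξ : ℝ) : fourierT f ξ = Lap f (-(Complex.I * ξ)) := by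
  unfold fourierT Lap; congr 1; funext z; congr 2; ring

def VM (m : ℕ) (H : ℝ → ℂ) : Prop := VV H ∧ ∃ E, VV E ∧ ∀ ξ : ℝ, ‖fourierT H ξ‖ = |ξ| ^ m * ‖fourierT E ξ‖

structure TT (m : ℕ) (H : ℝ → ℂ) : Prop where
  h0 : VM m H
  hp : VM m (ex 1 H)
  hm : VM m (ex (-1) H)

theorem TT.deriv {m : ℕ} {H : ℝ → ℂ} (h : TT m H) : TT m (deriv H) := by
  have hV := h.h0.1
  refine ⟨⟨hV.deriv, ?_⟩, ⟨hV.deriv.ex 1, ?_⟩, ⟨hV.deriv.ex (-1), ?_⟩⟩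
  · obtain ⟨E, hE, he⟩ := h.h0.2
    refine ⟨_, hE.deriv, fun ξ => ?_⟩
    have := he ξ
    rw [fourierT_Lap, fourierT_Lap] at this ⊢
    rw [Lap_deriv hV, Lap_deriv hE, norm_mul, norm_mul, this]; ring
  · obtain ⟨E, hE, he⟩ := h.hp.2
    refine ⟨_, hE.op 1 (-1), fun ξ => ?_⟩
    have := he ξ
    rw [fourierT_Lap, fourierT_Lap, Lap_ex] at this ⊢
    rw [Lap_deriv hV, Lap_op hE, norm_mul, norm_mul, this, show -(((1:ℝ):ℂ) + -(Complex.I * ξ)) = (((-1:ℝ):ℂ) - ((1:ℝ):ℂ) * -(Complex.I * ξ)) by push_cast; ring]; ring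
  · obtain ⟨E, hE, he⟩ := h.hm.2
    refine ⟨_, hE.op 1 1, fun ξ => ?_⟩
    have := he ξ
    rw [fourierT_Lap, fourierT_Lap, Lap_ex] at this ⊢
    rw [Lap_deriv hV, Lap_op hE, norm_mul, norm_mul, this, show -(((-1:ℝ):ℂ) + -(Complex.I * ξ)) = (((1:ℝ):ℂ) - ((1:ℝ):ℂ) * -(Complex.I * ξ)) by push_cast; ring]; ring

def Th (m : ℕ) (η : ℝ → ℂ) : ℝ → ℂ := (op 1 0)^[m] ((op 1 1)^[m] ((op (-1) 1)^[m] η))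

theorem Lap_Th {η : ℝ → ℂ} (h : VV η) (m : ℕ) (l : ℂ) : Lap (Th m η) l = ((-l) * (1 - l) * (1 + l)) ^ m * Lap η l := by
  unfold Th
  rw [Lap_iter ((h.iter _ _ _).iter _ _ _), Lap_iter (h.iter _ _ _), Lap_iter h, mul_pow, mul_pow]
  push_cast; ring

theorem VV_Th {η : ℝ → ℂ} (h : VV η) (m : ℕ) : VV (Th m η) := ((h.iter _ _ _).iter _ _ _).iter _ _ _

theorem TT_Th {η : ℝ → ℂ} (h : VV η) (m : ℕ) : TT m (Th m η) := by
  have hI : ∀ ξ : ℝ, ‖Complex.I * ξ‖ = |ξ| := fun ξ => by simp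
  refine ⟨⟨VV_Th h m, _, (h.iter 1 1 m).iter (-1) 1 m, fun ξ => ?_⟩, ⟨(VV_Th h m).ex 1, _, ((h.ex 1).iter 1 (-1) m).iter (-1) 2 m, fun ξ => ?_⟩,
    ⟨(VV_Th h m).ex (-1), _, ((h.ex (-1)).iter 1 1 m).iter 1 2 m, fun ξ => ?_⟩⟩
  · rw [fourierT_Lap, fourierT_Lap, Lap_Th h, Lap_iter (h.iter _ _ _), Lap_iter h, ← hI ξ, ← norm_pow, ← norm_mul]
    congr 1; rw [mul_pow, mul_pow]; push_cast; ring
  · rw [fourierT_Lap, fourierT_Lap, Lap_ex, Lap_Th h, Lap_iter ((h.ex _).iter _ _ _), Lap_iter (h.ex _), Lap_ex, ← hI ξ, ← norm_pow, ← norm_mul]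
    congr 1; rw [← mul_assoc, ← mul_assoc, ← mul_pow, ← mul_pow]; push_cast; ring
  · have hI' : |ξ| = ‖-(Complex.I * ξ)‖ := by rw [norm_neg, hI]
    rw [fourierT_Lap, fourierT_Lap, Lap_ex, Lap_Th h, Lap_iter ((h.ex _).iter _ _ _), Lap_iter (h.ex _), Lap_ex, hI', ← norm_pow, ← norm_mul]
    congr 1; rw [← mul_assoc, ← mul_assoc, ← mul_pow, ← mul_pow]; push_cast; ring

end

/-! ### Part P7b -/

noncomputable section

open MeasureTheory Filter
open scoped ENNReal Topology ContDiff


def cc (H : ℝ → ℂ) (N y : ℝ) (f : ℝ → ℂ) : ℂ := ∫ x : ℝ, f x * H (N * (x - y))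

structure Cells (N : ℝ) (J : Finset ℝ) : Prop where
  one : 1 ≤ N
  card : (J.card : ℝ) ≤ N
  sep : ∀ y ∈ J, ∀ y' ∈ J, y ≠ y' → 1 / N ≤ |y - y'|

def GS (H : ℝ → ℂ) (N : ℝ) (J : Finset ℝ) (ε : ℝ → ℂ) (x : ℝ) : ℂ := ∑ y ∈ J, ε y * H (N * (x - y))

theorem VV.zero {H : ℝ → ℂ} (h : VV H) {z : ℝ} (hz : 1/4 < |z|) : H z = 0 := by
  refine image_eq_zero_of_notMem_tsupport fun hh => ?_
  have := h.supp hh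
  rw [Set.mem_Icc] at this
  have := abs_le.2 this
  linarith

theorem integrable_scale {H : ℝ → ℂ} (h : Integrable H) {N : ℝ} (hN : 0 < N) (y : ℝ) :
    Integrable (fun x => H (N * (x - y))) :=
  ((h.comp_mul_left' hN.ne').comp_sub_right y)

theorem fourierT_scale (H : ℝ → ℂ) {N : ℝ} (hN : 0 < N) (y ξ : ℝ) :
    fourierT (fun x => H (N * (x - y))) ξ = ((N⁻¹ : ℝ) : ℂ) * Complex.exp (-(Complex.I * y * ξ)) * fourierT H (ξ / N) := by
  unfold fourierT
  have h1 := integral_sub_right_eq_self (μ := volume) (fun x : ℝ => H (N * x) * Complex.exp (-(Complex.I * (x + y) * ξ))) y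
  have h2 := Measure.integral_comp_mul_left (fun x : ℝ => H x * Complex.exp (-(Complex.I * (x / N + y) * ξ))) N
  have hNc : (N : ℂ) ≠ 0 := by exact_mod_cast hN.ne'
  calc (∫ x : ℝ, H (N * (x - y)) * Complex.exp (-(Complex.I * x * ξ)))
      = ∫ x : ℝ, H (N * (x - y)) * Complex.exp (-(Complex.I * (((x - y : ℝ) : ℂ) + y) * ξ)) := by
        congr 1; funext x; push_cast; simp
    _ = ∫ x : ℝ, H (N * x) * Complex.exp (-(Complex.I * (x + y) * ξ)) := h1
    _ = ∫ x : ℝ, H (N * x) * Complex.exp (-(Complex.I * (((N * x : ℝ) : ℂ) / N + y) * ξ)) := by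
        congr 1; funext x; push_cast; rw [mul_div_cancel_left₀ _ hNc]
    _ = _ := by
        rw [h2, abs_of_pos (inv_pos.2 hN), ← integral_const_mul, ← integral_smul]
        congr 1; funext x
        rw [Complex.real_smul, show -(Complex.I * ((x:ℂ) / N + y) * ξ) = -(Complex.I * y * ξ) + -(Complex.I * x * ((ξ / N : ℝ) : ℂ)) by
          push_cast; ring, Complex.exp_add]
        ring

theorem GS_int {H : ℝ → ℂ} (h : VV H) {N : ℝ} (hN : 0 < N) (J : Finset ℝ) (ε : ℝ → ℂ) : Integrable (GS H N J ε) := by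
  unfold GS
  exact integrable_finsetSum _ fun y _ => (integrable_scale h.integrable hN y).const_mul _

theorem GS_fourier {H : ℝ → ℂ} (h : VV H) {N : ℝ} (hN : 0 < N) (J : Finset ℝ) (ε : ℝ → ℂ) (ξ : ℝ) :
    fourierT (GS H N J ε) ξ = (((N⁻¹ : ℝ) : ℂ) * ∑ y ∈ J, ε y * Complex.exp (-(Complex.I * y * ξ))) * fourierT H (ξ / N) := by
  have : fourierT (GS H N J ε) ξ = ∑ y ∈ J, ε y * fourierT (fun x => H (N * (x - y))) ξ := by
    unfold fourierT GS
    simp_rw [Finset.sum_mul]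
    rw [integral_finsetSum]
    · refine Finset.sum_congr rfl fun y _ => ?_
      rw [← integral_const_mul]; congr 1; funext x; ring
    · intro y _
      exact fourierT_integrable ((integrable_scale h.integrable hN y).const_mul _) ξ
  rw [this]
  simp_rw [fourierT_scale H hN]
  rw [Finset.mul_sum, Finset.sum_mul]
  refine Finset.sum_congr rfl fun y _ => ?_
  ring

theorem GS_sq {H : ℝ → ℂ} (h : VV H) {N : ℝ} {J : Finset ℝ} (hJ : Cells N J) {ε : ℝ → ℂ} (hε : ∀ y, ‖ε y‖ₑ ≤ 1) (x : ℝ) :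
    ‖GS H N J ε x‖ₑ ^ 2 ≤ ∑ y ∈ J, ‖H (N * (x - y))‖ₑ ^ 2 := by
  have hN : 0 < N := by linarith [hJ.one]
  by_cases hx : ∃ y ∈ J, H (N * (x - y)) ≠ 0
  · obtain ⟨y, hy, hne⟩ := hx
    have h1 : |N * (x - y)| ≤ 1 / 4 := by
      by_contra hc; exact hne (h.zero (not_le.1 hc))
    have : GS H N J ε x = ε y * H (N * (x - y)) := by
      unfold GS
      refine Finset.sum_eq_single y (fun y' hy' hyy => ?_) (fun hh => absurd hy hh)
      rw [h.zero, mul_zero]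
      have h2 := hJ.sep y hy y' hy' hyy.symm
      rw [div_le_iff₀ hN] at h2
      rw [abs_mul, abs_of_pos hN] at h1 ⊢
      have h3 : |y - y'| ≤ |x - y| + |x - y'| := by
        rw [show y - y' = -(x - y) + (x - y') by ring]; exact (abs_add_le _ _).trans (by rw [abs_neg])
      nlinarith
    rw [this, enorm_mul, mul_pow]
    refine le_trans ?_ (Finset.single_le_sum (f := fun y => ‖H (N * (x - y))‖ₑ ^ 2) (fun _ _ => bot_le) hy)
    calc ‖ε y‖ₑ ^ 2 * ‖H (N * (x - y))‖ₑ ^ 2 ≤ 1 ^ 2 * ‖H (N * (x - y))‖ₑ ^ 2 := by gcongr; exact hε y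
      _ = _ := by simp
  · push Not at hx
    have : GS H N J ε x = 0 := Finset.sum_eq_zero fun y hy => by rw [hx y hy, mul_zero]
    simp [this]

theorem GS_L2 {H : ℝ → ℂ} (h : VV H) {N : ℝ} {J : Finset ℝ} (hJ : Cells N J) {ε : ℝ → ℂ} (hε : ∀ y, ‖ε y‖ₑ ≤ 1) :
    ∫⁻ x, ‖GS H N J ε x‖ₑ ^ 2 ≤ ∫⁻ z, ‖H z‖ₑ ^ 2 := by
  have hN : 0 < N := by linarith [hJ.one]
  have hm : Measurable fun z => ‖H z‖ₑ ^ 2 := (h.smooth.continuous.enorm.measurable.pow_const 2)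
  have hs : ∀ y : ℝ, ∫⁻ x, ‖H (N * (x - y))‖ₑ ^ 2 = ENNReal.ofReal N⁻¹ * ∫⁻ z, ‖H z‖ₑ ^ 2 := by
    intro y
    rw [lintegral_sub_right_eq_self (fun x => ‖H (N * x)‖ₑ ^ 2) y]
    have := lintegral_map (μ := volume) hm (measurable_const_mul N)
    rw [Real.map_volume_mul_left hN.ne', lintegral_smul_measure, abs_of_pos (inv_pos.2 hN)] at this
    exact this.symm
  refine (lintegral_mono fun x => GS_sq h hJ hε x).trans ?_
  have hmm : ∀ y ∈ J, AEMeasurable (fun x => ‖H (N * (x - y))‖ₑ ^ 2) := fun y _ =>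
    (h.smooth.continuous.comp (by fun_prop : Continuous fun x => N * (x - y))).enorm.measurable.pow_const 2 |>.aemeasurable
  rw [lintegral_finsetSum' _ hmm]
  simp_rw [hs]
  rw [Finset.sum_const, nsmul_eq_mul, ← mul_assoc]
  refine le_trans (mul_le_mul_left ?_ _) (one_mul _).le
  rw [← ENNReal.ofReal_natCast, ← ENNReal.ofReal_mul (by positivity), ← ENNReal.ofReal_one]
  refine ENNReal.ofReal_le_ofReal ?_
  rw [← div_eq_mul_inv]; exact (div_le_one hN).2 hJ.card

theorem VV.sq_fin {H : ℝ → ℂ} (h : VV H) : ∫⁻ z, ‖H z‖ₑ ^ 2 ≠ ⊤ := by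
  have : Integrable (fun z => H z * H z) := h.mul_int h.smooth.continuous
  have := this.2
  rw [hasFiniteIntegral_iff_enorm] at this
  simp_rw [enorm_mul, ← sq] at this
  exact this.ne

theorem wt_GS {σ N ξ a b : ℝ} {m : ℕ} (h0 : 0 ≤ σ) (hm : σ ≤ m) (hN : 1 ≤ N) (hb : 0 ≤ b) (hab : a = |ξ / N| ^ m * b) :
    (1 + ξ ^ 2) ^ (-σ) * a ^ 2 ≤ N ^ (-(2 * σ)) * (a ^ 2 + b ^ 2) := by
  have hN0 : 0 < N := by linarith
  have hNs : N ^ (-(2 * σ)) = (N ^ 2) ^ (-σ) := by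
    rw [← Real.rpow_natCast N 2, ← Real.rpow_mul hN0.le]; congr 1; push_cast; ring
  rw [hNs]
  rcases le_total N |ξ| with hc | hc
  · have h1 : N ^ 2 ≤ 1 + ξ ^ 2 := by nlinarith [sq_abs ξ, abs_nonneg ξ]
    have h2 : (1 + ξ ^ 2) ^ (-σ) ≤ (N ^ 2) ^ (-σ) := Real.rpow_le_rpow_of_nonpos (by positivity) h1 (by linarith)
    have h3 : 0 ≤ (N ^ 2) ^ (-σ) := by positivity
    nlinarith [sq_nonneg a, sq_nonneg b, mul_le_mul_of_nonneg_right h2 (sq_nonneg a), mul_nonneg h3 (sq_nonneg b)]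
  · have hz : |ξ / N| ≤ 1 := by rw [abs_div, abs_of_pos hN0]; exact (div_le_one hN0).2 hc
    have h1 : (|ξ / N| ^ m) ^ 2 ≤ ((ξ / N) ^ 2) ^ σ := by
      calc (|ξ / N| ^ m) ^ 2 = ((ξ / N) ^ 2) ^ (m : ℝ) := by
            rw [Real.rpow_natCast, ← sq_abs (ξ / N), ← pow_mul, ← pow_mul, mul_comm]
        _ ≤ ((ξ / N) ^ 2) ^ σ := by
            refine Real.rpow_le_rpow_of_exponent_ge_of_imp (by positivity) ?_ hm ?_
            · rw [← sq_abs]; exact pow_le_one₀ (abs_nonneg _) hz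
            · intro _ hσ
              have hσ' : (m : ℝ) = 0 := hσ
              linarith
    have h2 : ((ξ / N) ^ 2) ^ σ = (ξ ^ 2) ^ σ * (N ^ 2) ^ (-σ) := by
      rw [div_pow, Real.div_rpow (by positivity) (by positivity), Real.rpow_neg (by positivity), div_eq_mul_inv]
    have h3 : (1 + ξ ^ 2) ^ (-σ) * (ξ ^ 2) ^ σ ≤ 1 := by
      rw [Real.rpow_neg (by positivity), inv_mul_le_iff₀ (by positivity), mul_one]
      exact Real.rpow_le_rpow (by positivity) (by linarith) h0
    have h4 : 0 ≤ (N ^ 2) ^ (-σ) := by positivity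
    have h5 : 0 ≤ (1 + ξ ^ 2) ^ (-σ) := by positivity
    calc (1 + ξ ^ 2) ^ (-σ) * a ^ 2 = (1 + ξ ^ 2) ^ (-σ) * (|ξ / N| ^ m) ^ 2 * b ^ 2 := by rw [hab]; ring
      _ ≤ (1 + ξ ^ 2) ^ (-σ) * ((ξ ^ 2) ^ σ * (N ^ 2) ^ (-σ)) * b ^ 2 := by rw [← h2]; gcongr
      _ = ((1 + ξ ^ 2) ^ (-σ) * (ξ ^ 2) ^ σ) * ((N ^ 2) ^ (-σ) * b ^ 2) := by ring
      _ ≤ 1 * ((N ^ 2) ^ (-σ) * b ^ 2) := by gcongr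
      _ ≤ _ := by nlinarith [mul_nonneg h4 (sq_nonneg a)]

theorem cc_sum_eq {H : ℝ → ℂ} (h : VV H) {N : ℝ} (hN : 0 < N) (J : Finset ℝ) (ε : ℝ → ℂ) {f : ℝ → ℂ} (hf : Continuous f) :
    ∑ y ∈ J, ε y * cc H N y f = ∫ x, f x * GS H N J ε x := by
  unfold cc GS
  simp_rw [Finset.mul_sum]
  rw [integral_finsetSum]
  · refine Finset.sum_congr rfl fun y _ => ?_
    rw [← integral_const_mul]; congr 1; funext x; ring
  · intro y _
    have hc : Continuous fun x => H (N * (x - y)) := h.smooth.continuous.comp (by fun_prop)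
    refine Continuous.integrable_of_hasCompactSupport (hf.mul (continuous_const.mul hc)) ?_
    refine HasCompactSupport.mul_left (HasCompactSupport.mul_left ?_)
    refine HasCompactSupport.intro (K := Set.Icc (y - 1 / N) (y + 1 / N)) isCompact_Icc fun x hx => h.zero ?_
    by_contra hh
    refine hx ?_
    rw [abs_mul, abs_of_pos hN, not_lt] at hh
    have h1 : |x - y| ≤ 1 / N := by rw [le_div_iff₀ hN]; nlinarith [abs_nonneg (x - y)]
    have := abs_le.1 h1
    constructor <;> linarith

/-- Lemma T. -/
theorem lemT {m : ℕ} {H : ℝ → ℂ} (h : VM m H) : ∃ C : ℝ, 0 < C ∧ ∀ (N : ℝ) (J : Finset ℝ), Cells N J →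
    ∀ σ : ℝ, 0 ≤ σ → σ ≤ m → ∀ (q : ℝ → ℂ), Measurable q → Integrable q → ∀ A : ℝ, 0 ≤ A → N2 σ q ≤ ENNReal.ofReal (A ^ 2) →
    ∑ y ∈ J, ‖cc H N y (IF q)‖ ≤ C * A * N ^ (-σ) := by
  obtain ⟨hV, E, hE, he⟩ := h
  have hfin : ∫⁻ z, ‖H z‖ₑ ^ 2 + ‖E z‖ₑ ^ 2 ≠ ⊤ := by
    rw [lintegral_add_left (hV.smooth.continuous.enorm.measurable.pow_const 2)]
    exact ENNReal.add_ne_top.2 ⟨hV.sq_fin, hE.sq_fin⟩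
  set B : ℝ := (2 * Real.pi) * (∫⁻ z, ‖H z‖ₑ ^ 2 + ‖E z‖ₑ ^ 2).toReal with hB
  have hB0 : 0 ≤ B := by positivity
  refine ⟨B + 1, by positivity, fun N J hJ σ h0 hm q hq hqi A hA hN2 => ?_⟩
  have hN : 0 < N := by linarith [hJ.one]
  -- unimodular coefficients
  have hε : ∃ ε : ℝ → ℂ, (∀ y, ‖ε y‖ₑ ≤ 1) ∧ ∀ y, ε y * cc H N y (IF q) = ‖cc H N y (IF q)‖ := by
    refine ⟨fun y => (starRingEnd ℂ) (cc H N y (IF q)) / ‖cc H N y (IF q)‖, fun y => ?_, fun y => ?_⟩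
    · rw [← ofReal_norm, ← ENNReal.ofReal_one]
      refine ENNReal.ofReal_le_ofReal ?_
      rw [norm_div, RCLike.norm_conj, Complex.norm_real, norm_norm]
      exact div_self_le_one _
    · by_cases hz : cc H N y (IF q) = 0
      · simp [hz]
      · have : (‖cc H N y (IF q)‖ : ℂ) ≠ 0 := by exact_mod_cast norm_ne_zero_iff.2 hz
        rw [div_mul_eq_mul_div, mul_comm ((starRingEnd ℂ) _), Complex.mul_conj, div_eq_iff this, Complex.normSq_eq_norm_sq]
        push_cast; ring
  obtain ⟨ε, hε1, hε2⟩ := hε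
  have hS : ((∑ y ∈ J, ‖cc H N y (IF q)‖ : ℝ) : ℂ) = ∫ ξ, q ξ * fourierT (GS H N J ε) (-ξ) := by
    rw [← pairing hqi (GS_int hV hN J ε), ← cc_sum_eq hV hN J ε (continuous_IF hqi)]
    push_cast
    exact Finset.sum_congr rfl fun y _ => (hε2 y).symm
  set G := fourierT (GS H N J ε) with hG
  have hGc : Continuous G := continuous_fourierT (GS_int hV hN J ε)
  have hSn : ENNReal.ofReal (∑ y ∈ J, ‖cc H N y (IF q)‖) ≤ ∫⁻ ξ, (wt (σ/2) ξ * ‖q ξ‖ₑ) * (wt (-(σ/2)) ξ * ‖G (-ξ)‖ₑ) := by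
    have h1 : ENNReal.ofReal (∑ y ∈ J, ‖cc H N y (IF q)‖) = ‖∫ ξ, q ξ * G (-ξ)‖ₑ := by
      rw [← hS, ← ofReal_norm, Complex.norm_real, Real.norm_of_nonneg (Finset.sum_nonneg fun _ _ => norm_nonneg _)]
    rw [h1]
    refine (enorm_integral_le_lintegral_enorm _).trans (lintegral_mono fun ξ => ?_)
    rw [enorm_mul]
    calc ‖q ξ‖ₑ * ‖G (-ξ)‖ₑ = (wt (-(σ/2)) ξ * wt (σ/2) ξ) * (‖q ξ‖ₑ * ‖G (-ξ)‖ₑ) := by rw [wt_neg_mul, one_mul]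
      _ ≤ _ := le_of_eq (by ring)
  have hwm : ∀ τ : ℝ, Measurable (wt τ) := fun τ => by unfold wt; fun_prop
  have hCS := lintegral_CS (f := fun ξ => wt (σ/2) ξ * ‖q ξ‖ₑ) (g := fun ξ => wt (-(σ/2)) ξ * ‖G (-ξ)‖ₑ)
    ((hwm _).mul hq.enorm).aemeasurable ((hwm _).mul (hGc.comp continuous_neg).enorm.measurable).aemeasurable
  have e1 : ∫⁻ ξ, (wt (σ/2) ξ * ‖q ξ‖ₑ) ^ 2 ≤ ENNReal.ofReal (A ^ 2) := by
    refine le_trans (le_of_eq ?_) hN2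
    unfold N2; congr 1; funext ξ; rw [mul_pow, wt_half_sq]
  have e2 : ∫⁻ ξ, (wt (-(σ/2)) ξ * ‖G (-ξ)‖ₑ) ^ 2 ≤ ENNReal.ofReal (N ^ (-(2 * σ)) * B) := by
    have p : ∀ ξ, (wt (-(σ/2)) ξ * ‖G (-ξ)‖ₑ) ^ 2 ≤ ENNReal.ofReal (N ^ (-(2 * σ))) * (‖G (-ξ)‖ₑ ^ 2 + ‖fourierT (GS E N J ε) (-ξ)‖ₑ ^ 2) := by
      intro ξ
      rw [mul_pow, show -(σ/2) = (-σ)/2 by ring, wt_half_sq]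
      have hab : ‖G (-ξ)‖ = |(-ξ) / N| ^ m * ‖fourierT (GS E N J ε) (-ξ)‖ := by
        rw [hG, GS_fourier hV hN, GS_fourier hE hN, norm_mul _ (fourierT H _), norm_mul _ (fourierT E _), he]; ring
      have := wt_GS h0 hm hJ.one (norm_nonneg _) hab
      rw [neg_sq] at this
      have := ENNReal.ofReal_le_ofReal this
      rw [ENNReal.ofReal_mul (by positivity), ENNReal.ofReal_mul (by positivity), ENNReal.ofReal_add (by positivity) (by positivity),
        ENNReal.ofReal_pow (by positivity), ENNReal.ofReal_pow (by positivity), ofReal_norm, ofReal_norm] at this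
      exact this
    refine (lintegral_mono p).trans ?_
    rw [lintegral_const_mul' _ _ ENNReal.ofReal_ne_top, ENNReal.ofReal_mul (by positivity)]
    refine mul_le_mul_right ?_ _
    have hmG : Measurable fun ξ => ‖G (-ξ)‖ₑ ^ 2 := (hGc.comp continuous_neg).enorm.measurable.pow_const 2
    rw [lintegral_add_left hmG, lintegral_neg_eq_self (fun ξ => ‖G ξ‖ₑ ^ 2),
      lintegral_neg_eq_self (fun ξ => ‖fourierT (GS E N J ε) ξ‖ₑ ^ 2)]
    refine (add_le_add (plancherel (GS_int hV hN J ε)) (plancherel (GS_int hE hN J ε))).trans ?_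
    rw [← mul_add, hB, ENNReal.ofReal_mul (p := 2 * Real.pi) (by positivity), ENNReal.ofReal_toReal hfin,
      lintegral_add_left (hV.smooth.continuous.enorm.measurable.pow_const 2)]
    exact mul_le_mul_right (add_le_add (GS_L2 hV hJ hε1) (GS_L2 hE hJ hε1)) _
  have hfinal : ENNReal.ofReal ((∑ y ∈ J, ‖cc H N y (IF q)‖) ^ 2) ≤ ENNReal.ofReal (A ^ 2 * (N ^ (-(2 * σ)) * B)) := by
    rw [ENNReal.ofReal_pow (Finset.sum_nonneg fun _ _ => norm_nonneg _), ENNReal.ofReal_mul (by positivity)]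
    exact (pow_le_pow_left₀ bot_le hSn 2).trans (hCS.trans (mul_le_mul' e1 e2))
  have hfr := (ENNReal.ofReal_le_ofReal_iff (by positivity)).1 hfinal
  refine (fun hb hab => abs_le_of_sq_le_sq' hab hb |>.2) (by positivity) (hfr.trans ?_)
  have hNs : N ^ (-(2 * σ)) = (N ^ (-σ)) ^ 2 := by
    rw [← Real.rpow_natCast, ← Real.rpow_mul hN.le]; congr 1; push_cast; ring
  rw [hNs]
  have : B ≤ (B + 1) ^ 2 := by nlinarith
  calc A ^ 2 * ((N ^ (-σ)) ^ 2 * B) ≤ A ^ 2 * ((N ^ (-σ)) ^ 2 * (B + 1) ^ 2) := by gcongr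
    _ = _ := by ring

end

/-! ### Part P8 -/

noncomputable section

open MeasureTheory Filter
open scoped ENNReal Topology ContDiff


def om (s N : ℝ) : ℝ := N ^ (-1:ℝ) + N ^ (1 - s)
def rho (s N : ℝ) : ℝ := N ^ (-(min 1 ((s - 3/2)/2)))
def cq (w : ℝ → ℝ → ℂ) (t : ℝ) : ℝ → ℂ := cv (dx (ah w) t) (dx (ah w) t)
def mq (α : ℝ) (w : ℝ → ℝ → ℂ) (t : ℝ) (ξ : ℝ) : ℂ := m2 α ξ * cq w t ξ

structure SZ (s N K : ℝ) (w : ℝ → ℝ → ℂ) : Prop where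
  L0a : ∀ t, L1 0 (ah w t) ≤ ENNReal.ofReal (K / N)
  L1a : ∀ t, L1 0 (dx (ah w) t) ≤ ENNReal.ofReal (K * rho s N)
  Nsm : ∀ t, N2 (s - 1) (ah w t) ≤ ENNReal.ofReal ((K / N) ^ 2)
  Ns : ∀ t, N2 s (ah w t) ≤ ENNReal.ofReal (K ^ 2)
  dh0 : ∀ t, N2 0 (dx (hq w) t) ≤ ENNReal.ofReal ((K * om s N) ^ 2)
  dh1 : ∀ t, N2 1 (dx (hq w) t) ≤ ENNReal.ofReal ((K * (N * om s N)) ^ 2)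
  dA0 : ∀ t, N2 0 (dx (Aq (1/N) w) t) ≤ ENNReal.ofReal ((K * om s N) ^ 2)
  dA1 : ∀ t, N2 1 (dx (Aq (1/N) w) t) ≤ ENNReal.ofReal ((K * (N * om s N)) ^ 2)
  c0 : ∀ t, N2 0 (cq w t) ≤ ENNReal.ofReal ((K * om s N) ^ 2)
  c1 : ∀ t, N2 1 (cq w t) ≤ ENNReal.ofReal ((K * (N * om s N)) ^ 2)
  w1 : ∀ t, N2 0 (dx (ah w) t) ≤ ENNReal.ofReal ((K * om s N) ^ 2)
  h2 : ∀ t, N2 (s - 1) (hq w t) ≤ ENNReal.ofReal ((K / N) ^ 2)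
  h1 : ∀ t, L1 0 (hq w t) ≤ ENNReal.ofReal (K / N)
  A2 : ∀ t, N2 (s - 1) (Aq (1/N) w t) ≤ ENNReal.ofReal ((K / N) ^ 2)
  A1 : ∀ t, L1 0 (Aq (1/N) w t) ≤ ENNReal.ofReal (K / N)
  q2 : ∀ t, N2 (s - 1) (mq (1/N) w t) ≤ ENNReal.ofReal ((K * rho s N / N) ^ 2)
  q1 : ∀ t, L1 0 (mq (1/N) w t) ≤ ENNReal.ofReal (K / N)

theorem N2_cv' {σ : ℝ} (hσ : 0 ≤ σ) {a b : ℝ → ℂ} (ha : Measurable a) (hb : Measurable b) {A B A0 B0 : ℝ} (hA : 0 ≤ A) (hB : 0 ≤ B)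
    (hA0 : 0 ≤ A0) (hB0 : 0 ≤ B0) (h1 : N2 σ a ≤ ENNReal.ofReal (A ^ 2)) (h2 : N2 σ b ≤ ENNReal.ofReal (B ^ 2))
    (h3 : L1 0 a ≤ ENNReal.ofReal A0) (h4 : L1 0 b ≤ ENNReal.ofReal B0) :
    N2 σ (cv a b) ≤ ENNReal.ofReal (((2 * 4 ^ σ + 1) * (A * B0 + A0 * B)) ^ 2) := by
  refine (N2_cv σ hσ ha hb).trans ?_
  have h : ENNReal.ofReal (2 * 4 ^ σ) * (N2 σ a * L1 0 b ^ 2 + L1 0 a ^ 2 * N2 σ b) ≤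
      ENNReal.ofReal (2 * 4 ^ σ) * (ENNReal.ofReal (A ^ 2) * ENNReal.ofReal B0 ^ 2 + ENNReal.ofReal A0 ^ 2 * ENNReal.ofReal (B ^ 2)) := by gcongr
  refine h.trans ?_
  rw [← ENNReal.ofReal_pow hB0, ← ENNReal.ofReal_pow hA0, ← ENNReal.ofReal_mul (by positivity), ← ENNReal.ofReal_mul (by positivity),
    ← ENNReal.ofReal_add (by positivity) (by positivity), ← ENNReal.ofReal_mul (by positivity)]
  refine ENNReal.ofReal_le_ofReal ?_
  rw [mul_pow]
  have h5 : (0:ℝ) < 4 ^ σ := by positivity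
  have : A ^ 2 * B0 ^ 2 + A0 ^ 2 * B ^ 2 ≤ (A * B0 + A0 * B) ^ 2 := by nlinarith [mul_nonneg (mul_nonneg hA hB0) (mul_nonneg hA0 hB)]
  gcongr
  nlinarith

theorem N2_mult' {σ k c : ℝ} (hc : 0 ≤ c) {m q : ℝ → ℂ} (h : ∀ ξ, ‖m ξ‖ ≤ c * (1 + ξ ^ 2) ^ (k / 2)) {A : ℝ} 
    (h1 : N2 (σ + k) q ≤ ENNReal.ofReal (A ^ 2)) : N2 σ (fun ξ => m ξ * q ξ) ≤ ENNReal.ofReal ((c * A) ^ 2) := by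
  refine (N2_mult hc h).trans ?_
  rw [mul_pow, ENNReal.ofReal_mul (by positivity)]; gcongr

theorem L1_cv' {m : ℝ} (hm : 0 ≤ m) {a b : ℝ → ℂ} (ha : Measurable a) (hb : Measurable b) {A B A0 B0 : ℝ} (hA : 0 ≤ A) (hB : 0 ≤ B)
    (hA0 : 0 ≤ A0) (hB0 : 0 ≤ B0) (h1 : L1 m a ≤ ENNReal.ofReal A) (h2 : L1 m b ≤ ENNReal.ofReal B)
    (h3 : L1 0 a ≤ ENNReal.ofReal A0) (h4 : L1 0 b ≤ ENNReal.ofReal B0) :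
    L1 m (cv a b) ≤ ENNReal.ofReal (4 ^ (m / 2) * (A * B0 + A0 * B)) := by
  refine (L1_cv m hm ha hb).trans ?_
  rw [ENNReal.ofReal_mul (by positivity), ENNReal.ofReal_add (by positivity) (by positivity), ENNReal.ofReal_mul hA, ENNReal.ofReal_mul hA0]
  gcongr

theorem L1_mult' {σ k c : ℝ} (hc : 0 ≤ c) {m q : ℝ → ℂ} (h : ∀ ξ, ‖m ξ‖ ≤ c * (1 + ξ ^ 2) ^ (k / 2)) {A : ℝ} 
    (h1 : L1 (σ + k) q ≤ ENNReal.ofReal A) : L1 σ (fun ξ => m ξ * q ξ) ≤ ENNReal.ofReal (c * A) := by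
  refine (L1_mult hc h).trans ?_
  rw [ENNReal.ofReal_mul hc]; gcongr

theorem ofReal_sq_mono {a b : ℝ} (ha : 0 ≤ a) (h : a ≤ b) : ENNReal.ofReal (a ^ 2) ≤ ENNReal.ofReal (b ^ 2) :=
  ENNReal.ofReal_le_ofReal (by gcongr)

theorem L1_of_sq {x : ℝ≥0∞} {C A : ℝ} (hC : 0 ≤ C) (hA : 0 ≤ A) {y : ℝ≥0∞} (h : x ^ 2 ≤ ENNReal.ofReal C * y) (hy : y ≤ ENNReal.ofReal (A ^ 2)) :
    x ≤ ENNReal.ofReal (Real.sqrt C * A) := by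
  have : x ^ 2 ≤ ENNReal.ofReal (Real.sqrt C * A) ^ 2 := by
    rw [← ENNReal.ofReal_pow (by positivity), mul_pow, Real.sq_sqrt hC, ENNReal.ofReal_mul hC]
    exact h.trans (by gcongr)
  exact (ENNReal.pow_le_pow_left_iff (by norm_num)).1 this

theorem rho_facts {s N : ℝ} (hs : 3/2 < s) (hN : 1 ≤ N) : 0 < rho s N ∧ rho s N ≤ 1 ∧ N ^ (((s + 3/2)/2) - s) ≤ rho s N ∧ N ^ (-1:ℝ) ≤ rho s N := by
  unfold rho
  refine ⟨by positivity, Real.rpow_le_one_of_one_le_of_nonpos hN ?_, Real.rpow_le_rpow_of_exponent_le hN ?_, Real.rpow_le_rpow_of_exponent_le hN ?_⟩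
  · have : 0 ≤ min 1 ((s - 3/2)/2) := le_min (by norm_num) (by linarith)
    linarith
  · have := min_le_right (1:ℝ) ((s - 3/2)/2); linarith
  · have := min_le_left (1:ℝ) ((s - 3/2)/2); linarith

theorem om_facts {s N : ℝ} (hN : 1 ≤ N) : 0 < om s N ∧ (N ^ (2 - s) + N ^ (-1:ℝ)) / N ≤ om s N ∧
    (N ^ (3 - s) + N ^ (-1:ℝ)) / N ≤ N * om s N ∧ N ^ (2 - s) + N ^ (-1:ℝ) ≤ N * om s N := by
  have hN0 : 0 < N := by linarith
  have e1 : N ^ (2 - s) = N * N ^ (1 - s) := by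
    rw [show (2:ℝ) - s = 1 + (1 - s) by ring, Real.rpow_add hN0, Real.rpow_one]
  have e2 : N ^ (3 - s) = N * (N * N ^ (1 - s)) := by
    rw [← e1, show (3:ℝ) - s = 1 + (2 - s) by ring, Real.rpow_add hN0, Real.rpow_one]
  have e3 : N ^ (-1:ℝ) = N⁻¹ := Real.rpow_neg_one N
  have h1 : 0 < N ^ (1 - s) := by positivity
  have h2 : N⁻¹ ≤ 1 := inv_le_one_of_one_le₀ hN
  have h3 : 0 < N⁻¹ := by positivity
  have h4 : N * N⁻¹ = 1 := mul_inv_cancel₀ hN0.ne'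
  unfold om
  rw [e1, e2, e3]
  refine ⟨by positivity, ?_, ?_, ?_⟩
  · rw [div_le_iff₀ hN0]; nlinarith
  · rw [div_le_iff₀ hN0]; nlinarith
  · nlinarith

variable {s T α e : ℝ} {u0 : ℝ → ℂ} {w : ℝ → ℝ → ℂ}

theorem N2_all {s N K : ℝ} (hN : 1 ≤ N) (hK : 0 ≤ K) {a : ℝ → ℂ} (ha : Measurable a)
    (h1 : N2 (s - 1) a ≤ ENNReal.ofReal ((K / N) ^ 2)) (h2 : N2 (s + 2) a ≤ ENNReal.ofReal ((K * N ^ 2) ^ 2)) {γ : ℝ} (hγ : γ ≤ s + 2) :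
    N2 γ a ≤ ENNReal.ofReal ((2 * K * (N ^ (γ - s) + N ^ (-1:ℝ))) ^ 2) := by
  have hN0 : 0 < N := by linarith
  have e3 : N ^ (-1:ℝ) = N⁻¹ := Real.rpow_neg_one N
  rcases le_total γ (s - 1) with hc | hc
  · refine (N2_mono hc a).trans (h1.trans (ofReal_sq_mono (by positivity) ?_))
    rw [e3, div_eq_mul_inv]
    have : 0 < N ^ (γ - s) := by positivity
    have h3 : 0 < N⁻¹ := by positivity
    nlinarith [mul_nonneg hK this.le, mul_nonneg hK h3.le]
  · refine (N2_interp hc hγ (R := N ^ 2) (by positivity) a ha).trans ?_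
    have hp : ∀ x : ℝ, (N ^ 2) ^ x = N ^ (2 * x) := fun x => by
      rw [← Real.rpow_natCast N 2, ← Real.rpow_mul hN0.le]; norm_num
    have e4 : (N ^ 2) ^ (γ - (s - 1)) * (K / N) ^ 2 = (K * N ^ (γ - s)) ^ 2 := by
      rw [hp, show 2 * (γ - (s - 1)) = (γ - s) + (γ - s) + (2:ℕ) by push_cast; ring, Real.rpow_add hN0, Real.rpow_add hN0, Real.rpow_natCast]
      field_simp
    have e5 : (N ^ 2) ^ (γ - (s + 2)) * (K * N ^ 2) ^ 2 = (K * N ^ (γ - s)) ^ 2 := by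
      rw [hp, show 2 * (γ - (s + 2)) = (γ - s) + (γ - s) - (4:ℕ) by push_cast; ring, Real.rpow_sub hN0, Real.rpow_add hN0, Real.rpow_natCast]
      field_simp
    calc _ ≤ ENNReal.ofReal ((N ^ 2) ^ (γ - (s - 1))) * ENNReal.ofReal ((K / N) ^ 2) + ENNReal.ofReal ((N ^ 2) ^ (γ - (s + 2))) * ENNReal.ofReal ((K * N ^ 2) ^ 2) := by gcongr
      _ = ENNReal.ofReal ((K * N ^ (γ - s)) ^ 2 + (K * N ^ (γ - s)) ^ 2) := by
        rw [← ENNReal.ofReal_mul (by positivity), ← ENNReal.ofReal_mul (by positivity), e4, e5, ← ENNReal.ofReal_add (by positivity) (by positivity)]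
      _ ≤ _ := by
        refine ENNReal.ofReal_le_ofReal ?_
        have h6 : 0 ≤ K * N ^ (γ - s) := by positivity
        have h7 : 0 ≤ K * N ^ (-1:ℝ) := by positivity
        nlinarith [mul_nonneg h6 h7, sq_nonneg (K * N ^ (-1:ℝ))]

end

/-! ### Part P8b -/

noncomputable section

open MeasureTheory Filter
open scoped ENNReal Topology


theorem jp_two (ξ : ℝ) : (1 + ξ ^ 2) ^ ((2:ℝ) / 2) = 1 + ξ ^ 2 := by norm_num
theorem bd_h (ξ : ℝ) : ‖(3/2 : ℂ) * (Complex.I * ξ)‖ ≤ 3/2 * (1 + ξ ^ 2) ^ ((1:ℝ) / 2) := by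
  rw [norm_mul]; have := norm_iξ_le ξ; rw [one_mul] at this
  norm_num at this ⊢; exact this
theorem bd_dh (ξ : ℝ) : ‖Complex.I * ξ * ((3/2 : ℂ) * (Complex.I * ξ))‖ ≤ 3/2 * (1 + ξ ^ 2) ^ ((2:ℝ) / 2) := by
  rw [jp_two]; simp only [norm_mul, Complex.norm_I, Complex.norm_real, Real.norm_eq_abs]
  have : ‖(3/2:ℂ)‖ = 3/2 := by norm_num
  rw [this]; nlinarith [sq_abs ξ, abs_nonneg ξ]
theorem bd_A (α ξ : ℝ) : ‖m1 α ξ‖ ≤ 1 * (1 + ξ ^ 2) ^ ((1:ℝ) / 2) := by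
  rw [one_mul]; exact (m1_norm_le α ξ).trans (abs_le_jp ξ)
theorem bd_dA (α ξ : ℝ) : ‖Complex.I * ξ * m1 α ξ‖ ≤ 1 * (1 + ξ ^ 2) ^ ((2:ℝ) / 2) := by
  rw [jp_two, norm_mul]; simp only [norm_mul, Complex.norm_I, Complex.norm_real, Real.norm_eq_abs]
  have := m1_norm_le α ξ
  nlinarith [sq_abs ξ, abs_nonneg ξ, mul_le_mul_of_nonneg_left this (abs_nonneg ξ)]
theorem bd_m2 {α : ℝ} (hα : 0 < α) (ξ : ℝ) : ‖m2 α ξ‖ ≤ α * (1 + ξ ^ 2) ^ ((0:ℝ) / 2) := by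
  have h := m2_norm_le hα ξ
  rw [zero_div, Real.rpow_zero, mul_one]; exact h

theorem SZ_of {s : ℝ} (hs : 3/2 < s) {K : ℝ} (hK : 0 < K) : ∃ K' : ℝ, 0 < K' ∧ ∀ (N T e : ℝ) (u0 : ℝ → ℂ) (w : ℝ → ℝ → ℂ), 1 ≤ N →
    Sol s T (1/N) e u0 w → (∀ t, N2 (s - 1) (ah w t) ≤ ENNReal.ofReal ((K / N) ^ 2)) →
    (∀ t, N2 (s + 2) (ah w t) ≤ ENNReal.ofReal ((K * N ^ 2) ^ 2)) → SZ s N K' w := by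
  obtain ⟨C0, hC0, L0⟩ := L1_le_N2 (m := 0) (γ := s - 1) (by linarith)
  obtain ⟨C1, hC1, L1'⟩ := L1_le_N2 (m := 1) (γ := (s + 3/2)/2) (by linarith)
  set M := 2 * K with hM
  set k0 := Real.sqrt C0 * K with hk0
  set k1 := Real.sqrt C1 * (M * 2) with hk1
  have pM : 0 < M := by positivity
  have pk0 : 0 < k0 := by positivity
  have pk1 : 0 < k1 := by positivity
  set D : ℝ → ℝ := fun σ => 2 * 4 ^ σ + 1 with hD
  have pD : ∀ σ, 0 < D σ := fun σ => by simp only [hD]; positivity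
  set p2 := D 2 * (2 * M * k0) with hp2
  set p3 := D 3 * (2 * M * k0) with hp3
  set ps := D s * (4 * M * k0) with hps
  set pL := (4:ℝ) ^ ((1:ℝ)/2) * (2 * k1 * k0) with hpL
  set q0 := D 0 * (2 * M * k1) with hq0
  set q1 := D 1 * (2 * M * k1) with hq1
  set qs := D (s - 1) * (4 * M * k1) with hqs
  set qL := (4:ℝ) ^ ((0:ℝ)/2) * (2 * k1 * k1) with hqL
  have := pD 0; have := pD 1; have := pD 2; have := pD 3; have := pD s; have := pD (s - 1)
  have pp2 : 0 < p2 := by positivity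
  have pp3 : 0 < p3 := by positivity
  have pps : 0 < ps := by positivity
  have ppL : 0 < pL := by positivity
  have pq0 : 0 < q0 := by positivity
  have pq1 : 0 < q1 := by positivity
  have pqs : 0 < qs := by positivity
  have pqL : 0 < qL := by positivity
  refine ⟨K + 2 * M + k0 + k1 + 3/2 * (p2 + p3 + ps + pL) + q0 + q1 + qs + qL, by positivity, fun N T e u0 w hN S hN1 hN2 => ?_⟩
  set K' := K + 2 * M + k0 + k1 + 3/2 * (p2 + p3 + ps + pL) + q0 + q1 + qs + qL with hK'
  have hN0 : 0 < N := by linarith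
  obtain ⟨r0, r1, r2, r3⟩ := rho_facts hs hN
  obtain ⟨o0, o1, o2, o3⟩ := om_facts (s := s) hN
  have hww1 : N ^ (1 - s) + N ^ (-1:ℝ) = om s N := by unfold om; ring
  set ρ := rho s N with hρ
  set ww := om s N with hww
  have hS1 : N ^ (s - s) + N ^ (-1:ℝ) ≤ 2 := by
    rw [sub_self, Real.rpow_zero, Real.rpow_neg_one]; have := inv_le_one_of_one_le₀ hN; linarith
  have ma : ∀ t, Measurable (ah w t) := fun t => (S.ah_cont t).measurable
  have ma1 : ∀ t, Measurable (dx (ah w) t) := fun t => S.tf1.meas t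
  have Na : ∀ t γ, γ ≤ s + 2 → N2 γ (ah w t) ≤ ENNReal.ofReal ((M * (N ^ (γ - s) + N ^ (-1:ℝ))) ^ 2) := fun t γ hγ =>
    N2_all hN hK.le (ma t) (hN1 t) (hN2 t) hγ
  have b0 : ∀ t, L1 0 (ah w t) ≤ ENNReal.ofReal (k0 / N) := fun t => by
    have := L1_of_sq hC0.le (by positivity) (L0 _ (ma t)) (hN1 t)
    rwa [← mul_div_assoc] at this
  have b1 : ∀ t, L1 1 (ah w t) ≤ ENNReal.ofReal (k1 * ρ) := fun t => by
    refine (L1_of_sq hC1.le (by positivity) (L1' _ (ma t)) (Na t _ (by linarith))).trans (ENNReal.ofReal_le_ofReal ?_)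
    calc Real.sqrt C1 * (M * (N ^ ((s + 3/2)/2 - s) + N ^ (-1:ℝ))) ≤ Real.sqrt C1 * (M * (2 * ρ)) := by gcongr; linarith
      _ = k1 * ρ := by rw [hk1]; ring
  have b1' : ∀ t, L1 0 (dx (ah w) t) ≤ ENNReal.ofReal (k1 * ρ) := fun t => by
    have := L1_mult' (σ := 0) (k := 1) zero_le_one norm_iξ_le (q := ah w t) (A := k1 * ρ) (by rw [zero_add]; exact b1 t)
    rwa [one_mul] at this
  have Na1 : ∀ t σ, σ + 1 ≤ s + 2 → N2 σ (dx (ah w) t) ≤ ENNReal.ofReal ((M * (N ^ (σ + 1 - s) + N ^ (-1:ℝ))) ^ 2) := fun t σ hσ => by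
    have := N2_mult' (σ := σ) (k := 1) zero_le_one norm_iξ_le (Na t (σ + 1) hσ)
    rwa [one_mul] at this
  have NP : ∀ t σ, 0 ≤ σ → σ ≤ s + 2 → N2 σ (Pq w t) ≤ ENNReal.ofReal ((D σ * (2 * M * k0) * ((N ^ (σ - s) + N ^ (-1:ℝ)) / N)) ^ 2) := fun t σ h0 hσ => by
    refine (N2_cv' h0 (ma t) (ma t) (by positivity) (by positivity) (by positivity) (by positivity) (Na t σ hσ) (Na t σ hσ) (b0 t) (b0 t)).trans (le_of_eq ?_)
    congr 2; simp only [hD]; ring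
  have LP : ∀ t, L1 1 (Pq w t) ≤ ENNReal.ofReal (pL / N) := fun t => by
    refine (L1_cv' zero_le_one (ma t) (ma t) (by positivity) (by positivity) (by positivity) (by positivity) (b1 t) (b1 t) (b0 t) (b0 t)).trans (ENNReal.ofReal_le_ofReal ?_)
    calc (4:ℝ) ^ ((1:ℝ)/2) * (k1 * ρ * (k0 / N) + k0 / N * (k1 * ρ)) = (4:ℝ) ^ ((1:ℝ)/2) * ((2 * k1 * k0 / N) * ρ) := by ring
      _ ≤ (4:ℝ) ^ ((1:ℝ)/2) * ((2 * k1 * k0 / N) * 1) := by gcongr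
      _ = pL / N := by rw [hpL]; ring
  have Nc : ∀ t σ, 0 ≤ σ → σ + 1 ≤ s + 2 → N2 σ (cq w t) ≤ ENNReal.ofReal ((D σ * (2 * M * k1) * ((N ^ (σ + 1 - s) + N ^ (-1:ℝ)) * ρ)) ^ 2) := fun t σ h0 hσ => by
    refine (N2_cv' h0 (ma1 t) (ma1 t) (by positivity) (by positivity) (by positivity) (by positivity) (Na1 t σ hσ) (Na1 t σ hσ) (b1' t) (b1' t)).trans (le_of_eq ?_)
    congr 2; simp only [hD]; ring
  have Lc : ∀ t, L1 0 (cq w t) ≤ ENNReal.ofReal qL := fun t => by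
    refine (L1_cv' le_rfl (ma1 t) (ma1 t) (by positivity) (by positivity) (by positivity) (by positivity) (b1' t) (b1' t) (b1' t) (b1' t)).trans (ENNReal.ofReal_le_ofReal ?_)
    rw [hqL]
    refine mul_le_mul_of_nonneg_left ?_ (by positivity)
    calc k1 * ρ * (k1 * ρ) + k1 * ρ * (k1 * ρ) = (2 * k1 * k1) * (ρ * ρ) := by ring
      _ ≤ (2 * k1 * k1) * (1 * 1) := by gcongr
      _ = _ := by ring
  have P2 : ∀ t, N2 2 (Pq w t) ≤ ENNReal.ofReal ((p2 * ww) ^ 2) := fun t =>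
    (NP t 2 (by norm_num) (by linarith)).trans (ofReal_sq_mono (by positivity) (by gcongr))
  have P3 : ∀ t, N2 3 (Pq w t) ≤ ENNReal.ofReal ((p3 * (N * ww)) ^ 2) := fun t =>
    (NP t 3 (by norm_num) (by linarith)).trans (ofReal_sq_mono (by positivity) (by gcongr))
  have Ps : ∀ t, N2 s (Pq w t) ≤ ENNReal.ofReal ((ps / N) ^ 2) := fun t =>
    (NP t s (by linarith) (by linarith)).trans (ofReal_sq_mono (by positivity) (by
      calc D s * (2 * M * k0) * ((N ^ (s - s) + N ^ (-1:ℝ)) / N) ≤ D s * (2 * M * k0) * (2 / N) := by gcongr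
        _ = ps / N := by rw [hps]; ring))
  have C0' : ∀ t, N2 0 (cq w t) ≤ ENNReal.ofReal ((q0 * ww) ^ 2) := fun t =>
    (Nc t 0 le_rfl (by linarith)).trans (ofReal_sq_mono (by positivity) (by
      rw [zero_add, hww1]
      calc D 0 * (2 * M * k1) * (ww * ρ) ≤ D 0 * (2 * M * k1) * (ww * 1) := by gcongr
        _ = q0 * ww := by rw [hq0]; ring))
  have C1' : ∀ t, N2 1 (cq w t) ≤ ENNReal.ofReal ((q1 * (N * ww)) ^ 2) := fun t =>
    (Nc t 1 (by norm_num) (by linarith)).trans (ofReal_sq_mono (by positivity) (by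
      rw [show (1:ℝ) + 1 - s = 2 - s by ring]
      calc D 1 * (2 * M * k1) * ((N ^ (2 - s) + N ^ (-1:ℝ)) * ρ) ≤ D 1 * (2 * M * k1) * ((N * ww) * 1) := by gcongr
        _ = q1 * (N * ww) := by rw [hq1]; ring))
  have Cs' : ∀ t, N2 (s - 1) (cq w t) ≤ ENNReal.ofReal ((qs * ρ) ^ 2) := fun t =>
    (Nc t (s - 1) (by linarith) (by linarith)).trans (ofReal_sq_mono (by positivity) (by
      rw [show s - 1 + 1 - s = s - s by ring]
      calc D (s - 1) * (2 * M * k1) * ((N ^ (s - s) + N ^ (-1:ℝ)) * ρ) ≤ D (s - 1) * (2 * M * k1) * (2 * ρ) := by gcongr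
        _ = qs * ρ := by rw [hqs]; ring))
  have eh : ∀ t, hq w t = fun ξ : ℝ => ((3/2 : ℂ) * (Complex.I * ξ)) * Pq w t ξ := fun t => by funext ξ; simp only [hq, dx]; ring
  have edh : ∀ t, dx (hq w) t = fun ξ : ℝ => (Complex.I * ξ * ((3/2 : ℂ) * (Complex.I * ξ))) * Pq w t ξ := fun t => by funext ξ; simp only [hq, dx]; ring
  have eA : ∀ t, Aq (1/N) w t = fun ξ : ℝ => m1 (1/N) ξ * Pq w t ξ := fun t => by funext ξ; simp only [Aq]
  have edA : ∀ t, dx (Aq (1/N) w) t = fun ξ : ℝ => (Complex.I * ξ * m1 (1/N) ξ) * Pq w t ξ := fun t => by funext ξ; simp only [Aq, dx]; ring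
  have em : ∀ t, mq (1/N) w t = fun ξ : ℝ => m2 (1/N) ξ * cq w t ξ := fun t => by funext ξ; simp only [mq]
  have c32 : (0:ℝ) ≤ 3/2 := by norm_num
  have hα : 0 < 1/N := by positivity
  have hNww : 0 < N * ww := by positivity
  -- conversion helpers
  have cvt : ∀ {x : ℝ≥0∞} {a b : ℝ}, x ≤ ENNReal.ofReal (a ^ 2) → 0 ≤ a → a ≤ b → x ≤ ENNReal.ofReal (b ^ 2) := fun h h0 hab => h.trans (ofReal_sq_mono h0 hab)
  have cvl : ∀ {x : ℝ≥0∞} {a b : ℝ}, x ≤ ENNReal.ofReal a → a ≤ b → x ≤ ENNReal.ofReal b := fun h hab => h.trans (ENNReal.ofReal_le_ofReal hab)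
  have sc : ∀ {a z : ℝ}, a ≤ K' → 0 ≤ z → a * z ≤ K' * z := fun h hz => mul_le_mul_of_nonneg_right h hz
  have sd : ∀ {a : ℝ}, a ≤ K' → a / N ≤ K' / N := fun h => by gcongr
  refine ⟨fun t => cvl (b0 t) (sd (by linarith)), fun t => cvl (b1' t) (sc (by linarith) r0.le), fun t => cvt (hN1 t) (by positivity) (sd (by linarith)), fun t => ?_,
    fun t => ?_, fun t => ?_, fun t => ?_, fun t => ?_, fun t => cvt (C0' t) (by positivity) (sc (by linarith) o0.le), 
    fun t => cvt (C1' t) (by positivity) (sc (by linarith) hNww.le), fun t => ?_, fun t => ?_, fun t => ?_, fun t => ?_, fun t => ?_, fun t => ?_, fun t => ?_⟩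
  · refine cvt (Na t s (by linarith)) (by positivity) ?_
    calc M * (N ^ (s - s) + N ^ (-1:ℝ)) ≤ M * 2 := by gcongr
      _ ≤ K' := by linarith
  · rw [edh]
    refine cvt (N2_mult' (σ := 0) (k := 2) c32 bd_dh (by rw [zero_add]; exact P2 t)) (by positivity) ?_
    rw [← mul_assoc]; exact sc (by linarith) o0.le
  · rw [edh]
    refine cvt (N2_mult' (σ := 1) (k := 2) c32 bd_dh (by rw [show (1:ℝ) + 2 = 3 by norm_num]; exact P3 t)) (by positivity) ?_
    rw [← mul_assoc]; exact sc (by linarith) hNww.le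
  · rw [edA]
    refine cvt (N2_mult' (σ := 0) (k := 2) zero_le_one (bd_dA _) (by rw [zero_add]; exact P2 t)) (by positivity) ?_
    rw [← mul_assoc]; exact sc (by linarith) o0.le
  · rw [edA]
    refine cvt (N2_mult' (σ := 1) (k := 2) zero_le_one (bd_dA _) (by rw [show (1:ℝ) + 2 = 3 by norm_num]; exact P3 t)) (by positivity) ?_
    rw [← mul_assoc]; exact sc (by linarith) hNww.le
  · have := Na1 t 0 (by linarith)
    rw [zero_add, hww1] at this
    exact cvt this (by positivity) (sc (by linarith) o0.le)
  · rw [eh]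
    refine cvt (N2_mult' (σ := s - 1) (k := 1) c32 bd_h (by rw [sub_add_cancel]; exact Ps t)) (by positivity) ?_
    rw [← mul_div_assoc]; exact sd (by linarith)
  · rw [eh]
    refine cvl (L1_mult' (σ := 0) (k := 1) c32 bd_h (by rw [zero_add]; exact LP t)) ?_
    rw [← mul_div_assoc]; exact sd (by linarith)
  · rw [eA]
    refine cvt (N2_mult' (σ := s - 1) (k := 1) zero_le_one (bd_A _) (by rw [sub_add_cancel]; exact Ps t)) (by positivity) ?_
    rw [← mul_div_assoc]; exact sd (by linarith)
  · rw [eA]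
    refine cvl (L1_mult' (σ := 0) (k := 1) zero_le_one (bd_A _) (by rw [zero_add]; exact LP t)) ?_
    rw [← mul_div_assoc]; exact sd (by linarith)
  · rw [em]
    refine cvt (N2_mult' (σ := s - 1) (k := 0) hα.le (bd_m2 hα) (by rw [add_zero]; exact Cs' t)) (by positivity) ?_
    rw [show 1 / N * (qs * ρ) = qs * (ρ / N) by ring, mul_div_assoc]; exact sc (by linarith) (by positivity)
  · rw [em]
    refine cvl (L1_mult' (σ := 0) (k := 0) hα.le (bd_m2 hα) (by rw [add_zero]; exact Lc t)) ?_
    rw [show 1 / N * qL = qL / N by ring]; exact sd (by linarith)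

end

/-! ### Part P8c -/

noncomputable section

open MeasureTheory Filter
open scoped ENNReal Topology


def lam (N : ℝ) : ℝ := 17 / 12 * N
def U0 (s : ℝ) (φ : ℝ → ℂ) (N : ℝ) (x : ℝ) : ℂ := ((N ^ (-s) * Real.sin (lam N * x) + N ^ (-1:ℝ) : ℝ) : ℂ) * φ x
def pp (φhat : ℝ → ℝ) (ξ : ℝ) : ℂ := (φhat ξ : ℂ) / (2 * Real.pi)
def p0 (s : ℝ) (φhat : ℝ → ℝ) (N : ℝ) (ξ : ℝ) : ℂ :=
  ((N ^ (-1:ℝ) : ℝ) : ℂ) * pp φhat ξ + (((N ^ (-s) : ℝ) : ℂ) / (2 * Complex.I)) * (pp φhat (ξ - lam N) - pp φhat (ξ + lam N))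

theorem pp_cont {φhat : ℝ → ℝ} {φ : ℝ → ℂ} (hφ : CutoffPair φhat φ) : Continuous (pp φhat) := by
  have := hφ.smooth.continuous
  unfold pp; fun_prop
theorem pp_supp {φhat : ℝ → ℝ} {φ : ℝ → ℂ} (hφ : CutoffPair φhat φ) : HasCompactSupport (pp φhat) := by
  have : pp φhat = fun ξ => (fun r : ℝ => (r : ℂ) / (2 * Real.pi)) (φhat ξ) := rfl
  rw [this]
  exact hφ.compactSupport.comp_left (g := fun r : ℝ => (r : ℂ) / (2 * Real.pi)) (by simp)
theorem pp_int {φhat : ℝ → ℝ} {φ : ℝ → ℂ} (hφ : CutoffPair φhat φ) : Integrable (pp φhat) :=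
  (pp_cont hφ).integrable_of_hasCompactSupport (pp_supp hφ)
theorem IF_pp {φhat : ℝ → ℝ} {φ : ℝ → ℂ} (hφ : CutoffPair φhat φ) (x : ℝ) : IF (pp φhat) x = φ x := by
  have e : fourierT φ = fun ξ => (2 * Real.pi : ℂ) * pp φhat ξ := by
    funext ξ; rw [hφ.fourier_eq, pp]; field_simp
  have h := inversion_pt hφ.integrable (by rw [e]; exact (pp_int hφ).const_mul _) (hφ.continuous.continuousAt (x := x))
  rw [e, IF_smul] at h
  exact mul_left_cancel₀ two_pi_ne h
theorem IF_shift (q : ℝ → ℂ) (l x : ℝ) : IF (fun ξ => q (ξ - l)) x = Complex.exp (Complex.I * l * x) * IF q x := by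
  unfold IF
  rw [← integral_const_mul, ← integral_sub_right_eq_self (fun ξ : ℝ => Complex.exp (Complex.I * l * x) * (q ξ * Complex.exp (Complex.I * ξ * x))) l]
  congr 1; funext ξ
  rw [show Complex.exp (Complex.I * ξ * x) = Complex.exp (Complex.I * l * x) * Complex.exp (Complex.I * (ξ - l : ℝ) * x) by
    rw [← Complex.exp_add]; congr 1; push_cast; ring]
  ring
theorem p0_cont {φhat : ℝ → ℝ} {φ : ℝ → ℂ} (hφ : CutoffPair φhat φ) (s N : ℝ) : Continuous (p0 s φhat N) := by
  have := pp_cont hφ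
  unfold p0; fun_prop
theorem p0_int {φhat : ℝ → ℝ} {φ : ℝ → ℂ} (hφ : CutoffPair φhat φ) (s N : ℝ) : Integrable (p0 s φhat N) := by
  have h := pp_int hφ
  exact (h.const_mul _).add (((h.comp_sub_right _).sub (h.comp_add_right _)).const_mul _)
theorem IF_p0 {φhat : ℝ → ℝ} {φ : ℝ → ℂ} (hφ : CutoffPair φhat φ) (s N : ℝ) : IF (p0 s φhat N) = U0 s φ N := by
  funext x
  have h := pp_int hφ
  have hi : Integrable (fun ξ => pp φhat (ξ - lam N) - pp φhat (ξ + lam N)) := (h.comp_sub_right _).sub (h.comp_add_right _)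
  unfold p0
  rw [IF_add (h.const_mul _) (hi.const_mul _), IF_smul, IF_smul,
    IF_sub (h.comp_sub_right _) (h.comp_add_right _), IF_shift]
  have h2 := IF_shift (pp φhat) (-lam N) x
  simp only [sub_neg_eq_add] at h2
  rw [h2, IF_pp hφ, U0]
  push_cast
  rw [Complex.sin]
  have e1 : Complex.exp (Complex.I * lam N * x) = Complex.exp (lam N * x * Complex.I) := by congr 1; ring
  have e2 : Complex.exp (Complex.I * -lam N * x) = Complex.exp (-(lam N * x) * Complex.I) := by congr 1; ring
  rw [e1, e2]
  have hI : (1:ℂ) / (2 * Complex.I) = -Complex.I / 2 := by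
    rw [div_eq_div_iff (by simp) (by norm_num)]; linear_combination 2 * Complex.I_mul_I
  rw [div_eq_mul_one_div _ (2 * Complex.I), hI]
  ring

theorem U0_int {φhat : ℝ → ℝ} {φ : ℝ → ℂ} (hφ : CutoffPair φhat φ) (s N : ℝ) : Integrable (U0 s φ N) := by
  refine (hφ.integrable.bdd_mul (c := |N ^ (-s)| + |N ^ (-1:ℝ)|) ?_ ?_)
  · exact (by fun_prop : Continuous fun x : ℝ => ((N ^ (-s) * Real.sin (lam N * x) + N ^ (-1:ℝ) : ℝ) : ℂ)).aestronglyMeasurable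
  · refine Eventually.of_forall fun x => ?_
    rw [Complex.norm_real, Real.norm_eq_abs]
    refine (abs_add_le _ _).trans ?_
    rw [abs_mul]
    have := mul_le_mul_of_nonneg_left (Real.abs_sin_le_one (lam N * x)) (abs_nonneg (N ^ (-s)))
    linarith

theorem init_N2 {φhat : ℝ → ℝ} {φ : ℝ → ℂ} (hφ : CutoffPair φhat φ) {γ : ℝ} (hγ : 0 ≤ γ) : ∃ C : ℝ, 0 < C ∧ ∀ s N : ℝ, 1 ≤ N →
    N2 γ (p0 s φhat N) ≤ ENNReal.ofReal ((C * (N ^ (-1:ℝ) + N ^ (γ - s))) ^ 2) := by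
  set G : ℝ → ℝ := fun ξ => ‖pp φhat ξ‖ ^ 2 with hG
  have Gc : Continuous G := (pp_cont hφ).norm.pow 2
  have Gs : HasCompactSupport G := (pp_supp hφ).comp_left (g := fun z : ℂ => ‖z‖ ^ 2) (by simp)
  have Gi : Integrable G := Gc.integrable_of_hasCompactSupport Gs
  have G0 : ∀ ξ, 0 ≤ G ξ := fun ξ => by simp only [hG]; positivity
  have hz : ∀ ξ, 1/2 ≤ |ξ| → G ξ = 0 := fun ξ h => by simp [hG, pp, hφ.eq_zero ξ h]
  set Q := ∫ ξ, G ξ with hQ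
  have Q0 : 0 ≤ Q := integral_nonneg G0
  have lG : ∫⁻ ξ, ENNReal.ofReal (G ξ) = ENNReal.ofReal Q := (ofReal_integral_eq_lintegral_ofReal Gi (Eventually.of_forall G0)).symm
  refine ⟨Real.sqrt (9 * 5 ^ γ * Q + 1), by positivity, fun s N hN => ?_⟩
  have hN0 : 0 < N := by linarith
  set B := N ^ (-1:ℝ) + N ^ (γ - s) with hB
  have p1 : 0 < N ^ (-1:ℝ) := by positivity
  have p2 : 0 < N ^ (γ - s) := by positivity
  have w1 : ∀ ξ : ℝ, |ξ| ≤ 2 * N → (1 + ξ ^ 2) ^ γ ≤ 5 ^ γ * (N ^ γ) ^ 2 := fun ξ h => by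
    have : (1 + ξ ^ 2) ≤ 5 * N ^ 2 := by nlinarith [sq_abs ξ, abs_nonneg ξ]
    refine (Real.rpow_le_rpow (by positivity) this hγ).trans (le_of_eq ?_)
    rw [Real.mul_rpow (by norm_num) (by positivity), ← Real.rpow_natCast, ← Real.rpow_natCast, ← Real.rpow_mul hN0.le, ← Real.rpow_mul hN0.le]
    congr 2; push_cast; ring
  have hg : N ^ (-s) * N ^ γ ≤ B := by
    rw [← Real.rpow_add hN0, show -s + γ = γ - s by ring]; linarith
  have key : ∀ ξ, (1 + ξ ^ 2) ^ γ * ‖p0 s φhat N ξ‖ ^ 2 ≤ 3 * 5 ^ γ * B ^ 2 * (G ξ + G (ξ - lam N) + G (ξ + lam N)) := by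
    intro ξ
    have n1 : ‖p0 s φhat N ξ‖ ≤ N ^ (-1:ℝ) * ‖pp φhat ξ‖ + N ^ (-s) * ‖pp φhat (ξ - lam N)‖ + N ^ (-s) * ‖pp φhat (ξ + lam N)‖ := by
      unfold p0
      refine (norm_add_le _ _).trans ?_
      rw [norm_mul, norm_mul, norm_div, norm_mul]
      simp only [Complex.norm_real, Complex.norm_I, Real.norm_eq_abs, Complex.norm_ofNat, abs_of_pos p1, abs_of_pos (Real.rpow_pos_of_pos hN0 (-s))]
      have := norm_sub_le (pp φhat (ξ - lam N)) (pp φhat (ξ + lam N))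
      have q0 : 0 ≤ N ^ (-s) := by positivity
      have := mul_le_mul_of_nonneg_left this (by positivity : 0 ≤ N ^ (-s) / (2 * 1))
      have := mul_nonneg q0 (norm_nonneg (pp φhat (ξ - lam N)))
      have := mul_nonneg q0 (norm_nonneg (pp φhat (ξ + lam N)))
      linarith
    have n2 : ‖p0 s φhat N ξ‖ ^ 2 ≤ 3 * ((N ^ (-1:ℝ)) ^ 2 * G ξ + (N ^ (-s)) ^ 2 * G (ξ - lam N) + (N ^ (-s)) ^ 2 * G (ξ + lam N)) := by
      refine (pow_le_pow_left₀ (norm_nonneg _) n1 2).trans ?_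
      simp only [hG, ← mul_pow]
      generalize N ^ (-1:ℝ) * ‖pp φhat ξ‖ = a
      generalize N ^ (-s) * ‖pp φhat (ξ - lam N)‖ = b
      generalize N ^ (-s) * ‖pp φhat (ξ + lam N)‖ = c
      nlinarith [sq_nonneg (a - b), sq_nonneg (b - c), sq_nonneg (a - c)]
    have t1 : (1 + ξ ^ 2) ^ γ * ((N ^ (-1:ℝ)) ^ 2 * G ξ) ≤ 5 ^ γ * B ^ 2 * G ξ := by
      rcases le_or_gt (1/2) |ξ| with h | h
      · rw [hz ξ h]; simp
      · have : (1 + ξ ^ 2) ^ γ ≤ 5 ^ γ := Real.rpow_le_rpow (by positivity) (by nlinarith [sq_abs ξ, abs_nonneg ξ]) hγ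
        rw [← mul_assoc]
        refine mul_le_mul_of_nonneg_right ?_ (G0 _)
        refine mul_le_mul this (pow_le_pow_left₀ p1.le (by linarith) 2) (by positivity) (by positivity)
    have t2 : ∀ l, |l| ≤ 3/2 * N → (1 + ξ ^ 2) ^ γ * ((N ^ (-s)) ^ 2 * G (ξ - l)) ≤ 5 ^ γ * B ^ 2 * G (ξ - l) := fun l hl => by
      rcases le_or_gt (1/2) |ξ - l| with h | h
      · rw [hz _ h]; simp
      · have h3 : |ξ| ≤ 2 * N := by
          have := abs_add_le (ξ - l) l
          rw [sub_add_cancel] at this; linarith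
        rw [← mul_assoc]
        refine mul_le_mul_of_nonneg_right ?_ (G0 _)
        calc (1 + ξ ^ 2) ^ γ * (N ^ (-s)) ^ 2 ≤ 5 ^ γ * (N ^ γ) ^ 2 * (N ^ (-s)) ^ 2 := by have := w1 ξ h3; gcongr
          _ = 5 ^ γ * (N ^ (-s) * N ^ γ) ^ 2 := by ring
          _ ≤ _ := by gcongr
    have hl : |lam N| ≤ 3/2 * N := by unfold lam; rw [abs_of_pos (by positivity)]; linarith
    have t3 := t2 (lam N) hl
    have t4 := t2 (-lam N) (by rwa [abs_neg])
    rw [sub_neg_eq_add] at t4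
    have := mul_le_mul_of_nonneg_left n2 (by positivity : 0 ≤ (1 + ξ ^ 2) ^ γ)
    nlinarith
  have hle : N2 γ (p0 s φhat N) ≤ ∫⁻ ξ, ENNReal.ofReal (3 * 5 ^ γ * B ^ 2) * ((ENNReal.ofReal (G ξ) + ENNReal.ofReal (G (ξ - lam N))) + ENNReal.ofReal (G (ξ + lam N))) := by
    unfold N2
    refine lintegral_mono fun ξ => ?_
    rw [← ENNReal.ofReal_add (G0 _) (G0 _), ← ENNReal.ofReal_add (add_nonneg (G0 _) (G0 _)) (G0 _), ← ENNReal.ofReal_mul (by positivity), wt, ← ofReal_norm,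
      ← ENNReal.ofReal_pow (norm_nonneg _), ← ENNReal.ofReal_mul (by positivity)]
    exact ENNReal.ofReal_le_ofReal (key ξ)
  refine hle.trans (le_trans (le_of_eq ?_) (ENNReal.ofReal_le_ofReal (p := 3 * 5 ^ γ * B ^ 2 * (3 * Q)) ?_))
  · have m0 : Measurable fun ξ => ENNReal.ofReal (G ξ) := Gc.measurable.ennreal_ofReal
    have m1 : Measurable fun ξ => ENNReal.ofReal (G (ξ - lam N)) := m0.comp (measurable_id.sub_const _)
    have m2 : Measurable fun ξ => ENNReal.ofReal (G ξ) + ENNReal.ofReal (G (ξ - lam N)) := m0.add m1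
    rw [lintegral_const_mul' _ _ ENNReal.ofReal_ne_top, lintegral_add_left m2, lintegral_add_left m0,
      lintegral_sub_right_eq_self (fun ξ => ENNReal.ofReal (G ξ)), lintegral_add_right_eq_self (fun ξ => ENNReal.ofReal (G ξ)), lG,
      ← ENNReal.ofReal_add Q0 Q0, ← ENNReal.ofReal_add (by positivity) Q0, ← ENNReal.ofReal_mul (by positivity)]
    congr 1; ring
  · rw [mul_pow, Real.sq_sqrt (by positivity)]
    nlinarith [sq_nonneg B]

theorem ah_zero {φhat : ℝ → ℝ} {φ : ℝ → ℂ} (hφ : CutoffPair φhat φ) {s T α e N : ℝ} {w : ℝ → ℝ → ℂ} (S : Sol s T α e (U0 s φ N) w) :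
    ah w 0 = p0 s φhat N := by
  funext ξ
  rw [ah, S.w0, ← IF_p0 hφ, fourierT_IF (p0_cont hφ s N) (p0_int hφ s N) (by rw [IF_p0 hφ]; exact U0_int hφ s N),
    mul_div_cancel_left₀ _ two_pi_ne]

theorem init_sz {φhat : ℝ → ℝ} {φ : ℝ → ℂ} (hφ : CutoffPair φhat φ) {s : ℝ} (hs : 3/2 < s) {C2 : ℝ} (hC2 : 0 < C2) :
    ∃ K : ℝ, 0 < K ∧ ∀ (N T e : ℝ) (w : ℝ → ℝ → ℂ), 1 ≤ N → Sol s T (1/N) e (U0 s φ N) w →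
      (∀ t, sobolevNorm (s - 1) (w t) ≤ C2 * sobolevNorm (s - 1) (U0 s φ N)) →
      (∀ t, sobolevNorm (s + 2) (w t) ≤ C2 * sobolevNorm (s + 2) (U0 s φ N)) → SZ s N K w := by
  obtain ⟨c1, h1, H1⟩ := init_N2 hφ (γ := s - 1) (by linarith)
  obtain ⟨c2, h2, H2⟩ := init_N2 hφ (γ := s + 2) (by linarith)
  obtain ⟨K', hK', h⟩ := SZ_of hs (K := 2 * C2 * (c1 + c2)) (by positivity)
  refine ⟨K', hK', fun N T e w hN S b1 b2 => h N T e _ w hN S (fun t => ?_) fun t => ?_⟩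
  all_goals
    have hN0 : 0 < N := by linarith
    have hNi : N ^ (-1:ℝ) = 1 / N := by rw [Real.rpow_neg_one, one_div]
  · have e0 := S.ah_N2 0 (γ := s - 1) (by linarith)
    rw [ah_zero hφ S, S.w0] at e0
    have e1 := H1 s N hN
    rw [e0, ENNReal.ofReal_le_ofReal_iff (by positivity)] at e1
    have e2 := abs_le_of_sq_le_sq e1 (by positivity)
    have hx : N ^ (s - 1 - s) = 1 / N := by rw [← hNi]; congr 1; ring
    rw [hx, hNi] at e2
    rw [S.ah_N2 t (by linarith)]
    refine ofReal_sq_mono (div_nonneg (Real.sqrt_nonneg _) (by positivity)) ?_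
    calc sobolevNorm (s - 1) (w t) / (2 * Real.pi) ≤ C2 * sobolevNorm (s - 1) (U0 s φ N) / (2 * Real.pi) := by gcongr; exact b1 t
      _ = C2 * (sobolevNorm (s - 1) (U0 s φ N) / (2 * Real.pi)) := by ring
      _ ≤ C2 * (c1 * (1 / N + 1 / N)) := by gcongr; exact (le_abs_self _).trans e2
      _ = 2 * C2 * c1 / N := by ring
      _ ≤ _ := by gcongr; linarith
  · have e0 := S.ah_N2 0 (γ := s + 2) (by linarith)
    rw [ah_zero hφ S, S.w0] at e0
    have e1 := H2 s N hN
    rw [e0, ENNReal.ofReal_le_ofReal_iff (by positivity)] at e1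
    have e2 := abs_le_of_sq_le_sq e1 (by positivity)
    have hx : N ^ (s + 2 - s) = N ^ 2 := by rw [← Real.rpow_natCast]; congr 1; push_cast; ring
    rw [hx, hNi] at e2
    have h4 : 1 / N ≤ N ^ 2 := by
      rw [div_le_iff₀ hN0]; nlinarith [mul_le_mul hN hN zero_le_one hN0.le]
    rw [S.ah_N2 t le_rfl]
    refine ofReal_sq_mono (div_nonneg (Real.sqrt_nonneg _) (by positivity)) ?_
    calc sobolevNorm (s + 2) (w t) / (2 * Real.pi) ≤ C2 * sobolevNorm (s + 2) (U0 s φ N) / (2 * Real.pi) := by gcongr; exact b2 t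
      _ = C2 * (sobolevNorm (s + 2) (U0 s φ N) / (2 * Real.pi)) := by ring
      _ ≤ C2 * (c2 * (1 / N + N ^ 2)) := by gcongr; exact (le_abs_self _).trans e2
      _ ≤ C2 * (c2 * (N ^ 2 + N ^ 2)) := by gcongr
      _ = 2 * C2 * c2 * N ^ 2 := by ring
      _ ≤ _ := by gcongr; linarith

end

/-! ### Part P9 -/

noncomputable section

open MeasureTheory Filter
open scoped ENNReal Topology


structure PF (φ : ℝ → ℂ) (f d : ℝ → ℝ) (M : ℝ) : Prop where
  M1 : 1 ≤ M
  eq : ∀ x, φ x = f x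
  hd : ∀ x, HasDerivAt f (d x) x
  dc : Continuous d
  fb : ∀ x, |f x| ≤ M
  db : ∀ x, |d x| ≤ M
  f1 : 0 < f 1
  d1 : d 1 < 0

theorem phi_facts {φhat : ℝ → ℝ} {φ : ℝ → ℂ} (hφ : CutoffPair φhat φ) : ∃ f d M, PF φ f d M := by
  have h := pp_int hφ
  have pc := pp_cont hφ
  set q : ℝ → ℂ := fun ξ => Complex.I * ξ * pp φhat ξ with hq
  have qc : Continuous q := by simp only [hq]; fun_prop
  have qi : Integrable q := qc.integrable_of_hasCompactSupport ((pp_supp hφ).mul_left)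
  have eφ : φ = IF (pp φhat) := funext fun x => (IF_pp hφ x).symm
  have hdφ : ∀ x, HasDerivAt φ (IF q x) x := fun x => by rw [eφ]; exact IF_hasDerivAt h qi x
  have hreal : ∀ x, φ x = ((φ x).re : ℂ) := fun x => by
    symm; rw [← Complex.conj_eq_iff_re, ← IF_pp hφ x]
    unfold IF
    rw [← integral_conj, ← integral_neg_eq_self]
    congr 1; funext ξ
    rw [map_mul, ← Complex.exp_conj]
    simp only [pp, map_mul, map_div₀, Complex.conj_ofReal, Complex.conj_I, hφ.even, map_ofNat]
    congr 2; push_cast; ring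
  refine ⟨fun x => (φ x).re, fun x => (IF q x).re, (∫ ξ, ‖pp φhat ξ‖) + (∫ ξ, ‖q ξ‖) + 1, ?_, hreal, ?_, ?_, ?_, ?_, ?_, ?_⟩
  · have : 0 ≤ ∫ ξ, ‖pp φhat ξ‖ := integral_nonneg fun _ => norm_nonneg _
    have : 0 ≤ ∫ ξ, ‖q ξ‖ := integral_nonneg fun _ => norm_nonneg _
    linarith
  · exact fun x => (Complex.reCLM.hasFDerivAt.comp_hasDerivAt x (hdφ x))
  · exact Complex.continuous_re.comp (continuous_IF qi)
  · intro x
    have : 0 ≤ ∫ ξ, ‖q ξ‖ := integral_nonneg fun _ => norm_nonneg _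
    have h1 := norm_IF_le (pp φhat) x
    rw [IF_pp hφ] at h1
    have := Complex.abs_re_le_norm (φ x)
    linarith
  · intro x
    have : 0 ≤ ∫ ξ, ‖pp φhat ξ‖ := integral_nonneg fun _ => norm_nonneg _
    have h1 := norm_IF_le q x
    have := Complex.abs_re_le_norm (IF q x)
    linarith
  · have e : (φ 1).re = ∫ ξ : ℝ, φhat ξ * (Real.cos ξ / (2 * Real.pi)) := by
      rw [← IF_pp hφ, IF]
      have := Complex.reCLM.integral_comp_comm (IF_integrable h 1)
      simp only [Complex.reCLM_apply] at this
      rw [← this]; congr 1; funext ξ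
      have e1 : Complex.exp (Complex.I * ξ * (1:ℝ)) = Complex.cos ξ + Complex.sin ξ * Complex.I := by
        rw [← Complex.exp_mul_I]; congr 1; push_cast; ring
      have e2 : pp φhat ξ = ((φhat ξ / (2 * Real.pi) : ℝ) : ℂ) := by simp [pp]
      rw [e1, e2, Complex.re_ofReal_mul, ← Complex.ofReal_cos, ← Complex.ofReal_sin]
      simp [← Complex.ofReal_cos, -Complex.ofReal_cos]; ring
    rw [e]
    have c0 : Continuous φhat := hφ.smooth.continuous
    refine Continuous.integral_pos_of_hasCompactSupport_nonneg_nonzero (x := 0) (by fun_prop) hφ.compactSupport.mul_right (fun ξ => ?_) ?_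
    · rcases le_or_gt (1/2) |ξ| with h | h
      · simp [hφ.eq_zero ξ h]
      · refine mul_nonneg (hφ.nonneg ξ) (div_nonneg (Real.cos_nonneg_of_neg_pi_div_two_le_of_le ?_ ?_) (by positivity))
        · have := (abs_lt.1 h).1; linarith [Real.pi_gt_three]
        · have := (abs_lt.1 h).2; linarith [Real.pi_gt_three]
    · rw [hφ.eq_one 0 (by norm_num)]; simp [Real.pi_ne_zero]
  · have e : -(IF q 1).re = ∫ ξ : ℝ, φhat ξ * (ξ * Real.sin ξ / (2 * Real.pi)) := by
      rw [IF]
      have := Complex.reCLM.integral_comp_comm (IF_integrable qi 1)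
      simp only [Complex.reCLM_apply] at this
      rw [← this, ← integral_neg]; congr 1; funext ξ
      have e1 : Complex.exp (Complex.I * ξ * (1:ℝ)) = Complex.cos ξ + Complex.sin ξ * Complex.I := by
        rw [← Complex.exp_mul_I]; congr 1; push_cast; ring
      have e2 : q ξ = ((φhat ξ * ξ / (2 * Real.pi) : ℝ) : ℂ) * Complex.I := by simp [hq, pp]; ring
      rw [e1, e2, mul_assoc, Complex.re_ofReal_mul, ← Complex.ofReal_cos, ← Complex.ofReal_sin]
      simp [← Complex.ofReal_sin, -Complex.ofReal_sin]; ring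
    have c0 : Continuous φhat := hφ.smooth.continuous
    have : 0 < -(IF q 1).re := by
      rw [e]
      refine Continuous.integral_pos_of_hasCompactSupport_nonneg_nonzero (x := 1/4) (by fun_prop) hφ.compactSupport.mul_right (fun ξ => ?_) ?_
      · rcases le_or_gt (1/2) |ξ| with h | h
        · simp [hφ.eq_zero ξ h]
        · refine mul_nonneg (hφ.nonneg ξ) (div_nonneg ?_ (by positivity))
          have h1 := (abs_lt.1 h).1
          have h2 := (abs_lt.1 h).2
          rcases le_or_gt 0 ξ with h0 | h0
          · exact mul_nonneg h0 (Real.sin_nonneg_of_nonneg_of_le_pi h0 (by linarith [Real.pi_gt_three]))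
          · exact mul_nonneg_of_nonpos_of_nonpos h0.le (Real.sin_nonpos_of_nonpos_of_neg_pi_le h0.le (by linarith [Real.pi_gt_three]))
      · rw [hφ.eq_one (1/4) (by norm_num [abs_of_pos])]
        have : 0 < Real.sin (1/4) := Real.sin_pos_of_pos_of_lt_pi (by norm_num) (by linarith [Real.pi_gt_three])
        have := Real.pi_pos
        positivity
    linarith

/-- good family of cells -/
structure CL (f d : ℝ → ℝ) (c0 c1 N : ℝ) (J : Finset ℝ) : Prop where
  cells : Cells N J
  many : c1 * N ≤ J.card
  sin : ∀ y ∈ J, ∀ z, Real.sin (lam N * y + z) = -Real.sin z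
  cos : ∀ y ∈ J, ∀ z, Real.cos (lam N * y + z) = -Real.cos z
  fl : ∀ y ∈ J, ∀ x, |x - y| ≤ 1 / (2 * N) → c0 ≤ f x
  dl : ∀ y ∈ J, ∀ x, |x - y| ≤ 1 / (2 * N) → d x ≤ -c0

theorem cells_exist {φ : ℝ → ℂ} {f d : ℝ → ℝ} {M : ℝ} (h : PF φ f d M) : ∃ c0 c1 N0 : ℝ, 0 < c0 ∧ 0 < c1 ∧ 1 ≤ N0 ∧ ∀ N, N0 ≤ N →
    ∃ J, CL f d c0 c1 N J := by
  set c0 := min (f 1 / 2) (-d 1 / 2) with hc0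
  have p0 : 0 < c0 := lt_min (by linarith [h.f1]) (by linarith [h.d1])
  have fc : Continuous f := continuous_iff_continuousAt.2 fun x => (h.hd x).continuousAt
  have e1 : ∀ᶠ x in 𝓝 (1:ℝ), c0 < f x := fc.continuousAt.eventually (lt_mem_nhds (lt_of_le_of_lt (min_le_left _ _) (by linarith [h.f1])))
  have e2 : ∀ᶠ x in 𝓝 (1:ℝ), d x < -c0 := h.dc.continuousAt.eventually (gt_mem_nhds (by
    have := min_le_right (f 1 / 2) (-d 1 / 2); linarith [h.d1]))
  obtain ⟨r0, hr0, hr⟩ := Metric.eventually_nhds_iff.1 (e1.and e2)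
  set r := min r0 1 with hrd
  have rp : 0 < r := lt_min hr0 one_pos
  have r1 : r ≤ 1 := min_le_right _ _
  refine ⟨c0, r / 20, 20 / r, p0, by positivity, ?_, fun N hN => ?_⟩
  · rw [le_div_iff₀ rp]; linarith
  have hNr : 20 ≤ N * r := by rwa [div_le_iff₀ rp] at hN
  have hN0 : 0 < N := by by_contra! hh; nlinarith
  have hN1 : 20 ≤ N := by nlinarith
  have hl : 0 < lam N := by unfold lam; positivity
  have pi3 := Real.pi_gt_three
  have pi4 : Real.pi < 3.15 := Real.pi_lt_d2
  set k0 := ⌈lam N / (2 * Real.pi)⌉₊ with hk0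
  have k0a : lam N ≤ 2 * Real.pi * k0 := by
    have := Nat.le_ceil (lam N / (2 * Real.pi)); rw [div_le_iff₀ (by positivity)] at this; rw [mul_comm]; exact this
  have k0b : 2 * Real.pi * k0 ≤ lam N + 2 * Real.pi := by
    have := (Nat.ceil_lt_add_one (a := lam N / (2 * Real.pi)) (by positivity)).le
    rw [← hk0] at this
    calc 2 * Real.pi * k0 ≤ 2 * Real.pi * (lam N / (2 * Real.pi) + 1) := by gcongr
      _ = _ := by field_simp
  set mm := ⌊r * N / 10⌋₊ with hmm
  have m1 : (mm:ℝ) ≤ r * N / 10 := Nat.floor_le (by positivity)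
  have m2 : r * N / 10 - 1 ≤ mm := by have := Nat.lt_floor_add_one (r * N / 10); rw [← hmm] at this; linarith
  set Y : ℕ → ℝ := fun i => (Real.pi + 2 * Real.pi * (k0 + i)) / lam N with hY
  have Yinj : Function.Injective Y := fun i j hij => by
    simp only [hY] at hij
    have := (div_left_inj' hl.ne').1 hij
    have : (i:ℝ) = j := by nlinarith
    exact_mod_cast this
  have Yl : ∀ i, lam N * Y i = Real.pi + (k0 + i : ℕ) * (2 * Real.pi) := fun i => by
    simp only [hY]; rw [mul_div_cancel₀ _ hl.ne']; push_cast; ring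
  have Yb : ∀ i < mm, 1 ≤ Y i ∧ Y i + 1 / (2 * N) < 1 + r := fun i hi => by
    have hi' : (i:ℝ) + 1 ≤ mm := by exact_mod_cast hi
    have hi0 : (0:ℝ) ≤ i := Nat.cast_nonneg i
    constructor
    · simp only [hY]; rw [le_div_iff₀ hl]; nlinarith
    · have : Y i ≤ 1 + 9/10 * r := by
        simp only [hY]; rw [div_le_iff₀ hl]
        have : 2 * Real.pi * (i:ℝ) ≤ 2 * 3.15 * (r * N / 10) := by
          have : (i:ℝ) ≤ r * N / 10 := by linarith
          gcongr
        unfold lam at *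
        nlinarith
      have : 1 / (2 * N) ≤ r / 40 := by
        rw [div_le_div_iff₀ (by positivity) (by norm_num)]; nlinarith
      linarith
  have near : ∀ i < mm, ∀ x, |x - Y i| ≤ 1 / (2 * N) → c0 < f x ∧ d x < -c0 := fun i hi x hx => by
    apply hr
    rw [Real.dist_eq]
    have h1 := Yb i hi
    have h2 := abs_le.1 hx
    have h3 : 1 / (2 * N) < r := by
      rw [div_lt_iff₀ (by positivity)]; nlinarith
    have : r ≤ r0 := min_le_left _ _
    rw [abs_lt]; constructor <;> linarith
  refine ⟨(Finset.range mm).image Y, ⟨?_, ?_, ?_⟩, ?_, ?_, ?_, ?_, ?_⟩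
  · linarith
  · rw [Finset.card_image_of_injective _ Yinj, Finset.card_range]; nlinarith
  · intro y hy y' hy' hne
    obtain ⟨i, hi, rfl⟩ := Finset.mem_image.1 hy
    obtain ⟨j, hj, rfl⟩ := Finset.mem_image.1 hy'
    have hij : i ≠ j := fun h => hne (by rw [h])
    have : Y i - Y j = 2 * Real.pi / lam N * (i - j) := by simp only [hY]; ring
    rw [this, abs_mul, abs_of_pos (by positivity)]
    have h1 : (1:ℝ) ≤ |(i:ℝ) - j| := by
      have : (1:ℤ) ≤ |(i:ℤ) - j| := Int.one_le_abs (by omega)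
      exact_mod_cast this
    have h2 : 1 / N ≤ 2 * Real.pi / lam N := by
      rw [div_le_div_iff₀ hN0 hl]; unfold lam; nlinarith
    calc 1 / N ≤ 2 * Real.pi / lam N * 1 := by linarith
      _ ≤ _ := by gcongr
  · rw [Finset.card_image_of_injective _ Yinj, Finset.card_range]; linarith
  · intro y hy z
    obtain ⟨i, hi, rfl⟩ := Finset.mem_image.1 hy
    rw [Yl, show Real.pi + (k0 + i : ℕ) * (2 * Real.pi) + z = (z + Real.pi) + (k0 + i : ℕ) * (2 * Real.pi) by ring, Real.sin_add_nat_mul_two_pi, Real.sin_add_pi]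
  · intro y hy z
    obtain ⟨i, hi, rfl⟩ := Finset.mem_image.1 hy
    rw [Yl, show Real.pi + (k0 + i : ℕ) * (2 * Real.pi) + z = (z + Real.pi) + (k0 + i : ℕ) * (2 * Real.pi) by ring, Real.cos_add_nat_mul_two_pi, Real.cos_add_pi]
  · intro y hy x hx
    obtain ⟨i, hi, rfl⟩ := Finset.mem_image.1 hy
    exact (near i (Finset.mem_range.1 hi) x hx).1.le
  · intro y hy x hx
    obtain ⟨i, hi, rfl⟩ := Finset.mem_image.1 hy
    exact (near i (Finset.mem_range.1 hi) x hx).2.le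

end

/-! ### Part P9b -/

noncomputable section

open MeasureTheory Filter
open scoped ENNReal Topology


variable {s T e : ℝ} {u0 : ℝ → ℂ} {w : ℝ → ℝ → ℂ}

theorem IF_le_of_L1 {q : ℝ → ℂ} {c : ℝ} (hc : 0 ≤ c) (h : L1 0 q ≤ ENNReal.ofReal c) (x : ℝ) : ‖IF q x‖ ≤ c := by
  have := (enorm_IF_le q x).trans ((L1_zero q).symm.le.trans h)
  rw [← ofReal_norm] at this
  exact (ENNReal.ofReal_le_ofReal_iff hc).1 this

theorem Sol.BB_small {N K : ℝ} (hN : 1 ≤ N) (hK : 0 < K) (S : Sol s T (1/N) e u0 w) (Z : SZ s N K w) (t x : ℝ) :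
    ‖DD w t x‖ ≤ K ^ 2 ∧ ‖BB (1/N) w t x‖ ≤ K ^ 2 / N := by
  have hN0 : 0 < N := by linarith
  have hρ := rho_facts S.hs hN
  have hD : ∀ x, ‖DD w t x‖ ≤ K ^ 2 := fun x => by
    refine (norm_th_mul_le _ _ _ _).trans ?_
    rw [norm_pow]
    have := IF_le_of_L1 (by have := hρ.1; positivity) (Z.L1a t) x
    have h2 : K * rho s N ≤ K := by nlinarith [hρ.2.1]
    gcongr
    exact this.trans h2
  refine ⟨hD x, ?_⟩
  unfold BB
  rw [norm_mul]
  have h1 := norm_cv_le_sup hD (k := fun x => (kk (1/N) x : ℂ)) (integrable_kk S.hα).ofReal x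
  rw [integral_norm_kk S.hα] at h1
  have : ‖(1/2:ℂ)‖ = 1/2 := by norm_num
  rw [this]
  have h3 : K ^ 2 * (1 / N) = K ^ 2 / N := by ring
  rw [h3] at h1
  have : 0 ≤ K ^ 2 / N := by positivity
  linarith [norm_nonneg (cv (DD w t) (fun x => (kk (1/N) x : ℂ)) x)]

theorem Sol.close {N K : ℝ} (hN : 1 ≤ N) (hK : 0 < K) (S : Sol s T (1/N) e u0 w) (Z : SZ s N K w) {t : ℝ} (ht : t ∈ Set.Icc 0 T) (x : ℝ) :
    ‖IF (ah w t) x - u0 x‖ ≤ (2 * K + K ^ 2) * t / N := by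
  have hN0 : 0 < N := by linarith
  refine dense_le (Measure.dense_of_ae S.GG_ae) isOpen_univ (f := fun x => ‖IF (ah w t) x - u0 x‖)
    (g := fun _ => (2 * K + K ^ 2) * t / N) ?_ continuousOn_const ?_ (Set.mem_univ x)
  · exact ((continuous_IF (S.ah_int t)).sub S.u0c).norm.continuousOn
  · intro z hz _
    have h0 : IF (ah w t) z = w t z := by have := hz t ht; unfold dd at this; exact (sub_eq_zero.1 this).symm
    show ‖IF (ah w t) z - u0 z‖ ≤ _
    rw [h0, S.eq' ht z, sub_sub_cancel_left, norm_neg]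
    have := intervalIntegral.norm_integral_le_of_norm_le_const (a := 0) (b := t) (C := (2 * K + K ^ 2) / N)
      (f := fun τ => (th w τ z * IF (hq w τ) z + e * (IF (Aq (1/N) w τ) z + BB (1/N) w τ z))) ?_
    · refine this.trans (le_of_eq ?_)
      rw [sub_zero, abs_of_nonneg ht.1]; ring
    · intro τ _
      have a1 := (norm_th_mul_le w τ z (IF (hq w τ) z)).trans (IF_le_of_L1 (by positivity) (Z.h1 τ) z)
      have a2 := IF_le_of_L1 (by positivity) (Z.A1 τ) z
      have a3 := (S.BB_small hN hK Z τ z).2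
      have he : ‖(e:ℂ)‖ ≤ 1 := by rcases S.he with h | h <;> simp [h]
      calc ‖(th w τ z * IF (hq w τ) z + e * (IF (Aq (1/N) w τ) z + BB (1/N) w τ z))‖
          ≤ K / N + 1 * (K / N + K ^ 2 / N) := by
            refine (norm_add_le _ _).trans (add_le_add a1 ?_)
            rw [norm_mul]
            refine mul_le_mul he ((norm_add_le _ _).trans (add_le_add a2 a3)) (norm_nonneg _) (by norm_num)
        _ = _ := by ring

theorem U0_deriv {φ : ℝ → ℂ} {f d : ℝ → ℝ} {M : ℝ} (hp : PF φ f d M) (N x : ℝ) :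
    HasDerivAt (U0 s φ N) ((d x * (N ^ (-s) * Real.sin (lam N * x) + N ^ (-1:ℝ)) + f x * (lam N * N ^ (-s) * Real.cos (lam N * x)) : ℝ) : ℂ) x := by
  have h1 : HasDerivAt (fun x => (N ^ (-s) * Real.sin (lam N * x) + N ^ (-1:ℝ)) * f x)
      (d x * (N ^ (-s) * Real.sin (lam N * x) + N ^ (-1:ℝ)) + f x * (lam N * N ^ (-s) * Real.cos (lam N * x))) x := by
    have h2 : HasDerivAt (fun x => lam N * x) (lam N) x := by simpa using (hasDerivAt_id x).const_mul (lam N)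
    have := (((h2.sin).const_mul (N ^ (-s))).add_const (N ^ (-1:ℝ))).mul (hp.hd x)
    refine (this.congr_deriv (g' := _) ?_)
    ring
  have := h1.ofReal_comp
  refine this.congr_of_eventuallyEq (Eventually.of_forall fun y => ?_)
  simp only [U0, hp.eq]; push_cast; ring

theorem real_hk {c0 M ε a b f d lm sn cs : ℝ} (hc0 : 0 < c0) (ha : 0 < a) (hb : 0 < b) (hab : a ≤ b / 2) 
    (hf : c0 ≤ f) (hfM : f ≤ M) (hd : d ≤ -c0) (hdM : -M ≤ d) (hs : |sn| ≤ 1) (hcs : -1 ≤ cs) (hcs' : cs ≤ -(1/2)) {N : ℝ} (hN : 1 ≤ N) (hlm : lm = 17/12 * N)  :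
    c0 * b / 2 ≤ f * (a * sn + b) ∧ f * (a * sn + b) ≤ 2 * M * b ∧ d * (a * sn + b) + f * (lm * a * cs) ≤ -(c0/2) * (b + N * a) ∧
      -(4 * M * (b + N * a)) ≤ d * (a * sn + b) + f * (lm * a * cs) := by
  obtain ⟨s1, s2⟩ := abs_le.1 hs
  have q1 : b / 2 ≤ a * sn + b := by nlinarith
  have q2 : a * sn + b ≤ 2 * b := by nlinarith
  have hM : 0 < M := by linarith
  have hna : 0 < N * a := by positivity
  have q3 : lm * a * cs ≤ -(1/2) * (N * a) := by rw [hlm]; nlinarith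
  have q4 : -(2 * (N * a)) ≤ lm * a * cs := by rw [hlm]; nlinarith
  refine ⟨by nlinarith, by nlinarith, ?_, ?_⟩
  · have : d * (a * sn + b) ≤ -c0 * (b/2) := by nlinarith
    have : f * (lm * a * cs) ≤ c0 * (-(1/2) * (N * a)) := by nlinarith
    nlinarith
  · have : -(M * (2 * b)) ≤ d * (a * sn + b) := by nlinarith
    have : -(M * (2 * (N * a))) ≤ f * (lm * a * cs) := by nlinarith
    nlinarith

theorem real_hk2 {c0 ε M b o A B E E1 F : ℝ} (hc0 : 0 < c0) (hε : 0 < ε) (hε2 : 32 * M * ε ≤ c0 ^ 2) (hε1 : ε ≤ 1) (hM : 1 ≤ M)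
    (hb : 0 < b) (ho : 0 < o) (r1 : c0 * b / 2 ≤ A) (r2 : A ≤ 2 * M * b) (r3 : B ≤ -(c0/2) * o) (r4 : -(4 * M * o) ≤ B)
    (k1 : |E| ≤ ε * b) (k2 : |E1| ≤ ε * o) (k3 : |F| ≤ ε * b * (ε * o)) :
    c0 ^ 2 / 32 * (b * o) ≤ -(3 * (A * B + A * E1 + B * E + F)) := by
  have hbo : 0 < b * o := by positivity
  have m1 : A * B ≤ -(c0 ^ 2 / 4) * (b * o) := by
    have : c0 * b / 2 * (c0 / 2 * o) ≤ A * (-B) := mul_le_mul r1 (by linarith) (by positivity) (le_trans (by positivity) r1)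
    linarith
  have m2 : A * E1 ≤ 2 * M * b * (ε * o) := by
    refine (le_abs_self _).trans ?_
    rw [abs_mul]
    refine mul_le_mul ?_ k2 (abs_nonneg _) (by positivity)
    rw [abs_of_nonneg (le_trans (by positivity) r1)]; exact r2
  have m3 : B * E ≤ 4 * M * o * (ε * b) := by
    refine (le_abs_self _).trans ?_
    rw [abs_mul]
    refine mul_le_mul ?_ k1 (abs_nonneg _) (by positivity)
    have h1 : 0 ≤ 4 * M * o := by positivity
    have h2 : 0 ≤ c0 / 2 * o := by positivity
    rw [abs_le]; constructor
    · exact r4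
    · linarith
  have m4 := (le_abs_self _).trans k3
  have m5 : ε * b * (ε * o) ≤ M * ε * (b * o) := by
    have : ε * ε ≤ M * ε := mul_le_mul_of_nonneg_right (by linarith) hε.le
    calc ε * b * (ε * o) = ε * ε * (b * o) := by ring
      _ ≤ _ := mul_le_mul_of_nonneg_right this hbo.le
  have m6 : M * ε * (b * o) ≤ c0 ^ 2 / 32 * (b * o) := mul_le_mul_of_nonneg_right (by linarith) hbo.le
  have m7 : 0 ≤ c0 ^ 2 * (b * o) := by positivity
  linarith

theorem hk_cell {φ : ℝ → ℂ} {f d : ℝ → ℝ} {M N c0 c1 ε : ℝ} {J : Finset ℝ} (hp : PF φ f d M) (hcl : CL f d c0 c1 N J) (hc0 : 0 < c0)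
    (hN : 1 ≤ N) (hab : N ^ (-s) ≤ N ^ (-1:ℝ) / 2) (hε : 0 < ε) (hε1 : ε ≤ 1) (hε2 : 32 * M * ε ≤ c0 ^ 2)
    (S : Sol s T (1/N) e (U0 s φ N) w) {y : ℝ} (hy : y ∈ J) {t x : ℝ} (hx : |x - y| ≤ 1 / (2 * N))
    (h1 : ‖IF (ah w t) x - U0 s φ N x‖ ≤ ε / N) (h2 : ‖IF (dx (ah w) t) x - IF (dx (ah w) 0) x‖ ≤ ε * om s N) :
    c0 ^ 2 / 32 * (om s N / N) ≤ -(IF (hq w t) x).re := by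
  have hN0 : 0 < N := by linarith
  have hW := S.hW1 0 x
  rw [S.W0] at hW
  rw [hW.unique (U0_deriv hp N x)] at h2
  have hb : N ^ (-1:ℝ) = 1 / N := by rw [Real.rpow_neg_one]; ring
  have hNa : N * N ^ (-s) = N ^ (1 - s) := by
    rw [show 1 - s = 1 + -s by ring, Real.rpow_add hN0, Real.rpow_one]
  have hz : |lam N * (x - y)| ≤ 17/24 := by
    rw [abs_mul, lam, abs_of_pos (by positivity)]
    calc 17/12 * N * |x - y| ≤ 17/12 * N * (1 / (2 * N)) := by gcongr
      _ = 17/24 := by field_simp; norm_num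
  have hlx : lam N * x = lam N * y + lam N * (x - y) := by ring
  have hc : 1/2 ≤ Real.cos (lam N * (x - y)) := by
    have := Real.one_sub_sq_div_two_le_cos (x := lam N * (x - y))
    have h3 := sq_abs (lam N * (x - y))
    nlinarith [abs_nonneg (lam N * (x - y))]
  obtain ⟨r1, r2, r3, r4⟩ := real_hk (M := M) (ε := ε) (a := N ^ (-s)) (b := N ^ (-1:ℝ)) (f := f x) (d := d x) (lm := lam N)
    (sn := Real.sin (lam N * x)) (cs := Real.cos (lam N * x)) hc0 (by positivity) (by positivity) hab (hcl.fl y hy x hx)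
    ((le_abs_self _).trans (hp.fb x)) (hcl.dl y hy x hx) ((abs_le.1 (hp.db x)).1) (Real.abs_sin_le_one _) (Real.neg_one_le_cos _)
    (by rw [hlx, hcl.cos y hy]; linarith) hN rfl
  rw [hNa] at r3 r4
  have hom : N ^ (-1:ℝ) + N ^ (1 - s) = om s N := rfl
  rw [hom] at r3 r4
  set A := f x * (N ^ (-s) * Real.sin (lam N * x) + N ^ (-1:ℝ)) with hA
  set B := d x * (N ^ (-s) * Real.sin (lam N * x) + N ^ (-1:ℝ)) + f x * (lam N * N ^ (-s) * Real.cos (lam N * x)) with hB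
  have hUA : U0 s φ N x = (A : ℂ) := by simp only [U0, hp.eq, hA]; push_cast; ring
  rw [hUA] at h1
  rw [S.h_eq]
  set E := IF (ah w t) x - (A : ℂ) with hE
  set E1 := IF (dx (ah w) t) x - (B : ℂ) with hE1
  have e1 : IF (ah w t) x = A + E := by rw [hE]; ring
  have e2 : IF (dx (ah w) t) x = B + E1 := by rw [hE1]; ring
  rw [e1, e2]
  have hω : 0 < om s N := (om_facts hN).1
  have hM := hp.M1
  have k1 := (Complex.abs_re_le_norm E).trans h1
  have k2 := (Complex.abs_re_le_norm E1).trans h2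
  have k3 : |(E * E1).re| ≤ ε / N * (ε * om s N) := (Complex.abs_re_le_norm _).trans (by
    rw [norm_mul]; exact mul_le_mul h1 h2 (norm_nonneg _) (by positivity))
  have hre : (3 * ((A + E) * (B + E1))).re = 3 * (A * B + A * E1.re + B * E.re + (E * E1).re) := by
    simp [Complex.mul_re, Complex.add_re, Complex.add_im]; ring
  rw [hre]
  have hbp : 0 < N ^ (-1:ℝ) := by positivity
  have hεN : ε / N = ε * N ^ (-1:ℝ) := by rw [hb]; ring
  rw [hεN] at k1 k3
  have hoN : om s N / N = N ^ (-1:ℝ) * om s N := by rw [hb]; ring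
  rw [hoN]
  set b := N ^ (-1:ℝ)
  set o := om s N
  exact real_hk2 hc0 hε hε2 hε1 hM hbp hω r1 r2 r3 r4 k1 k2 k3

end

/-! ### Part P9c -/

noncomputable section

open MeasureTheory Filter
open scoped ENNReal Topology


variable {s T e : ℝ} {u0 : ℝ → ℂ} {w : ℝ → ℝ → ℂ}

def Iy (N y : ℝ) : Set ℝ := Set.Ioo (y - 1 / (2 * N)) (y + 1 / (2 * N))

theorem vol_Iy {N : ℝ} (hN : 0 < N) (y : ℝ) : volume (Iy N y) = ENNReal.ofReal (1 / N) := by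
  unfold Iy
  rw [Real.volume_Ioo]; congr 1; field_simp; ring

theorem sup_avg {N y x : ℝ} (hN : 0 < N) {a : ℝ≥0∞} {g : ℝ → ℝ≥0∞} (hg : Measurable g) {b : ℝ≥0∞}
    (h : ∀ x' ∈ Iy N y, a ≤ g x' + b) : a ≤ ENNReal.ofReal N * (∫⁻ x in Iy N y, g x) + b := by
  have hv := vol_Iy hN y
  have h1 : ENNReal.ofReal (1/N) * a ≤ (∫⁻ x in Iy N y, g x) + ENNReal.ofReal (1/N) * b := by
    calc ENNReal.ofReal (1/N) * a = ∫⁻ x in Iy N y, a := by rw [setLIntegral_const, hv, mul_comm]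
      _ ≤ ∫⁻ x in Iy N y, (g x + b) := setLIntegral_mono (by fun_prop) h
      _ = _ := by rw [lintegral_add_left hg, setLIntegral_const, hv, mul_comm b]
  have h2 : ENNReal.ofReal N * ENNReal.ofReal (1/N) = 1 := by
    rw [← ENNReal.ofReal_mul hN.le, mul_one_div_cancel hN.ne', ENNReal.ofReal_one]
  calc a = ENNReal.ofReal N * (ENNReal.ofReal (1/N) * a) := by rw [← mul_assoc, h2, one_mul]
    _ ≤ ENNReal.ofReal N * ((∫⁻ x in Iy N y, g x) + ENNReal.ofReal (1/N) * b) := by gcongr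
    _ = _ := by rw [mul_add, ← mul_assoc, h2, one_mul]

def qf (N y : ℝ) (q : ℝ → ℂ) : ℝ≥0∞ :=
  ENNReal.ofReal N * (∫⁻ x in Iy N y, ‖IF q x‖ₑ) + ∫⁻ x in Iy N y, ‖IF (fun ξ : ℝ => Complex.I * ξ * q ξ) x‖ₑ

theorem sup_qf {N y x : ℝ} (hN : 0 < N) {q : ℝ → ℂ} (hq : Integrable q) (hq' : Integrable (fun ξ : ℝ => Complex.I * ξ * q ξ))
    (hx : x ∈ Iy N y) : ‖IF q x‖ₑ ≤ qf N y q := by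
  refine sup_avg hN (x := x) (continuous_IF hq).enorm.measurable fun x' hx' => ?_
  have h1 : ∫ z in x'..x, IF (fun ξ : ℝ => Complex.I * ξ * q ξ) z = IF q x - IF q x' :=
    intervalIntegral.integral_eq_sub_of_hasDerivAt (fun z _ => IF_hasDerivAt hq hq' z) ((continuous_IF hq').intervalIntegrable _ _)
  have h2 : ‖IF q x - IF q x'‖ₑ ≤ ∫⁻ x in Iy N y, ‖IF (fun ξ : ℝ => Complex.I * ξ * q ξ) x‖ₑ := by
    rw [← h1]
    have : ‖∫ z in x'..x, IF (fun ξ : ℝ => Complex.I * ξ * q ξ) z‖ₑ ≤ ∫⁻ z in Set.uIoc x' x, ‖IF (fun ξ : ℝ => Complex.I * ξ * q ξ) z‖ₑ := by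
      rw [← ofReal_norm, intervalIntegral.norm_integral_eq_norm_integral_uIoc, ofReal_norm]
      exact enorm_integral_le_lintegral_enorm _
    refine this.trans (lintegral_mono_set ?_)
    intro z hz
    unfold Iy at *
    rw [Set.mem_uIoc] at hz
    simp only [Set.mem_Ioo] at *
    constructor <;> rcases hz with hz | hz <;> linarith [hz.1, hz.2, hx.1, hx.2, hx'.1, hx'.2]
  calc ‖IF q x‖ₑ = ‖IF q x' + (IF q x - IF q x')‖ₑ := by rw [add_sub_cancel]
    _ ≤ _ := (enorm_add_le _ _).trans (by gcongr)

theorem Cells.disj {N : ℝ} {J : Finset ℝ} (hJ : Cells N J) : (J : Set ℝ).PairwiseDisjoint (Iy N) := by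
  intro y hy y' hy' hne
  rw [Function.onFun, Set.disjoint_left]
  intro x hx hx'
  have := hJ.sep y hy y' hy' hne
  have hN := hJ.one
  have : |y - y'| < 1 / N := by
    unfold Iy at *
    have : 1 / N = 1 / (2 * N) + 1 / (2 * N) := by field_simp; norm_num
    rw [abs_lt]; constructor <;> linarith [hx.1, hx.2, hx'.1, hx'.2]
  linarith

theorem Cells.sum_set {N : ℝ} {J : Finset ℝ} (hJ : Cells N J) (g : ℝ → ℝ≥0∞) :
    ∑ y ∈ J, ∫⁻ x in Iy N y, g x = ∫⁻ x in ⋃ y ∈ J, Iy N y, g x :=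
  (lintegral_biUnion_finset hJ.disj (fun _ _ => measurableSet_Ioo) g).symm

theorem Cells.sum_L1 {N : ℝ} {J : Finset ℝ} (hJ : Cells N J) {g : ℝ → ℝ≥0∞} (hg : Measurable g) {A : ℝ} (hA : 0 ≤ A)
    (h : ∫⁻ x, g x ^ 2 ≤ ENNReal.ofReal (A ^ 2)) : ∑ y ∈ J, ∫⁻ x in Iy N y, g x ≤ ENNReal.ofReal A := by
  rw [hJ.sum_set]
  have hN := hJ.one
  have hN0 : 0 < N := by linarith
  set U := ⋃ y ∈ J, Iy N y with hU
  have hUm : MeasurableSet U := Finset.measurableSet_biUnion _ fun _ _ => measurableSet_Ioo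
  have hv : volume U ≤ 1 := by
    refine (measure_biUnion_finset_le _ _).trans ?_
    simp only [vol_Iy hN0, Finset.sum_const, nsmul_eq_mul]
    rw [← ENNReal.ofReal_natCast, ← ENNReal.ofReal_mul (by positivity), ← ENNReal.ofReal_one]
    refine ENNReal.ofReal_le_ofReal ?_
    rw [mul_one_div, div_le_one hN0]; exact hJ.card
  rw [← lintegral_indicator hUm]
  have e1 : ∀ x, U.indicator g x = U.indicator (fun _ => 1) x * g x := fun x => by
    by_cases hx : x ∈ U <;> simp [hx]
  simp_rw [e1]
  have := lintegral_CS (f := U.indicator (fun _ => 1)) (g := g) (measurable_const.indicator hUm).aemeasurable hg.aemeasurable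
  have e2 : ∫⁻ x, (U.indicator (fun _ => (1:ℝ≥0∞)) x) ^ 2 ≤ 1 := by
    have : ∀ x, (U.indicator (fun _ => (1:ℝ≥0∞)) x) ^ 2 = U.indicator (fun _ => 1) x := fun x => by
      by_cases hx : x ∈ U <;> simp [hx]
    simp_rw [this]
    rw [lintegral_indicator hUm]; simpa using hv
  have h3 := this.trans (mul_le_mul' e2 h)
  rw [one_mul, ENNReal.ofReal_pow hA] at h3
  exact (ENNReal.pow_le_pow_left_iff (by norm_num)).1 h3

theorem sum_qf {N A : ℝ} {J : Finset ℝ} (hJ : Cells N J) {q : ℝ → ℂ} (hq : Integrable q) (hq' : Integrable (fun ξ : ℝ => Complex.I * ξ * q ξ))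
    (hA : 0 ≤ A) (h0 : N2 0 q ≤ ENNReal.ofReal (A ^ 2)) (h1 : N2 1 q ≤ ENNReal.ofReal ((N * A) ^ 2)) :
    ∑ y ∈ J, qf N y q ≤ ENNReal.ofReal (6 * (N * A)) := by
  have hN0 : 0 < N := by linarith [hJ.one]
  have hpi : 2 * Real.pi ≤ 9 := by linarith [Real.pi_lt_four, Real.pi_lt_d2]
  have h1' : N2 0 (fun ξ : ℝ => Complex.I * ξ * q ξ) ≤ ENNReal.ofReal ((1 * (N * A)) ^ 2) := by
    refine N2_mult' (σ := 0) (k := 1) zero_le_one (fun ξ => ?_) (by rw [zero_add]; exact h1)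
    exact norm_iξ_le ξ
  rw [one_mul] at h1'
  have key : ∀ (p : ℝ → ℂ) (B : ℝ), Integrable p → 0 ≤ B → N2 0 p ≤ ENNReal.ofReal (B ^ 2) →
      ∑ y ∈ J, ∫⁻ x in Iy N y, ‖IF p x‖ₑ ≤ ENNReal.ofReal (3 * B) := by
    intro p B hp hB h
    refine hJ.sum_L1 (continuous_IF hp).enorm.measurable (by positivity) ((plancherel_IF hp).trans ?_)
    rw [← N2_zero]
    calc ENNReal.ofReal (2 * Real.pi) * N2 0 p ≤ ENNReal.ofReal 9 * ENNReal.ofReal (B ^ 2) :=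
          mul_le_mul' (ENNReal.ofReal_le_ofReal hpi) h
      _ = _ := by rw [← ENNReal.ofReal_mul (by norm_num)]; congr 1; ring
  unfold qf
  rw [Finset.sum_add_distrib, ← Finset.mul_sum]
  calc _ ≤ ENNReal.ofReal N * ENNReal.ofReal (3 * A) + ENNReal.ofReal (3 * (N * A)) :=
        add_le_add (mul_le_mul' le_rfl (key q A hq hA h0)) (key _ _ hq' (by positivity) h1')
    _ = _ := by
        rw [← ENNReal.ofReal_mul hN0.le, ← ENNReal.ofReal_add (by positivity) (by positivity)]; congr 1; ring

theorem gg_harnack {α x x' ζ : ℝ} (hα : 0 < α) (h : |x - x'| ≤ α) : gg α (x - ζ) ≤ 3 * gg α (x' - ζ) := by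
  unfold gg
  have h1 : Real.exp (-|x - ζ| / α) ≤ Real.exp 1 * Real.exp (-|x' - ζ| / α) := by
    rw [← Real.exp_add]
    apply Real.exp_le_exp.2
    have : |x' - ζ| ≤ |x - ζ| + |x - x'| := by
      rw [show x' - ζ = (x - ζ) - (x - x') by ring]; exact abs_sub _ _
    rw [div_le_iff₀ hα, add_mul, div_mul_cancel₀ _ hα.ne']; linarith
  have h2 : Real.exp 1 ≤ 3 := by linarith [Real.exp_one_lt_d9]
  have h3 : Real.exp (-|x - ζ| / α) ≤ 3 * Real.exp (-|x' - ζ| / α) := h1.trans (by gcongr)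
  calc 1 / (2 * α) * Real.exp (-|x - ζ| / α) ≤ 1 / (2 * α) * (3 * Real.exp (-|x' - ζ| / α)) := by gcongr
    _ = _ := by ring

theorem Sol.Gn_jm {α : ℝ} (S : Sol s T α e u0 w) (τ : ℝ) :
    Measurable (fun p : ℝ × ℝ => ‖IF (dx (ah w) τ) p.2‖ₑ ^ 2 * ENNReal.ofReal (gg α (p.1 - p.2))) := by
  have h1 : Continuous (fun p : ℝ × ℝ => IF (dx (ah w) τ) p.2) := (continuous_IF (S.tf1.integrable (by norm_num) τ)).comp continuous_snd
  have h2 : Continuous (fun p : ℝ × ℝ => gg α (p.1 - p.2)) := (continuous_gg α).comp (continuous_fst.sub continuous_snd)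
  exact (h1.enorm.measurable.pow_const 2).mul h2.measurable.ennreal_ofReal

theorem Sol.Gn_meas {α : ℝ} (S : Sol s T α e u0 w) (τ : ℝ) : Measurable (Gn α w τ) := by
  unfold Gn
  exact (S.Gn_jm τ).lintegral_prod_right'

theorem Sol.Gn_int {α : ℝ} (S : Sol s T α e u0 w) (τ : ℝ) : ∫⁻ x, Gn α w τ x = ∫⁻ x, ‖IF (dx (ah w) τ) x‖ₑ ^ 2 := by
  unfold Gn
  rw [lintegral_lintegral_swap (S.Gn_jm τ).aemeasurable]
  refine lintegral_congr fun ζ => ?_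
  rw [lintegral_const_mul _ (by have := continuous_gg α; fun_prop)]
  have : ∫⁻ x, ENNReal.ofReal (gg α (x - ζ)) = 1 := by
    rw [lintegral_sub_right_eq_self (fun x => ENNReal.ofReal (gg α x)) ζ, ← ofReal_integral_eq_lintegral_ofReal (integrable_gg S.hα)
      (Eventually.of_forall (gg_nonneg S.hα)), integral_gg S.hα, ENNReal.ofReal_one]
  rw [this, mul_one]

def Qy (N : ℝ) (w : ℝ → ℝ → ℂ) (y τ : ℝ) : ℝ≥0∞ :=
  (qf N y (dx (hq w) τ) + qf N y (dx (Aq (1/N) w) τ)) + (qf N y (cq w τ) + 3 * (ENNReal.ofReal N * ∫⁻ x in Iy N y, Gn (1/N) w τ x))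

theorem TF.qint {q : ℝ → ℝ → ℂ} (hq : TF 1 q) (τ : ℝ) : Integrable (q τ) ∧ Integrable (fun ξ : ℝ => Complex.I * ξ * q τ ξ) :=
  ⟨hq.integrable (by norm_num) τ, (TF.dx (m := 0) (by norm_num; exact hq)).integrable (by norm_num) τ⟩

theorem Sol.Dn_le_Qy {N : ℝ} (hN : 0 < N) (S : Sol s T (1/N) e u0 w) {x y : ℝ} (hx : x ∈ Iy N y) (τ : ℝ) :
    Dn (1/N) w τ x ≤ Qy N w y τ := by
  unfold Dn Qy
  have t1 : TF 1 (dx (hq w)) := TF.dx (m := 1) (by norm_num; exact S.tfh)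
  have t2 : TF 1 (dx (Aq (1/N) w)) := TF.dx (m := 1) (by rw [show (1:ℝ) + 1 = 2 by norm_num]; exact S.tfA)
  have t3 : TF 1 (cq w) := (TF.cv (by norm_num) S.tf1 S.tf1).mono (by norm_num)
  have i1 := S.tf1.integrable (by norm_num) τ
  have e1 : ‖IF (dx (ah w) τ) x‖ₑ ^ 2 = ‖IF (cq w τ) x‖ₑ := by
    rw [cq, IF_cv i1 i1, ← pow_two, enorm_pow]
  rw [e1]
  refine add_le_add (add_le_add (sup_qf hN (t1.qint τ).1 (t1.qint τ).2 hx) (sup_qf hN (t2.qint τ).1 (t2.qint τ).2 hx))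
    (add_le_add (sup_qf hN (t3.qint τ).1 (t3.qint τ).2 hx) ?_)
  have := sup_avg (y := y) (x := x) hN (a := Gn (1/N) w τ x) (g := fun x => 3 * Gn (1/N) w τ x) (b := 0) ((S.Gn_meas τ).const_mul 3) ?_
  · rw [add_zero, lintegral_const_mul _ (S.Gn_meas τ)] at this
    exact this.trans (le_of_eq (by ring))
  · intro x' hx'
    rw [add_zero]
    unfold Gn
    rw [← lintegral_const_mul' _ _ (by norm_num)]
    refine lintegral_mono fun ζ => ?_
    have h1 : |x - x'| ≤ 1 / N := by
      unfold Iy at *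
      have : 1 / N = 1 / (2 * N) + 1 / (2 * N) := by field_simp; norm_num
      rw [abs_le]; constructor <;> linarith [hx.1, hx.2, hx'.1, hx'.2]
    have h2 : ENNReal.ofReal (gg (1/N) (x - ζ)) ≤ 3 * ENNReal.ofReal (gg (1/N) (x' - ζ)) := by
      have := ENNReal.ofReal_le_ofReal (gg_harnack (ζ := ζ) S.hα h1)
      rwa [ENNReal.ofReal_mul (by norm_num), show ENNReal.ofReal 3 = 3 by norm_num] at this
    calc _ ≤ ‖IF (dx (ah w) τ) ζ‖ₑ ^ 2 * (3 * ENNReal.ofReal (gg (1/N) (x' - ζ))) := mul_le_mul' le_rfl h2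
      _ = _ := by ring

theorem om_le_two {s N : ℝ} (hs : 3/2 < s) (hN : 1 ≤ N) : om s N ≤ 2 := by
  unfold om
  have := Real.rpow_le_one_of_one_le_of_nonpos hN (show (-1:ℝ) ≤ 0 by norm_num)
  have := Real.rpow_le_one_of_one_le_of_nonpos hN (show (1 - s:ℝ) ≤ 0 by linarith)
  linarith

theorem Sol.sum_Qy {N K : ℝ} {J : Finset ℝ} (hJ : Cells N J) (hK : 0 < K) (S : Sol s T (1/N) e u0 w) (Z : SZ s N K w) (τ : ℝ) :
    ∑ y ∈ J, Qy N w y τ ≤ ENNReal.ofReal ((18 * K + 54 * K ^ 2) * (N * om s N)) := by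
  have hN0 : 0 < N := by linarith [hJ.one]
  have hω := (om_facts (s := s) hJ.one).1
  have hω2 := om_le_two S.hs hJ.one
  have t1 : TF 1 (dx (hq w)) := TF.dx (m := 1) (by norm_num; exact S.tfh)
  have t2 : TF 1 (dx (Aq (1/N) w)) := TF.dx (m := 1) (by rw [show (1:ℝ) + 1 = 2 by norm_num]; exact S.tfA)
  have t3 : TF 1 (cq w) := (TF.cv (by norm_num) S.tf1 S.tf1).mono (by norm_num)
  have ee : (K * (N * om s N)) = N * (K * om s N) := by ring
  have hKo : 0 ≤ K * om s N := by positivity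
  have s1 := sum_qf hJ (t1.qint τ).1 (t1.qint τ).2 hKo (Z.dh0 τ) (by rw [← ee]; exact Z.dh1 τ)
  have s2 := sum_qf hJ (t2.qint τ).1 (t2.qint τ).2 hKo (Z.dA0 τ) (by rw [← ee]; exact Z.dA1 τ)
  have s3 := sum_qf hJ (t3.qint τ).1 (t3.qint τ).2 hKo (Z.c0 τ) (by rw [← ee]; exact Z.c1 τ)
  have hpi : 2 * Real.pi ≤ 9 := by linarith [Real.pi_lt_four, Real.pi_lt_d2]
  have s4 : ∑ y ∈ J, ∫⁻ x in Iy N y, Gn (1/N) w τ x ≤ ENNReal.ofReal (18 * K ^ 2 * om s N) := by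
    rw [hJ.sum_set]
    refine (setLIntegral_le_lintegral _ _).trans ?_
    rw [S.Gn_int τ]
    refine (plancherel_IF (S.tf1.integrable (by norm_num) τ)).trans ?_
    rw [← N2_zero]
    calc _ ≤ ENNReal.ofReal 9 * ENNReal.ofReal ((K * om s N) ^ 2) := mul_le_mul' (ENNReal.ofReal_le_ofReal hpi) (Z.w1 τ)
      _ = ENNReal.ofReal (9 * K ^ 2 * om s N * om s N) := by rw [← ENNReal.ofReal_mul (by norm_num)]; congr 1; ring
      _ ≤ _ := by
        refine ENNReal.ofReal_le_ofReal ?_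
        have : 9 * K ^ 2 * om s N * om s N ≤ 9 * K ^ 2 * om s N * 2 := by gcongr
        linarith
  unfold Qy
  rw [Finset.sum_add_distrib, Finset.sum_add_distrib, Finset.sum_add_distrib, ← Finset.mul_sum, ← Finset.mul_sum]
  calc _ ≤ (ENNReal.ofReal (6 * (N * (K * om s N))) + ENNReal.ofReal (6 * (N * (K * om s N)))) + (ENNReal.ofReal (6 * (N * (K * om s N)))
        + ENNReal.ofReal 3 * (ENNReal.ofReal N * ENNReal.ofReal (18 * K ^ 2 * om s N))) := by
        rw [show (3:ℝ≥0∞) = ENNReal.ofReal 3 by norm_num]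
        exact add_le_add (add_le_add s1 s2) (add_le_add s3 (mul_le_mul' le_rfl (mul_le_mul' le_rfl s4)))
    _ = _ := by
        rw [← ENNReal.ofReal_mul hN0.le, ← ENNReal.ofReal_mul (by norm_num), ← ENNReal.ofReal_add (by positivity) (by positivity), ← ENNReal.ofReal_add (by positivity) (by positivity), ← ENNReal.ofReal_add (by positivity) (by positivity)]
        congr 1; ring

theorem sum_lint_le {ι X : Type*} [MeasurableSpace X] (μ : Measure X) (J : Finset ι) (f : ι → X → ℝ≥0∞) :
    ∑ y ∈ J, ∫⁻ τ, f y τ ∂μ ≤ ∫⁻ τ, ∑ y ∈ J, f y τ ∂μ := by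
  classical
  induction J using Finset.induction_on with
  | empty => simp
  | insert a J ha ih =>
    simp only [Finset.sum_insert ha]
    exact (add_le_add le_rfl ih).trans (le_lintegral_add _ _)

open Classical in
/-- Markov: few cells are bad -/
theorem Sol.few_bad {N K B T0 : ℝ} {J : Finset ℝ} (hJ : Cells N J) (hK : 0 < K) (S : Sol s T (1/N) e u0 w) (Z : SZ s N K w)
    (hT0 : 0 ≤ T0) :
    ((J.filter fun y => ¬ ∀ x ∈ Iy N y, ∫⁻ τ in Set.Ioc 0 T0, Dn (1/N) w τ x ≤ ENNReal.ofReal B).card : ℝ) * B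
      ≤ (18 * K + 54 * K ^ 2) * (N * om s N) * T0 := by
  have hN0 : 0 < N := by linarith [hJ.one]
  have hω := (om_facts (s := s) hJ.one).1
  set F := J.filter fun y => ¬ ∀ x ∈ Iy N y, ∫⁻ τ in Set.Ioc 0 T0, Dn (1/N) w τ x ≤ ENNReal.ofReal B with hF
  have h1 : ∑ y ∈ F, ENNReal.ofReal B ≤ ∑ y ∈ F, ∫⁻ τ in Set.Ioc 0 T0, Qy N w y τ := by
    refine Finset.sum_le_sum fun y hy => ?_
    have := (Finset.mem_filter.1 hy).2
    push Not at this
    obtain ⟨x, hx, hlt⟩ := this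
    exact hlt.le.trans (lintegral_mono fun τ => S.Dn_le_Qy hN0 hx τ)
  have h2 : ∑ y ∈ F, ∫⁻ τ in Set.Ioc 0 T0, Qy N w y τ ≤ ∫⁻ τ in Set.Ioc 0 T0, ENNReal.ofReal ((18 * K + 54 * K ^ 2) * (N * om s N)) := by
    refine (Finset.sum_le_sum_of_subset (Finset.filter_subset _ _)).trans ((sum_lint_le _ J _).trans (lintegral_mono fun τ => S.sum_Qy hJ hK Z τ))
  have h3 := h1.trans h2
  rw [setLIntegral_const, Real.volume_Ioc, sub_zero, ← ENNReal.ofReal_mul (by positivity), Finset.sum_const, nsmul_eq_mul,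
    ← ENNReal.ofReal_natCast, ← ENNReal.ofReal_mul (by positivity)] at h3
  exact (ENNReal.ofReal_le_ofReal_iff (by positivity)).1 h3

end

/-! ### Part P9d -/

noncomputable section

open MeasureTheory Filter
open scoped ENNReal Topology


variable {s T e : ℝ} {u0 : ℝ → ℂ} {w : ℝ → ℝ → ℂ}

def SwY (T T0 N : ℝ) (w : ℝ → ℝ → ℂ) (y b : ℝ) : Prop := Sw T w (y - 1 / (2 * N)) (y + 1 / (2 * N)) T0 b

open Classical in
theorem good_cells {φ : ℝ → ℂ} {f d : ℝ → ℝ} {M N c0 c1 ε K T0 : ℝ} {J : Finset ℝ} (hp : PF φ f d M) (hcl : CL f d c0 c1 N J) (hc0 : 0 < c0)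
    (hN : 1 ≤ N) (hab : N ^ (-s) ≤ N ^ (-1:ℝ) / 2) (hε : 0 < ε) (hε1 : ε ≤ 1) (hε2 : 32 * M * ε ≤ c0 ^ 2) (hK : 0 < K)
    (S : Sol s T (1/N) e (U0 s φ N) w) (Z : SZ s N K w) (hT0 : T0 ∈ Set.Icc 0 T) (h1 : (2 * K + K ^ 2) * T0 ≤ ε)
    (h2 : 8 * (18 * K + 54 * K ^ 2) * T0 ≤ c1 * ε) :
    ((J.filter fun y => ¬ ∃ b, SwY T T0 N w y b).card : ℝ) ≤ c1 * N / 4 := by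
  have hN0 : 0 < N := by linarith
  have hω := (om_facts (s := s) hN).1
  have hb := S.few_bad (B := ε * om s N / 2) hcl.cells hK Z hT0.1
  have hsub : (J.filter fun y => ¬ ∃ b, SwY T T0 N w y b) ⊆
      (J.filter fun y => ¬ ∀ x ∈ Iy N y, ∫⁻ τ in Set.Ioc 0 T0, Dn (1/N) w τ x ≤ ENNReal.ofReal (ε * om s N / 2)) := by
    intro y hy
    rw [Finset.mem_filter] at hy ⊢
    refine ⟨hy.1, fun hgood => hy.2 ?_⟩
    have hlt : y - 1 / (2 * N) < y + 1 / (2 * N) := by have : 0 < 1 / (2 * N) := by positivity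
                                                       linarith
    refine S.bootstrap (κ := c0 ^ 2 / 32 * (om s N / N)) (δ := ε * om s N) (B := ε * om s N / 2) hT0 hlt (by positivity) (by positivity)
      (by have : 0 < ε * om s N := by positivity
          linarith) hgood ?_
    intro t ht x hx hd
    refine hk_cell hp hcl hc0 hN hab hε hε1 hε2 S hy.1 ?_ ?_ hd
    · rw [abs_le]; constructor <;> linarith [hx.1, hx.2]
    · refine (S.close hN hK Z ⟨ht.1, ht.2.trans hT0.2⟩ x).trans ?_
      have : (2 * K + K ^ 2) * t ≤ (2 * K + K ^ 2) * T0 := by gcongr; exact ht.2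
      exact div_le_div_of_nonneg_right (this.trans h1) hN0.le
  have hc := Finset.card_le_card hsub
  have hc' : ((J.filter fun y => ¬ ∃ b, SwY T T0 N w y b).card : ℝ) ≤ _ := Nat.cast_le.2 hc
  have h3 : ((J.filter fun y => ¬ ∃ b, SwY T T0 N w y b).card : ℝ) * (ε * om s N / 2) ≤ (c1 * N / 4) * (ε * om s N / 2) := by
    refine (mul_le_mul_of_nonneg_right hc' (by positivity)).trans (hb.trans ?_)
    have := mul_le_mul_of_nonneg_right h2 (show 0 ≤ N * om s N / 8 by positivity)
    linarith
  exact le_of_mul_le_mul_right h3 (by positivity)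

end

/-! ### Part P10 -/

noncomputable section

open MeasureTheory Filter
open scoped ENNReal Topology


variable {s T e : ℝ} {u0 : ℝ → ℂ} {w : ℝ → ℝ → ℂ}

def ez (N y a x : ℝ) : ℂ := Complex.exp (a * ((N * (x - y) : ℝ) : ℂ))

theorem kk_right {N x y ζ : ℝ} (hN : 0 < N) (hx : x ∈ Iy N y) (hζ : ζ ∈ Set.Ioi (y + 1 / (2 * N))) :
    (kk (1/N) (x - ζ) : ℂ) = ez N y 1 x * kk (1/N) (y - ζ) := by
  have h0 : 0 < 1 / (2 * N) := by positivity
  have h1 : ¬ 0 < x - ζ := by have := hx.2; have := Set.mem_Ioi.1 hζ; linarith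
  have h2 : ¬ 0 < y - ζ := by have := Set.mem_Ioi.1 hζ; linarith
  unfold kk ez
  rw [if_neg h1, if_neg h2, show (x - ζ) / (1/N) = N * (x - y) + (y - ζ) / (1/N) by field_simp; ring, Real.exp_add]
  push_cast; rw [one_mul]; ring

theorem kk_left {N x y ζ : ℝ} (hN : 0 < N) (hx : x ∈ Iy N y) (hζ : ζ ∈ Set.Iic (y - 1 / (2 * N))) :
    (kk (1/N) (x - ζ) : ℂ) = ez N y (-1) x * kk (1/N) (y - ζ) := by
  have h0 : 0 < 1 / (2 * N) := by positivity
  have h1 : 0 < x - ζ := by have := hx.1; have := Set.mem_Iic.1 hζ; linarith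
  have h2 : 0 < y - ζ := by have := Set.mem_Iic.1 hζ; linarith
  unfold kk ez
  rw [if_pos h1, if_pos h2, show -(x - ζ) / (1/N) = -(N * (x - y)) + -(y - ζ) / (1/N) by field_simp; ring, Real.exp_add]
  push_cast; rw [neg_one_mul]; ring

theorem kk_shift_int {α : ℝ} (hα : 0 < α) (x : ℝ) : Integrable (fun ζ => (kk α (x - ζ) : ℂ)) :=
  ((integrable_kk hα).comp_sub_left x).ofReal

theorem Dkk_int {α M : ℝ} (hα : 0 < α) {D : ℝ → ℂ} (hD : Integrable D) (x : ℝ) :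
    Integrable (fun ζ => D ζ * (kk α (x - ζ) : ℂ)) := by
  refine Integrable.mul_bdd (c := 1/2) hD ?_ (Eventually.of_forall fun ζ => ?_)
  · exact (kk_shift_int hα x).aestronglyMeasurable
  · rw [Complex.norm_real]; exact abs_kk_le hα _

theorem cv_split {N y x : ℝ} (hN : 0 < N) {D : ℝ → ℂ} (hD : Integrable D) (hx : x ∈ Iy N y) :
    cv D (fun x => (kk (1/N) x : ℂ)) x = (∫ ζ in (y - 1 / (2 * N))..(y + 1 / (2 * N)), D ζ * (kk (1/N) (x - ζ) : ℂ)) +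
      (ez N y 1 x * (∫ ζ in Set.Ioi (y + 1 / (2 * N)), D ζ * (kk (1/N) (y - ζ) : ℂ)) +
       ez N y (-1) x * ∫ ζ in Set.Iic (y - 1 / (2 * N)), D ζ * (kk (1/N) (y - ζ) : ℂ)) := by
  have hα : 0 < 1/N := by positivity
  have hlt : y - 1 / (2 * N) ≤ y + 1 / (2 * N) := by have : 0 < 1 / (2 * N) := by positivity
                                                     linarith
  have hi := Dkk_int (M := 0) hα hD x
  have e1 : ∫ ζ in Set.Ioi (y + 1 / (2 * N)), D ζ * (kk (1/N) (x - ζ) : ℂ) = ez N y 1 x * (∫ ζ in Set.Ioi (y + 1 / (2 * N)), D ζ * (kk (1/N) (y - ζ) : ℂ)) := by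
    rw [← integral_const_mul]
    refine setIntegral_congr_fun measurableSet_Ioi fun ζ hζ => ?_
    show _ = _
    rw [kk_right hN hx hζ]; ring
  have e2 : ∫ ζ in Set.Iic (y - 1 / (2 * N)), D ζ * (kk (1/N) (x - ζ) : ℂ) = ez N y (-1) x * (∫ ζ in Set.Iic (y - 1 / (2 * N)), D ζ * (kk (1/N) (y - ζ) : ℂ)) := by
    rw [← integral_const_mul]
    refine setIntegral_congr_fun measurableSet_Iic fun ζ hζ => ?_
    show _ = _
    rw [kk_left hN hx hζ]; ring
  rw [← e1, ← e2]
  unfold cv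
  rw [intervalIntegral.integral_of_le hlt, ← intervalIntegral.integral_Iic_add_Ioi (b := y - 1 / (2 * N)) hi.integrableOn hi.integrableOn,
    ← Set.Ioc_union_Ioi_eq_Ioi hlt, setIntegral_union (Set.Ioc_disjoint_Ioi le_rfl) measurableSet_Ioi hi.integrableOn hi.integrableOn]
  ring

theorem tail_bdd {α M y : ℝ} (hα : 0 < α) {D : ℝ → ℂ} (hM : ∀ x, ‖D x‖ ≤ M) (A : Set ℝ) :
    ‖∫ ζ in A, D ζ * (kk α (y - ζ) : ℂ)‖ ≤ M * α := by
  have hM0 : 0 ≤ M := (norm_nonneg _).trans (hM 0)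
  calc ‖∫ ζ in A, D ζ * (kk α (y - ζ) : ℂ)‖ ≤ ∫ ζ in A, M * ‖(kk α (y - ζ) : ℂ)‖ := by
        refine norm_integral_le_of_norm_le ((kk_shift_int hα y).norm.const_mul M).integrableOn (Eventually.of_forall fun ζ => ?_)
        rw [norm_mul]; gcongr; exact hM ζ
    _ ≤ ∫ ζ, M * ‖(kk α (y - ζ) : ℂ)‖ := setIntegral_le_integral ((kk_shift_int hα y).norm.const_mul M) (Eventually.of_forall fun ζ => by positivity)
    _ = M * α := by
        rw [integral_const_mul, integral_sub_left_eq_self (fun ζ => ‖(kk α ζ : ℂ)‖) volume y, integral_norm_kk hα]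

theorem tail_meas {α y : ℝ} {D : ℝ → ℝ → ℂ} (hD : Measurable (fun p : ℝ × ℝ => D p.1 p.2)) (A : Set ℝ) :
    Measurable (fun τ => ∫ ζ in A, D τ ζ * (kk α (y - ζ) : ℂ)) := by
  have : Measurable (fun p : ℝ × ℝ => D p.1 p.2 * (kk α (y - p.2) : ℂ)) := by
    have := measurable_kk α
    fun_prop
  exact (this.stronglyMeasurable.integral_prod_right' (ν := volume.restrict A)).measurable

theorem split_time {N M : ℝ} (hN : 0 < N) {D : ℝ → ℝ → ℂ} (hm : Measurable (fun p : ℝ × ℝ => D p.1 p.2)) (hD : ∀ τ, Integrable (D τ))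
    (hM : ∀ τ x, ‖D τ x‖ ≤ M) (y : ℝ) {t : ℝ} (ht : 0 ≤ t) : ∃ Cp Cm : ℂ, ‖Cp‖ ≤ M / N * t ∧ ‖Cm‖ ≤ M / N * t ∧ ∀ x ∈ Iy N y,
      ∫ τ in (0:ℝ)..t, cv (D τ) (fun x => (kk (1/N) x : ℂ)) x = 
        (∫ τ in (0:ℝ)..t, ∫ ζ in (y - 1 / (2 * N))..(y + 1 / (2 * N)), D τ ζ * (kk (1/N) (x - ζ) : ℂ)) + (Cp * ez N y 1 x + Cm * ez N y (-1) x) := by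
  have hα : 0 < 1/N := by positivity
  have hlt : y - 1 / (2 * N) ≤ y + 1 / (2 * N) := by have : 0 < 1 / (2 * N) := by positivity
                                                     linarith
  have bd : ∀ A : Set ℝ, ∀ τ x, ‖∫ ζ in A, D τ ζ * (kk (1/N) (x - ζ) : ℂ)‖ ≤ M / N := fun A τ x =>
    (tail_bdd hα (hM τ) A).trans (le_of_eq (by ring))
  have ii : ∀ A : Set ℝ, ∀ x, IntervalIntegrable (fun τ => ∫ ζ in A, D τ ζ * (kk (1/N) (x - ζ) : ℂ)) volume 0 t := fun A x =>
    ii_bdd (tail_meas hm A) (fun τ _ => bd A τ x)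
  have nb : ∀ A : Set ℝ, ‖∫ τ in (0:ℝ)..t, ∫ ζ in A, D τ ζ * (kk (1/N) (y - ζ) : ℂ)‖ ≤ M / N * t := fun A => by
    have := intervalIntegral.norm_integral_le_of_norm_le_const (a := 0) (b := t) (C := M / N)
      (f := fun τ => ∫ ζ in A, D τ ζ * (kk (1/N) (y - ζ) : ℂ)) (fun τ _ => bd A τ y)
    rwa [sub_zero, abs_of_nonneg ht] at this
  refine ⟨_, _, nb (Set.Ioi (y + 1 / (2 * N))), nb (Set.Iic (y - 1 / (2 * N))), fun x hx => ?_⟩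
  simp_rw [fun τ => cv_split hN (hD τ) hx]
  have i1 := ii (Set.Ioc (y - 1 / (2 * N)) (y + 1 / (2 * N))) x
  simp_rw [intervalIntegral.integral_of_le hlt]
  rw [intervalIntegral.integral_add i1 (((ii _ y).const_mul _).add ((ii _ y).const_mul _)),
    intervalIntegral.integral_add ((ii _ y).const_mul _) ((ii _ y).const_mul _), intervalIntegral.integral_const_mul, intervalIntegral.integral_const_mul]
  ring

theorem IF_mul_m2 {α : ℝ} (hα : 0 < α) {q : ℝ → ℂ} (hq : Integrable q) (x : ℝ) :
    IF (fun ξ => m2 α ξ * q ξ) x = cv (IF q) (fun x => (kk α x : ℂ)) x := by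
  unfold cv
  rw [pairing hq (kk_shift_int hα x)]
  unfold IF
  refine integral_congr_ae (Eventually.of_forall fun ξ => ?_)
  show m2 α ξ * q ξ * _ = q ξ * _
  have : fourierT (fun ζ => (kk α (x - ζ) : ℂ)) (-ξ) = Complex.exp (Complex.I * ξ * x) * m2 α ξ := by
    rw [m2, ← fourierT_kk hα ξ]
    unfold fourierT
    rw [← integral_const_mul, ← integral_sub_left_eq_self _ volume x]
    refine integral_congr_ae (Eventually.of_forall fun ζ => ?_)
    show _ = _
    simp only [sub_sub_cancel]
    rw [mul_left_comm, ← Complex.exp_add]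
    congr 2; push_cast; ring
  rw [this]; ring

/-- the nonlocal term on a good cell -/
theorem Sol.bt_cell {N K T0 y b : ℝ} (hN : 1 ≤ N) (hK : 0 < K) (S : Sol s T (1/N) e u0 w) (Z : SZ s N K w) 
    (hb : SwY T T0 N w y b) {t : ℝ} (ht : t ∈ Set.Icc 0 T0) :
    ∃ Cp Cm : ℂ, ‖Cp‖ ≤ K ^ 2 / N * t ∧ ‖Cm‖ ≤ K ^ 2 / N * t ∧ ∀ x ∈ Iy N y,
      bt (1/N) w t x = (1/2) * (∫ τ in (0:ℝ)..min t b, IF (mq (1/N) w τ) x) + (Cp * ez N y 1 x + Cm * ez N y (-1) x) := by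
  have hN0 : 0 < N := by linarith
  have hα := S.hα
  have hρ := rho_facts S.hs hN
  have hlt : y - 1 / (2 * N) ≤ y + 1 / (2 * N) := by have : 0 < 1 / (2 * N) := by positivity
                                                     linarith
  have hb0 := hb.1.1
  have htb : 0 ≤ min t b := le_min ht.1 hb0
  have hWc := S.W1c
  set W2 : ℝ → ℝ → ℂ := fun τ x => IF (dx (ah w) τ) x ^ 2 with hW2
  have hW2m : Measurable (fun p : ℝ × ℝ => W2 p.1 p.2) := (hWc.pow 2).measurable
  have hW2b : ∀ τ x, ‖W2 τ x‖ ≤ K ^ 2 := fun τ x => by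
    rw [hW2, norm_pow]
    have := IF_le_of_L1 (by have := hρ.1; positivity) (Z.L1a τ) x
    have h2 : K * rho s N ≤ K := by nlinarith [hρ.2.1]
    gcongr
    exact this.trans h2
  obtain ⟨p1, n1, hp1, hn1, e1⟩ := split_time hN0 S.DD_meas S.DD_int (fun τ x => (S.BB_small hN hK Z τ x).1) y ht.1
  obtain ⟨p2, n2, hp2, hn2, e2⟩ := split_time hN0 hW2m S.W1sq_int hW2b y htb
  have hmq : ∀ τ x, IF (mq (1/N) w τ) x = cv (W2 τ) (fun x => (kk (1/N) x : ℂ)) x := fun τ x => by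
    have i1 := S.tf1.integrable (by norm_num) τ
    have : IF (cq w τ) = W2 τ := by ext z; rw [cq, IF_cv i1 i1, hW2]; ring
    have hc : Integrable (cq w τ) := cv_integrable i1 i1
    rw [← this, ← IF_mul_m2 hα hc]; rfl
  have hle : K ^ 2 / N * min t b ≤ K ^ 2 / N * t := by gcongr; exact min_le_left _ _
  refine ⟨(1/2) * (p1 - p2), (1/2) * (n1 - n2), ?_, ?_, fun x hx => ?_⟩
  · rw [norm_mul, show ‖(1/2:ℂ)‖ = 1/2 by norm_num]; linarith [norm_sub_le p1 p2]
  · rw [norm_mul, show ‖(1/2:ℂ)‖ = 1/2 by norm_num]; linarith [norm_sub_le n1 n2]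
  · have hbt : bt (1/N) w t x = (1/2) * ∫ τ in (0:ℝ)..t, cv (DD w τ) (fun x => (kk (1/N) x : ℂ)) x := by
      unfold bt BB; rw [intervalIntegral.integral_const_mul]
    simp_rw [hmq]
    rw [hbt, e1 x hx, e2 x hx]
    have km : Measurable (fun p : ℝ × ℝ => (kk (1/N) (x - p.2) : ℂ)) := by have := measurable_kk (1/N); fun_prop
    have kb : ∀ ζ, ‖(kk (1/N) (x - ζ) : ℂ)‖ ≤ 1/2 := fun ζ => by rw [Complex.norm_real]; exact abs_kk_le hα _
    have key : (∫ τ in (0:ℝ)..t, ∫ ζ in (y - 1 / (2 * N))..(y + 1 / (2 * N)), DD w τ ζ * (kk (1/N) (x - ζ) : ℂ)) =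
        ∫ τ in (0:ℝ)..min t b, ∫ ζ in (y - 1 / (2 * N))..(y + 1 / (2 * N)), W2 τ ζ * (kk (1/N) (x - ζ) : ℂ) := by
      rw [swap_bdd (f := fun τ ζ => DD w τ ζ * (kk (1/N) (x - ζ) : ℂ)) (M := K ^ 2 * (1/2)) (S.DD_meas.mul km) (fun τ _ ζ => by
            rw [norm_mul]; exact mul_le_mul (S.BB_small hN hK Z τ ζ).1 (kb ζ) (norm_nonneg _) (by positivity)),
        swap_bdd (f := fun τ ζ => W2 τ ζ * (kk (1/N) (x - ζ) : ℂ)) (M := K ^ 2 * (1/2)) (hW2m.mul km) (fun τ _ ζ => by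
            rw [norm_mul]; exact mul_le_mul (hW2b τ ζ) (kb ζ) (norm_nonneg _) (by positivity))]
      refine intervalIntegral.integral_congr_ae ?_
      have hne : ∀ᵐ ζ : ℝ, ζ ≠ y + 1 / (2 * N) := by simp [ae_iff]
      filter_upwards [S.GG_ae, hne] with ζ hζ hζ1 hζ2
      rw [Set.uIoc_of_le hlt] at hζ2
      rw [intervalIntegral.integral_mul_const, intervalIntegral.integral_mul_const]
      congr 1
      exact sw_int hb ⟨hζ2.1, lt_of_le_of_ne hζ2.2 hζ1⟩ hζ ht (f := fun τ => W2 τ ζ) ((S.tf1.mono (by norm_num)).tcont ζ |>.pow 2)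
    rw [key]; ring

end

/-! ### Part P10b -/

noncomputable section

open MeasureTheory Filter
open scoped ENNReal Topology


variable {s T e : ℝ} {u0 : ℝ → ℂ} {w : ℝ → ℝ → ℂ}

theorem VV.cont {H : ℝ → ℂ} (h : VV H) : Continuous H := h.smooth.continuous

theorem cc_int {H : ℝ → ℂ} (h : VV H) {N : ℝ} (hN : 0 < N) (y : ℝ) {f : ℝ → ℂ} (hf : Continuous f) :
    Integrable (fun x => f x * H (N * (x - y))) := by
  have := h.mul_int (g := fun z => f (z / N + y)) (by fun_prop)
  have := integrable_scale this hN y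
  refine this.congr (Eventually.of_forall fun x => ?_)
  beta_reduce
  rw [mul_comm]; congr 2; field_simp; ring

theorem VV.zero_out {H : ℝ → ℂ} (h : VV H) {N y x : ℝ} (hN : 0 < N) (hx : x ∉ Iy N y) : H (N * (x - y)) = 0 := by
  refine h.zero ?_
  rw [abs_mul, abs_of_pos hN]
  have h1 : 1 / (2 * N) ≤ |x - y| := by
    by_contra hc
    rw [not_le, abs_lt] at hc
    exact hx ⟨by linarith [hc.1], by linarith [hc.2]⟩
  have h2 : N * (1 / (2 * N)) = 1/2 := by field_simp
  have := mul_le_mul_of_nonneg_left h1 hN.le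
  linarith

theorem cc_congr {H : ℝ → ℂ} (h : VV H) {N : ℝ} (hN : 0 < N) (y : ℝ) {f g : ℝ → ℂ} (hfg : ∀ x ∈ Iy N y, f x = g x) :
    cc H N y f = cc H N y g := by
  unfold cc
  refine integral_congr_ae (Eventually.of_forall fun x => ?_)
  beta_reduce
  by_cases hx : x ∈ Iy N y
  · rw [hfg x hx]
  · rw [h.zero_out hN hx]; simp

theorem cc_add {H : ℝ → ℂ} (h : VV H) {N : ℝ} (hN : 0 < N) (y : ℝ) {f g : ℝ → ℂ} (hf : Continuous f) (hg : Continuous g) :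
    cc H N y (fun x => f x + g x) = cc H N y f + cc H N y g := by
  unfold cc
  rw [← integral_add (cc_int h hN y hf) (cc_int h hN y hg)]
  simp_rw [add_mul]

theorem cc_sub {H : ℝ → ℂ} (h : VV H) {N : ℝ} (hN : 0 < N) (y : ℝ) {f g : ℝ → ℂ} (hf : Continuous f) (hg : Continuous g) :
    cc H N y (fun x => f x - g x) = cc H N y f - cc H N y g := by
  unfold cc
  rw [← integral_sub (cc_int h hN y hf) (cc_int h hN y hg)]
  simp_rw [sub_mul]

theorem cc_smul (H : ℝ → ℂ) (N y : ℝ) (c : ℂ) (f : ℝ → ℂ) :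
    cc H N y (fun x => c * f x) = c * cc H N y f := by
  unfold cc
  rw [← integral_const_mul]
  simp_rw [mul_assoc]

theorem cc_ez (H : ℝ → ℂ) (N y a : ℝ) (f : ℝ → ℂ) : cc H N y (fun x => ez N y a x * f x) = cc (ex a H) N y f := by
  unfold cc ez ex
  refine integral_congr_ae (Eventually.of_forall fun x => ?_)
  beta_reduce
  ring

theorem cc_ii {H : ℝ → ℂ} (h : VV H) {N : ℝ} (hN : 0 < N) (y : ℝ) (f : ℝ → ℂ) :
    cc H N y f = ∫ x in (y - 1 / (2 * N))..(y + 1 / (2 * N)), f x * H (N * (x - y)) := by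
  have h0 : 0 < 1 / (2 * N) := by positivity
  rw [intervalIntegral.integral_of_le (by linarith), ← integral_indicator measurableSet_Ioc]
  unfold cc
  refine integral_congr_ae (Eventually.of_forall fun x => ?_)
  beta_reduce
  by_cases hx : x ∈ Set.Ioc (y - 1 / (2 * N)) (y + 1 / (2 * N))
  · rw [Set.indicator_of_mem hx]
  · rw [Set.indicator_of_notMem hx, h.zero_out hN (fun h' => hx ⟨h'.1, h'.2.le⟩), mul_zero]

theorem cc_tint {H : ℝ → ℂ} (h : VV H) {N : ℝ} (hN : 0 < N) (y : ℝ) {F : ℝ → ℝ → ℂ} (hF : Continuous (fun p : ℝ × ℝ => F p.1 p.2)) (r : ℝ) :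
    cc H N y (fun x => ∫ τ in (0:ℝ)..r, F τ x) = ∫ τ in (0:ℝ)..r, cc H N y (F τ) := by
  have hc := h.cont
  simp_rw [cc_ii h hN, ← intervalIntegral.integral_mul_const]
  refine (intervalIntegral_intervalIntegral_swap ?_).symm
  have : Continuous (fun p : ℝ × ℝ => F p.1 p.2 * H (N * (p.2 - y))) := by fun_prop
  exact (this.continuousOn.integrableOn_compact (isCompact_uIcc.prod isCompact_uIcc)).mono_set
    (Set.prod_mono Set.uIoc_subset_uIcc Set.uIoc_subset_uIcc)

theorem cc_tcont {H : ℝ → ℂ} (h : VV H) {N : ℝ} (hN : 0 < N) (y : ℝ) {F : ℝ → ℝ → ℂ} (hF : Continuous (fun p : ℝ × ℝ => F p.1 p.2)) :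
    Continuous (fun τ => cc H N y (F τ)) := by
  have hc := h.cont
  simp_rw [cc_ii h hN]
  refine intervalIntegral.continuous_parametric_intervalIntegral_of_continuous' (f := fun τ x => F τ x * H (N * (x - y))) ?_ _ _
  show Continuous (fun p : ℝ × ℝ => F p.1 p.2 * H (N * (p.2 - y)))
  fun_prop

theorem cc_dx {H : ℝ → ℂ} (h : VV H) {N : ℝ} (hN : 0 < N) (y : ℝ) {q : ℝ → ℂ} (hq : Integrable q)
    (hq' : Integrable (fun ξ : ℝ => Complex.I * ξ * q ξ)) :
    cc H N y (IF (fun ξ : ℝ => Complex.I * ξ * q ξ)) = -(N * cc (deriv H) N y (IF q)) := by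
  have hd : ∀ x, HasDerivAt (fun x => H (N * (x - y))) (N * deriv H (N * (x - y))) x := fun x => by
    have h1 : HasDerivAt (fun x : ℝ => N * (x - y)) N x := by
      simpa using ((hasDerivAt_id x).sub_const y).const_mul N
    have := (h.hd (N * (x - y))).scomp x h1
    rw [Complex.real_smul] at this
    exact this
  have hi := cc_int h.deriv hN y (continuous_IF hq)
  have key := integral_mul_deriv_eq_deriv_mul_of_integrable (u := IF q) (u' := IF (fun ξ : ℝ => Complex.I * ξ * q ξ))
    (v := fun x => H (N * (x - y))) (v' := fun x => N * deriv H (N * (x - y))) (fun x _ => IF_hasDerivAt hq hq' x) (fun x _ => hd x)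
    (by refine (hi.const_mul (N:ℂ)).congr (Eventually.of_forall fun x => ?_)
        simp only [Pi.mul_apply]; ring)
    (cc_int h hN y (continuous_IF hq')) (cc_int h hN y (continuous_IF hq))
  unfold cc
  rw [← integral_const_mul, ← neg_eq_iff_eq_neg, ← key]
  refine integral_congr_ae (Eventually.of_forall fun x => ?_)
  beta_reduce
  ring

theorem Sol.tfm {α : ℝ} (S : Sol s T α e u0 w) : TF 2 (mq α w) :=
  TF.mult (m := 2) (k := 0) S.hα.le (measurable_m2 α) (bd_m2 S.hα) (by rw [add_zero]; exact TF.cv (by norm_num) S.tf1 S.tf1)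

/-- testing the solution formula on a good cell -/
theorem Sol.cell_cc {N K T0 y b : ℝ} (hN : 1 ≤ N) (hK : 0 < K) (S : Sol s T (1/N) e u0 w) (Z : SZ s N K w) (hT0 : T0 ∈ Set.Icc 0 T)
    (hb : SwY T T0 N w y b) {t : ℝ} (ht : t ∈ Set.Icc 0 T0) {H : ℝ → ℂ} (h : VV H) {g : ℝ → ℂ} (hg : Continuous g) :
    ∃ Cp Cm : ℂ, ‖Cp‖ ≤ K ^ 2 / N * t ∧ ‖Cm‖ ≤ K ^ 2 / N * t ∧
      cc H N y (fun x => IF (ah w t) x * g x) = cc H N y (fun x => u0 x * g x) - (∫ τ in (0:ℝ)..min t b, cc H N y (fun x => IF (hq w τ) x * g x))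
        - e * ((∫ τ in (0:ℝ)..t, cc H N y (fun x => IF (Aq (1/N) w τ) x * g x)) +
          ((1/2) * (∫ τ in (0:ℝ)..min t b, cc H N y (fun x => IF (mq (1/N) w τ) x * g x)) +
            (Cp * cc (ex 1 H) N y g + Cm * cc (ex (-1) H) N y g))) := by
  have hN0 : 0 < N := by linarith
  obtain ⟨Cp, Cm, hp, hm, hbt⟩ := S.bt_cell hN hK Z hb ht
  refine ⟨Cp, Cm, hp, hm, ?_⟩
  have ch := (S.tfh.mono (by norm_num : (0:ℝ) ≤ 2))
  have cA := (S.tfA.mono (by norm_num : (0:ℝ) ≤ 2))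
  have cm := (S.tfm.mono (by norm_num : (0:ℝ) ≤ 2))
  have J : ∀ {q : ℝ → ℝ → ℂ}, TF 0 q → Continuous (fun p : ℝ × ℝ => IF (q p.1) p.2 * g p.2) := fun hq =>
    hq.continuous.mul (hg.comp continuous_snd)
  have I : ∀ {q : ℝ → ℝ → ℂ}, TF 0 q → ∀ r, ∫ τ in (0:ℝ)..r, cc H N y (fun x => IF (q τ) x * g x) =
      cc H N y (fun x => (∫ τ in (0:ℝ)..r, IF (q τ) x) * g x) := fun hq r => by
    simp_rw [← intervalIntegral.integral_mul_const]
    rw [cc_tint h hN0 y (J hq)]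
  have C0 : ∀ {q : ℝ → ℝ → ℂ}, TF 0 q → ∀ r, Continuous (fun x => (∫ τ in (0:ℝ)..r, IF (q τ) x) * g x) := fun hq r => (hq.tint_cont r).mul hg
  have ez_c : ∀ a, Continuous (fun x => ez N y a x) := fun a => by unfold ez; fun_prop
  have u0c := S.u0c
  have e1 : cc H N y (fun x => IF (ah w t) x * g x) = cc H N y (fun x => (u0 x * g x - (∫ τ in (0:ℝ)..min t b, IF (hq w τ) x) * g x)
      - e * ((∫ τ in (0:ℝ)..t, IF (Aq (1/N) w τ) x) * g x + ((1/2) * ((∫ τ in (0:ℝ)..min t b, IF (mq (1/N) w τ) x) * g x) +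
        (Cp * (ez N y 1 x * g x) + Cm * (ez N y (-1) x * g x))))) := by
    refine cc_congr h hN0 y fun x hx => ?_
    have f := S.formula hT0 hb ht hx
    rw [Yy, S.W0, hbt x hx] at f
    linear_combination (-(g x)) * f
  have k1 := C0 ch (min t b)
  have k2 := C0 cA t
  have k3 := C0 cm (min t b)
  have k4 : Continuous (fun x => ez N y 1 x * g x) := (ez_c 1).mul hg
  have k5 : Continuous (fun x => ez N y (-1) x * g x) := (ez_c (-1)).mul hg
  have sm : ∀ {f : ℝ → ℂ} (c : ℂ), Continuous f → Continuous (fun x => c * f x) := fun c hf => continuous_const.mul hf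
  have ad : ∀ {f g : ℝ → ℂ}, Continuous f → Continuous g → Continuous (fun x => f x + g x) := fun hf hg => hf.add hg
  have k0 : Continuous (fun x => u0 x * g x) := u0c.mul hg
  have k9 : Continuous (fun x => u0 x * g x - (∫ τ in (0:ℝ)..min t b, IF (hq w τ) x) * g x) := k0.sub k1
  have k6 := ad (sm Cp k4) (sm Cm k5)
  have k7 := ad (sm (1/2:ℂ) k3) k6
  have k8 := ad k2 k7
  rw [e1, cc_sub h hN0 y k9 (sm (e:ℂ) k8), cc_sub h hN0 y k0 k1, cc_smul,
    cc_add h hN0 y k2 k7, cc_add h hN0 y (sm _ k3) k6, cc_smul, cc_add h hN0 y (sm _ k4) (sm _ k5),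
    cc_smul, cc_smul, cc_ez, cc_ez, I ch, I cA, I cm]

theorem sum_time {J : Finset ℝ} {f : ℝ → ℝ → ℂ} (hf : ∀ y, Continuous (f y)) {r : ℝ → ℝ} {t M : ℝ} (ht : 0 ≤ t) (hr : ∀ y ∈ J, r y ∈ Set.Icc 0 t)
    (hM : ∀ τ ∈ Set.Icc 0 t, ∑ y ∈ J, ‖f y τ‖ ≤ M) : ∑ y ∈ J, ‖∫ τ in (0:ℝ)..r y, f y τ‖ ≤ M * t := by
  have i : ∀ y a b, IntervalIntegrable (fun τ => ‖f y τ‖) volume a b := fun y a b => (hf y).norm.intervalIntegrable a b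
  calc ∑ y ∈ J, ‖∫ τ in (0:ℝ)..r y, f y τ‖ ≤ ∑ y ∈ J, ∫ τ in (0:ℝ)..t, ‖f y τ‖ := by
        refine Finset.sum_le_sum fun y hy => ?_
        refine (intervalIntegral.norm_integral_le_integral_norm (hr y hy).1).trans ?_
        exact intervalIntegral.integral_mono_interval le_rfl (hr y hy).1 (hr y hy).2 (Eventually.of_forall fun τ => norm_nonneg _) (i y _ _)
    _ = ∫ τ in (0:ℝ)..t, ∑ y ∈ J, ‖f y τ‖ := (intervalIntegral.integral_finset_sum fun y _ => i y _ _).symm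
    _ ≤ ∫ τ in (0:ℝ)..t, M := intervalIntegral.integral_mono_on ht
        ((continuous_finset_sum _ fun y _ => (hf y).norm).intervalIntegrable _ _) (by simp) hM
    _ = M * t := by simp [mul_comm]

end

/-! ### Part P10c -/

noncomputable section

open MeasureTheory Filter
open scoped ENNReal Topology


variable {s T e : ℝ} {u0 : ℝ → ℂ} {w : ℝ → ℝ → ℂ}

theorem Cells.subset {N : ℝ} {J G : Finset ℝ} (h : Cells N J) (hG : G ⊆ J) : Cells N G where
  one := h.one
  card := le_trans (by exact_mod_cast Finset.card_le_card hG) h.card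
  sep := fun y hy y' hy' => h.sep y (hG hy) y' (hG hy')

theorem pw1 {N : ℝ} (hN : 1 ≤ N) (s : ℝ) : N ^ (-(s - 1)) = N ^ 2 * N ^ (-s - 1) := by
  have : 0 < N := by linarith
  rw [← Real.rpow_natCast, ← Real.rpow_add this]; congr 1; push_cast; ring

theorem pw2 {N : ℝ} (hN : 1 ≤ N) (s : ℝ) : N ^ (-s) = N * N ^ (-s - 1) := by
  have : 0 < N := by linarith
  nth_rewrite 2 [← Real.rpow_one N]
  rw [← Real.rpow_add this]; congr 1; ring

/-- products of small functions -/
theorem prod_sum {m : ℕ} {H : ℝ → ℂ} (h : VM m H) (hs : 3/2 < s) (hm : s ≤ m) {K : ℝ} (hK : 0 < K) : ∃ C : ℝ, 0 < C ∧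
    ∀ (N : ℝ) (J : Finset ℝ), Cells N J → ∀ q p : ℝ → ℂ, Measurable q → Measurable p →
      N2 (s - 1) q ≤ ENNReal.ofReal ((K / N) ^ 2) → L1 0 q ≤ ENNReal.ofReal (K / N) →
      N2 (s - 1) p ≤ ENNReal.ofReal ((K / N) ^ 2) → L1 0 p ≤ ENNReal.ofReal (K / N) →
      ∑ y ∈ J, ‖cc H N y (fun x => IF q x * IF p x)‖ ≤ C * N ^ (-s - 1) := by
  obtain ⟨C, hC, hT⟩ := lemT h
  refine ⟨C * ((2 * 4 ^ (s - 1) + 1) * (2 * K ^ 2)), by positivity, fun N J hJ q p hqm hpm q2 q1 p2 p1 => ?_⟩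
  have hN := hJ.one
  have hN0 : 0 < N := by linarith
  have qi := integrable_of_L1 hqm le_rfl (ne_top_of_le_ne_top ENNReal.ofReal_ne_top q1)
  have pi := integrable_of_L1 hpm le_rfl (ne_top_of_le_ne_top ENNReal.ofReal_ne_top p1)
  have k0 : 0 ≤ K / N := by positivity
  have e1 : (fun x => IF q x * IF p x) = IF (cv q p) := by ext x; rw [IF_cv qi pi]
  have := hT N J hJ (s - 1) (by linarith) (by linarith) (cv q p) (measurable_cv hqm hpm) (cv_integrable qi pi) _ (by positivity)
    (N2_cv' (by linarith) hqm hpm k0 k0 k0 k0 q2 p2 q1 p1)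
  rw [e1]
  refine this.trans (le_of_eq ?_)
  rw [pw1 hN]; field_simp; ring

theorem norm_e_le (he : e = 0 ∨ e = 1) (z : ℂ) : ‖(e:ℂ) * z‖ ≤ ‖z‖ := by
  rcases he with h | h <;> simp [h]

theorem sq_half {m : ℕ} {H : ℝ → ℂ} (h : TT m H) (hs : 3/2 < s) (hm : s ≤ m) {K : ℝ} (hK : 0 < K) : ∃ C : ℝ, 0 < C ∧
    ∀ (N T T0 e : ℝ) (u0 : ℝ → ℂ) (w : ℝ → ℝ → ℂ) (J : Finset ℝ) (b : ℝ → ℝ), Cells N J → Sol s T (1/N) e u0 w → SZ s N K w → T0 ∈ Set.Icc 0 T →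
      (∀ y ∈ J, SwY T T0 N w y (b y)) → ∀ t ∈ Set.Icc 0 T0, ∀ t',
      ∑ y ∈ J, ‖cc H N y (fun x => IF (ah w t) x * IF (ah w t') x) - cc H N y (fun x => u0 x * IF (ah w t') x)‖ ≤ C * t * N ^ (-s - 1) := by
  obtain ⟨C, hC, hP⟩ := prod_sum h.h0 hs hm hK
  obtain ⟨D1, hD1, hT1⟩ := lemT h.hp
  obtain ⟨D2, hD2, hT2⟩ := lemT h.hm
  refine ⟨3 * C + K ^ 3 * (D1 + D2), by positivity, fun N T T0 e u0 w J b hJ S Z hT0 hb t ht t' => ?_⟩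
  have hN := hJ.one
  have hN0 : 0 < N := by linarith
  have V := h.h0.1
  have am := S.tf0.meas t'
  have gc : Continuous (IF (ah w t')) := continuous_IF (S.ah_int t')
  have ch := (S.tfh.mono (by norm_num : (0:ℝ) ≤ 2))
  have cA := (S.tfA.mono (by norm_num : (0:ℝ) ≤ 2))
  have cm := (S.tfm.mono (by norm_num : (0:ℝ) ≤ 2))
  have hρ := rho_facts S.hs hN
  have q2 : ∀ τ, N2 (s - 1) (mq (1/N) w τ) ≤ ENNReal.ofReal ((K / N) ^ 2) := fun τ =>
    (Z.q2 τ).trans (ofReal_sq_mono (by have := hρ.1; positivity) (by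
      have : K * rho s N ≤ K := by nlinarith [hρ.2.1]
      gcongr))
  have tc : ∀ {q : ℝ → ℝ → ℂ}, TF 0 q → ∀ y, Continuous (fun τ => cc H N y (fun x => IF (q τ) x * IF (ah w t') x)) := fun hq y =>
    cc_tcont V hN0 y (hq.continuous.mul (gc.comp continuous_snd))
  have b1 : ∑ y ∈ J, ‖∫ τ in (0:ℝ)..min t (b y), cc H N y (fun x => IF (hq w τ) x * IF (ah w t') x)‖ ≤ C * N ^ (-s - 1) * t :=
    sum_time (tc ch) ht.1 (fun y hy => ⟨le_min ht.1 (hb y hy).1.1, min_le_left _ _⟩) fun τ _ =>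
      hP N J hJ _ _ (ch.meas τ) am (Z.h2 τ) (Z.h1 τ) (Z.Nsm t') (Z.L0a t')
  have b2 : ∑ y ∈ J, ‖∫ τ in (0:ℝ)..t, cc H N y (fun x => IF (Aq (1/N) w τ) x * IF (ah w t') x)‖ ≤ C * N ^ (-s - 1) * t :=
    sum_time (r := fun _ => t) (tc cA) ht.1 (fun y hy => ⟨ht.1, le_rfl⟩) fun τ _ =>
      hP N J hJ _ _ (cA.meas τ) am (Z.A2 τ) (Z.A1 τ) (Z.Nsm t') (Z.L0a t')
  have b3 : ∑ y ∈ J, ‖∫ τ in (0:ℝ)..min t (b y), cc H N y (fun x => IF (mq (1/N) w τ) x * IF (ah w t') x)‖ ≤ C * N ^ (-s - 1) * t :=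
    sum_time (tc cm) ht.1 (fun y hy => ⟨le_min ht.1 (hb y hy).1.1, min_le_left _ _⟩) fun τ _ =>
      hP N J hJ _ _ (cm.meas τ) am (q2 τ) (Z.q1 τ) (Z.Nsm t') (Z.L0a t')
  have b4 := hT1 N J hJ s (by linarith) hm _ am (S.ah_int t') K hK.le (Z.Ns t')
  have b5 := hT2 N J hJ s (by linarith) hm _ am (S.ah_int t') K hK.le (Z.Ns t')
  have key : ∀ y ∈ J, ‖cc H N y (fun x => IF (ah w t) x * IF (ah w t') x) - cc H N y (fun x => u0 x * IF (ah w t') x)‖ ≤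
      ‖∫ τ in (0:ℝ)..min t (b y), cc H N y (fun x => IF (hq w τ) x * IF (ah w t') x)‖ +
      ‖∫ τ in (0:ℝ)..t, cc H N y (fun x => IF (Aq (1/N) w τ) x * IF (ah w t') x)‖ +
      ‖∫ τ in (0:ℝ)..min t (b y), cc H N y (fun x => IF (mq (1/N) w τ) x * IF (ah w t') x)‖ +
      K ^ 2 / N * t * ‖cc (ex 1 H) N y (IF (ah w t'))‖ + K ^ 2 / N * t * ‖cc (ex (-1) H) N y (IF (ah w t'))‖ := fun y hy => by
    obtain ⟨Cp, Cm, hp, hm', hc⟩ := S.cell_cc hN hK Z hT0 (hb y hy) ht V gc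
    rw [hc]
    set X1 := ∫ τ in (0:ℝ)..min t (b y), cc H N y (fun x => IF (hq w τ) x * IF (ah w t') x)
    set X2 := ∫ τ in (0:ℝ)..t, cc H N y (fun x => IF (Aq (1/N) w τ) x * IF (ah w t') x)
    set X3 := ∫ τ in (0:ℝ)..min t (b y), cc H N y (fun x => IF (mq (1/N) w τ) x * IF (ah w t') x)
    set Y1 := cc (ex 1 H) N y (IF (ah w t'))
    set Y2 := cc (ex (-1) H) N y (IF (ah w t'))
    have n1 : ‖Cp * Y1‖ ≤ K ^ 2 / N * t * ‖Y1‖ := by rw [norm_mul]; gcongr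
    have n2 : ‖Cm * Y2‖ ≤ K ^ 2 / N * t * ‖Y2‖ := by rw [norm_mul]; gcongr
    have n3 : ‖(1/2:ℂ) * X3‖ ≤ ‖X3‖ := by rw [norm_mul]; norm_num; linarith [norm_nonneg X3]
    have n4 := norm_e_le S.he (X2 + ((1/2:ℂ) * X3 + (Cp * Y1 + Cm * Y2)))
    have n5 := norm_add_le X2 ((1/2:ℂ) * X3 + (Cp * Y1 + Cm * Y2))
    have n6 := norm_add_le ((1/2:ℂ) * X3) (Cp * Y1 + Cm * Y2)
    have n7 := norm_add_le (Cp * Y1) (Cm * Y2)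
    have n8 := norm_sub_le (-X1) ((e:ℂ) * (X2 + ((1/2:ℂ) * X3 + (Cp * Y1 + Cm * Y2))))
    rw [norm_neg] at n8
    rw [show ∀ a b c : ℂ, a - b - c - a = -b - c from fun a b c => by ring]
    linarith
  refine (Finset.sum_le_sum key).trans ?_
  simp only [Finset.sum_add_distrib, ← Finset.mul_sum]
  have p1 : K ^ 2 / N * t * ∑ y ∈ J, ‖cc (ex 1 H) N y (IF (ah w t'))‖ ≤ K ^ 2 / N * t * (D1 * K * N ^ (-s)) :=
    mul_le_mul_of_nonneg_left b4 (by have := ht.1; positivity)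
  have p2 : K ^ 2 / N * t * ∑ y ∈ J, ‖cc (ex (-1) H) N y (IF (ah w t'))‖ ≤ K ^ 2 / N * t * (D2 * K * N ^ (-s)) :=
    mul_le_mul_of_nonneg_left b5 (by have := ht.1; positivity)
  have e1 : ∀ D, K ^ 2 / N * t * (D * K * N ^ (-s)) = K ^ 3 * D * t * N ^ (-s - 1) := fun D => by
    rw [pw2 hN]; field_simp
  rw [e1] at p1 p2
  linarith

theorem sqdiff {m : ℕ} {H : ℝ → ℂ} (h : TT m H) (hs : 3/2 < s) (hm : s ≤ m) {K : ℝ} (hK : 0 < K) : ∃ C : ℝ, 0 < C ∧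
    ∀ (N T T0 e : ℝ) (u0 : ℝ → ℂ) (w : ℝ → ℝ → ℂ) (J : Finset ℝ) (b : ℝ → ℝ), Cells N J → Sol s T (1/N) e u0 w → SZ s N K w → T0 ∈ Set.Icc 0 T →
      (∀ y ∈ J, SwY T T0 N w y (b y)) → ∀ t ∈ Set.Icc 0 T0,
      ∑ y ∈ J, ‖cc H N y (fun x => IF (ah w t) x ^ 2) - cc H N y (fun x => u0 x ^ 2)‖ ≤ C * t * N ^ (-s - 1) := by
  obtain ⟨C, hC, hP⟩ := sq_half h hs hm hK
  refine ⟨2 * C, by positivity, fun N T T0 e u0 w J b hJ S Z hT0 hb t ht => ?_⟩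
  have h1 := hP N T T0 e u0 w J b hJ S Z hT0 hb t ht t
  have h2 := hP N T T0 e u0 w J b hJ S Z hT0 hb t ht 0
  rw [S.W0] at h2
  have key : ∀ y ∈ J, ‖cc H N y (fun x => IF (ah w t) x ^ 2) - cc H N y (fun x => u0 x ^ 2)‖ ≤ 
     ‖cc H N y (fun x => IF (ah w t) x * IF (ah w t) x) - cc H N y (fun x => u0 x * IF (ah w t) x)‖ +
     ‖cc H N y (fun x => IF (ah w t) x * u0 x) - cc H N y (fun x => u0 x * u0 x)‖ := fun y _ => by
    refine le_trans (le_of_eq ?_) (norm_add_le _ _)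
    simp_rw [pow_two, fun x => mul_comm (IF (ah w t) x) (u0 x)]
    congr 1; ring
  refine (Finset.sum_le_sum key).trans ?_
  rw [Finset.sum_add_distrib]
  linarith

end

/-! ### Part P10d -/

noncomputable section

open MeasureTheory Filter
open scoped ENNReal Topology


def SS (H : ℝ → ℂ) : ℂ := ∫ z : ℝ, (Real.sin (17/12 * z) : ℂ) * H z

theorem cc_scale (H : ℝ → ℂ) {N : ℝ} (hN : 0 < N) (y : ℝ) (f : ℝ → ℂ) :
    cc H N y f = ((N⁻¹ : ℝ) : ℂ) * ∫ z : ℝ, f (z / N + y) * H z := by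
  have h1 := integral_sub_right_eq_self (μ := volume) (fun x : ℝ => f (x + y) * H (N * x)) y
  have h2 := Measure.integral_comp_mul_left (fun x : ℝ => f (x / N + y) * H x) N
  unfold cc
  simp only [sub_add_cancel] at h1
  rw [h1, ← Complex.real_smul, ← abs_of_pos (inv_pos.2 hN), ← h2]
  congr 1; funext x
  rw [mul_div_cancel_left₀ _ hN.ne']

theorem cc_sup {H : ℝ → ℂ} (h : VV H) {N : ℝ} (hN : 0 < N) (y : ℝ) {f : ℝ → ℂ} {c : ℝ} (hf : ∀ x ∈ Iy N y, ‖f x‖ ≤ c) :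
    ‖cc H N y f‖ ≤ c * (∫ z, ‖H z‖) / N := by
  have e1 : (∫ x, ‖H (N * (x - y))‖) = (∫ z, ‖H z‖) / N := by
    have := cc_scale (fun z => (‖H z‖ : ℂ)) hN y (fun _ => 1)
    unfold cc at this
    simp only [one_mul] at this
    rw [integral_complex_ofReal, integral_complex_ofReal] at this
    have h2 : (∫ x, ‖H (N * (x - y))‖) = N⁻¹ * ∫ z, ‖H z‖ := by exact_mod_cast this
    rw [h2]; ring
  rw [mul_div_assoc, ← e1, ← integral_const_mul]
  refine norm_integral_le_of_norm_le ((integrable_scale h.integrable hN y).norm.const_mul c) (Eventually.of_forall fun x => ?_)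
  by_cases hx : x ∈ Iy N y
  · rw [norm_mul]; gcongr; exact hf x hx
  · simp [h.zero_out hN hx]

theorem pp_N2 {φhat : ℝ → ℝ} {φ : ℝ → ℂ} (hφ : CutoffPair φhat φ) (σ : ℝ) : N2 σ (pp φhat) ≠ ⊤ := by
  have hc := pp_cont hφ
  have c1 : Continuous (fun ξ : ℝ => (1 + ξ ^ 2) ^ σ * ‖pp φhat ξ‖ ^ 2) :=
    ((by fun_prop : Continuous (fun ξ : ℝ => 1 + ξ ^ 2)).rpow_const (fun ξ => Or.inl (jp_pos ξ).ne')).mul (hc.norm.pow 2)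
  have s1 : HasCompactSupport (fun ξ : ℝ => (1 + ξ ^ 2) ^ σ * ‖pp φhat ξ‖ ^ 2) :=
    HasCompactSupport.mul_left ((pp_supp hφ).comp_left (g := fun z : ℂ => ‖z‖ ^ 2) (by simp))
  have i1 : Integrable (fun ξ : ℝ => (1 + ξ ^ 2) ^ σ * ‖pp φhat ξ‖ ^ 2) := c1.integrable_of_hasCompactSupport s1
  have e1 : N2 σ (pp φhat) = ∫⁻ ξ, ENNReal.ofReal ((1 + ξ ^ 2) ^ σ * ‖pp φhat ξ‖ ^ 2) := by
    unfold N2 wt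
    refine lintegral_congr fun ξ => ?_
    rw [ENNReal.ofReal_mul (by positivity), ENNReal.ofReal_pow (norm_nonneg _), ofReal_norm]
  rw [e1, ← ofReal_integral_eq_lintegral_ofReal i1 (Eventually.of_forall fun ξ => by positivity)]
  exact ENNReal.ofReal_ne_top

theorem pp2_N2 {φhat : ℝ → ℝ} {φ : ℝ → ℂ} (hφ : CutoffPair φhat φ) {σ : ℝ} (hσ : 0 ≤ σ) : ∃ A : ℝ, 0 < A ∧
    N2 σ (cv (pp φhat) (pp φhat)) ≤ ENNReal.ofReal (A ^ 2) := by
  have hm := (pp_cont hφ).measurable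
  have hL : L1 0 (pp φhat) ≠ ⊤ := by rw [L1_zero]; exact (pp_int hφ).2.ne
  have h1 := N2_cv σ hσ hm hm
  have h2 : N2 σ (cv (pp φhat) (pp φhat)) ≠ ⊤ := by
    refine ne_top_of_le_ne_top ?_ h1
    have := pp_N2 hφ σ
    finiteness
  set X := N2 σ (cv (pp φhat) (pp φhat))
  refine ⟨Real.sqrt (X.toReal + 1), by positivity, ?_⟩
  rw [Real.sq_sqrt (by positivity)]
  calc X = ENNReal.ofReal X.toReal := (ENNReal.ofReal_toReal h2).symm
    _ ≤ _ := ENNReal.ofReal_le_ofReal (by linarith)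

theorem PF.lip {φ : ℝ → ℂ} {f d : ℝ → ℝ} {M : ℝ} (hp : PF φ f d M) (x y : ℝ) : |f x - f y| ≤ M * |x - y| := by
  have := Convex.norm_image_sub_le_of_norm_hasDerivWithin_le (f := f) (f' := d) (s := Set.univ) (C := M) (x := y) (y := x)
    (fun z _ => (hp.hd z).hasDerivWithinAt) (fun z _ => hp.db z) convex_univ trivial trivial
  simpa using this

theorem u0sq {φhat : ℝ → ℝ} {φ : ℝ → ℂ} (hφ : CutoffPair φhat φ) {f d : ℝ → ℝ} {M : ℝ} (hp : PF φ f d M) {m : ℕ} {H : ℝ → ℂ} (h : VM m H) {s : ℝ}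
    (hs : 3/2 < s) (hm : s ≤ m) : ∃ C : ℝ, 0 < C ∧ ∀ (N c0 c1 : ℝ) (J G : Finset ℝ), CL f d c0 c1 N J → G ⊆ J →
      ∑ y ∈ G, ‖cc H N y (fun x => U0 s φ N x ^ 2) + ((2 * N ^ (-s - 2) * f y ^ 2 : ℝ) : ℂ) * SS H‖ ≤ C * N ^ (-s - 1) * om s N := by
  obtain ⟨C, hC, hT⟩ := lemT h
  obtain ⟨A, hA, hA2⟩ := pp2_N2 hφ (σ := m) (by positivity)
  have V := h.1
  set I := ∫ z, ‖H z‖ with hI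
  have hI0 : 0 ≤ I := integral_nonneg fun z => norm_nonneg _
  refine ⟨C * A + 3 * M ^ 2 * I, by have := hp.M1; positivity, fun N c0 c1 J G hcl hG => ?_⟩
  have hN := hcl.cells.one
  have hN0 : 0 < N := by linarith
  have hGc := hcl.cells.subset hG
  set a := N ^ (-s) with ha
  set b := N ^ (-1:ℝ) with hb
  have hb1 : b = 1 / N := by rw [hb, Real.rpow_neg_one]; ring
  have a0 : 0 < a := by positivity
  have b0 : 0 < b := by positivity
  have hM := hp.M1
  have ppi := pp_int hφ
  have phc := hφ.continuous
  have b1 := hT N G hGc m (by positivity) le_rfl _ (measurable_cv (pp_cont hφ).measurable (pp_cont hφ).measurable) (cv_integrable ppi ppi) A hA.le hA2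
  set P := IF (cv (pp φhat) (pp φhat)) with hP
  have Pc : Continuous P := continuous_IF (cv_integrable ppi ppi)
  have Pe : ∀ x, P x = (f x : ℂ) ^ 2 := fun x => by rw [hP, IF_cv ppi ppi, IF_pp hφ, hp.eq]; ring
  have fc : Continuous f := continuous_iff_continuousAt.2 fun x => (hp.hd x).continuousAt
  have key : ∀ y ∈ G, ‖cc H N y (fun x => U0 s φ N x ^ 2) + ((2 * N ^ (-s - 2) * f y ^ 2 : ℝ) : ℂ) * SS H‖ ≤
      b ^ 2 * ‖cc H N y P‖ + (a ^ 2 * M ^ 2 + 2 * a * b * (M ^ 2 / N)) * I / N := fun y hy => by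
    set E : ℝ → ℂ := fun x => ((a ^ 2 * Real.sin (lam N * x) ^ 2 * f x ^ 2 + 2 * a * b * (f x ^ 2 - f y ^ 2) * Real.sin (lam N * x) : ℝ) : ℂ) with hE
    have Ec : Continuous E := by rw [hE]; fun_prop
    set Q : ℝ → ℂ := fun x => (Real.sin (lam N * x) : ℂ) with hQ
    have Qc : Continuous Q := by rw [hQ]; fun_prop
    have sm : ∀ {f : ℝ → ℂ} (c : ℂ), Continuous f → Continuous (fun x => c * f x) := fun c hf => continuous_const.mul hf
    have ad : ∀ {f g : ℝ → ℂ}, Continuous f → Continuous g → Continuous (fun x => f x + g x) := fun hf hg => hf.add hg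
    have e1 : (fun x => U0 s φ N x ^ 2) = fun x => ((b:ℂ) ^ 2 * P x + E x) + ((2 * a * b * f y ^ 2 : ℝ) : ℂ) * Q x := by
      ext x
      rw [Pe, U0, hp.eq, hE, hQ]
      push_cast
      ring
    have e2 : cc H N y Q = -(((N⁻¹ : ℝ) : ℂ) * SS H) := by
      rw [cc_scale H hN0, ← mul_neg, SS, ← integral_neg]
      congr 2; ext z
      rw [hQ]; beta_reduce
      rw [show lam N * (z / N + y) = lam N * y + 17/12 * z by unfold lam; field_simp; ring, hcl.sin y (hG hy)]
      push_cast; ring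
    have e3 : 2 * N ^ (-s - 2) * f y ^ 2 = 2 * a * b * f y ^ 2 * N⁻¹ := by
      have : N ^ (-s - 2) = a * b * N⁻¹ := by
        rw [ha, hb, ← Real.rpow_neg_one N, ← Real.rpow_add hN0, ← Real.rpow_add hN0]; congr 1; ring
      rw [this]; ring
    rw [e1, cc_add V hN0 y (ad (sm _ Pc) Ec) (sm _ Qc), cc_add V hN0 y (sm _ Pc) Ec, cc_smul, cc_smul, e2, e3]
    have n1 : ‖cc H N y E‖ ≤ (a ^ 2 * M ^ 2 + 2 * a * b * (M ^ 2 / N)) * I / N := by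
      refine cc_sup V hN0 y fun x hx => ?_
      rw [hE, Complex.norm_real, Real.norm_eq_abs]
      have hxy : |x - y| ≤ 1 / (2 * N) := abs_le.2 ⟨by linarith [hx.1], by linarith [hx.2]⟩
      have s1 : |Real.sin (lam N * x)| ≤ 1 := Real.abs_sin_le_one _
      have f1 := hp.fb x
      have f2 := hp.fb y
      have d1 : |f x ^ 2 - f y ^ 2| ≤ M ^ 2 / N := by
        rw [sq_sub_sq, abs_mul]
        have g1 : |f x + f y| ≤ 2 * M := (abs_add_le _ _).trans (by linarith)
        have g2 : |f x - f y| ≤ M * (1 / (2 * N)) := (hp.lip x y).trans (by gcongr)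
        calc |f x + f y| * |f x - f y| ≤ (2 * M) * (M * (1 / (2 * N))) := by gcongr
          _ = M ^ 2 / N := by field_simp
      refine (abs_add_le _ _).trans ?_
      have t1 : |a ^ 2 * Real.sin (lam N * x) ^ 2 * f x ^ 2| ≤ a ^ 2 * M ^ 2 := by
        rw [abs_mul, abs_mul, abs_of_nonneg (sq_nonneg a), abs_pow, abs_pow]
        calc a ^ 2 * |Real.sin (lam N * x)| ^ 2 * |f x| ^ 2 ≤ a ^ 2 * 1 ^ 2 * M ^ 2 := by gcongr
          _ = _ := by ring
      have t2 : |2 * a * b * (f x ^ 2 - f y ^ 2) * Real.sin (lam N * x)| ≤ 2 * a * b * (M ^ 2 / N) := by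
        rw [abs_mul, abs_mul, abs_of_pos (by positivity : 0 < 2 * a * b)]
        calc 2 * a * b * |f x ^ 2 - f y ^ 2| * |Real.sin (lam N * x)| ≤ 2 * a * b * (M ^ 2 / N) * 1 := by gcongr
          _ = _ := by ring
      linarith
    have n2 : ‖(b:ℂ) ^ 2 * cc H N y P‖ = b ^ 2 * ‖cc H N y P‖ := by
      rw [norm_mul, norm_pow, Complex.norm_real, Real.norm_eq_abs, abs_of_pos b0]
    have n3 := norm_add_le ((b:ℂ) ^ 2 * cc H N y P) (cc H N y E)
    refine le_trans (le_of_eq ?_) (n3.trans (by rw [n2]; gcongr))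
    congr 1; push_cast; ring
  refine (Finset.sum_le_sum key).trans ?_
  rw [Finset.sum_add_distrib, ← Finset.mul_sum, Finset.sum_const, nsmul_eq_mul]
  have hcard := hGc.card
  have r1 : N ^ (-s - 1) = a * b := by rw [ha, hb, ← Real.rpow_add hN0]; congr 1
  have r2 : N ^ (1 - s) = N * a := by rw [ha]; nth_rewrite 2 [← Real.rpow_one N]; rw [← Real.rpow_add hN0]; congr 1
  have r3 : N ^ (-(m:ℝ)) ≤ a := Real.rpow_le_rpow_of_exponent_le hN (by linarith)
  have om1 : om s N = b + N * a := by rw [om, r2]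
  have t1 : b ^ 2 * ∑ y ∈ G, ‖cc H N y P‖ ≤ b ^ 2 * (C * A * a) := by
    refine mul_le_mul_of_nonneg_left (b1.trans ?_) (by positivity)
    gcongr
  have t2 : (G.card : ℝ) * ((a ^ 2 * M ^ 2 + 2 * a * b * (M ^ 2 / N)) * I / N) ≤ (a ^ 2 * M ^ 2 + 2 * a * b * (M ^ 2 / N)) * I := by
    calc (G.card : ℝ) * ((a ^ 2 * M ^ 2 + 2 * a * b * (M ^ 2 / N)) * I / N) ≤ N * ((a ^ 2 * M ^ 2 + 2 * a * b * (M ^ 2 / N)) * I / N) := by gcongr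
      _ = _ := by field_simp
  have hNb : N * b = 1 := by rw [hb1]; field_simp
  have t3 : M ^ 2 / N = M ^ 2 * b := by rw [hb1]; ring
  have t4 : a ^ 2 = a * b * (N * a) := by
    calc a ^ 2 = a * a * 1 := by ring
      _ = a * a * (N * b) := by rw [hNb]
      _ = _ := by ring
  rw [r1, om1]
  rw [t3, t4] at t2
  have z1 : 0 ≤ a * b * (N * a) * (C * A) := by positivity
  have z2 : 0 ≤ a * b * b * M ^ 2 * I := by positivity
  have z3 : 0 ≤ a * b * (N * a) * M ^ 2 * I := by positivity
  rw [t3, t4]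
  linarith

end

/-! ### Part P10e -/

noncomputable section

open MeasureTheory Filter
open scoped ENNReal Topology
variable {s T e : ℝ} {u0 : ℝ → ℂ} {w : ℝ → ℝ → ℂ}

/-- the combination `H - H''` -/
def Ps (H : ℝ → ℂ) : ℝ → ℂ := fun z => 1 * H z + (-1) * deriv (deriv H) z

theorem VV.Ps {H : ℝ → ℂ} (h : VV H) : VV (Ps H) := h.lin h.deriv.deriv 1 (-1)

theorem deriv_Ps {H : ℝ → ℂ} (h : VV H) : deriv (Ps H) = Ps (deriv H) := by
  funext z
  exact (((h.hd z).const_mul 1).add ((h.deriv.deriv.hd z).const_mul (-1))).deriv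

theorem cc_Ps {H : ℝ → ℂ} (h : VV H) {N : ℝ} (hN : 0 < N) (y : ℝ) {f : ℝ → ℂ} (hf : Continuous f) :
    cc (Ps H) N y f = cc H N y f - cc (deriv (deriv H)) N y f := by
  unfold cc
  rw [← integral_sub (cc_int h hN y hf) (cc_int h.deriv.deriv hN y hf)]
  refine integral_congr_ae (Eventually.of_forall fun x => ?_)
  simp only [Ps]; ring

theorem Lap_lin {f g : ℝ → ℂ} (hf : VV f) (hg : VV g) (a b l : ℂ) :
    Lap (fun z => a * f z + b * g z) l = a * Lap f l + b * Lap g l := by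
  unfold Lap
  rw [← integral_const_mul, ← integral_const_mul, ← integral_add ((hf.mul_int (cont_exp l)).const_mul a) ((hg.mul_int (cont_exp l)).const_mul b)]
  refine integral_congr_ae (Eventually.of_forall fun x => ?_)
  beta_reduce; ring

theorem Lap_Ps {H : ℝ → ℂ} (h : VV H) (l : ℂ) : Lap (Ps H) l = (1 - l ^ 2) * Lap H l := by
  unfold Ps
  rw [Lap_lin h h.deriv.deriv, Lap_deriv h.deriv, Lap_deriv h]; ring

theorem cc_ex_one {H : ℝ → ℂ} (h : VV H) {N : ℝ} (hN : 0 < N) (y a : ℝ) (ha : a ^ 2 = 1) :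
    cc (ex a (Ps H)) N y (fun _ => 1) = 0 := by
  have h1 := Lap_Ps h (a : ℂ)
  have h2 : (1 - (a:ℂ) ^ 2) = 0 := by rw [← Complex.ofReal_pow, ha]; simp
  rw [h2, zero_mul] at h1
  rw [cc_scale _ hN]
  have : (∫ z : ℝ, (1:ℂ) * ex a (Ps H) z) = Lap (Ps H) a := by
    unfold Lap
    refine integral_congr_ae (Eventually.of_forall fun x => ?_)
    simp only [ex]; ring
  rw [this, h1, mul_zero]

theorem Sol.cc_h {α : ℝ} (S : Sol s T α e u0 w) {H : ℝ → ℂ} (h : VV H) {N : ℝ} (hN : 0 < N) (y τ : ℝ) :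
    cc H N y (IF (hq w τ)) = -((3/2) * N * cc (deriv H) N y (fun x => IF (ah w τ) x ^ 2)) := by
  have e1 : IF (hq w τ) = fun x => (3/2) * IF (dx (Pq w) τ) x := by
    funext x; exact IF_smul _ _ _
  have t1 : TF 2 (dx (Pq w)) := TF.dx (m := 2) (by norm_num; exact S.tfP)
  rw [e1, cc_smul]
  have e2 := cc_dx h hN y (S.tfP.integrable (by norm_num) τ) (t1.integrable (by norm_num) τ)
  have e3 : IF (Pq w τ) = fun x => IF (ah w τ) x ^ 2 := funext fun x => S.P_eq τ x
  rw [e3] at e2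
  have e4 : cc H N y (IF (dx (Pq w) τ)) = -(N * cc (deriv H) N y (fun x => IF (ah w τ) x ^ 2)) := e2
  rw [e4]; ring

theorem Sol.cc_A {N : ℝ} (S : Sol s T (1/N) e u0 w) {H : ℝ → ℂ} (h : VV H) (hN : 0 < N) (y τ : ℝ) :
    cc (Ps H) N y (IF (Aq (1/N) w τ)) = -(N * cc (deriv (deriv (deriv H))) N y (fun x => IF (ah w τ) x ^ 2)) := by
  have p1 : TF 2 (dx (Pq w)) := TF.dx (m := 2) (by norm_num; exact S.tfP)
  have p2 : TF 1 (dx (dx (Pq w))) := TF.dx (m := 1) (by norm_num; exact p1)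
  have p3 : TF 0 (dx (dx (dx (Pq w)))) := TF.dx (m := 0) (by norm_num; exact p2)
  have a0 := S.tfA
  have a1 : TF 1 (dx (Aq (1/N) w)) := TF.dx (m := 1) (by rw [show (1:ℝ)+1=2 by norm_num]; exact S.tfA)
  have a2 : TF 0 (dx (dx (Aq (1/N) w))) := TF.dx (m := 0) (by rw [show (0:ℝ)+1=1 by norm_num]; exact a1)
  have iP := S.tfP.integrable (by norm_num) τ
  have iA := a0.integrable (by norm_num) τ
  have e1 : cc H N y (IF (dx (dx (Aq (1/N) w)) τ)) = -(N * cc (deriv H) N y (IF (dx (Aq (1/N) w) τ))) :=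
    cc_dx h hN y (a1.integrable (by norm_num) τ) (a2.integrable (by norm_num) τ)
  have e2 : cc (deriv H) N y (IF (dx (Aq (1/N) w) τ)) = -(N * cc (deriv (deriv H)) N y (IF (Aq (1/N) w τ))) :=
    cc_dx h.deriv hN y iA (a1.integrable (by norm_num) τ)
  have f1 : cc H N y (IF (dx (dx (dx (Pq w))) τ)) = -(N * cc (deriv H) N y (IF (dx (dx (Pq w)) τ))) :=
    cc_dx h hN y (p2.integrable (by norm_num) τ) (p3.integrable (by norm_num) τ)
  have f2 : cc (deriv H) N y (IF (dx (dx (Pq w)) τ)) = -(N * cc (deriv (deriv H)) N y (IF (dx (Pq w) τ))) :=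
    cc_dx h.deriv hN y (p1.integrable (by norm_num) τ) (p2.integrable (by norm_num) τ)
  have f3 : cc (deriv (deriv H)) N y (IF (dx (Pq w) τ)) = -(N * cc (deriv (deriv (deriv H))) N y (IF (Pq w τ))) :=
    cc_dx h.deriv.deriv hN y iP (p1.integrable (by norm_num) τ)
  have e3 : IF (Pq w τ) = fun x => IF (ah w τ) x ^ 2 := funext fun x => S.P_eq τ x
  have hN' : (N:ℂ) ≠ 0 := by exact_mod_cast hN.ne'
  have key : ∀ x, IF (Aq (1/N) w τ) x = ((N:ℂ)^2)⁻¹ * IF (dx (dx (Aq (1/N) w)) τ) x + ((N:ℂ)^2)⁻¹ * IF (dx (dx (dx (Pq w))) τ) x := by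
    intro x
    rw [← IF_smul, ← IF_smul, ← IF_add ((a2.integrable (by norm_num) τ).const_mul _) ((p3.integrable (by norm_num) τ).const_mul _)]
    congr 1
    funext ξ
    have hne : (1 + ((1 / N : ℝ) : ℂ) ^ 2 * (ξ:ℂ) ^ 2) ≠ 0 := by
      have : (0:ℝ) < 1 + (1/N)^2 * ξ^2 := by positivity
      exact_mod_cast this.ne'
    have hI : Complex.I ^ 2 = -1 := Complex.I_sq
    have hA : Aq (1/N) w τ ξ * (1 + ((1 / N : ℝ) : ℂ) ^ 2 * (ξ:ℂ) ^ 2) = -(Complex.I * ((1 / N : ℝ) : ℂ) ^ 2 * (ξ : ℂ) ^ 3) * Pq w τ ξ := by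
      unfold Aq m1; field_simp
    have hc : ((1 / N : ℝ) : ℂ) ^ 2 = ((N:ℂ)^2)⁻¹ := by push_cast; field_simp
    rw [hc] at hA
    simp only [_root_.dx]
    linear_combination hA - ((N:ℂ)^2)⁻¹ * (ξ^2 * Aq (1/N) w τ ξ + Complex.I * ξ^3 * Pq w τ ξ) * hI
  have c2 : Continuous (fun x => ((N:ℂ)^2)⁻¹ * IF (dx (dx (Aq (1/N) w)) τ) x) := continuous_const.mul (continuous_IF (a2.integrable (by norm_num) τ))
  have c3 : Continuous (fun x => ((N:ℂ)^2)⁻¹ * IF (dx (dx (dx (Pq w))) τ) x) := continuous_const.mul (continuous_IF (p3.integrable (by norm_num) τ))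
  have k2 : cc H N y (IF (Aq (1/N) w τ)) = ((N:ℂ)^2)⁻¹ * cc H N y (IF (dx (dx (Aq (1/N) w)) τ)) + ((N:ℂ)^2)⁻¹ * cc H N y (IF (dx (dx (dx (Pq w))) τ)) := by
    rw [← cc_smul, ← cc_smul, ← cc_add h hN y c2 c3]
    congr 1; funext x; exact key x
  rw [cc_Ps h hN y (continuous_IF iA), k2, e1, e2, f1, f2, f3, e3]
  field_simp
  ring

theorem Sol.Uc {α : ℝ} (S : Sol s T α e u0 w) : Continuous (fun p : ℝ × ℝ => IF (ah w p.1) p.2) := S.tf0.continuous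

theorem Sol.cc2_cont {α : ℝ} (S : Sol s T α e u0 w) {H : ℝ → ℂ} (h : VV H) {N : ℝ} (hN : 0 < N) (y : ℝ) :
    Continuous (fun τ => cc H N y (fun x => IF (ah w τ) x ^ 2)) :=
  cc_tcont h hN y (F := fun τ x => IF (ah w τ) x ^ 2) (S.Uc.pow 2)

theorem Sol.cell_psi {N K T0 y b : ℝ} (hN : 1 ≤ N) (hK : 0 < K) (S : Sol s T (1/N) e u0 w) (Z : SZ s N K w) (hT0 : T0 ∈ Set.Icc 0 T)
    (hb : SwY T T0 N w y b) {t : ℝ} (ht : t ∈ Set.Icc 0 T0) {H : ℝ → ℂ} (h : VV H) :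
    cc (Ps H) N y (IF (ah w t)) = cc (Ps H) N y u0
      + (3/2) * N * ((∫ τ in (0:ℝ)..min t b, cc (deriv H) N y (fun x => IF (ah w τ) x ^ 2))
          - ∫ τ in (0:ℝ)..min t b, cc (deriv (deriv (deriv H))) N y (fun x => IF (ah w τ) x ^ 2))
      + e * (N * ∫ τ in (0:ℝ)..t, cc (deriv (deriv (deriv H))) N y (fun x => IF (ah w τ) x ^ 2))
      - e * ((1/2) * ((∫ τ in (0:ℝ)..min t b, cc H N y (IF (mq (1/N) w τ)))
          - ∫ τ in (0:ℝ)..min t b, cc (deriv (deriv H)) N y (IF (mq (1/N) w τ)))) := by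
  have hN0 : 0 < N := by linarith
  obtain ⟨Cp, Cm, -, -, E⟩ := S.cell_cc hN hK Z hT0 hb ht h.Ps (g := fun _ => 1) continuous_const
  rw [cc_ex_one h hN0 y 1 (by norm_num), cc_ex_one h hN0 y (-1) (by norm_num)] at E
  simp only [mul_one, mul_zero, add_zero] at E
  have eta : ∀ q : ℝ → ℂ, (fun x => IF q x) = IF q := fun q => rfl
  have eta2 : (fun x => u0 x) = u0 := rfl
  have i1 := (S.cc2_cont h.deriv hN0 y)
  have i3 := (S.cc2_cont h.deriv.deriv.deriv hN0 y)
  have hmc : Continuous (fun p : ℝ × ℝ => IF (mq (1/N) w p.1) p.2) := (S.tfm.mono (by norm_num : (0:ℝ) ≤ 2)).continuous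
  have j0 : Continuous (fun τ => cc H N y (IF (mq (1/N) w τ))) := cc_tcont h hN0 y (F := fun τ => IF (mq (1/N) w τ)) hmc
  have j2 : Continuous (fun τ => cc (deriv (deriv H)) N y (IF (mq (1/N) w τ))) := cc_tcont h.deriv.deriv hN0 y (F := fun τ => IF (mq (1/N) w τ)) hmc
  have a1 : (∫ τ in (0:ℝ)..min t b, cc (Ps H) N y (IF (hq w τ))) = -((3/2) * N * ((∫ τ in (0:ℝ)..min t b, cc (deriv H) N y (fun x => IF (ah w τ) x ^ 2))
          - ∫ τ in (0:ℝ)..min t b, cc (deriv (deriv (deriv H))) N y (fun x => IF (ah w τ) x ^ 2))) := by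
    rw [← intervalIntegral.integral_sub (i1.intervalIntegrable _ _) (i3.intervalIntegrable _ _), ← intervalIntegral.integral_const_mul, ← intervalIntegral.integral_neg]
    refine intervalIntegral.integral_congr fun τ _ => ?_
    beta_reduce
    rw [S.cc_h h.Ps hN0, deriv_Ps h, cc_Ps h.deriv hN0 y (f := fun x => IF (ah w τ) x ^ 2) ((continuous_IF (S.ah_int τ)).pow 2)]
  have a2 : (∫ τ in (0:ℝ)..t, cc (Ps H) N y (IF (Aq (1/N) w τ))) = -(N * ∫ τ in (0:ℝ)..t, cc (deriv (deriv (deriv H))) N y (fun x => IF (ah w τ) x ^ 2)) := by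
    rw [← intervalIntegral.integral_const_mul, ← intervalIntegral.integral_neg]
    exact intervalIntegral.integral_congr fun τ _ => S.cc_A h hN0 y τ
  have a3 : (∫ τ in (0:ℝ)..min t b, cc (Ps H) N y (IF (mq (1/N) w τ))) = ((∫ τ in (0:ℝ)..min t b, cc H N y (IF (mq (1/N) w τ)))
          - ∫ τ in (0:ℝ)..min t b, cc (deriv (deriv H)) N y (IF (mq (1/N) w τ))) := by
    rw [← intervalIntegral.integral_sub (j0.intervalIntegrable _ _) (j2.intervalIntegrable _ _)]
    exact intervalIntegral.integral_congr fun τ _ => cc_Ps h hN0 y (continuous_IF (S.tfm.integrable (by norm_num) τ))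
  simp only [eta, eta2] at E
  rw [a1, a2, a3] at E
  rw [E]; ring

end

/-! ### Part P10f -/

noncomputable section

open MeasureTheory Filter
open scoped ENNReal Topology

theorem SS_Lap {H : ℝ → ℂ} (h : VV H) : SS H = (Lap H (-(Complex.I * (17/12))) - Lap H (Complex.I * (17/12))) * (Complex.I / 2) := by
  unfold SS Lap
  rw [← integral_sub (h.mul_int (cont_exp _)) (h.mul_int (cont_exp _)), ← integral_mul_const]
  refine integral_congr_ae (Eventually.of_forall fun z => ?_)
  beta_reduce
  rw [Complex.ofReal_sin, Complex.sin]
  have e1 : -((17/12 * z : ℝ) : ℂ) * Complex.I = -(Complex.I * (17/12)) * z := by push_cast; ring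
  have e2 : ((17/12 * z : ℝ) : ℂ) * Complex.I = (Complex.I * (17/12)) * z := by push_cast; ring
  rw [e1, e2]; ring

theorem SS_ddd {H : ℝ → ℂ} (h : VV H) : SS (deriv (deriv (deriv H))) = -(17/12)^2 * SS (deriv H) := by
  rw [SS_Lap h.deriv.deriv.deriv, SS_Lap h.deriv, Lap_deriv h.deriv.deriv, Lap_deriv h.deriv.deriv, Lap_deriv h.deriv, Lap_deriv h.deriv]
  linear_combination ((Lap (deriv H) (-(Complex.I * (17/12))) - Lap (deriv H) (Complex.I * (17/12))) * (Complex.I / 2) * (17/12)^2) * Complex.I_sq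

theorem SS_ne : ∃ η : ℝ → ℂ, VV η ∧ ∀ k : ℕ, SS (deriv (Th (2 * k) η)) ≠ 0 := by
  let B : ContDiffBump (0:ℝ) := ⟨1/8, 1/4, by norm_num, by norm_num⟩
  let η : ℝ → ℂ := fun z => (B z : ℂ)
  have hv : VV η := by
    refine ⟨Complex.ofRealCLM.contDiff.comp B.contDiff, ?_⟩
    refine (closure_mono (t := Function.support B) ?_).trans ?_
    · intro z hz; simp only [η, Function.mem_support] at hz ⊢; exact_mod_cast hz
    · have := B.tsupport_eq
      unfold tsupport at this
      rw [this, Real.closedBall_eq_Icc]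
      norm_num [B]
  refine ⟨η, hv, fun k => ?_⟩
  have hT := VV_Th hv (2 * k)
  rw [SS_Lap hT.deriv, Lap_deriv hT, Lap_deriv hT, Lap_Th hv, Lap_Th hv]
  set c : ℂ := 17/12
  have p : ∀ l : ℂ, l ^ 2 = -c^2 → ((-l) * (1 - l) * (1 + l)) ^ (2 * k) = (-c^2 * (1 + c^2)^2)^k := by
    intro l hl
    rw [pow_mul]; congr 1
    linear_combination (l^4 - c^2*l^2 + c^4 - 2*(l^2 - c^2) + 1) * hl
  have l1 : (Complex.I * c) ^ 2 = -c^2 := by linear_combination c^2 * Complex.I_sq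
  have l2 : (-(Complex.I * c)) ^ 2 = -c^2 := by linear_combination c^2 * Complex.I_sq
  rw [p _ l1, p _ l2]
  have e1 : Lap η (-(Complex.I * c)) + Lap η (Complex.I * c) = ((2 * ∫ z, B z * Real.cos (17/12 * z) : ℝ) : ℂ) := by
    push_cast
    rw [← integral_complex_ofReal]
    unfold Lap
    rw [← integral_add (hv.mul_int (cont_exp _)) (hv.mul_int (cont_exp _)), ← integral_const_mul]
    refine integral_congr_ae (Eventually.of_forall fun z => ?_)
    beta_reduce
    rw [Complex.ofReal_mul, Complex.ofReal_cos, Complex.cos]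
    have e1 : -((17/12 * z : ℝ) : ℂ) * Complex.I = -(Complex.I * c) * z := by push_cast; ring
    have e2 : ((17/12 * z : ℝ) : ℂ) * Complex.I = (Complex.I * c) * z := by push_cast; ring
    rw [e1, e2]; simp only [η]; ring
  have pos : 0 < ∫ z, B z * Real.cos (17/12 * z) := by
    have hcos : ∀ z : ℝ, |z| < 1/4 → 0 < Real.cos (17/12 * z) := by
      intro z hz
      rw [abs_lt] at hz
      have := Real.pi_gt_three
      exact Real.cos_pos_of_mem_Ioo ⟨by linarith, by linarith⟩
    have hz0 : ∀ z : ℝ, ¬ |z| < 1/4 → B z = 0 := by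
      intro z hz
      exact B.zero_of_le_dist (by rw [Real.dist_0_eq_abs]; exact not_lt.1 hz)
    have hc : Continuous (fun z => B z * Real.cos (17/12 * z)) := B.continuous.mul (by fun_prop)
    refine hc.integral_pos_of_hasCompactSupport_nonneg_nonzero (B.hasCompactSupport.mul_right) (fun z => ?_) (x := 0) ?_
    · by_cases hz : |z| < 1/4
      · exact mul_nonneg B.nonneg (hcos z hz).le
      · simp [hz0 z hz]
    · have : B 0 = 1 := B.one_of_mem_closedBall (by simp [B])
      simp [this]
  set X := (-c^2 * (1 + c^2)^2)^k
  have hX : X ≠ 0 := by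
    apply pow_ne_zero
    simp only [c]; norm_num
  have e2 : (-(-(Complex.I * c)) * (X * Lap η (-(Complex.I * c))) - -(Complex.I * c) * (X * Lap η (Complex.I * c))) * (Complex.I / 2)
      = -(c / 2) * X * (Lap η (-(Complex.I * c)) + Lap η (Complex.I * c)) := by
    linear_combination (c / 2) * X * (Lap η (-(Complex.I * c)) + Lap η (Complex.I * c)) * Complex.I_sq
  rw [e2, e1]
  refine mul_ne_zero (mul_ne_zero (by simp only [c]; norm_num) hX) ?_
  exact_mod_cast (by positivity : (2 * ∫ z, B z * Real.cos (17/12 * z)) ≠ 0)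

/-- the coefficient of the main term -/
def pc (b b' t : ℝ) : ℝ := (3/2) * (1 + (17/12)^2) * (min t b - min t b') - (17/12)^2 * t

theorem pc_lower {b b' T0 : ℝ} (hb : b ∈ Set.Icc 0 T0) (hb' : b' ∈ Set.Icc 0 T0) :
    (1/10) * T0 ≤ |pc b b' (T0/3)| + |pc b b' (2*T0/3)| + |pc b b' T0| := by
  obtain ⟨h1, h2⟩ := hb
  obtain ⟨h3, h4⟩ := hb'
  unfold pc
  rw [min_eq_right h2, min_eq_right h4]
  have a1 := abs_le.1 (le_refl |3 / 2 * (1 + (17 / 12) ^ 2) * (min (T0 / 3) b - min (T0 / 3) b') - (17 / 12) ^ 2 * (T0 / 3)|)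
  have a2 := abs_le.1 (le_refl |3 / 2 * (1 + (17 / 12) ^ 2) * (min (2 * T0 / 3) b - min (2 * T0 / 3) b') - (17 / 12) ^ 2 * (2 * T0 / 3)|)
  have a3 := abs_le.1 (le_refl |3 / 2 * (1 + (17 / 12) ^ 2) * (b - b') - (17 / 12) ^ 2 * T0|)
  generalize |3 / 2 * (1 + (17 / 12) ^ 2) * (min (T0 / 3) b - min (T0 / 3) b') - (17 / 12) ^ 2 * (T0 / 3)| = A at *
  generalize |3 / 2 * (1 + (17 / 12) ^ 2) * (min (2 * T0 / 3) b - min (2 * T0 / 3) b') - (17 / 12) ^ 2 * (2 * T0 / 3)| = B at *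
  generalize |3 / 2 * (1 + (17 / 12) ^ 2) * (b - b') - (17 / 12) ^ 2 * T0| = C at *
  by_contra hcon
  push Not at hcon
  obtain ⟨a11, a12⟩ := a1
  obtain ⟨a21, a22⟩ := a2
  obtain ⟨a31, a32⟩ := a3
  rcases le_total (T0/3) b with k1 | k1 <;> rcases le_total (T0/3) b' with k2 | k2 <;> rcases le_total (2*T0/3) b with k3 | k3 <;>
    rcases le_total (2*T0/3) b' with k4 | k4 <;>
    simp only [min_eq_left, min_eq_right, k1, k2, k3, k4] at a11 a12 a21 a22 <;> linarith

end

/-! ### Part P10g -/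

noncomputable section

open MeasureTheory Filter
open scoped ENNReal Topology
variable {s T e : ℝ} {u0 : ℝ → ℂ} {w : ℝ → ℝ → ℂ}

/-- the size of the main term in the cell at `y` -/
def Ay (s : ℝ) (f : ℝ → ℝ) (N y : ℝ) : ℝ := 2 * N ^ (-s - 2) * f y ^ 2

theorem sqmain {φhat : ℝ → ℝ} {φ : ℝ → ℂ} (hφ : CutoffPair φhat φ) {f d : ℝ → ℝ} {M : ℝ} (hp : PF φ f d M) {m : ℕ} {H : ℝ → ℂ} (h : TT m H)
    (hs : 3/2 < s) (hm : s ≤ m) {K : ℝ} (hK : 0 < K) : ∃ C : ℝ, 0 < C ∧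
    ∀ (N T T0 e c0 c1 : ℝ) (w : ℝ → ℝ → ℂ) (J G : Finset ℝ) (b r : ℝ → ℝ), CL f d c0 c1 N J → G ⊆ J → Sol s T (1/N) e (U0 s φ N) w → SZ s N K w →
      T0 ∈ Set.Icc 0 T → (∀ y ∈ G, SwY T T0 N w y (b y)) → ∀ t ∈ Set.Icc 0 T0, (∀ y ∈ G, r y ∈ Set.Icc 0 t) →
      ∑ y ∈ G, ‖(∫ τ in (0:ℝ)..r y, cc H N y (fun x => IF (ah w τ) x ^ 2)) + r y * (Ay s f N y * SS H)‖ ≤ C * (t * (t + om s N)) * N ^ (-s - 1) := by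
  obtain ⟨Ca, ha, Ea⟩ := sqdiff h hs hm hK
  obtain ⟨Cb, hb, Eb⟩ := u0sq hφ hp h.h0 hs hm
  refine ⟨Ca + Cb, by positivity, ?_⟩
  intro N T T0 e c0 c1 w J G b r hcl hG S Z hT0 hsw t ht hr
  have hN : 1 ≤ N := hcl.cells.one
  have hN0 : 0 < N := by linarith
  have hom := (om_facts (s := s) hN).1
  have hpw : 0 < N ^ (-s - 1) := by positivity
  have hc : ∀ y, Continuous (fun τ => cc H N y (fun x => IF (ah w τ) x ^ 2) + Ay s f N y * SS H) := fun y =>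
    (S.cc2_cont h.h0.1 hN0 y).add continuous_const
  have key := sum_time hc ht.1 hr (M := (Ca * t + Cb * om s N) * N ^ (-s - 1)) (by
    intro τ hτ
    have e1 := Ea N T T0 e _ w G b (hcl.cells.subset hG) S Z hT0 hsw τ ⟨hτ.1, hτ.2.trans ht.2⟩
    have e2 := Eb N c0 c1 J G hcl hG
    have e3 : Ca * τ * N ^ (-s - 1) ≤ Ca * t * N ^ (-s - 1) := by gcongr; exact hτ.2
    calc ∑ y ∈ G, ‖cc H N y (fun x => IF (ah w τ) x ^ 2) + Ay s f N y * SS H‖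
        ≤ ∑ y ∈ G, (‖cc H N y (fun x => IF (ah w τ) x ^ 2) - cc H N y (fun x => U0 s φ N x ^ 2)‖
          + ‖cc H N y (fun x => U0 s φ N x ^ 2) + ((2 * N ^ (-s - 2) * f y ^ 2 : ℝ) : ℂ) * SS H‖) := by
          refine Finset.sum_le_sum fun y _ => ?_
          refine le_trans (le_of_eq ?_) (norm_add_le _ _)
          congr 1; unfold Ay; ring
      _ ≤ _ := by rw [Finset.sum_add_distrib]; linarith)
  have e4 : (Ca * t + Cb * om s N) * N ^ (-s - 1) * t ≤ (Ca + Cb) * (t * (t + om s N)) * N ^ (-s - 1) := by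
    have p1 : 0 ≤ Ca * (t * om s N) * N ^ (-s - 1) := mul_nonneg (mul_nonneg ha.le (mul_nonneg ht.1 hom.le)) hpw.le
    have p2 : 0 ≤ Cb * (t * t) * N ^ (-s - 1) := mul_nonneg (mul_nonneg hb.le (mul_nonneg ht.1 ht.1)) hpw.le
    linarith
  refine le_trans (le_of_eq ?_) (key.trans e4)
  refine Finset.sum_congr rfl fun y _ => ?_
  rw [intervalIntegral.integral_add ((S.cc2_cont h.h0.1 hN0 y).intervalIntegrable _ _) (continuous_const.intervalIntegrable _ _),
    intervalIntegral.integral_const]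
  congr 2
  rw [sub_zero, Complex.real_smul]

theorem mqmain {m : ℕ} {H : ℝ → ℂ} (h : VM m H)
    (hs : 3/2 < s) (hm : s ≤ m) {K : ℝ} (hK : 0 < K) : ∃ C : ℝ, 0 < C ∧
    ∀ (N T e : ℝ) (u0 : ℝ → ℂ) (w : ℝ → ℝ → ℂ) (G : Finset ℝ) (r : ℝ → ℝ), Cells N G → Sol s T (1/N) e u0 w → SZ s N K w →
      ∀ t, 0 ≤ t → (∀ y ∈ G, r y ∈ Set.Icc 0 t) →
      ∑ y ∈ G, ‖∫ τ in (0:ℝ)..r y, cc H N y (IF (mq (1/N) w τ))‖ ≤ C * (t * rho s N) * N ^ (-s) := by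
  obtain ⟨C, hC, E⟩ := lemT h
  refine ⟨C * K, by positivity, ?_⟩
  intro N T e u0 w G r hG S Z t ht hr
  have hN : 1 ≤ N := hG.one
  have hN0 : 0 < N := by linarith
  have hrho := (rho_facts hs hN).1
  have hmc : Continuous (fun p : ℝ × ℝ => IF (mq (1/N) w p.1) p.2) := (S.tfm.mono (by norm_num : (0:ℝ) ≤ 2)).continuous
  have hc : ∀ y, Continuous (fun τ => cc H N y (IF (mq (1/N) w τ))) := fun y =>
    cc_tcont h.1 hN0 y (F := fun τ => IF (mq (1/N) w τ)) hmc
  have key := sum_time hc ht hr (M := C * (K * rho s N / N) * N ^ (-(s - 1))) (fun τ _ =>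
    E N G hG (s - 1) (by linarith) (by linarith) _ (S.tfm.meas τ) (S.tfm.integrable (by norm_num) τ) _ (by positivity) (Z.q2 τ))
  refine key.trans (le_of_eq ?_)
  rw [pw1 hN, pw2 hN]; field_simp

theorem Sol.diff_psi {u v : ℝ → ℝ → ℂ} {N K T0 y b b' : ℝ} (hN : 1 ≤ N) (hK : 0 < K) (Su : Sol s T (1/N) 1 u0 u) (Sv : Sol s T (1/N) 0 u0 v)
    (Zu : SZ s N K u) (Zv : SZ s N K v) (hT0 : T0 ∈ Set.Icc 0 T)
    (hb : SwY T T0 N u y b) (hb' : SwY T T0 N v y b') {t : ℝ} (ht : t ∈ Set.Icc 0 T0) {H : ℝ → ℂ} (h : VV H) :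
    cc H N y (IF (fun ξ => ah u t ξ - ah v t ξ)) - cc (deriv (deriv H)) N y (IF (fun ξ => ah u t ξ - ah v t ξ)) =
      (3/2) * N * ((∫ τ in (0:ℝ)..min t b, cc (deriv H) N y (fun x => IF (ah u τ) x ^ 2))
          - ∫ τ in (0:ℝ)..min t b, cc (deriv (deriv (deriv H))) N y (fun x => IF (ah u τ) x ^ 2))
      - (3/2) * N * ((∫ τ in (0:ℝ)..min t b', cc (deriv H) N y (fun x => IF (ah v τ) x ^ 2))
          - ∫ τ in (0:ℝ)..min t b', cc (deriv (deriv (deriv H))) N y (fun x => IF (ah v τ) x ^ 2))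
      + N * (∫ τ in (0:ℝ)..t, cc (deriv (deriv (deriv H))) N y (fun x => IF (ah u τ) x ^ 2))
      - (1/2) * ((∫ τ in (0:ℝ)..min t b, cc H N y (IF (mq (1/N) u τ)))
          - ∫ τ in (0:ℝ)..min t b, cc (deriv (deriv H)) N y (IF (mq (1/N) u τ))) := by
  have hN0 : 0 < N := by linarith
  have e1 := Su.cell_psi hN hK Zu hT0 hb ht h
  have e2 := Sv.cell_psi hN hK Zv hT0 hb' ht h
  have e3 : IF (fun ξ => ah u t ξ - ah v t ξ) = fun x => IF (ah u t) x - IF (ah v t) x := by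
    funext x; exact IF_sub (Su.ah_int t) (Sv.ah_int t) x
  have cu := continuous_IF (Su.ah_int t)
  have cv' := continuous_IF (Sv.ah_int t)
  rw [cc_Ps h hN0 y cu] at e1
  rw [cc_Ps h hN0 y cv'] at e2
  rw [e3, cc_sub h hN0 y cu cv', cc_sub h.deriv.deriv hN0 y cu cv']
  push_cast at e1 e2
  linear_combination e1 - e2

theorem alg_main (N A p c mb mb' t : ℝ) (S1 S3 X1 X2 X3 X4 X5 X6 X7 : ℂ) (hS : S3 = -(17/12)^2 * S1)
    (hp : p = (3/2) * (1 + (17/12)^2) * (mb - mb') - (17/12)^2 * t) :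
    (3/2) * N * (X1 - X2) - (3/2) * N * (X3 - X4) + N * X5 - (1/2) * (X6 - X7) + ((N * A * p : ℝ) : ℂ) * S1 =
    (3/2) * N * ((X1 + mb * (A * S1)) - (X2 + mb * (A * S3))) - (3/2) * N * ((X3 + mb' * (A * S1)) - (X4 + mb' * (A * S3)))
      + N * (X5 + t * (A * S3)) - (1/2) * (X6 - X7) := by
  rw [hS, hp]; push_cast; ring

theorem norm_alg {N : ℝ} (hN : 0 ≤ N) (X1 X2 X3 X4 X5 X6 X7 : ℂ) :
    ‖(3/2) * N * (X1 - X2) - (3/2) * N * (X3 - X4) + N * X5 - (1/2) * (X6 - X7)‖ ≤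
      2 * N * (‖X1‖ + ‖X2‖ + ‖X3‖ + ‖X4‖ + ‖X5‖) + (‖X6‖ + ‖X7‖) := by
  have n1 : ‖(3/2) * (N:ℂ) * (X1 - X2)‖ ≤ (3/2) * N * (‖X1‖ + ‖X2‖) := by
    rw [norm_mul, norm_mul, Complex.norm_real, Real.norm_eq_abs, abs_of_nonneg hN, show ‖(3/2:ℂ)‖ = 3/2 by norm_num]
    gcongr; exact norm_sub_le _ _
  have n2 : ‖(3/2) * (N:ℂ) * (X3 - X4)‖ ≤ (3/2) * N * (‖X3‖ + ‖X4‖) := by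
    rw [norm_mul, norm_mul, Complex.norm_real, Real.norm_eq_abs, abs_of_nonneg hN, show ‖(3/2:ℂ)‖ = 3/2 by norm_num]
    gcongr; exact norm_sub_le _ _
  have n3 : ‖(N:ℂ) * X5‖ = N * ‖X5‖ := by
    rw [norm_mul, Complex.norm_real, Real.norm_eq_abs, abs_of_nonneg hN]
  have n4 : ‖(1/2) * (X6 - X7)‖ ≤ (1/2) * (‖X6‖ + ‖X7‖) := by
    rw [norm_mul, show ‖(1/2:ℂ)‖ = 1/2 by norm_num]
    gcongr; exact norm_sub_le _ _
  have t1 := norm_sub_le ((3/2) * (N:ℂ) * (X1 - X2) - (3/2) * N * (X3 - X4) + N * X5) ((1/2) * (X6 - X7))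
  have t2 := norm_add_le ((3/2) * (N:ℂ) * (X1 - X2) - (3/2) * N * (X3 - X4)) (N * X5)
  have t3 := norm_sub_le ((3/2) * (N:ℂ) * (X1 - X2)) ((3/2) * N * (X3 - X4))
  have q : 0 ≤ N * (‖X1‖ + ‖X2‖ + ‖X3‖ + ‖X4‖ + ‖X5‖) := by positivity
  have q5 : 0 ≤ N * ‖X5‖ := by positivity
  have q6 := norm_nonneg X6
  have q7 := norm_nonneg X7
  linarith

theorem combine {φhat : ℝ → ℝ} {φ : ℝ → ℂ} (hφ : CutoffPair φhat φ) {f d : ℝ → ℝ} {M : ℝ} (hp : PF φ f d M) {m : ℕ} {H : ℝ → ℂ} (h : TT m H)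
    (hs : 3/2 < s) (hm : s ≤ m) {K : ℝ} (hK : 0 < K) : ∃ C : ℝ, 0 < C ∧
    ∀ (N T T0 c0 c1 : ℝ) (u v : ℝ → ℝ → ℂ) (J G : Finset ℝ) (b b' : ℝ → ℝ), CL f d c0 c1 N J → G ⊆ J → Sol s T (1/N) 1 (U0 s φ N) u →
      Sol s T (1/N) 0 (U0 s φ N) v → SZ s N K u → SZ s N K v →
      T0 ∈ Set.Icc 0 T → (∀ y ∈ G, SwY T T0 N u y (b y)) → (∀ y ∈ G, SwY T T0 N v y (b' y)) → ∀ t ∈ Set.Icc 0 T0,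
      ∑ y ∈ G, ‖(cc H N y (IF (fun ξ => ah u t ξ - ah v t ξ)) - cc (deriv (deriv H)) N y (IF (fun ξ => ah u t ξ - ah v t ξ))) +
        ((N * Ay s f N y * pc (b y) (b' y) t : ℝ) : ℂ) * SS (deriv H)‖ ≤ C * (t * (t + om s N + rho s N)) * N ^ (-s) := by
  have hV := h.h0.1
  obtain ⟨C1, hC1, E1⟩ := sqmain hφ hp h.deriv hs hm hK
  obtain ⟨C3, hC3, E3⟩ := sqmain hφ hp h.deriv.deriv.deriv hs hm hK
  obtain ⟨D0, hD0, F0⟩ := mqmain h.h0 hs hm hK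
  obtain ⟨D2, hD2, F2⟩ := mqmain h.deriv.deriv.h0 hs hm hK
  refine ⟨4 * C1 + 6 * C3 + (D0 + D2), by positivity, ?_⟩
  intro N T T0 c0 c1 u v J G b b' hcl hG Su Sv Zu Zv hT0 hb hb' t ht
  have hN : 1 ≤ N := hcl.cells.one
  have hN0 : 0 < N := by linarith
  have hom := (om_facts (s := s) hN).1
  have hrho := (rho_facts hs hN).1
  have r1 : ∀ y ∈ G, min t (b y) ∈ Set.Icc 0 t := fun y hy => ⟨le_min ht.1 (hb y hy).1.1, min_le_left _ _⟩
  have r2 : ∀ y ∈ G, min t (b' y) ∈ Set.Icc 0 t := fun y hy => ⟨le_min ht.1 (hb' y hy).1.1, min_le_left _ _⟩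
  have r3 : ∀ y ∈ G, (fun _ : ℝ => t) y ∈ Set.Icc 0 t := fun y hy => ⟨ht.1, le_rfl⟩
  have x1 := E1 N T T0 1 c0 c1 u J G b (fun y => min t (b y)) hcl hG Su Zu hT0 hb t ht r1
  have x2 := E3 N T T0 1 c0 c1 u J G b (fun y => min t (b y)) hcl hG Su Zu hT0 hb t ht r1
  have x3 := E1 N T T0 0 c0 c1 v J G b' (fun y => min t (b' y)) hcl hG Sv Zv hT0 hb' t ht r2
  have x4 := E3 N T T0 0 c0 c1 v J G b' (fun y => min t (b' y)) hcl hG Sv Zv hT0 hb' t ht r2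
  have x5 := E3 N T T0 1 c0 c1 u J G b (fun _ => t) hcl hG Su Zu hT0 hb t ht r3
  have x6 := F0 N T 1 _ u G (fun y => min t (b y)) (hcl.cells.subset hG) Su Zu t ht.1 r1
  have x7 := F2 N T 1 _ u G (fun y => min t (b y)) (hcl.cells.subset hG) Su Zu t ht.1 r1
  have hle : ∑ y ∈ G, ‖(cc H N y (IF (fun ξ => ah u t ξ - ah v t ξ)) - cc (deriv (deriv H)) N y (IF (fun ξ => ah u t ξ - ah v t ξ))) +
        ((N * Ay s f N y * pc (b y) (b' y) t : ℝ) : ℂ) * SS (deriv H)‖ ≤ _ :=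
    Finset.sum_le_sum fun y hy => (le_of_eq (congrArg norm ((congrArg (· + ((N * Ay s f N y * pc (b y) (b' y) t : ℝ) : ℂ) * SS (deriv H))
      (Sol.diff_psi hN hK Su Sv Zu Zv hT0 (hb y hy) (hb' y hy) ht hV)).trans
        (alg_main N (Ay s f N y) (pc (b y) (b' y) t) 0 (min t (b y)) (min t (b' y)) t _ _ _ _ _ _ _ _ _ (SS_ddd hV) rfl)))).trans
      (norm_alg hN0.le _ _ _ _ _ _ _)
  refine hle.trans ?_
  rw [Finset.sum_add_distrib, ← Finset.mul_sum, Finset.sum_add_distrib, Finset.sum_add_distrib, Finset.sum_add_distrib, Finset.sum_add_distrib,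
    Finset.sum_add_distrib]
  have e0 : N ^ (-s) = N * N ^ (-s - 1) := pw2 hN s
  have hpw : 0 < N ^ (-s - 1) := by positivity
  have y1 := add_le_add (add_le_add (add_le_add (add_le_add x1 x2) x3) x4) x5
  have y2 := mul_le_mul_of_nonneg_left y1 (by positivity : 0 ≤ 2 * N)
  have y3 := add_le_add y2 (add_le_add x6 x7)
  refine y3.trans ?_
  rw [e0]
  have g1 : 0 ≤ C1 * (t * rho s N) * (N * N ^ (-s - 1)) := mul_nonneg (mul_nonneg hC1.le (mul_nonneg ht.1 hrho.le)) (by positivity)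
  have g2 : 0 ≤ C3 * (t * rho s N) * (N * N ^ (-s - 1)) := mul_nonneg (mul_nonneg hC3.le (mul_nonneg ht.1 hrho.le)) (by positivity)
  have g3 : 0 ≤ (D0 + D2) * (t * (t + om s N)) * (N * N ^ (-s - 1)) :=
    mul_nonneg (mul_nonneg (by positivity) (mul_nonneg ht.1 (add_nonneg ht.1 hom.le))) (by positivity)
  linarith

end

/-! ### Part P10h -/

noncomputable section

open MeasureTheory Filter
open scoped ENNReal Topology

theorem large_N {s δ : ℝ} (hs : 3/2 < s) (hδ : 0 < δ) : ∃ N1 : ℝ, 1 ≤ N1 ∧ ∀ N, N1 ≤ N → om s N + rho s N ≤ δ ∧ N ^ (-s) ≤ N ^ (-1:ℝ) / 2 := by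
  have t1 : Tendsto (fun N : ℝ => N ^ (-1:ℝ)) atTop (𝓝 0) := tendsto_rpow_neg_atTop (by norm_num)
  have t2 : Tendsto (fun N : ℝ => N ^ (1 - s)) atTop (𝓝 0) := by
    have := tendsto_rpow_neg_atTop (y := s - 1) (by linarith)
    simpa using this
  have t3 : Tendsto (fun N : ℝ => rho s N) atTop (𝓝 0) :=
    tendsto_rpow_neg_atTop (lt_min (by norm_num) (by linarith))
  have t4 : Tendsto (fun N : ℝ => om s N + rho s N) atTop (𝓝 0) := by
    simpa [om] using (t1.add t2).add t3
  have ev := (t4.eventually (ge_mem_nhds hδ)).and ((t2.eventually (ge_mem_nhds (show (0:ℝ) < 1/2 by norm_num))).and (eventually_ge_atTop (1:ℝ)))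
  obtain ⟨N1, h1⟩ := eventually_atTop.1 ev
  refine ⟨max 1 N1, le_max_left _ _, fun N hN => ?_⟩
  obtain ⟨a, b, c⟩ := h1 N ((le_max_right _ _).trans hN)
  refine ⟨a, ?_⟩
  have hN0 : 0 < N := by linarith
  have e1 : N ^ (-s) = N ^ (-1:ℝ) * N ^ (1 - s) := by rw [← Real.rpow_add hN0]; congr 1; ring
  rw [e1]
  have : 0 < N ^ (-1:ℝ) := by positivity
  have := mul_le_mul_of_nonneg_left b this.le
  linarith

theorem diff_N2 {s T α e e' : ℝ} {u0 : ℝ → ℂ} {u v : ℝ → ℝ → ℂ} (Su : Sol s T α e u0 u) (Sv : Sol s T α e' u0 v) (t : ℝ) :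
    N2 s (fun ξ => ah u t ξ - ah v t ξ) ≤ ENNReal.ofReal (sobolevNorm s (fun x => u t x - v t x) ^ 2) := by
  have hm : MemSobolev s (fun x => u t x - v t x) :=
    memSob_mono (by linarith) ((Su.mem t).sub' (Sv.mem t))
  have e1 : (fun ξ => ah u t ξ - ah v t ξ) = fun ξ => fourierT (fun x => u t x - v t x) ξ / (2 * Real.pi) := by
    funext ξ
    rw [fourierT_sub (Su.mem t).1 (Sv.mem t).1]; unfold ah; ring
  rw [e1, N2_div, memSob_L2 hm]
  have : (1 / (2 * Real.pi)) ^ 2 ≤ 1 := by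
    have := Real.pi_gt_three
    rw [sq_le_one_iff₀ (by positivity), div_le_one (by positivity)]; linarith
  calc _ ≤ ENNReal.ofReal 1 * _ := mul_le_mul' (ENNReal.ofReal_le_ofReal this) le_rfl
    _ = _ := by simp

open Classical in
theorem core {φhat : ℝ → ℝ} {φ : ℝ → ℂ} (hφ : CutoffPair φhat φ) {s : ℝ} (hs : 3/2 < s) {T : ℝ} (hT : 0 < T) {C2 : ℝ} (hC2 : 0 < C2) :
    ∃ η0 : ℝ, 0 < η0 ∧ ∃ T0 : ℝ, 0 < T0 ∧ T0 ≤ T ∧ ∃ N0 : ℝ, 1 ≤ N0 ∧ ∀ (N : ℝ) (u v : ℝ → ℝ → ℂ), N0 ≤ N →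
      Sol s T (1/N) 1 (U0 s φ N) u → Sol s T (1/N) 0 (U0 s φ N) v →
      (∀ t, sobolevNorm (s - 1) (u t) ≤ C2 * sobolevNorm (s - 1) (U0 s φ N)) →
      (∀ t, sobolevNorm (s + 2) (u t) ≤ C2 * sobolevNorm (s + 2) (U0 s φ N)) →
      (∀ t, sobolevNorm (s - 1) (v t) ≤ C2 * sobolevNorm (s - 1) (U0 s φ N)) →
      (∀ t, sobolevNorm (s + 2) (v t) ≤ C2 * sobolevNorm (s + 2) (U0 s φ N)) →
      ∃ t ∈ Set.Icc 0 T0, η0 ≤ sobolevNorm s (fun x => u t x - v t x) := by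
  obtain ⟨f, d, M, hp⟩ := phi_facts hφ
  have hM := hp.M1
  obtain ⟨c0, c1, N0, hc0, hc1, hN0, hcells⟩ := cells_exist hp
  obtain ⟨η, hη, hSS⟩ := SS_ne
  obtain ⟨k, hk⟩ := exists_nat_ge s
  have hm : s ≤ ((2 * k : ℕ) : ℝ) := by push_cast; linarith
  have hTT := TT_Th hη (2 * k)
  have hS := hSS k
  generalize Th (2 * k) η = H at hTT hS
  generalize 2 * k = m at hm hTT
  obtain ⟨K, hK, hSZ⟩ := init_sz hφ hs hC2
  obtain ⟨C, hC, hcomb⟩ := combine hφ hp hTT hs hm hK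
  obtain ⟨L0, hL0, hl0⟩ := lemT hTT.h0
  obtain ⟨L2, hL2, hl2⟩ := lemT hTT.deriv.deriv.h0
  set σ0 := ‖SS (deriv H)‖ with hσ0
  have hσ : 0 < σ0 := norm_pos_iff.2 hS
  set X := c0 ^ 2 * c1 * σ0 / 10 with hX
  have hXp : 0 < X := by positivity
  set ε := min 1 (c0 ^ 2 / (32 * M)) with hε
  have hεp : 0 < ε := lt_min one_pos (by positivity)
  have hε1 : ε ≤ 1 := min_le_left _ _
  have hε2 : 32 * M * ε ≤ c0 ^ 2 := by
    have : ε ≤ c0 ^ 2 / (32 * M) := min_le_right _ _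
    rw [le_div_iff₀ (by positivity)] at this; linarith
  set T0 := min (min T (ε / (2 * K + K ^ 2))) (min (c1 * ε / (8 * (18 * K + 54 * K ^ 2))) (X / (12 * C))) with hT0
  have hT0p : 0 < T0 := lt_min (lt_min hT (by positivity)) (lt_min (by positivity) (by positivity))
  have hT0T : T0 ≤ T := (min_le_left _ _).trans (min_le_left _ _)
  have g1 : (2 * K + K ^ 2) * T0 ≤ ε := by
    have : T0 ≤ ε / (2 * K + K ^ 2) := (min_le_left _ _).trans (min_le_right _ _)
    rw [le_div_iff₀ (by positivity)] at this; linarith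
  have g2 : 8 * (18 * K + 54 * K ^ 2) * T0 ≤ c1 * ε := by
    have : T0 ≤ c1 * ε / (8 * (18 * K + 54 * K ^ 2)) := (min_le_right _ _).trans (min_le_left _ _)
    rw [le_div_iff₀ (by positivity)] at this; linarith
  have g3 : 12 * C * T0 ≤ X := by
    have : T0 ≤ X / (12 * C) := (min_le_right _ _).trans (min_le_right _ _)
    rw [le_div_iff₀ (by positivity)] at this; linarith
  obtain ⟨N1, hN1, hlarge⟩ := large_N hs (show 0 < X / (12 * C) by positivity)
  refine ⟨X * T0 / (6 * (L0 + L2)), by positivity, T0, hT0p, hT0T, max N0 N1, hN0.trans (le_max_left _ _), ?_⟩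
  intro N u v hN Su Sv b1 b2 b3 b4
  have hNN1 : N1 ≤ N := (le_max_right _ _).trans hN
  have hN' : 1 ≤ N := hN1.trans hNN1
  have hNp : 0 < N := by linarith
  obtain ⟨l1, l2⟩ := hlarge N hNN1
  obtain ⟨J, hcl⟩ := hcells N ((le_max_left _ _).trans hN)
  have Zu := hSZ N T 1 u hN' Su b1 b2
  have Zv := hSZ N T 0 v hN' Sv b3 b4
  have hT0' : T0 ∈ Set.Icc 0 T := ⟨hT0p.le, hT0T⟩
  have gu := good_cells hp hcl hc0 hN' l2 hεp hε1 hε2 hK Su Zu hT0' g1 g2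
  have gv := good_cells hp hcl hc0 hN' l2 hεp hε1 hε2 hK Sv Zv hT0' g1 g2
  set G := J.filter fun y => (∃ b, SwY T T0 N u y b) ∧ ∃ b, SwY T T0 N v y b with hG
  have hGJ : G ⊆ J := Finset.filter_subset _ _
  have hcard : c1 * N / 2 ≤ (G.card : ℝ) := by
    have e1 : J ⊆ G ∪ ((J.filter fun y => ¬ ∃ b, SwY T T0 N u y b) ∪ (J.filter fun y => ¬ ∃ b, SwY T T0 N v y b)) := by
      intro y hy
      simp only [hG, Finset.mem_union, Finset.mem_filter]
      tauto
    have e2 := Finset.card_le_card e1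
    have e3 := Finset.card_union_le G ((J.filter fun y => ¬ ∃ b, SwY T T0 N u y b) ∪ (J.filter fun y => ¬ ∃ b, SwY T T0 N v y b))
    have e4 := Finset.card_union_le (J.filter fun y => ¬ ∃ b, SwY T T0 N u y b) (J.filter fun y => ¬ ∃ b, SwY T T0 N v y b)
    have e5 : (J.card : ℝ) ≤ G.card + ((J.filter fun y => ¬ ∃ b, SwY T T0 N u y b).card + (J.filter fun y => ¬ ∃ b, SwY T T0 N v y b).card) := by
      exact_mod_cast (e2.trans e3).trans (by gcongr)
    have := hcl.many
    linarith
  have hb0 : ∀ y, ∃ b, y ∈ G → SwY T T0 N u y b := by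
    intro y
    by_cases hy : y ∈ G
    · obtain ⟨b, hb⟩ := (Finset.mem_filter.1 hy).2.1
      exact ⟨b, fun _ => hb⟩
    · exact ⟨0, fun h => absurd h hy⟩
  have hb0' : ∀ y, ∃ b, y ∈ G → SwY T T0 N v y b := by
    intro y
    by_cases hy : y ∈ G
    · obtain ⟨b, hb⟩ := (Finset.mem_filter.1 hy).2.2
      exact ⟨b, fun _ => hb⟩
    · exact ⟨0, fun h => absurd h hy⟩
  choose b hb using hb0
  choose b' hb' using hb0'
  by_contra hcon
  push Not at hcon
  have hpw : 0 < N ^ (-s) := by positivity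
  -- bound for each time
  have main : ∀ t ∈ Set.Icc 0 T0, ∑ y ∈ G, N * Ay s f N y * |pc (b y) (b' y) t| * σ0 < (X * T0 / 6 + 2 * (X * T0 / 12)) * N ^ (-s) := by
    intro t ht
    have h1 := hcomb N T T0 c0 c1 u v J G b b' hcl hGJ Su Sv Zu Zv hT0' hb hb' t ht
    have hlt := hcon t ht
    have hmeas : Measurable (fun ξ => ah u t ξ - ah v t ξ) := ((Su.ah_cont t).sub (Sv.ah_cont t)).measurable
    have hintg : Integrable (fun ξ => ah u t ξ - ah v t ξ) := (Su.ah_int t).sub (Sv.ah_int t)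
    have hA : 0 ≤ sobolevNorm s (fun x => u t x - v t x) := Real.sqrt_nonneg _
    have h2 := hl0 N G (hcl.cells.subset hGJ) s (by linarith) hm _ hmeas hintg _ hA (diff_N2 Su Sv t)
    have h3 := hl2 N G (hcl.cells.subset hGJ) s (by linarith) hm _ hmeas hintg _ hA (diff_N2 Su Sv t)
    set A := sobolevNorm s (fun x => u t x - v t x)
    have h4 : ∑ y ∈ G, N * Ay s f N y * |pc (b y) (b' y) t| * σ0 ≤
        ∑ y ∈ G, (‖(cc H N y (IF (fun ξ => ah u t ξ - ah v t ξ)) - cc (deriv (deriv H)) N y (IF (fun ξ => ah u t ξ - ah v t ξ))) +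
        ((N * Ay s f N y * pc (b y) (b' y) t : ℝ) : ℂ) * SS (deriv H)‖ + (‖cc H N y (IF (fun ξ => ah u t ξ - ah v t ξ))‖ + ‖cc (deriv (deriv H)) N y (IF (fun ξ => ah u t ξ - ah v t ξ))‖)) := by
      refine Finset.sum_le_sum fun y _ => ?_
      have hAy : 0 ≤ N * Ay s f N y := by unfold Ay; positivity
      have e1 : N * Ay s f N y * |pc (b y) (b' y) t| * σ0 = ‖((N * Ay s f N y * pc (b y) (b' y) t : ℝ) : ℂ) * SS (deriv H)‖ := by
        rw [norm_mul, Complex.norm_real, Real.norm_eq_abs, abs_mul, abs_of_nonneg hAy]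
      rw [e1]
      have e2 := norm_sub_le (cc H N y (IF (fun ξ => ah u t ξ - ah v t ξ))) (cc (deriv (deriv H)) N y (IF (fun ξ => ah u t ξ - ah v t ξ)))
      have e3 := norm_sub_le ((cc H N y (IF (fun ξ => ah u t ξ - ah v t ξ)) - cc (deriv (deriv H)) N y (IF (fun ξ => ah u t ξ - ah v t ξ))) +
        ((N * Ay s f N y * pc (b y) (b' y) t : ℝ) : ℂ) * SS (deriv H)) (cc H N y (IF (fun ξ => ah u t ξ - ah v t ξ)) - cc (deriv (deriv H)) N y (IF (fun ξ => ah u t ξ - ah v t ξ)))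
      rw [add_sub_cancel_left] at e3
      linarith
    rw [Finset.sum_add_distrib, Finset.sum_add_distrib] at h4
    have h5 : C * (t * (t + om s N + rho s N)) ≤ 2 * (X * T0 / 12) := by
      have q1 : t * (t + om s N + rho s N) ≤ T0 * (T0 + X / (12 * C)) :=
        mul_le_mul ht.2 (by linarith [ht.2]) (by linarith [ht.1, (om_facts (s := s) hN').1, (rho_facts hs hN').1]) hT0p.le
      have q2 := mul_le_mul_of_nonneg_left q1 hC.le
      have q3 : C * (T0 * (T0 + X / (12 * C))) = (C * T0) * T0 + X * T0 / 12 := by field_simp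
      have q4 : (C * T0) * T0 ≤ X / 12 * T0 := by gcongr; linarith
      linarith
    have h6 : (L0 + L2) * A < X * T0 / 6 := by
      rw [lt_div_iff₀ (by positivity)] at hlt
      linarith
    have h7 := mul_le_mul_of_nonneg_right h5 hpw.le
    have h8 := mul_lt_mul_of_pos_right h6 hpw
    linarith
  have m1 := main (T0/3) ⟨by linarith, by linarith⟩
  have m2 := main (2*T0/3) ⟨by linarith, by linarith⟩
  have m3 := main T0 ⟨hT0p.le, le_rfl⟩
  have low : X * T0 * N ^ (-s) ≤ ∑ y ∈ G, N * Ay s f N y * |pc (b y) (b' y) (T0/3)| * σ0 + ∑ y ∈ G, N * Ay s f N y * |pc (b y) (b' y) (2*T0/3)| * σ0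
      + ∑ y ∈ G, N * Ay s f N y * |pc (b y) (b' y) T0| * σ0 := by
    rw [← Finset.sum_add_distrib, ← Finset.sum_add_distrib]
    have hpw1 : 0 < N ^ (-s - 1) := by positivity
    have q1 : ∀ y ∈ G, (2 * N ^ (-s - 1) * c0 ^ 2) * ((1/10) * T0) * σ0 ≤ N * Ay s f N y * |pc (b y) (b' y) (T0/3)| * σ0 + N * Ay s f N y * |pc (b y) (b' y) (2*T0/3)| * σ0
      + N * Ay s f N y * |pc (b y) (b' y) T0| * σ0 := by
      intro y hy
      have r1 := pc_lower (hb y hy).1 (hb' y hy).1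
      have r2 : c0 ≤ f y := hcl.fl y (hGJ hy) y (by simp; positivity)
      have r3 : N * Ay s f N y = 2 * N ^ (-s - 1) * f y ^ 2 := by
        unfold Ay
        have : N ^ (-s - 1) = N * N ^ (-s - 2) := by
          rw [← Real.rpow_one_add' hNp.le (by linarith)]; congr 1; ring
        rw [this]; ring
      have r4 : 2 * N ^ (-s - 1) * c0 ^ 2 ≤ N * Ay s f N y := by rw [r3]; gcongr
      have r5 : (2 * N ^ (-s - 1) * c0 ^ 2) * ((1/10) * T0) ≤ (N * Ay s f N y) * (|pc (b y) (b' y) (T0/3)| + |pc (b y) (b' y) (2*T0/3)| + |pc (b y) (b' y) T0|) :=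
        mul_le_mul r4 r1 (by positivity) (le_trans (by positivity) r4)
      have r6 := mul_le_mul_of_nonneg_right r5 hσ.le
      linarith
    have q2 := Finset.card_nsmul_le_sum G _ _ q1
    rw [nsmul_eq_mul] at q2
    refine le_trans ?_ q2
    have q3 : 0 ≤ (2 * N ^ (-s - 1) * c0 ^ 2) * ((1/10) * T0) * σ0 := by positivity
    have q4 := mul_le_mul_of_nonneg_right hcard q3
    refine le_trans (le_of_eq ?_) q4
    rw [pw2 hN', hX]; ring
  linarith

end

/-! ### Part P11 -/

noncomputable section

open MeasureTheory Filter
open scoped ENNReal Topology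

/-- clamping of time to `[0,T]` -/
def clp (T t : ℝ) : ℝ := max 0 (min t T)

theorem clp_mem {T : ℝ} (hT : 0 < T) (t : ℝ) : clp T t ∈ Set.Icc 0 T := ⟨le_max_left _ _, max_le hT.le (min_le_right _ _)⟩
theorem clp_eq {T t : ℝ} (h : t ∈ Set.Icc 0 T) : clp T t = t := by
  unfold clp; rw [min_eq_left h.2, max_eq_right h.1]

theorem clp_tendsto {T : ℝ} (hT : 0 < T) (t0 : ℝ) : Tendsto (clp T) (𝓝 t0) (𝓝[Set.Icc 0 T] (clp T t0)) := by
  refine tendsto_nhdsWithin_iff.2 ⟨?_, Eventually.of_forall fun t => clp_mem hT t⟩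
  have : Continuous (clp T) := by unfold clp; fun_prop
  exact this.tendsto t0

theorem U0_eq (s : ℝ) (φ : ℝ → ℂ) (n : ℕ) : (fun x => fn s φ n x + gn φ n x) = U0 s φ ((2:ℝ) ^ n) := by
  funext x
  have e1 : ((2:ℝ) ^ n) ^ (-s) = 2 ^ (-(n:ℝ) * s) := by
    rw [← Real.rpow_natCast, ← Real.rpow_mul (by norm_num)]; congr 1; ring
  have e2 : ((2:ℝ) ^ n) ^ (-1:ℝ) = 2 ^ (-(n:ℝ)) := by
    rw [← Real.rpow_natCast, ← Real.rpow_mul (by norm_num)]; congr 1; ring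
  unfold fn gn U0 lam
  rw [e1, e2]; push_cast; ring

theorem mkSol {s T e α : ℝ} (hs : 3/2 < s) (hT : 0 < T) (hα : 0 < α) (he : e = 0 ∨ e = 1) {u0 : ℝ → ℂ} (h0 : Continuous u0) {u : ℝ → ℝ → ℂ}
    (hmem : ∀ t ∈ Set.Icc (0 : ℝ) T, MemSobolev (s + 2) (u t))
    (hcont : ∀ t₀ ∈ Set.Icc (0 : ℝ) T, Filter.Tendsto (fun t => sobolevNorm (s + 2) (fun x => u t x - u t₀ x))
        (nhdsWithin t₀ (Set.Icc (0 : ℝ) T)) (nhds 0))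
    (heq : ∀ t ∈ Set.Icc (0 : ℝ) T, ∀ x : ℝ, u t x = u0 x - ∫ τ in (0 : ℝ)..t, (3 * u τ x * deriv (u τ) x +
    e * (fourierMult (m1 α) (fun y => u τ y ^ 2) x + (1 / 2) * fourierMult (m2 α) (fun y => deriv (u τ) y ^ 2) x))) :
    Sol s T α e u0 (fun t => u (clp T t)) where
  hs := hs
  hT := hT
  hα := hα
  he := he
  u0c := h0
  mem := fun t => hmem _ (clp_mem hT t)
  cont := fun t0 => (hcont _ (clp_mem hT t0)).comp (clp_tendsto hT t0)
  eq := by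
    intro t ht x
    rw [clp_eq ht, heq t ht x]
    congr 1
    refine intervalIntegral.integral_congr fun τ hτ => ?_
    rw [Set.uIcc_of_le ht.1] at hτ
    beta_reduce
    rw [clp_eq ⟨hτ.1, hτ.2.trans ht.2⟩]
  left := by
    intro t ht
    have : clp T t = clp T 0 := by
      rw [clp_eq ⟨le_rfl, hT.le⟩]; unfold clp
      rw [min_eq_left (by linarith), max_eq_left ht]
    beta_reduce; rw [this]
  right := by
    intro t ht
    have : clp T t = clp T T := by
      unfold clp; rw [min_eq_right ht, min_self]
    beta_reduce; rw [this]

theorem sob_le {s T e u0 w N K} (hK : 0 < K) (S : Sol s T (1/N) e u0 w) (Z : SZ s N K w) (t : ℝ) : sobolevNorm s (w t) ≤ 2 * Real.pi * K := by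
  have h1 := Z.Ns t
  rw [S.ah_N2 t (by linarith), ENNReal.ofReal_le_ofReal_iff (by positivity)] at h1
  have h2 := abs_le_of_sq_le_sq h1 hK.le
  have h3 := (abs_le.1 h2)
  have h4 := h3.2
  have := Real.pi_pos
  rw [div_le_iff₀ (by positivity)] at h4
  linarith

theorem sob_sub_le {s : ℝ} {f g : ℝ → ℂ} (hf : MemSobolev s f) (hg : MemSobolev s g) {B : ℝ} (hB : 0 ≤ B) (h1 : sobolevNorm s f ≤ B) (h2 : sobolevNorm s g ≤ B) :
    sobolevNorm s (fun x => f x - g x) ≤ 2 * B := by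
  have e1 := memSob_L2 (hf.sub' hg)
  have hm : Measurable (fourierT f) := (continuous_fourierT hf.1).measurable
  have e2 := N2_sub_le s (b := fourierT g) hm
  have e3 : fourierT (fun x => f x - g x) = fun ξ => fourierT f ξ - fourierT g ξ := funext fun ξ => fourierT_sub hf.1 hg.1 ξ
  rw [← e3, e1, memSob_L2 hf, memSob_L2 hg, ← ENNReal.ofReal_add (by positivity) (by positivity),
    show (2:ℝ≥0∞) = ENNReal.ofReal 2 by simp, ← ENNReal.ofReal_mul (by norm_num), ENNReal.ofReal_le_ofReal_iff (by positivity)] at e2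
  have n1 : 0 ≤ sobolevNorm s f := Real.sqrt_nonneg _
  have n2 : 0 ≤ sobolevNorm s g := Real.sqrt_nonneg _
  refine le_of_sq_le_sq ?_ (by positivity)
  have : sobolevNorm s f ^ 2 ≤ B ^ 2 := by gcongr
  have : sobolevNorm s g ^ 2 ≤ B ^ 2 := by gcongr
  nlinarith

end

/-- **Non-uniform zero-filter convergence (Theorem 1.2).** Let `s > 3/2`, `T > 0`,
`α_n = 2^{-n}`, and `u_0^n = f_n + g_n`. If, for every `n ≥ 1`, `u^n ∈ C([0,T]; H^{s+2})`
solves the Camassa–Holm equation with filter parameter `α_n` and initial data `u_0^n` (in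
integral form), `v^n ∈ C([0,T]; H^{s+2})` solves the Burgers equation `v_t + 3v∂_xv = 0`
with the same initial data (in integral form), and both satisfy the a priori bounds
`sup_{[0,T]} ‖·‖_{H^γ} ≤ C₂‖u_0^n‖_{H^γ}` for `γ ∈ {s−1, s, s+1, s+2}` with `C₂`
independent of `n`, then there are `η₀ > 0` and `0 < T₀ ≤ T` with
`liminf_{n→∞} sup_{t∈[0,T₀]} ‖u^n(t) − v^n(t)‖_{H^s} ≥ η₀`: the Camassa–Holm solutions do
not converge to the Burgers solutions in `L^∞(0,T₀;H^s)` uniformly in the initial data as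
the filter parameter tends to zero. -/
theorem ch_burgers_nonuniform_convergence (s : ℝ) (hs : 3 / 2 < s) (T : ℝ) (hT : 0 < T)
    (φhat : ℝ → ℝ) (φ : ℝ → ℂ) (hφ : CutoffPair φhat φ)
    (C₂ : ℝ) (hC₂ : 0 < C₂) (u v : ℕ → ℝ → ℝ → ℂ)
    (humem : ∀ n : ℕ, 1 ≤ n → ∀ t ∈ Set.Icc (0 : ℝ) T, MemSobolev (s + 2) (u n t))
    (hvmem : ∀ n : ℕ, 1 ≤ n → ∀ t ∈ Set.Icc (0 : ℝ) T, MemSobolev (s + 2) (v n t))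
    (hucont : ∀ n : ℕ, 1 ≤ n → ∀ t₀ ∈ Set.Icc (0 : ℝ) T,
      Filter.Tendsto (fun t => sobolevNorm (s + 2) (fun x => u n t x - u n t₀ x))
        (nhdsWithin t₀ (Set.Icc (0 : ℝ) T)) (nhds 0))
    (hvcont : ∀ n : ℕ, 1 ≤ n → ∀ t₀ ∈ Set.Icc (0 : ℝ) T,
      Filter.Tendsto (fun t => sobolevNorm (s + 2) (fun x => v n t x - v n t₀ x))
        (nhdsWithin t₀ (Set.Icc (0 : ℝ) T)) (nhds 0))
    (hueq : ∀ n : ℕ, 1 ≤ n → ∀ t ∈ Set.Icc (0 : ℝ) T, ∀ x : ℝ,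
      u n t x = (fn s φ n x + gn φ n x) -
        ∫ τ in (0 : ℝ)..t, chRHS ((2 : ℝ) ^ (-(n : ℝ))) (u n τ) x)
    (hveq : ∀ n : ℕ, 1 ≤ n → ∀ t ∈ Set.Icc (0 : ℝ) T, ∀ x : ℝ,
      v n t x = (fn s φ n x + gn φ n x) -
        ∫ τ in (0 : ℝ)..t, 3 * v n τ x * deriv (v n τ) x)
    (hubd : ∀ n : ℕ, 1 ≤ n → ∀ γ ∈ ({s - 1, s, s + 1, s + 2} : Set ℝ),
      ∀ t ∈ Set.Icc (0 : ℝ) T,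
        sobolevNorm γ (u n t) ≤ C₂ * sobolevNorm γ (fun x => fn s φ n x + gn φ n x))
    (hvbd : ∀ n : ℕ, 1 ≤ n → ∀ γ ∈ ({s - 1, s, s + 1, s + 2} : Set ℝ),
      ∀ t ∈ Set.Icc (0 : ℝ) T,
        sobolevNorm γ (v n t) ≤ C₂ * sobolevNorm γ (fun x => fn s φ n x + gn φ n x)) :
    ∃ η₀ : ℝ, 0 < η₀ ∧ ∃ T₀ : ℝ, 0 < T₀ ∧ T₀ ≤ T ∧
      η₀ ≤ Filter.liminf
        (fun n : ℕ => ⨆ t : Set.Icc (0 : ℝ) T₀,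
          sobolevNorm s (fun x => u n t.1 x - v n t.1 x))
        Filter.atTop := by
  obtain ⟨η0, hη0, T0, hT0, hT0T, N0, hN0, hcore⟩ := core hφ hs hT hC₂
  obtain ⟨K, hK, hSZ⟩ := init_sz hφ hs hC₂
  refine ⟨η0, hη0, T0, hT0, hT0T, ?_⟩
  have hU0c : ∀ n : ℕ, Continuous (U0 s φ ((2:ℝ) ^ n)) := by
    intro n
    have := hφ.continuous
    unfold U0; fun_prop
  have hα : ∀ n : ℕ, (2 : ℝ) ^ (-(n : ℝ)) = 1 / (2:ℝ) ^ n := by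
    intro n; rw [Real.rpow_neg (by norm_num), Real.rpow_natCast, one_div]
  have hone : ∀ n : ℕ, (1:ℝ) ≤ (2:ℝ) ^ n := fun n => one_le_pow₀ (by norm_num)
  have Su : ∀ n : ℕ, 1 ≤ n → Sol s T (1 / (2:ℝ) ^ n) 1 (U0 s φ ((2:ℝ) ^ n)) (fun t => u n (clp T t)) := by
    intro n hn
    refine mkSol hs hT (by positivity) (Or.inr rfl) (hU0c n) (humem n hn) (hucont n hn) ?_
    intro t ht x
    rw [hueq n hn t ht x, ← U0_eq, hα n]
    congr 1
    refine intervalIntegral.integral_congr fun τ _ => ?_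
    simp only [chRHS, Complex.ofReal_one, one_mul]
    rw [add_assoc]
    rfl
  have Sv : ∀ n : ℕ, 1 ≤ n → Sol s T (1 / (2:ℝ) ^ n) 0 (U0 s φ ((2:ℝ) ^ n)) (fun t => v n (clp T t)) := by
    intro n hn
    refine mkSol hs hT (by positivity) (Or.inl rfl) (hU0c n) (hvmem n hn) (hvcont n hn) ?_
    intro t ht x
    rw [hveq n hn t ht x, ← U0_eq]
    simp
  have bu : ∀ n : ℕ, 1 ≤ n → ∀ γ ∈ ({s - 1, s, s + 1, s + 2} : Set ℝ), ∀ t,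
      sobolevNorm γ (u n (clp T t)) ≤ C₂ * sobolevNorm γ (U0 s φ ((2:ℝ) ^ n)) := by
    intro n hn γ hγ t
    rw [← U0_eq]; exact hubd n hn γ hγ _ (clp_mem hT t)
  have bv : ∀ n : ℕ, 1 ≤ n → ∀ γ ∈ ({s - 1, s, s + 1, s + 2} : Set ℝ), ∀ t,
      sobolevNorm γ (v n (clp T t)) ≤ C₂ * sobolevNorm γ (U0 s φ ((2:ℝ) ^ n)) := by
    intro n hn γ hγ t
    rw [← U0_eq]; exact hvbd n hn γ hγ _ (clp_mem hT t)
  have hb : ∀ n : ℕ, 1 ≤ n → ∀ t : Set.Icc (0 : ℝ) T0, sobolevNorm s (fun x => u n t.1 x - v n t.1 x) ≤ 2 * (2 * Real.pi * K) := by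
    intro n hn t
    have ht : t.1 ∈ Set.Icc 0 T := ⟨t.2.1, t.2.2.trans hT0T⟩
    have Zu := hSZ _ T 1 _ (hone n) (Su n hn) (bu n hn _ (by simp)) (bu n hn _ (by simp))
    have Zv := hSZ _ T 0 _ (hone n) (Sv n hn) (bv n hn _ (by simp)) (bv n hn _ (by simp))
    have h1 := sob_le hK (Su n hn) Zu t.1
    have h2 := sob_le hK (Sv n hn) Zv t.1
    simp only [clp_eq ht] at h1 h2
    have := Real.pi_pos
    exact sob_sub_le (memSob_mono (by linarith) (humem n hn _ ht)) (memSob_mono (by linarith) (hvmem n hn _ ht)) (by positivity) h1 h2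
  have hbdd : ∀ n : ℕ, 1 ≤ n → BddAbove (Set.range fun t : Set.Icc (0 : ℝ) T0 => sobolevNorm s (fun x => u n t.1 x - v n t.1 x)) := by
    intro n hn
    refine ⟨2 * (2 * Real.pi * K), ?_⟩
    rintro _ ⟨t, rfl⟩
    exact hb n hn t
  haveI : Nonempty (Set.Icc (0:ℝ) T0) := ⟨⟨0, le_rfl, hT0.le⟩⟩
  refine le_liminf_of_le ?_ ?_
  · refine IsBoundedUnder.isCoboundedUnder_ge ⟨2 * (2 * Real.pi * K), ?_⟩
    rw [eventually_map]
    filter_upwards [eventually_ge_atTop 1] with n hn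
    exact ciSup_le fun t => hb n hn t
  · have hl : Tendsto (fun n : ℕ => (2:ℝ) ^ n) atTop atTop := tendsto_pow_atTop_atTop_of_one_lt (by norm_num)
    filter_upwards [eventually_ge_atTop 1, hl.eventually_ge_atTop N0] with n hn hnN
    obtain ⟨t, ht, hle⟩ := hcore _ _ _ hnN (Su n hn) (Sv n hn) (bu n hn _ (by simp)) (bu n hn _ (by simp)) (bv n hn _ (by simp)) (bv n hn _ (by simp))
    simp only [clp_eq (show t ∈ Set.Icc 0 T from ⟨ht.1, ht.2.trans hT0T⟩)] at hle
    exact hle.trans (le_ciSup (hbdd n hn) ⟨t, ht⟩)
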